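/- Let Γ = ℤ^8 ⋊ ℤ/9 where the generator of ℤ/9 acts on ℤ^8 by the matrix [[-1,0,-1,-1,-1,0,0,0],[1,1,1,0,1,0,1,0],[0,0,0,0,0,0,1,0],[0,0,0,0,1,0,0,0],[1,0,0,0,0,0,-1,-1],[-1,-1,0,0,-1,-1,0,0],[-1,-1,0,0,0,0,0,1],[0,1,0,0,0,1,0,0]], and let G = ℤ/9, L = ℤ^8 with this action. Then H^4(Γ, ℤ) ≅ ℤ^8 ⊕ (ℤ/9)^2 ⊕ (ℤ/3)^4, while ⊕_{i+j=4} H^i(G, H^j(L, ℤ)) ≅ ℤ^8 ⊕ ℤ/9 ⊕ (ℤ/3)^6; in particular these two groups are not isomorphic, so Γ is a counterexample with odd-order cyclic holonomy to the conjectured decomposition H^k(L ⋊ G, ℤ) ≅ ⊕_{i+j=k} H^i(G, H^j(L, ℤ)). -/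

import Mathlib

open Matrix

namespace Crystal

/-- The lattice `ℤ^n`, written multiplicatively so that it can be a factor of a semidirect
product of groups. -/
abbrev Lat (n : ℕ) : Type := Multiplicative (Fin n → ℤ)

/-- The invertible integer matrix determined by `M` with `M ^ (m + 1) = 1`. -/
def matUnit {n : ℕ} (M : Matrix (Fin n) (Fin n) ℤ) (m : ℕ) (hm : M ^ (m + 1) = 1) :
    (Matrix (Fin n) (Fin n) ℤ)ˣ :=
  ⟨M, M ^ m, by rw [← pow_succ']; exact hm, by rw [← pow_succ]; exact hm⟩

/-- Linear automorphisms of `ℤ^n` as multiplicative automorphisms of the multiplicative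
version of `ℤ^n`. -/
def linToAut (n : ℕ) : ((Fin n → ℤ) ≃ₗ[ℤ] (Fin n → ℤ)) →* MulAut (Lat n) :=
  MonoidHom.mk' (fun e => AddEquiv.toMultiplicative e.toAddEquiv) (fun _ _ => rfl)

/-- An invertible integer matrix acts on the (multiplicative) lattice `ℤ^n` by (left)
matrix-vector multiplication. -/
def glToAut (n : ℕ) : (Matrix (Fin n) (Fin n) ℤ)ˣ →* MulAut (Lat n) :=
  (linToAut n).comp
    ((LinearMap.GeneralLinearGroup.generalLinearEquiv ℤ (Fin n → ℤ)).toMonoidHom.comp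
      (Matrix.GeneralLinearGroup.toLin).toMonoidHom)

/-- The homomorphism from `ℤ/m` (written multiplicatively) to a group `G` sending the
generator `1` to a chosen element `α` satisfying `α ^ m = 1`. -/
def zmodHom {G : Type*} [Group G] (m : ℕ) [NeZero m] (α : G) (hα : α ^ m = 1) :
    Multiplicative (ZMod m) →* G :=
  MonoidHom.mk' (fun g => α ^ (g.toAdd.val)) (by
    intro a b
    show α ^ (ZMod.val (a.toAdd + b.toAdd)) = α ^ (ZMod.val a.toAdd) * α ^ (ZMod.val b.toAdd)
    rw [ZMod.val_add, ← pow_eq_pow_mod _ hα, pow_add])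

/-- The action of `ℤ/q` on the lattice `ℤ^n` in which the generator `1` of `ℤ/q` acts by left
multiplication by the integer matrix `M`; `M` is required to satisfy `M ^ q = 1`. -/
def matAction {n : ℕ} (q : ℕ) [NeZero q] (M : Matrix (Fin n) (Fin n) ℤ)
    (hq : M ^ q = 1) : Multiplicative (ZMod q) →* MulAut (Lat n) :=
  zmodHom q (glToAut n (matUnit M (q - 1) (by
      rwa [Nat.sub_add_cancel (Nat.one_le_iff_ne_zero.2 (NeZero.ne q))])))
    (by
      rw [← map_pow]
      convert map_one (glToAut n)
      ext i j
      rw [Units.val_pow_eq_pow_val]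
      simp [matUnit, hq])

/-- The crystallographic group `ℤ^n ⋊ ℤ/q` in which the generator `1` of `ℤ/q` acts on the
lattice `ℤ^n` by left multiplication by the integer matrix `M` (with `M ^ q = 1`). -/
abbrev Crys {n : ℕ} (q : ℕ) [NeZero q] (M : Matrix (Fin n) (Fin n) ℤ) (hq : M ^ q = 1) : Type :=
  SemidirectProduct (Lat n) (Multiplicative (ZMod q)) (matAction q M hq)


open CategoryTheory groupCohomology

variable {k : Type} [CommRing k]

lemma comp_contractNth {G H : Type*} [Monoid G] [Monoid H] (f : G →* H) {n : ℕ}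
    (j : Fin (n + 1)) (g : Fin (n + 1) → G) (i : Fin n) :
    f (Fin.contractNth j (· * ·) g i) = Fin.contractNth j (· * ·) (fun l => f (g l)) i := by
  rcases lt_trichotomy (i : ℕ) j with h | h | h
  · rw [Fin.contractNth_apply_of_lt _ _ _ _ h, Fin.contractNth_apply_of_lt _ _ _ _ h]
  · rw [Fin.contractNth_apply_of_eq _ _ _ _ h, Fin.contractNth_apply_of_eq _ _ _ _ h,
      _root_.map_mul]
  · rw [Fin.contractNth_apply_of_gt _ _ _ _ h, Fin.contractNth_apply_of_gt _ _ _ _ h]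

/-- The map of inhomogeneous cochain complexes induced (contravariantly in the group,
covariantly in the coefficients) by a group homomorphism `f : H →* G` together with a
compatible linear map `τ : A → B` of coefficients. -/
def cochainsMap {G H : Type} [Group G] [Group H] (A : Rep k G) (B : Rep k H)
    (f : H →* G) (τ : A →ₗ[k] B)
    (hcomp : ∀ (h : H) (a : A), τ (A.ρ (f h) a) = B.ρ h (τ a)) :
    inhomogeneousCochains A ⟶ inhomogeneousCochains B where
  f n := ModuleCat.ofHom
    { toFun := fun F v => τ (F (fun i => f (v i)))
      map_add' := fun x y => by funext v; simp
      map_smul' := fun r x => by funext v; simp }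
  comm' i j hij := by
    have hij' : i + 1 = j := hij
    subst hij'
    rw [inhomogeneousCochains.d_def, inhomogeneousCochains.d_def]
    ext F v
    show (inhomogeneousCochains.d B i) (fun w => τ (F (fun l => f (w l)))) v
      = τ ((inhomogeneousCochains.d A i) F (fun l => f (v l)))
    simp only [inhomogeneousCochains.d_hom_apply, map_add, map_sum, _root_.map_smul]
    congr 1
    · exact (hcomp (v 0) _).symm
    · refine Finset.sum_congr rfl fun j' _ => ?_
      have hc : (fun l => f (j'.contractNth (· * ·) v l))
          = j'.contractNth (· * ·) (fun l => f (v l)) := by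
        funext l
        exact comp_contractNth f j' v l
      rw [hc]

lemma cochainsMap_eq_id {G : Type} [Group G] (A : Rep k G) (f : G →* G) (τ : A →ₗ[k] A)
    (hcomp : ∀ (h : G) (a : A), τ (A.ρ (f h) a) = A.ρ h (τ a))
    (hf : ∀ x, f x = x) (hτ : ∀ a, τ a = a) :
    cochainsMap A A f τ hcomp = 𝟙 _ := by
  apply HomologicalComplex.Hom.ext
  funext n
  ext F v
  show τ (F (fun i => f (v i))) = F v
  simp only [hf, hτ]

lemma cochainsMap_comp {G H K : Type} [Group G] [Group H] [Group K]
    (A : Rep k G) (B : Rep k H) (C : Rep k K)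
    (f₁ : H →* G) (τ₁ : A →ₗ[k] B) (h₁ : ∀ (h : H) (a : A), τ₁ (A.ρ (f₁ h) a) = B.ρ h (τ₁ a))
    (f₂ : K →* H) (τ₂ : B →ₗ[k] C) (h₂ : ∀ (h : K) (a : B), τ₂ (B.ρ (f₂ h) a) = C.ρ h (τ₂ a))
    (f₃ : K →* G) (τ₃ : A →ₗ[k] C) (h₃ : ∀ (h : K) (a : A), τ₃ (A.ρ (f₃ h) a) = C.ρ h (τ₃ a))
    (hf : ∀ x, f₁ (f₂ x) = f₃ x) (hτ : ∀ a, τ₂ (τ₁ a) = τ₃ a) :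
    cochainsMap A B f₁ τ₁ h₁ ≫ cochainsMap B C f₂ τ₂ h₂ = cochainsMap A C f₃ τ₃ h₃ := by
  apply HomologicalComplex.Hom.ext
  funext n
  ext F v
  show τ₂ (τ₁ (F (fun i => f₁ (f₂ (v i))))) = τ₃ (F (fun i => f₃ (v i)))
  simp only [hf]
  exact hτ _

/-- Given an action `φ` of a group `G` on a group `L` and a representation `ψ` of `G` on a
`k`-module `V`, this is `H^j(L, V)` (with `L` acting trivially on the coefficients `V`),
endowed with the `G`-action functorially induced by the action of `G` on `L` and on `V`:
`g` acts via the conjugation automorphism `φ g⁻¹` of `L` and via `ψ g` on `V`. -/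
noncomputable def cohRep {G L V : Type} [Group G] [Group L] [AddCommGroup V] [Module k V]
    (φ : G →* MulAut L) (ψ : Representation k G V) (j : ℕ) : Rep k G :=
  Rep.of (X := groupCohomology (Rep.trivial k L V) j)
    { toFun := fun g => ModuleCat.Hom.hom (HomologicalComplex.homologyMap
        (cochainsMap (Rep.trivial k L V) (Rep.trivial k L V) (φ g⁻¹).toMonoidHom (ψ g)
          (fun _ _ => rfl)) j)
      map_one' := by
        have h := cochainsMap_eq_id (Rep.trivial k L V) (φ 1⁻¹).toMonoidHom (ψ 1) (fun _ _ => rfl)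
          (fun x => by simp) (fun a => by simp)
        rw [h]
        exact congrArg ModuleCat.Hom.hom (HomologicalComplex.homologyMap_id _ j)
      map_mul' := fun g₁ g₂ => by
        have h := cochainsMap_comp (Rep.trivial k L V) (Rep.trivial k L V) (Rep.trivial k L V)
          (φ g₂⁻¹).toMonoidHom (ψ g₂) (fun _ _ => rfl)
          (φ g₁⁻¹).toMonoidHom (ψ g₁) (fun _ _ => rfl)
          (φ (g₁ * g₂)⁻¹).toMonoidHom (ψ (g₁ * g₂)) (fun _ _ => rfl)
          (fun x => by simp [_root_.mul_inv_rev]) (fun a => by simp)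
        rw [← h, HomologicalComplex.homologyMap_comp]
        rfl }


/-- `H^i(G, H^j(L, ℤ))`: the `i`-th cohomology of the cyclic group `ℤ/q` with coefficients in
the `j`-th cohomology of the lattice `ℤ^n` (with trivial `ℤ` coefficients), where the
`ℤ/q`-action on `H^j(ℤ^n, ℤ)` is the one functorially induced by the matrix action on the
lattice. -/
noncomputable abbrev cohOfCoh {n : ℕ} (q : ℕ) [NeZero q] (M : Matrix (Fin n) (Fin n) ℤ)
    (hq : M ^ q = 1) (i j : ℕ) : ModuleCat ℤ :=
  groupCohomology
    (cohRep (matAction q M hq) (1 : Representation ℤ (Multiplicative (ZMod q)) ℤ) j) i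

/-- `H^k(Γ, ℤ)` for `Γ = ℤ^n ⋊ ℤ/q`, with trivial coefficients `ℤ`. -/
noncomputable abbrev cohCrys {n : ℕ} (q : ℕ) [NeZero q] (M : Matrix (Fin n) (Fin n) ℤ)
    (hq : M ^ q = 1) (k : ℕ) : ModuleCat ℤ :=
  groupCohomology (Rep.trivial ℤ (Crys q M hq) ℤ) k

end Crystal

/-- The holonomy matrix. -/
def holM : Matrix (Fin 8) (Fin 8) ℤ := !![-1, 0, -1, -1, -1, 0, 0, 0; 1, 1, 1, 0, 1, 0, 1, 0; 0, 0, 0, 0, 0, 0, 1, 0; 0, 0, 0, 0, 1, 0, 0, 0; 1, 0, 0, 0, 0, 0, -1, -1; -1, -1, 0, 0, -1, -1, 0, 0; -1, -1, 0, 0, 0, 0, 0, 1; 0, 1, 0, 0, 0, 1, 0, 0]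

lemma holM_pow : holM ^ 9 = 1 := by decide

/-- `H^k(ℤ^8 ⋊ ℤ/9, ℤ)`, where the generator of `ℤ/9` acts on `ℤ^8` by left
multiplication by the matrix `holM`. -/
noncomputable abbrev H (k : ℕ) : ModuleCat ℤ := Crystal.cohCrys 9 holM holM_pow k

/-- `H^i(ℤ/9, H^j(ℤ^8, ℤ))`, with the functorially induced action on coefficients. -/
noncomputable abbrev Hc (i j : ℕ) : ModuleCat ℤ := Crystal.cohOfCoh 9 holM holM_pow i j

open CategoryTheory

namespace OHC

lemma sc_homology_desc {k : Type} [CommRing k] (S : ShortComplex (ModuleCat.{0} k)) :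
    ∃ π : LinearMap.ker S.g.hom →ₗ[k] S.homology, Function.Surjective π ∧
      ∀ x, π x = 0 ↔ ∃ y, S.f.hom y = x := by
  let e := S.moduleCatHomologyIso.toLinearEquiv
  refine ⟨e.symm.toLinearMap.comp (Submodule.mkQ (LinearMap.range S.moduleCatToCycles)), ?_, ?_⟩
  · exact e.symm.surjective.comp (Submodule.mkQ_surjective _)
  · intro x
    refine Iff.trans e.symm.map_eq_zero_iff (Iff.trans (Submodule.Quotient.mk_eq_zero _) ?_)
    constructor
    · rintro ⟨y, hy⟩
      exact ⟨y, congrArg Subtype.val hy⟩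
    · rintro ⟨y, hy⟩
      exact ⟨y, Subtype.ext hy⟩

/-- Element-level description of homology of a complex of modules. -/
lemma homology_desc_aux {k : Type} [CommRing k] {ι : Type} {c : ComplexShape ι}
    (K : HomologicalComplex (ModuleCat.{0} k) c)
    (i j l : ι) (hi : c.prev j = i) (hk : c.next j = l) :
    ∃ π : LinearMap.ker (K.d j l).hom →ₗ[k] K.homology j, Function.Surjective π ∧
      ∀ x, π x = 0 ↔ ∃ y, (K.d i j).hom y = x := by
  obtain ⟨π, h1, h2⟩ := sc_homology_desc (K.sc' i j l)
  let e := (K.homologyIsoSc' i j l hi hk).toLinearEquiv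
  refine ⟨e.symm.toLinearMap.comp π, e.symm.surjective.comp h1, fun x => ?_⟩
  exact Iff.trans e.symm.map_eq_zero_iff (h2 x)

section
variable {k : Type} [CommRing k] {G : Type} [Group G] (I : ℕ → Type)
  (d : ∀ n, Rep.free k G (I (n+1)) ⟶ Rep.free k G (I n))
  (ε : Rep.free k G (I 0) ⟶ Rep.trivial k G k)
  (hd : ∀ n, d (n+1) ≫ d n = 0) (hε : d 0 ≫ ε = 0)

noncomputable abbrev resCx : ChainComplex (Rep k G) ℕ :=
  ChainComplex.of (fun n => Rep.free k G (I n)) d hd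

lemma resCx_d (n : ℕ) : (resCx I d hd).d (n+1) n = d n := by simp [resCx]

lemma resCx_eps : (resCx I d hd).d 1 0 ≫ ε = 0 ↔ d 0 ≫ ε = 0 := by
  rw [resCx_d I d hd 0]

noncomputable def resPi : resCx I d hd ⟶
    (ChainComplex.single₀ (Rep k G)).obj (Rep.trivial k G k) :=
  ((resCx I d hd).toSingle₀Equiv _).symm ⟨ε, (resCx_eps I d ε hd).2 hε⟩

lemma resPi_f0 : (resPi I d ε hd hε).f 0 = ε := by
  unfold resPi
  simp [ChainComplex.toSingle₀Equiv]

lemma resPi_quasiIso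
    (hs : Function.Surjective ε.hom)
    (h0 : ∀ x, ε.hom x = 0 → ∃ y, (d 0).hom y = x)
    (hn : ∀ n x, (d n).hom x = 0 → ∃ y, (d (n+1)).hom y = x) :
    QuasiIso (resPi I d ε hd hε) where
  quasiIsoAt m := by
    induction m with
    | zero =>
      rw [ChainComplex.quasiIsoAt₀_iff, ShortComplex.quasiIso_iff_of_zeros' _ rfl rfl rfl]
      constructor
      · apply (forget₂ _ (ModuleCat k)).reflects_exact_of_faithful
        rw [ShortComplex.moduleCat_exact_iff]
        intro x hx
        obtain ⟨y, hy⟩ := h0 x (by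
          have h2 := resPi_f0 I d ε hd hε
          have h3 : ((resPi I d ε hd hε).f 0).hom x = 0 := hx
          rw [h2] at h3
          exact h3)
        refine ⟨y, ?_⟩
        have h4 : ((resCx I d hd).d 1 0).hom y = x := by
          rw [resCx_d I d hd 0]; exact hy
        exact h4
      · rw [Rep.epi_iff_surjective]
        intro x
        obtain ⟨y, hy⟩ := hs x
        refine ⟨y, ?_⟩
        have h3 : ((resPi I d ε hd hε).f 0).hom y = x := by
          rw [resPi_f0]; exact hy
        exact h3
    | succ m _ =>
      rw [quasiIsoAt_iff_exactAt' (hL := ChainComplex.exactAt_succ_single_obj ..),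
          HomologicalComplex.exactAt_iff' _ (m + 2) (m + 1) m (by simp) (by simp)]
      apply (forget₂ _ (ModuleCat k)).reflects_exact_of_faithful
      rw [ShortComplex.moduleCat_exact_iff]
      intro x hx
      obtain ⟨y, hy⟩ := hn m x (by
        have h3 : ((resCx I d hd).d (m+1) m).hom x = 0 := hx
        rw [resCx_d] at h3
        exact h3)
      refine ⟨y, ?_⟩
      have h4 : ((resCx I d hd).d (m+1+1) (m+1)).hom y = x := by
        rw [resCx_d]; exact hy
      exact h4

noncomputable def res 
    (hs : Function.Surjective ε.hom)
    (h0 : ∀ x, ε.hom x = 0 → ∃ y, (d 0).hom y = x)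
    (hn : ∀ n x, (d n).hom x = 0 → ∃ y, (d (n+1)).hom y = x) :
    ProjectiveResolution (Rep.trivial k G k) where
  complex := resCx I d hd
  projective n := inferInstanceAs <| Projective (Rep.free k G (I n))
  π := resPi I d ε hd hε
  quasiIso := resPi_quasiIso I d ε hd hε hs h0 hn

/-- Coboundary on functions determined by `d`. -/
noncomputable def cob (A : Rep k G) (n : ℕ) (f : I n → A) : I (n+1) → A := fun i =>
  Representation.freeLift A.ρ f ((d n).hom (Finsupp.single i (MonoidAlgebra.single 1 1)))

lemma cob_comp (A : Rep k G) (m : ℕ) (f : I m → A) :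
    d m ≫ Rep.freeLift k G A f = Rep.freeLift k G A (cob I d A m f) := by
  apply Rep.free_ext
  intro i
  have h1 : (Rep.freeLift k G A (cob I d A m f)).hom (Finsupp.single i (MonoidAlgebra.single 1 1))
      = (1:k) • A.ρ 1 (cob I d A m f i) :=
    Representation.freeLift_single_single ..
  rw [h1]
  simp only [map_one, one_smul]
  rfl

lemma transport_desc {X0 X1 X2 A0 A1 A2 H H' : Type} [AddCommGroup X0] [Module k X0]
    [AddCommGroup X1] [Module k X1] [AddCommGroup X2] [Module k X2]
    [AddCommGroup A0] [Module k A0] [AddCommGroup A1] [Module k A1] [AddCommGroup A2] [Module k A2]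
    [AddCommGroup H] [Module k H] [AddCommGroup H'] [Module k H']
    (D0 : X0 →ₗ[k] X1) (D1 : X1 →ₗ[k] X2) (F0 : X0 ≃ₗ[k] A0) (F1 : X1 ≃ₗ[k] A1)
    (F2 : X2 ≃ₗ[k] A2) (c0 : A0 → A1) (c1 : A1 → A2)
    (k0 : ∀ f, D0 (F0.symm f) = F1.symm (c0 f)) (k1 : ∀ f, D1 (F1.symm f) = F2.symm (c1 f))
    (e : H' ≃ₗ[k] H) (π : LinearMap.ker D1 →ₗ[k] H) (h1 : Function.Surjective π)
    (h2 : ∀ x, π x = 0 ↔ ∃ y, D0 y = x) :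
    ∃ π : {f : A1 // c1 f = 0} → H',
      (∀ x y z, z.1 = x.1 + y.1 → π z = π x + π y) ∧ Function.Surjective π ∧
      ∀ x, π x = 0 ↔ ∃ y, c0 y = x := by
  refine ⟨fun x => e.symm (π ⟨F1.symm x.1, ?_⟩), ?_, ?_, ?_⟩
  · rw [LinearMap.mem_ker, k1, x.2, map_zero]
  · intro x y z hz
    rw [← map_add, ← map_add]
    refine congrArg e.symm (congrArg π (Subtype.ext ?_))
    change F1.symm z.1 = F1.symm x.1 + F1.symm y.1
    rw [hz, map_add]
  · intro w
    obtain ⟨x, hx⟩ := h1 (e w)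
    have hx2 : F1.symm (F1 x.1) = x.1 := F1.symm_apply_apply _
    refine ⟨⟨F1 x.1, ?_⟩, ?_⟩
    · apply F2.symm.injective
      rw [← k1, hx2, map_zero]
      exact x.2
    · rw [LinearEquiv.symm_apply_eq, ← hx]
      congr 1
      exact Subtype.ext hx2
  · intro x
    rw [LinearEquiv.map_eq_zero_iff, h2]
    constructor
    · rintro ⟨y, hy⟩
      refine ⟨F0 y, ?_⟩
      apply F1.symm.injective
      rw [← k0, F0.symm_apply_apply, hy]
    · rintro ⟨y, hy⟩
      refine ⟨F0.symm y, ?_⟩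
      rw [k0, hy]

lemma free_res (hd : ∀ n, d (n+1) ≫ d n = 0) (hε : d 0 ≫ ε = 0) (A : Rep k G)
    (hs : Function.Surjective ε.hom)
    (h0 : ∀ x, ε.hom x = 0 → ∃ y, (d 0).hom y = x)
    (hn : ∀ n x, (d n).hom x = 0 → ∃ y, (d (n+1)).hom y = x) (n : ℕ) :
    ∃ π : {f : I (n+1) → A // cob I d A (n+1) f = 0} → groupCohomology A (n+1),
      (∀ x y z, z.1 = x.1 + y.1 → π z = π x + π y) ∧ Function.Surjective π ∧
      ∀ x, π x = 0 ↔ ∃ y, cob I d A n y = x := by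
  let P := res I d ε hd hε hs h0 hn
  obtain ⟨π, h1, h2⟩ := homology_desc_aux (P.complex.linearYonedaObj k A) n (n+1) (n+2)
    (by simp) (by simp)
  let e := (groupCohomologyIso A (n+1) P).toLinearEquiv
  have key : ∀ m (g : Rep.free k G (I m) ⟶ A),
      (((P.complex.linearYonedaObj k A).d m (m+1)).hom g : Rep.free k G (I (m+1)) ⟶ A)
        = d m ≫ g := by
    intro m g
    have := resCx_d I d hd m
    change ((resCx I d hd).d (m+1) m) ≫ g = d m ≫ g
    rw [this]
  let F : ∀ m, (Rep.free k G (I m) ⟶ A) ≃ₗ[k] (I m → A) := fun m => Rep.freeLiftLEquiv k G (I m) A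
  have hF : ∀ m f, (F m).symm f = Rep.freeLift k G A f := fun m f => rfl
  have key2 : ∀ m f, ((P.complex.linearYonedaObj k A).d m (m+1)).hom ((F m).symm f)
      = (F (m+1)).symm (cob I d A m f) := by
    intro m f
    rw [hF, hF]
    exact (key m _).trans (cob_comp I d A m f)
  exact transport_desc _ _ (F n) (F (n+1)) (F (n+2)) _ _ (key2 n) (key2 (n+1)) e π h1 h2

end
end OHC

open CategoryTheory

namespace OHC
set_option linter.unusedSectionVars false
section
variable {G : Type} [Group G] {J : Type} {W : Type} [AddCommGroup W]

/-- the free module. -/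
abbrev FM (J G : Type) := J →₀ MonoidAlgebra ℤ G

noncomputable def bs (p : J) (g : G) : FM J G := Finsupp.single p (MonoidAlgebra.single g 1)

noncomputable def lin (F : J → G → W) : FM J G →ₗ[ℤ] W :=
  Finsupp.linearCombination ℤ (fun x : J × G => F x.1 x.2) ∘ₗ
    (Finsupp.curryLinearEquiv ℤ).symm.toLinearMap ∘ₗ
    Finsupp.mapRange.linearMap (MonoidAlgebra.coeffLinearEquiv ℤ).toLinearMap

@[simp] lemma lin_bs (F : J → G → W) (p : J) (g : G) : lin F (bs p g) = F p g := by
  simp [lin, bs]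

lemma fm_ext {f g : FM J G →ₗ[ℤ] W} (h : ∀ p x, f (bs p x) = g (bs p x)) : f = g := by
  ext p x
  simpa [bs] using h p x

noncomputable def ρF : Representation ℤ G (FM J G) := Representation.free ℤ G J

@[simp] lemma ρF_bs (g h : G) (p : J) : ρF g (bs p h) = bs p (g * h) := by
  simp [ρF, bs]

lemma ρF_mul (g h : G) (x : FM J G) : ρF g (ρF h x) = ρF (g * h) x := by
  simp [map_mul]

noncomputable def eqv {J' : Type} (F : J → FM J' G) : FM J G →ₗ[ℤ] FM J' G :=
  lin (fun p g => ρF g (F p))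

@[simp] lemma eqv_bs {J' : Type} (F : J → FM J' G) (p : J) (g : G) :
    eqv F (bs p g) = ρF g (F p) := by simp [eqv]

lemma eqv_ρ {J' : Type} (F : J → FM J' G) (g : G) (x : FM J G) :
    eqv F (ρF g x) = ρF g (eqv F x) := by
  have : eqv F ∘ₗ ρF g = ρF g ∘ₗ eqv F := fm_ext (fun p x => by
    simp only [LinearMap.comp_apply, ρF_bs, eqv_bs, ρF_mul])
  exact LinearMap.congr_fun this x

noncomputable def eqvHom {J' : Type} (F : J → FM J' G) : Rep.free ℤ G J ⟶ Rep.free ℤ G J' :=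
  Rep.freeLift ℤ G (Rep.free ℤ G J') F

lemma eqvHom_apply {J' : Type} (F : J → FM J' G) (x : FM J G) :
    (eqvHom F).hom x = eqv F x := by
  have : (eqvHom F).hom.toLinearMap = eqv F := fm_ext (fun p x => by
    rw [eqv_bs]
    refine (Representation.freeLift_single_single (Rep.free ℤ G J').ρ p x (1:ℤ) F).trans ?_
    rw [one_smul]; rfl)
  exact LinearMap.congr_fun this x
end

section
variable {N C : Type} [Group N] [CommGroup C] (φ : C →* MulAut N)

/-- Index set of the big free module. -/
abbrev JJ (N : Type) := Σ j : ℕ, (Fin j → N)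

abbrev BM (φ : C →* MulAut N) := FM (JJ N) (N ⋊[φ] C)

/-- basis element. -/
noncomputable def be (j : ℕ) (v : Fin j → N) (x : N) (c : C) : BM φ := bs (⟨j, v⟩ : JJ N) ⟨x, c⟩

variable {φ} in
lemma bm_ext {W : Type} [AddCommGroup W] {f g : BM φ →ₗ[ℤ] W}
    (h : ∀ j v x c, f (be φ j v x c) = g (be φ j v x c)) : f = g :=
  fm_ext (fun p x => h p.1 p.2 x.left x.right)

noncomputable def bd0 : JJ N → BM φ
  | ⟨0, _⟩ => 0
  | ⟨j+1, v⟩ => be φ j (Fin.tail v) (v 0) 1 +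
      ∑ k : Fin (j+1), (-1 : ℤ)^((k:ℕ)+1) • be φ j (k.contractNth (· * ·) v) 1 1

noncomputable def bd : BM φ →ₗ[ℤ] BM φ := eqv (bd0 φ)

lemma rho_be (j v x c y d) : ρF (⟨x, c⟩ : N ⋊[φ] C) (be φ j v y d) = be φ j v (x * φ c y) (c * d) := by
  simp only [be, ρF_bs]; rfl

@[simp] lemma bd_zero (v x c) : bd φ (be φ 0 v x c) = 0 := by
  simp [bd, be, bd0]

lemma bd_succ (j v x c) : bd φ (be φ (j+1) v x c) = be φ j (Fin.tail v) (x * φ c (v 0)) c +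
      ∑ k : Fin (j+1), (-1 : ℤ)^((k:ℕ)+1) • be φ j (k.contractNth (· * ·) v) x c := by
  conv_lhs => rw [be, bd, eqv_bs]
  simp only [bd0, map_add, map_sum, _root_.map_smul, rho_be, mul_one, map_one]

noncomputable def sc : BM φ →ₗ[ℤ] BM φ :=
  lin (fun p g => be φ (p.1+1) (Fin.cons (φ g.right⁻¹ g.left) p.2) 1 g.right)

@[simp] lemma sc_be (j v x c) : sc φ (be φ j v x c) = be φ (j+1) (Fin.cons (φ c⁻¹ x) v) 1 c := by
  simp [sc, be]

noncomputable def rh : BM φ →ₗ[ℤ] BM φ :=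
  lin (fun p g => if p.1 = 0 then be φ 0 Fin.elim0 1 g.right else 0)

@[simp] lemma rh_zero (v x c) : rh φ (be φ 0 v x c) = be φ 0 Fin.elim0 1 c := by
  simp [rh, be]
@[simp] lemma rh_succ (j v x c) : rh φ (be φ (j+1) v x c) = 0 := by
  simp [rh, be]

lemma contract_cons_zero {j : ℕ} (a : N) (v : Fin (j+1) → N) :
    (0 : Fin (j+2)).contractNth (· * ·) (Fin.cons a v : Fin (j+2) → N)
      = Fin.cons (a * v 0) (Fin.tail v) := by
  funext i
  refine Fin.cases ?_ (fun i => ?_) i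
  · rw [Fin.contractNth_apply_of_eq _ _ _ _ rfl]; simp
  · rw [Fin.contractNth_apply_of_gt _ _ _ _ (by simp)]
    simp [Fin.tail]

lemma contract_cons_succ {j : ℕ} (a : N) (v : Fin (j+1) → N) (k : Fin (j+1)) :
    k.succ.contractNth (· * ·) (Fin.cons a v : Fin (j+2) → N)
      = Fin.cons a (k.contractNth (· * ·) v) := by
  funext i
  refine Fin.cases ?_ (fun i => ?_) i
  · rw [Fin.contractNth_apply_of_lt _ _ _ _ (by simp)]; simp
  · rcases lt_trichotomy (i : ℕ) k with h | h | h
    · rw [Fin.contractNth_apply_of_lt _ _ _ _ (by simpa using h), Fin.cons_succ,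
        Fin.contractNth_apply_of_lt _ _ _ _ h]
      simp [← Fin.succ_castSucc]
    · rw [Fin.contractNth_apply_of_eq _ _ _ _ (by simpa using h)]
      simp only [Fin.cons_succ]
      rw [Fin.contractNth_apply_of_eq _ _ _ _ h]
      simp [← Fin.succ_castSucc]
    · rw [Fin.contractNth_apply_of_gt _ _ _ _ (by simpa using h)]
      simp only [Fin.cons_succ]
      rw [Fin.contractNth_apply_of_gt _ _ _ _ h]

lemma bd_sc : bd φ ∘ₗ sc φ + sc φ ∘ₗ bd φ = LinearMap.id - rh φ := by
  apply bm_ext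
  intro j v x c
  simp only [LinearMap.add_apply, LinearMap.comp_apply, LinearMap.sub_apply, LinearMap.id_apply,
    sc_be]
  have e1 : (1 : N) * φ c (φ c⁻¹ x) = x := by
    rw [one_mul, ← MulAut.mul_apply, ← map_mul]; simp
  cases j with
  | zero =>
    rw [bd_succ, Fin.cons_zero, e1]
    simp only [bd_zero, map_zero, add_zero, rh_zero, Fin.tail_cons]
    rw [Fin.sum_univ_one]
    have h1 : ∀ w : Fin 0 → N, w = v := fun w => Subsingleton.elim _ _
    have h2 : (Fin.elim0 : Fin 0 → N) = v := Subsingleton.elim _ _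
    rw [h1 (Fin.contractNth _ _ _), h2]
    simp [sub_eq_add_neg]
  | succ j =>
    rw [bd_succ, Fin.cons_zero, e1, bd_succ, Fin.sum_univ_succ]
    simp only [contract_cons_zero, contract_cons_succ, Fin.tail_cons, map_add, map_sum,
      _root_.map_smul, sc_be, rh_succ, sub_zero, Fin.val_zero, Fin.val_succ]
    have e2 : φ c⁻¹ (x * φ c (v 0)) = φ c⁻¹ x * v 0 := by
      rw [map_mul, ← MulAut.mul_apply N (φ c⁻¹) (φ c), ← map_mul]; simp
    rw [e2]
    have e3 : ∀ k : Fin (j+1), (-1:ℤ)^((k:ℕ)+1+1) = - (-1:ℤ)^((k:ℕ)+1) := fun k => by ring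
    simp only [e3, neg_smul, Finset.sum_neg_distrib]
    simp only [zero_add, pow_one, neg_smul, one_smul]
    abel

lemma rh_bd : rh φ ∘ₗ bd φ = 0 := by
  apply bm_ext
  intro j v x c
  rcases j with _ | _ | j
  · simp
  · simp [bd_succ]
  · simp [bd_succ]

lemma bd_rh : bd φ ∘ₗ rh φ = 0 := by
  apply bm_ext
  intro j v x c
  rcases j with _ | j
  · simp
  · simp

lemma bd_bd : bd φ ∘ₗ bd φ = 0 := by
  have key : (bd φ ∘ₗ bd φ) ∘ₗ sc φ = sc φ ∘ₗ (bd φ ∘ₗ bd φ) := by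
    have h := bd_sc φ
    have h1 : bd φ ∘ₗ sc φ = LinearMap.id - rh φ - sc φ ∘ₗ bd φ := by rw [← h]; abel
    rw [LinearMap.comp_assoc, h1, LinearMap.comp_sub, LinearMap.comp_sub, bd_rh,
      ← LinearMap.comp_assoc, h1, LinearMap.sub_comp, LinearMap.sub_comp, rh_bd,
      LinearMap.comp_assoc]
    simp
  apply bm_ext
  intro j
  induction j with
  | zero => intro v x c; simp
  | succ j ih =>
    intro v x c
    have h1 : be φ (j+1) v x c = ρF (⟨x, c⟩ : N ⋊[φ] C) (sc φ (be φ j (Fin.tail v) (v 0) 1)) := by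
      rw [sc_be, rho_be]
      simp
    have h2 : ∀ g y, (bd φ ∘ₗ bd φ) (ρF g y) = ρF g ((bd φ ∘ₗ bd φ) y) := fun g y => by
      simp only [LinearMap.comp_apply, bd, eqv_ρ]
    rw [h1, h2, ← LinearMap.comp_apply _ (sc φ), key, LinearMap.comp_apply, ih]
    simp

/-- the operators `T_c`. -/
noncomputable def TT (d : C) : BM φ →ₗ[ℤ] BM φ :=
  eqv (fun p => be φ p.1 (fun i => φ d⁻¹ (p.2 i)) 1 d)

@[simp] lemma TT_be (d j v x c) : TT φ d (be φ j v x c) = be φ j (fun i => φ d⁻¹ (v i)) x (c * d) := by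
  conv_lhs => rw [be, TT, eqv_bs, rho_be]
  simp

lemma TT_TT (c d : C) : TT φ c ∘ₗ TT φ d = TT φ (c * d) := by
  apply bm_ext
  intro j v x a
  simp only [LinearMap.comp_apply, TT_be, ← MulAut.mul_apply, ← map_mul, _root_.mul_inv_rev]
  rw [mul_comm c d, mul_comm c⁻¹, mul_assoc]

lemma TT_one : TT φ (1 : C) = LinearMap.id := by
  apply bm_ext
  intro j v x a
  simp

lemma TT_sc (d : C) : TT φ d ∘ₗ sc φ = sc φ ∘ₗ TT φ d := by
  apply bm_ext
  intro j v x a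
  simp only [LinearMap.comp_apply, TT_be, sc_be]
  congr 1
  funext i
  refine Fin.cases ?_ (fun i => ?_) i
  · simp only [Fin.cons_zero, ← MulAut.mul_apply, ← map_mul, _root_.mul_inv_rev]
  · simp

lemma TT_bd (d : C) : TT φ d ∘ₗ bd φ = bd φ ∘ₗ TT φ d := by
  apply bm_ext
  intro j v x a
  rcases j with _ | j
  · simp
  · simp only [LinearMap.comp_apply, TT_be, bd_succ, map_add, map_sum, _root_.map_smul]
    congr 1
    · congr 1
      simp only [← MulAut.mul_apply, ← map_mul]
      simp
    · refine Finset.sum_congr rfl fun k _ => ?_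
      congr 2
      funext i
      exact Crystal.comp_contractNth (φ d⁻¹).toMonoidHom k v i

end
end OHC

open CategoryTheory

namespace OHC
set_option linter.unusedSectionVars false
section
variable {N : Type} [Group N] {q : ℕ} [NeZero q] (φ : Multiplicative (ZMod q) →* MulAut N)

abbrev tg (q : ℕ) : Multiplicative (ZMod q) := Multiplicative.ofAdd 1

noncomputable def th (m : ℕ) : BM φ →ₗ[ℤ] BM φ :=
  if Even m then ∑ d, TT φ d else TT φ (tg q) - LinearMap.id

lemma th_congr {m n : ℕ} (h : Even m ↔ Even n) : th φ m = th φ n := by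
  simp [th, h]

lemma th_bd (m : ℕ) : th φ m ∘ₗ bd φ = bd φ ∘ₗ th φ m := by
  unfold th
  split_ifs
  · refine LinearMap.ext fun y => ?_
    simp only [LinearMap.comp_apply, LinearMap.sum_apply, map_sum]
    exact Finset.sum_congr rfl fun d _ => LinearMap.congr_fun (TT_bd φ d) y
  · rw [LinearMap.sub_comp, LinearMap.comp_sub, TT_bd]; rfl

lemma th_sc (m : ℕ) : th φ m ∘ₗ sc φ = sc φ ∘ₗ th φ m := by
  unfold th
  split_ifs
  · refine LinearMap.ext fun y => ?_
    simp only [LinearMap.comp_apply, LinearMap.sum_apply, map_sum]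
    exact Finset.sum_congr rfl fun d _ => LinearMap.congr_fun (TT_sc φ d) y
  · rw [LinearMap.sub_comp, LinearMap.comp_sub, TT_sc]; rfl

lemma th_th (m : ℕ) : th φ m ∘ₗ th φ (m+1) = 0 := by
  have hTT : ∀ c d y, TT φ c (TT φ d y) = TT φ (c * d) y :=
    fun c d y => LinearMap.congr_fun (TT_TT φ c d) y
  refine LinearMap.ext fun y => ?_
  unfold th
  by_cases h : Even m
  · have h1 : ¬ Even (m+1) := by rw [Nat.even_add_one]; simpa using h
    simp only [h, h1, if_true, if_false, LinearMap.comp_apply, LinearMap.sub_apply, map_sub,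
      LinearMap.sum_apply, hTT, LinearMap.id_apply, LinearMap.zero_apply]
    rw [sub_eq_zero]
    exact Fintype.sum_equiv (Equiv.mulRight (tg q)) _ _ (fun x => rfl)
  · have h1 : Even (m+1) := by rw [Nat.even_add_one]; simpa using h
    simp only [h, h1, if_true, if_false, LinearMap.comp_apply, LinearMap.sub_apply, map_sum,
      LinearMap.sum_apply, hTT, LinearMap.id_apply, LinearMap.zero_apply]
    rw [Finset.sum_sub_distrib, sub_eq_zero]
    exact Fintype.sum_equiv (Equiv.mulLeft (tg q)) _ _ (fun x => rfl)

lemma th_rho (m : ℕ) (g) (x : BM φ) : th φ m (ρF g x) = ρF g (th φ m x) := by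
  unfold th
  split_ifs
  · simp only [LinearMap.sum_apply, map_sum, TT, eqv_ρ]
  · simp only [LinearMap.sub_apply, LinearMap.id_apply, map_sub, TT, eqv_ρ]

noncomputable def DD0 (m : ℕ) (p : JJ N) : BM φ :=
  bd0 φ p + (-1 : ℤ)^p.1 • th φ (m + p.1) (be φ p.1 p.2 1 1)

noncomputable def DD (m : ℕ) : BM φ →ₗ[ℤ] BM φ := eqv (DD0 φ m)

noncomputable def DP (j m : ℕ) : BM φ →ₗ[ℤ] BM φ := bd φ + (-1 : ℤ)^j • th φ (m+j)

lemma DD_be (m j v x c) : DD φ m (be φ j v x c) = DP φ j m (be φ j v x c) := by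
  have h : be φ j v x c = ρF (⟨x, c⟩ : N ⋊[φ] _) (be φ j v 1 1) := by rw [rho_be]; simp
  conv_lhs => rw [be, DD, eqv_bs]
  simp only [DD0, DP, LinearMap.add_apply, LinearMap.smul_apply, map_add, _root_.map_smul,
    ← th_rho, rho_be, map_one, mul_one]
  congr 1
  conv_rhs => rw [be, bd, eqv_bs]

lemma DD_bd (m j v x c) : DD φ m (bd φ (be φ (j+1) v x c)) = DP φ j m (bd φ (be φ (j+1) v x c)) := by
  rw [bd_succ]
  simp only [map_add, map_sum, _root_.map_smul, DD_be]

lemma DD_TT (m j v x c d) : DD φ m (TT φ d (be φ j v x c)) = DP φ j m (TT φ d (be φ j v x c)) := by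
  rw [TT_be, DD_be]

lemma DD_th (m n j v x c) : DD φ m (th φ n (be φ j v x c)) = DP φ j m (th φ n (be φ j v x c)) := by
  unfold th
  split_ifs
  · simp only [LinearMap.sum_apply, map_sum, DD_TT]
  · simp only [LinearMap.sub_apply, LinearMap.id_apply, map_sub, DD_TT, DD_be]

lemma DD_DD (m : ℕ) : DD φ m ∘ₗ DD φ (m+1) = 0 := by
  apply bm_ext
  intro j v x c
  have hbb : ∀ y, bd φ (bd φ y) = 0 := fun y => LinearMap.congr_fun (bd_bd φ) y
  have htt : ∀ m y, th φ m (th φ (m+1) y) = 0 := fun m y => LinearMap.congr_fun (th_th φ m) y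
  have htb : ∀ m y, th φ m (bd φ y) = bd φ (th φ m y) := fun m y => LinearMap.congr_fun (th_bd φ m) y
  rw [LinearMap.comp_apply, DD_be]
  simp only [DP, LinearMap.add_apply, LinearMap.smul_apply, map_add, _root_.map_smul, DD_th]
  have e1 : m + 1 + j = m + j + 1 := by ring
  rcases j with _ | j
  · simp [hbb, ← htb, htt, e1]
  · rw [DD_bd]
    simp only [DP, LinearMap.add_apply, LinearMap.smul_apply, hbb, zero_add, htb]
    rw [e1, htt, th_congr φ (m := m + (j+1) + 1) (n := m + j) (by
      rw [show m + (j+1) + 1 = (m+j)+2 by ring, Nat.even_add]; simp)]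
    rw [pow_succ]
    simp

noncomputable def b0 (c : Multiplicative (ZMod q)) : BM φ := be φ 0 Fin.elim0 1 c

lemma TT_b0 (c d) : TT φ d (b0 φ c) = b0 φ (c * d) := by
  rw [b0, b0, TT_be]
  congr 1
  exact Subsingleton.elim _ _

lemma bd_b0 (c) : bd φ (b0 φ c) = 0 := bd_zero _ _ _ _

noncomputable def hv (m : ℕ) (c : Multiplicative (ZMod q)) : BM φ :=
  if Even m then ∑ i ∈ Finset.range (c.toAdd.val), b0 φ ((tg q)^i)
  else if c.toAdd.val = q - 1 then b0 φ 1 else 0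

noncomputable def hh (m : ℕ) : BM φ →ₗ[ℤ] BM φ :=
  lin (fun p g => if p.1 = 0 then hv φ m g.right else 0)

@[simp] lemma hh_zero (m v x c) : hh φ m (be φ 0 v x c) = hv φ m c := by
  simp [hh, be]
@[simp] lemma hh_succ (m j v x c) : hh φ m (be φ (j+1) v x c) = 0 := by
  simp [hh, be]

lemma hh_bd (m) : hh φ m ∘ₗ bd φ = 0 := by
  apply bm_ext
  intro j v x c
  rcases j with _ | _ | j
  · simp
  · simp [bd_succ]
  · simp [bd_succ]

lemma hh_th_succ (m n j v x c) : hh φ m (th φ n (be φ (j+1) v x c)) = 0 := by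
  unfold th
  split_ifs <;> simp

lemma DD_hv (m n c) : DD φ m (hv φ n c) = th φ m (hv φ n c) := by
  have h : ∀ c, DD φ m (b0 φ c) = th φ m (b0 φ c) := by
    intro c
    rw [b0, DD_be, DP]
    simp
  unfold hv
  split_ifs
  · simp only [map_sum, h]
  · exact h _
  · simp

lemma tg_pow_val (c : Multiplicative (ZMod q)) : (tg q)^(c.toAdd.val) = c := by
  rw [tg, ← ofAdd_nsmul]
  simp

lemma sum_b0 : ∑ d, b0 φ d = ∑ i ∈ Finset.range q, b0 φ ((tg q)^i) := by
  symm
  refine Finset.sum_bij (fun i _ => (tg q)^i) (fun _ _ => Finset.mem_univ _) ?_ ?_ (fun _ _ => rfl)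
  · intro i hi j hj h
    simp only [tg, ← ofAdd_nsmul] at h
    have h2 := Multiplicative.ofAdd.injective h
    simp only [nsmul_eq_mul, mul_one] at h2
    have h3 := congrArg ZMod.val h2
    rwa [ZMod.val_natCast_of_lt (Finset.mem_range.1 hi), ZMod.val_natCast_of_lt (Finset.mem_range.1 hj)] at h3
  · intro d _
    exact ⟨d.toAdd.val, Finset.mem_range.2 (ZMod.val_lt _), tg_pow_val d⟩

lemma hv_even (m : ℕ) (hm : Even m) (c) : th φ (m+1) (hv φ m c) = b0 φ c - b0 φ 1 := by
  have h1 : ¬ Even (m+1) := by rw [Nat.even_add_one]; simpa using hm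
  simp only [th, h1, hv, hm, if_false, if_true, LinearMap.sub_apply, LinearMap.id_apply, map_sum,
    TT_b0, ← pow_succ]
  rw [Finset.sum_range_sub (fun i => b0 φ (tg q ^ i)), tg_pow_val, pow_zero]

lemma hv_id (m : ℕ) (v x c) :
    th φ (m+2) (hv φ (m+1) c) + hh φ m (th φ (m+1) (be φ 0 v x c)) = b0 φ c := by
  have hq : 0 < q := Nat.pos_of_ne_zero (NeZero.ne q)
  by_cases hm : Even m
  · have h1 : ¬ Even (m+1) := by rw [Nat.even_add_one]; simpa using hm
    have h2 : Even (m+2) := by rw [Nat.even_add]; simpa using hm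
    simp only [th, h1, h2, hv, if_false, if_true, LinearMap.sub_apply, LinearMap.id_apply, map_sub,
      LinearMap.sum_apply, TT_be, hh_zero, hm]
    have hc : (Multiplicative.toAdd (c * tg q)).val = (c.toAdd + 1).val := rfl
    rw [hc]
    have hlt := ZMod.val_lt c.toAdd
    by_cases hcq : c.toAdd.val = q - 1
    · have h3 : (c.toAdd + 1).val = 0 := by
        rw [ZMod.val_eq_zero]
        have : c.toAdd = ((q - 1 : ℕ) : ZMod q) := by rw [← hcq]; simp
        rw [this, Nat.cast_sub hq]; simp
      simp only [hcq, if_true, TT_b0, one_mul, sum_b0, h3]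
      have h4 : Finset.range q = Finset.range ((q - 1) + 1) := by congr 1; omega
      have h5 := tg_pow_val c
      rw [hcq] at h5
      rw [h4, Finset.sum_range_succ, h5]
      simp
    · have h3 : (c.toAdd + 1).val = c.toAdd.val + 1 := by
        have h6 : (c.toAdd + 1) = ((c.toAdd.val + 1 : ℕ) : ZMod q) := by simp
        rw [h6, ZMod.val_natCast_of_lt (by omega)]
      rw [h3, Finset.sum_range_succ]
      simp [hcq, tg_pow_val]
  · have h1 : Even (m+1) := by rw [Nat.even_add_one]; simpa using hm
    rw [hv_even φ (m+1) h1]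
    simp only [th, h1, if_true, LinearMap.sum_apply, TT_be, map_sum, hh_zero, hv, hm, if_false]
    rw [Fintype.sum_equiv (Equiv.mulLeft c)
      (fun x => if (Multiplicative.toAdd (c * x)).val = q - 1 then b0 φ 1 else 0)
      (fun d => if d.toAdd.val = q - 1 then b0 φ 1 else 0) (fun x => rfl)]
    rw [Finset.sum_eq_single (Multiplicative.ofAdd ((q - 1 : ℕ) : ZMod q))]
    · simp [ZMod.val_natCast_of_lt (show q - 1 < q by omega)]
    · intro b _ hb
      rw [if_neg]
      intro h
      apply hb
      rw [← h]; simp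
    · simp

noncomputable def SS (m : ℕ) : BM φ →ₗ[ℤ] BM φ := sc φ + hh φ m

lemma SS_id (m : ℕ) : DD φ (m+2) ∘ₗ SS φ (m+1) + SS φ m ∘ₗ DD φ (m+1) = LinearMap.id := by
  apply bm_ext
  intro j v x c
  have hts : ∀ m y, th φ m (sc φ y) = sc φ (th φ m y) := fun m y => LinearMap.congr_fun (th_sc φ m) y
  have hbs := LinearMap.congr_fun (bd_sc φ) (be φ j v x c)
  have hhb : ∀ m y, hh φ m (bd φ y) = 0 := fun m y => LinearMap.congr_fun (hh_bd φ m) y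
  simp only [LinearMap.add_apply, LinearMap.comp_apply, SS, map_add, LinearMap.id_apply] at hbs ⊢
  have e : DD φ (m+2) (sc φ (be φ j v x c)) = DP φ (j+1) (m+2) (sc φ (be φ j v x c)) := by
    rw [sc_be, DD_be]
  rw [e, DD_be]
  simp only [DP, LinearMap.add_apply, LinearMap.smul_apply, map_add, _root_.map_smul, hhb, hts,
    LinearMap.sub_apply, LinearMap.id_apply] at hbs ⊢
  rw [th_congr φ (m := m + 2 + (j+1)) (n := m + 1 + j) (by
      rw [show m + 2 + (j+1) = (m+1+j)+2 by ring, Nat.even_add]; simp)]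
  have hbs' : bd φ (sc φ (be φ j v x c)) = be φ j v x c - rh φ (be φ j v x c) -
    sc φ (bd φ (be φ j v x c)) := by rw [← hbs]; simp
  rw [hbs']
  rcases j with _ | j
  · have := hv_id φ m v x c
    rw [hh_zero, DD_hv, rh_zero]
    simp only [bd_zero, map_zero, add_zero, zero_add, pow_zero, one_smul, pow_one, neg_smul]
    rw [eq_comm, ← sub_eq_iff_eq_add'] at this
    rw [← this, b0]
    abel
  · rw [hh_succ, hh_th_succ, rh_succ, pow_succ (-1:ℤ) (j+1)]
    simp only [mul_neg, mul_one, neg_smul, map_zero, sub_zero, smul_zero, add_zero]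
    abel

noncomputable def aug : BM φ →ₗ[ℤ] ℤ := lin (fun p _ => if p.1 = 0 then 1 else 0)

lemma SS_zero (v x c) : DD φ 1 (SS φ 0 (be φ 0 v x c)) =
    be φ 0 v x c - b0 φ 1 - th φ 2 (sc φ (be φ 0 v x c)) := by
  have hbs := LinearMap.congr_fun (bd_sc φ) (be φ 0 v x c)
  have e : DD φ 1 (sc φ (be φ 0 v x c)) = DP φ (0+1) 1 (sc φ (be φ 0 v x c)) := by
    rw [sc_be, DD_be]
  simp only [LinearMap.add_apply, LinearMap.comp_apply, SS, map_add, LinearMap.id_apply,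
    LinearMap.sub_apply, bd_zero, map_zero, add_zero, rh_zero, hh_zero, DD_hv] at hbs ⊢
  have h1 : th φ 1 (hv φ 0 c) = _ := hv_even φ 0 (by simp) c
  rw [h1, e, DP]
  simp only [LinearMap.add_apply, LinearMap.smul_apply, hbs, b0, zero_add, pow_one, neg_smul,
    one_smul, LinearMap.neg_apply, show 1 + 1 = 2 from rfl]
  abel

end
end OHC

open CategoryTheory

namespace OHC
set_option linter.unusedSectionVars false
section
variable {N : Type} [Group N] {q : ℕ} [NeZero q] (φ : Multiplicative (ZMod q) →* MulAut N)

abbrev II (N : Type) (n : ℕ) := {p : JJ N // p.1 ≤ n}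
abbrev PM (φ : Multiplicative (ZMod q) →* MulAut N) (n : ℕ) := FM (II N n) (N ⋊[φ] (Multiplicative (ZMod q)))

noncomputable def qq0 (n : ℕ) (p : JJ N) : PM φ n :=
  if h : p.1 ≤ n then bs (⟨p, h⟩ : II N n) 1 else 0

noncomputable def qq (n : ℕ) : BM φ →ₗ[ℤ] PM φ n := eqv (qq0 φ n)

noncomputable def ic (n : ℕ) : PM φ n →ₗ[ℤ] BM φ := eqv (fun p => bs p.1 1)

lemma qq_of_lt (n j v x c) (h : n < j) : qq φ n (be φ j v x c) = 0 := by
  rw [be, qq, eqv_bs, qq0, dif_neg (by simpa using h), map_zero]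

lemma qq_of_le (n j v x c) (h : j ≤ n) : qq φ n (be φ j v x c) = bs (⟨⟨j,v⟩, h⟩ : II N n) ⟨x, c⟩ := by
  rw [be, qq, eqv_bs, qq0, dif_pos h, ρF_bs, mul_one]

lemma ic_bs (n j v h x c) : ic φ n (bs (⟨⟨j,v⟩, h⟩ : II N n) ⟨x, c⟩) = be φ j v x c := by
  rw [ic, eqv_bs, ρF_bs, mul_one]; rfl

lemma qq_ic (n) (x : PM φ n) : qq φ n (ic φ n x) = x := by
  have : qq φ n ∘ₗ ic φ n = LinearMap.id := by
    apply fm_ext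
    rintro ⟨⟨j, v⟩, h⟩ ⟨x, c⟩
    rw [LinearMap.comp_apply, ic_bs, qq_of_le φ n j v x c h]; rfl
  exact LinearMap.congr_fun this x

lemma qq_th (n m j v x c) (h : n < j) : qq φ n (th φ m (be φ j v x c)) = 0 := by
  unfold th
  split_ifs <;> simp [qq_of_lt φ n j _ _ _ h]

lemma qq_DD (n m) (y : BM φ) : qq φ n (DD φ m (ic φ (n+1) (qq φ (n+1) y))) = qq φ n (DD φ m y) := by
  have : qq φ n ∘ₗ DD φ m ∘ₗ ic φ (n+1) ∘ₗ qq φ (n+1) = qq φ n ∘ₗ DD φ m := by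
    apply bm_ext
    intro j v x c
    simp only [LinearMap.comp_apply]
    by_cases h : j ≤ n + 1
    · rw [qq_of_le φ (n+1) j v x c h, ic_bs]
    · push Not at h
      rw [qq_of_lt φ (n+1) j v x c h, map_zero, map_zero, map_zero, DD_be]
      obtain ⟨j, rfl⟩ : ∃ i, j = i + 1 := ⟨j-1, by omega⟩
      rw [DP, bd, LinearMap.add_apply, ← bd, bd_succ]
      simp only [LinearMap.smul_apply, map_add, map_sum, _root_.map_smul,
        qq_of_lt φ n j _ _ _ (by omega : n < j), qq_th φ n _ (j+1) _ _ _ (by omega : n < j+1)]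
      simp
  exact LinearMap.congr_fun this y

lemma qq_SS (n m) (y : BM φ) (hy : qq φ n y = 0) : qq φ (n+1) (SS φ m y) = 0 := by
  have : qq φ (n+1) ∘ₗ SS φ m ∘ₗ ic φ n ∘ₗ qq φ n = qq φ (n+1) ∘ₗ SS φ m := by
    apply bm_ext
    intro j v x c
    simp only [LinearMap.comp_apply]
    by_cases h : j ≤ n
    · rw [qq_of_le φ n j v x c h, ic_bs]
    · push Not at h
      rw [qq_of_lt φ n j v x c h, map_zero, map_zero, map_zero, SS]
      obtain ⟨j, rfl⟩ : ∃ i, j = i + 1 := ⟨j-1, by omega⟩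
      simp only [LinearMap.add_apply, sc_be, hh_succ, add_zero]
      rw [qq_of_lt φ _ _ _ _ _ (by omega)]
  have h2 := LinearMap.congr_fun this y
  simp only [LinearMap.comp_apply, hy, map_zero] at h2
  exact h2.symm

noncomputable def dd0 (n : ℕ) (p : II N (n+1)) : PM φ n := qq φ n (DD0 φ (n+1) p.1)

noncomputable def dd (n : ℕ) : Rep.free ℤ (N ⋊[φ] (Multiplicative (ZMod q))) (II N (n+1)) ⟶
    Rep.free ℤ (N ⋊[φ] (Multiplicative (ZMod q))) (II N n) := eqvHom (dd0 φ n)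

lemma dd_apply (n : ℕ) (x : PM φ (n+1)) : (dd φ n).hom x = qq φ n (DD φ (n+1) (ic φ (n+1) x)) := by
  have h := eqvHom_apply (dd0 φ n) x
  refine h.trans ?_
  have : eqv (dd0 φ n) = qq φ n ∘ₗ DD φ (n+1) ∘ₗ ic φ (n+1) := by
    apply fm_ext
    rintro ⟨⟨j, v⟩, h⟩ ⟨x, c⟩
    rw [eqv_bs, LinearMap.comp_apply, LinearMap.comp_apply, ic_bs, dd0, be, DD, eqv_bs, qq, eqv_ρ]
  exact LinearMap.congr_fun this x

noncomputable def epsF : Rep.free ℤ (N ⋊[φ] (Multiplicative (ZMod q))) (II N 0) ⟶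
    Rep.trivial ℤ (N ⋊[φ] (Multiplicative (ZMod q))) ℤ :=
  Rep.freeLift ℤ _ (Rep.trivial ℤ (N ⋊[φ] (Multiplicative (ZMod q))) ℤ) (fun _ => (1:ℤ))

lemma eps_bs (p g) : (epsF φ).hom (bs p g) = (1 : ℤ) := by
  refine (Representation.freeLift_single_single _ p g (1:ℤ) _).trans ?_
  simp

lemma dd_dd (n : ℕ) : dd φ (n+1) ≫ dd φ n = 0 := by
  apply Rep.free_ext
  intro i
  change (dd φ n).hom ((dd φ (n+1)).hom (bs i 1)) = 0
  rw [dd_apply, dd_apply, qq_DD]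
  have := LinearMap.congr_fun (DD_DD φ (n+1)) (ic φ (n+2) (bs i 1))
  rw [LinearMap.comp_apply, LinearMap.zero_apply] at this
  rw [this, map_zero]

lemma epsF_apply (x : PM φ 0) : (epsF φ).hom x = lin (fun _ _ => (1:ℤ)) x := by
  have : (epsF φ).hom.toLinearMap = lin (J := II N 0) (G := N ⋊[φ] (Multiplicative (ZMod q))) (fun _ _ => (1:ℤ)) := by
    apply fm_ext
    intro p g
    rw [lin_bs]
    exact eps_bs φ p g
  exact LinearMap.congr_fun this x

lemma qq0_be (v x c) : qq φ 0 (be φ 0 v x c) = bs (⟨⟨0, Fin.elim0⟩, le_refl 0⟩ : II N 0) ⟨x, c⟩ := by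
  rw [qq_of_le φ 0 0 v x c (le_refl 0), Subsingleton.elim v Fin.elim0]

lemma dd_eps : dd φ 0 ≫ epsF φ = 0 := by
  apply Rep.free_ext
  rintro ⟨⟨j, v⟩, h⟩
  change (epsF φ).hom ((dd φ 0).hom (bs _ 1)) = 0
  rw [dd_apply]
  have h1 := ic_bs φ (0+1) j v h 1 1
  erw [h1]
  rw [DD_be, DP, epsF_apply]
  obtain rfl | rfl : j = 0 ∨ j = 1 := by simp at h; omega
  · rw [LinearMap.add_apply, bd_zero, zero_add, LinearMap.smul_apply, th, if_neg (by decide)]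
    simp [qq0_be]
  · rw [LinearMap.add_apply, bd_succ, LinearMap.smul_apply, map_add, _root_.map_smul,
      qq_th φ 0 _ 1 _ _ _ (by omega), smul_zero, add_zero]
    simp [qq0_be]

lemma dd_ex0 (x : PM φ 0) (hx : (epsF φ).hom x = 0) : ∃ y, (dd φ 0).hom y = x := by
  refine ⟨qq φ 1 (SS φ 0 (ic φ 0 x)), ?_⟩
  rw [dd_apply]
  rw [epsF_apply] at hx
  refine (qq_DD φ 0 (0+1) _).trans ?_
  have : qq φ 0 ∘ₗ DD φ (0+1) ∘ₗ SS φ 0 ∘ₗ ic φ 0 = LinearMap.id -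
    (LinearMap.toSpanSingleton ℤ _ (bs (⟨⟨0, Fin.elim0⟩, le_refl 0⟩ : II N 0) 1)) ∘ₗ lin (fun _ _ => (1:ℤ)) := by
    apply fm_ext
    rintro ⟨⟨j, v⟩, h⟩ ⟨x, c⟩
    obtain rfl : j = 0 := by simpa using h
    simp only [LinearMap.comp_apply, LinearMap.sub_apply]
    rw [ic_bs]
    have := SS_zero φ v x c
    simp only [zero_add] at this ⊢
    rw [this, map_sub, map_sub, sc_be, qq_th φ 0 _ _ _ _ _ (by omega), b0, qq0_be, qq0_be, lin_bs]
    simp [Subsingleton.elim v Fin.elim0]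
  have h2 := LinearMap.congr_fun this x
  simp only [LinearMap.comp_apply, LinearMap.sub_apply, hx] at h2
  rw [h2]; simp

lemma eps_surj : Function.Surjective (epsF φ).hom := by
  intro z
  refine ⟨z • bs (⟨⟨0, Fin.elim0⟩, le_refl 0⟩ : II N 0) 1, ?_⟩
  rw [epsF_apply, _root_.map_smul, lin_bs]; simp

lemma dd_ex (n : ℕ) (x : PM φ (n+1)) (hx : (dd φ n).hom x = 0) : ∃ y, (dd φ (n+1)).hom y = x := by
  rw [dd_apply] at hx
  refine ⟨qq φ (n+2) (SS φ (n+1) (ic φ (n+1) x)), ?_⟩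
  rw [dd_apply, qq_DD]
  have := LinearMap.congr_fun (SS_id φ n) (ic φ (n+1) x)
  simp only [LinearMap.add_apply, LinearMap.comp_apply, LinearMap.id_apply] at this
  rw [eq_sub_of_add_eq this, map_sub, qq_ic, qq_SS φ n n _ hx, sub_zero]

end
end OHC

open CategoryTheory

namespace OHC
set_option linter.unusedSectionVars false
set_option linter.unusedVariables false

/-- Inhomogeneous integral cochains. -/
abbrev Co (N : Type) (j : ℕ) := (Fin j → N) → ℤ

section
variable {N : Type} [Group N] {q : ℕ} [NeZero q] (φ : Multiplicative (ZMod q) →* MulAut N)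

def del (j : ℕ) : Co N j →+ Co N (j+1) where
  toFun f v := f (Fin.tail v) + ∑ k : Fin (j+1), (-1 : ℤ)^((k:ℕ)+1) * f (k.contractNth (· * ·) v)
  map_zero' := by funext v; simp
  map_add' f g := by
    funext v; simp only [Pi.add_apply, mul_add, Finset.sum_add_distrib]; ring

def tac (j : ℕ) (d : Multiplicative (ZMod q)) : Co N j →+ Co N j where
  toFun f v := f (fun i => φ d⁻¹ (v i))
  map_zero' := by funext v; simp
  map_add' f g := by funext v; simp

def tau (j : ℕ) : Co N j →+ Co N j := tac φ j (tg q)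
def nm (j : ℕ) : Co N j →+ Co N j := ∑ d, tac φ j d

def thc (m j : ℕ) : Co N j →+ Co N j := if Even m then nm φ j else tau φ j - AddMonoidHom.id _

noncomputable def ev (F : (j : ℕ) → Co N j) : BM φ →ₗ[ℤ] ℤ := lin (fun p _ => F p.1 p.2)

lemma ev_be (F : (j : ℕ) → Co N j) (j v x c) : ev φ F (be φ j v x c) = F j v := by
  rw [ev, be, lin_bs]

lemma ev_TT (F : (j : ℕ) → Co N j) (j v x c d) : ev φ F (TT φ d (be φ j v x c)) = tac φ j d (F j) v := by
  rw [TT_be, ev_be]; rfl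

lemma ev_th (F : (j : ℕ) → Co N j) (m j v x c) : ev φ F (th φ m (be φ j v x c)) = thc φ m j (F j) v := by
  unfold th thc
  split_ifs
  · simp only [LinearMap.sum_apply, map_sum, ev_TT, nm, AddMonoidHom.finsetSum_apply, Finset.sum_apply]
  · simp only [LinearMap.sub_apply, map_sub, ev_TT, LinearMap.id_apply, ev_be]; rfl

lemma ev_bd (F : (j : ℕ) → Co N j) (j v x c) : ev φ F (bd φ (be φ (j+1) v x c)) = del j (F j) v := by
  rw [bd_succ]
  simp only [map_add, map_sum, _root_.map_smul, ev_be, smul_eq_mul]; rfl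

def ex (n : ℕ) (f : II N n → ℤ) (j : ℕ) : Co N j := fun v => if h : j ≤ n then f ⟨⟨j, v⟩, h⟩ else 0

lemma ev_ex (n : ℕ) (f : II N n → ℤ) (y : BM φ) :
    lin (fun p _ => f p) (qq φ n y) = ev φ (ex n f) y := by
  have : lin (fun p _ => f p) ∘ₗ qq φ n = ev φ (ex n f) := by
    apply bm_ext
    intro j v x c
    rw [LinearMap.comp_apply, ev_be, ex]
    split_ifs with h
    · rw [qq_of_le φ n j v x c h, lin_bs]
    · rw [qq_of_lt φ n j v x c (by omega), map_zero]
  exact LinearMap.congr_fun this y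

lemma cob_eq (n : ℕ) (f : II N n → ℤ) (j v h) :
    cob (II N) (dd φ) (Rep.trivial ℤ (N ⋊[φ] (Multiplicative (ZMod q))) ℤ) n f ⟨⟨j, v⟩, h⟩
      = ev φ (ex n f) (DP φ j (n+1) (be φ j v 1 1)) := by
  have h1 : ∀ y : PM φ n, Representation.freeLift (Rep.trivial ℤ (N ⋊[φ] (Multiplicative (ZMod q))) ℤ).ρ f y
      = lin (fun p _ => f p) y := by
    intro y
    have : (Representation.freeLift (Rep.trivial ℤ (N ⋊[φ] (Multiplicative (ZMod q))) ℤ).ρ f).toLinearMap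
        = lin (J := II N n) (G := N ⋊[φ] (Multiplicative (ZMod q))) (fun p _ => f p) := by
      apply fm_ext
      intro p g
      rw [lin_bs]
      refine (Representation.freeLift_single_single _ p g (1:ℤ) _).trans ?_
      simp
    exact LinearMap.congr_fun this y
  have h2 : (dd φ n).hom (bs (⟨⟨j, v⟩, h⟩ : II N (n+1)) 1) = qq φ n (DP φ j (n+1) (be φ j v 1 1)) := by
    rw [dd_apply, ← DD_be]
    exact congrArg _ (congrArg _ (ic_bs φ (n+1) j v h 1 1))
  change Representation.freeLift (Rep.trivial ℤ (N ⋊[φ] (Multiplicative (ZMod q))) ℤ).ρ f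
    ((dd φ n).hom (bs (⟨⟨j, v⟩, h⟩ : II N (n+1)) 1)) = _
  rw [h2, h1, ev_ex]

lemma cob_zero (n : ℕ) (f : II N n → ℤ) (v h) :
    cob (II N) (dd φ) (Rep.trivial ℤ (N ⋊[φ] (Multiplicative (ZMod q))) ℤ) n f ⟨⟨0, v⟩, h⟩
      = thc φ (n+1) 0 (ex n f 0) v := by
  rw [cob_eq, DP, LinearMap.add_apply, bd_zero, zero_add, LinearMap.smul_apply, _root_.map_smul, ev_th]
  simp

lemma cob_succ (n : ℕ) (f : II N n → ℤ) (j v h) :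
    cob (II N) (dd φ) (Rep.trivial ℤ (N ⋊[φ] (Multiplicative (ZMod q))) ℤ) n f ⟨⟨j+1, v⟩, h⟩
      = del j (ex n f j) v + (-1)^(j+1) * thc φ (n+1+(j+1)) (j+1) (ex n f (j+1)) v := by
  rw [cob_eq, DP, LinearMap.add_apply, map_add, ev_bd, LinearMap.smul_apply, _root_.map_smul, ev_th, smul_eq_mul]

abbrev Cx3 (N : Type) := Co N 3 × Co N 2 × Co N 1 × ℤ
abbrev Cx4 (N : Type) := Co N 4 × Co N 3 × Co N 2 × Co N 1 × ℤ

def D3 : Cx3 N →+ Cx4 N where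
  toFun g := (del 3 g.1, del 2 g.2.1 - (tau φ 3 g.1 - g.1), del 1 g.2.2.1 + nm φ 2 g.2.1,
    - (tau φ 1 g.2.2.1 - g.2.2.1), q * g.2.2.2)
  map_zero' := by simp
  map_add' f g := by
    ext <;> simp <;> ring

structure Closed (f : Cx4 N) : Prop where
  h5 : del 4 f.1 = 0
  h4 : del 3 f.2.1 + (tau φ 4 f.1 - f.1) = 0
  h3 : del 2 f.2.2.1 - nm φ 3 f.2.1 = 0
  h2 : del 1 f.2.2.2.1 + (tau φ 2 f.2.2.1 - f.2.2.1) = 0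
  h1 : nm φ 1 f.2.2.2.1 = 0

def pk4 (f : Cx4 N) : II N 4 → ℤ
  | ⟨⟨0, _⟩, _⟩ => f.2.2.2.2
  | ⟨⟨1, v⟩, _⟩ => f.2.2.2.1 v
  | ⟨⟨2, v⟩, _⟩ => f.2.2.1 v
  | ⟨⟨3, v⟩, _⟩ => f.2.1 v
  | ⟨⟨4, v⟩, _⟩ => f.1 v
  | ⟨⟨j+5, v⟩, h⟩ => 0

def pk3 (f : Cx3 N) : II N 3 → ℤ
  | ⟨⟨0, _⟩, _⟩ => f.2.2.2
  | ⟨⟨1, v⟩, _⟩ => f.2.2.1 v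
  | ⟨⟨2, v⟩, _⟩ => f.2.1 v
  | ⟨⟨3, v⟩, _⟩ => f.1 v
  | ⟨⟨j+4, v⟩, h⟩ => 0

lemma pk4_surj (f : II N 4 → ℤ) : ∃ g, pk4 g = f := by
  refine ⟨(fun v => f ⟨⟨4, v⟩, by simp⟩, fun v => f ⟨⟨3, v⟩, by simp⟩, fun v => f ⟨⟨2, v⟩, by simp⟩,
    fun v => f ⟨⟨1, v⟩, by simp⟩, f ⟨⟨0, Fin.elim0⟩, by simp⟩), ?_⟩
  funext ⟨⟨j, v⟩, h⟩
  change j ≤ 4 at h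
  match j, v, h with
  | 0, v, h => rw [Subsingleton.elim v Fin.elim0]; rfl
  | 1, v, h => rfl
  | 2, v, h => rfl
  | 3, v, h => rfl
  | 4, v, h => rfl
  | j+5, v, h => omega

lemma pk3_surj (f : II N 3 → ℤ) : ∃ g, pk3 g = f := by
  refine ⟨(fun v => f ⟨⟨3, v⟩, by simp⟩, fun v => f ⟨⟨2, v⟩, by simp⟩,
    fun v => f ⟨⟨1, v⟩, by simp⟩, f ⟨⟨0, Fin.elim0⟩, by simp⟩), ?_⟩
  funext ⟨⟨j, v⟩, h⟩
  change j ≤ 3 at h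
  match j, v, h with
  | 0, v, h => rw [Subsingleton.elim v Fin.elim0]; rfl
  | 1, v, h => rfl
  | 2, v, h => rfl
  | 3, v, h => rfl
  | j+4, v, h => omega

lemma pk4_inj : Function.Injective (pk4 (N := N)) := by
  intro f g h
  have e : ∀ p, pk4 f p = pk4 g p := fun p => congrFun h p
  refine Prod.ext (funext fun v => e ⟨⟨4, v⟩, by simp⟩) (Prod.ext (funext fun v => e ⟨⟨3, v⟩, by simp⟩)
    (Prod.ext (funext fun v => e ⟨⟨2, v⟩, by simp⟩) (Prod.ext (funext fun v => e ⟨⟨1, v⟩, by simp⟩)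
      (e ⟨⟨0, Fin.elim0⟩, by simp⟩))))

lemma pk4_add (f g : Cx4 N) : pk4 (f + g) = pk4 f + pk4 g := by
  funext ⟨⟨j, v⟩, h⟩
  change j ≤ 4 at h
  match j, v, h with
  | 0, v, h => rfl
  | 1, v, h => rfl
  | 2, v, h => rfl
  | 3, v, h => rfl
  | 4, v, h => rfl
  | j+5, v, h => omega

lemma ex4 (f : Cx4 N) : ex 4 (pk4 f) 0 = (fun _ => f.2.2.2.2) ∧ ex 4 (pk4 f) 1 = f.2.2.2.1 ∧
    ex 4 (pk4 f) 2 = f.2.2.1 ∧ ex 4 (pk4 f) 3 = f.2.1 ∧ ex 4 (pk4 f) 4 = f.1 ∧ ex 4 (pk4 f) 5 = 0 :=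
  ⟨rfl, rfl, rfl, rfl, rfl, rfl⟩

lemma ex3 (f : Cx3 N) : ex 3 (pk3 f) 0 = (fun _ => f.2.2.2) ∧ ex 3 (pk3 f) 1 = f.2.2.1 ∧
    ex 3 (pk3 f) 2 = f.2.1 ∧ ex 3 (pk3 f) 3 = f.1 ∧ ex 3 (pk3 f) 4 = 0 :=
  ⟨rfl, rfl, rfl, rfl, rfl⟩

lemma thc_even (m j : ℕ) (h : Even m) : thc φ m j = nm φ j := if_pos h
lemma thc_odd (m j : ℕ) (h : ¬ Even m) : thc φ m j = tau φ j - AddMonoidHom.id _ := if_neg h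

lemma del0 (c : ℤ) : del (N := N) 0 (fun _ => c) = 0 := by
  funext v; simp [del]

lemma cob4 (f : Cx4 N) : cob (II N) (dd φ) (Rep.trivial ℤ (N ⋊[φ] (Multiplicative (ZMod q))) ℤ) 4 (pk4 f) = 0
    ↔ Closed φ f := by
  obtain ⟨e0, e1, e2, e3, e4, e5⟩ := ex4 f
  constructor
  · intro h
    refine ⟨?_, ?_, ?_, ?_, ?_⟩ <;> funext v
    · have := congrFun h ⟨⟨5, v⟩, le_refl 5⟩
      rw [cob_succ, e4, e5, map_zero] at this
      simpa using this
    · have := congrFun h ⟨⟨4, v⟩, by simp⟩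
      rw [cob_succ, e4, e3, thc_odd φ _ _ (by decide)] at this
      simpa using this
    · have := congrFun h ⟨⟨3, v⟩, by simp⟩
      rw [cob_succ, e3, e2, thc_even φ _ _ (by decide)] at this
      have h3 : ((-1:ℤ))^(2+1) = -1 := by norm_num
      rw [h3] at this
      simpa [sub_eq_add_neg] using this
    · have := congrFun h ⟨⟨2, v⟩, by simp⟩
      rw [cob_succ, e1, e2, thc_odd φ _ _ (by decide)] at this
      simpa using this
    · have := congrFun h ⟨⟨1, v⟩, by simp⟩
      rw [cob_succ, e1, e0, del0, thc_even φ _ _ (by decide)] at this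
      simpa using this
  · rintro ⟨h5, h4, h3, h2, h1⟩
    funext ⟨⟨j, v⟩, h⟩
    change j ≤ 5 at h
    match j, v, h with
    | 0, v, h => 
      rw [cob_zero, e0, thc_odd φ _ _ (by decide)]
      simp [tau, tac]
    | 1, v, h =>
      rw [cob_succ, e1, e0, del0, thc_even φ _ _ (by decide), h1]; simp
    | 2, v, h =>
      rw [cob_succ, e1, e2, thc_odd φ _ _ (by decide)]
      simpa using congrFun h2 v
    | 3, v, h => 
      rw [cob_succ, e3, e2, thc_even φ _ _ (by decide)]
      have e3 : ((-1:ℤ))^(2+1) = -1 := by norm_num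
      rw [e3]
      simpa [sub_eq_add_neg] using congrFun h3 v
    | 4, v, h =>
      rw [cob_succ, e4, e3, thc_odd φ _ _ (by decide)]
      simpa using congrFun h4 v
    | 5, v, h =>
      rw [cob_succ, e4, e5, map_zero, h5]; simp
    | j+6, v, h => omega

lemma cob3 (f : Cx3 N) : cob (II N) (dd φ) (Rep.trivial ℤ (N ⋊[φ] (Multiplicative (ZMod q))) ℤ) 3 (pk3 f)
    = pk4 (D3 φ f) := by
  obtain ⟨e0, e1, e2, e3, e4⟩ := ex3 f
  funext ⟨⟨j, v⟩, h⟩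
  change j ≤ 4 at h
  match j, v, h with
  | 0, v, h => 
    rw [cob_zero, e0, thc_even φ _ _ (by decide)]
    simp [nm, tac, pk4, D3]
  | 1, v, h =>
    rw [cob_succ, e1, e0, del0, thc_odd φ _ _ (by decide)]
    simp [pk4, D3]
  | 2, v, h =>
    rw [cob_succ, e1, e2, thc_even φ _ _ (by decide)]
    simp [pk4, D3]
  | 3, v, h => 
    rw [cob_succ, e3, e2, thc_odd φ _ _ (by decide)]
    have e3 : ((-1:ℤ))^(2+1) = -1 := by norm_num
    rw [e3]
    simp [pk4, D3]; ring
  | 4, v, h =>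
    rw [cob_succ, e4, e3, map_zero]
    simp [pk4, D3]
  | j+5, v, h => omega

lemma H4_desc : ∃ π : {f : Cx4 N // Closed φ f} →
      groupCohomology (Rep.trivial ℤ (N ⋊[φ] (Multiplicative (ZMod q))) ℤ) 4,
    (∀ x y z, z.1 = x.1 + y.1 → π z = π x + π y) ∧ Function.Surjective π ∧
    ∀ x, π x = 0 ↔ ∃ y, D3 φ y = x.1 := by
  obtain ⟨π, h1, h2, h3⟩ := free_res (II N) (dd φ) (epsF φ) (dd_dd φ) (dd_eps φ)
    (Rep.trivial ℤ (N ⋊[φ] (Multiplicative (ZMod q))) ℤ) (eps_surj φ) (dd_ex0 φ) (dd_ex φ) 3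
  refine ⟨fun f => π ⟨pk4 f.1, (cob4 φ f.1).2 f.2⟩, ?_, ?_, ?_⟩
  · intro x y z hz
    refine h1 _ _ _ ?_
    change pk4 z.1 = pk4 x.1 + pk4 y.1
    rw [hz, pk4_add]
  · intro w
    obtain ⟨⟨f, hf⟩, rfl⟩ := h2 w
    obtain ⟨g, rfl⟩ := pk4_surj f
    exact ⟨⟨g, (cob4 φ g).1 hf⟩, rfl⟩
  · intro x
    rw [h3]
    constructor
    · rintro ⟨y, hy⟩
      obtain ⟨g, rfl⟩ := pk3_surj y
      exact ⟨g, pk4_inj ((cob3 φ g).symm.trans hy)⟩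
    · rintro ⟨y, hy⟩
      refine ⟨pk3 y, ?_⟩
      exact (cob3 φ y).trans (congrArg pk4 hy)

end
end OHC

open CategoryTheory

namespace OHC
set_option linter.unusedSectionVars false
set_option linter.unusedVariables false

/-- `M` is generated by `m` elements. -/
def GenBy (M : Type) [AddCommGroup M] (m : ℕ) : Prop := ∃ f : (Fin m → ℤ) →+ M, Function.Surjective f

lemma GenBy.iff {M : Type} [AddCommGroup M] {m : ℕ} :
    GenBy M m ↔ ∃ g : Fin m → M, ∀ x, ∃ c : Fin m → ℤ, x = ∑ i, c i • g i := by
  constructor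
  · rintro ⟨f, hf⟩
    refine ⟨fun i => f (Pi.single i 1), fun x => ?_⟩
    obtain ⟨c, rfl⟩ := hf x
    refine ⟨c, ?_⟩
    simp only [← map_zsmul, ← map_sum]
    congr 1
    funext j
    simp [Finset.sum_apply, Pi.single_apply]
  · rintro ⟨g, hg⟩
    refine ⟨⟨⟨fun c => ∑ i, c i • g i, by simp⟩, fun x y => by simp [add_smul, Finset.sum_add_distrib]⟩, fun x => ?_⟩
    obtain ⟨c, hc⟩ := hg x
    exact ⟨c, hc.symm⟩

lemma GenBy.ext {A B C : Type} [AddCommGroup A] [AddCommGroup B] [AddCommGroup C] {a c : ℕ}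
    (f : A →+ B) (g : B →+ C) (h : ∀ x, g x = 0 → ∃ y, f y = x) (hA : GenBy A a) (hC : GenBy C c) :
    GenBy B (a + c) := by
  obtain ⟨ga, hga⟩ := GenBy.iff.1 hA
  obtain ⟨p, hp⟩ := hC
  let K : AddSubgroup (Fin c → ℤ) := g.range.comap p
  obtain ⟨r, b⟩ := Submodule.basisOfPid (Pi.basisFun ℤ (Fin c)) (AddSubgroup.toIntSubmodule K)
  have hr : r ≤ c := by
    have h1 := Module.finrank_eq_card_basis b
    have h2 := Submodule.finrank_le (AddSubgroup.toIntSubmodule K)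
    rw [h1] at h2
    simpa using h2
  have hl : ∀ i : Fin r, ∃ y : B, g y = p (b i).1 := fun i => (b i).2
  choose l hl using hl
  let e : Fin c → B := fun i => if h : (i:ℕ) < r then l ⟨i, h⟩ else 0
  rw [GenBy.iff]
  refine ⟨Fin.append (fun i => f (ga i)) e, fun x => ?_⟩
  obtain ⟨y, hy⟩ := hp (g x)
  let yk : AddSubgroup.toIntSubmodule K := ⟨y, ⟨x, hy.symm⟩⟩
  have hy2 : y = ∑ i, b.repr yk i • (b i).1 := by
    have := congrArg (AddSubgroup.toIntSubmodule K).subtype (b.sum_repr yk)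
    simp only [map_sum, _root_.map_smul] at this
    exact this.symm
  have hx : g (x - ∑ i, b.repr yk i • l i) = 0 := by
    rw [map_sub, map_sum, ← hy, hy2, map_sum]
    simp only [map_zsmul, hl]
    exact sub_self _
  obtain ⟨w, hw⟩ := h _ hx
  obtain ⟨ca, rfl⟩ := hga w
  refine ⟨Fin.append ca (fun i => if h : (i:ℕ) < r then b.repr yk ⟨i, h⟩ else 0), ?_⟩
  rw [Fin.sum_univ_add]
  simp only [Fin.append_left, Fin.append_right]
  rw [map_sum] at hw
  simp only [map_zsmul] at hw
  rw [hw]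
  have : ∑ i : Fin c, (if h : (i:ℕ) < r then b.repr yk ⟨i, h⟩ else 0) • e i = ∑ i, b.repr yk i • l i := by
    obtain ⟨s, rfl⟩ := Nat.exists_eq_add_of_le hr
    rw [Fin.sum_univ_add]
    simp [e]
  rw [this]
  abel

lemma GenBy.of_equiv {A B : Type} [AddCommGroup A] [AddCommGroup B] (e : A ≃+ B) {m : ℕ} (h : GenBy A m) :
    GenBy B m := by
  obtain ⟨f, hf⟩ := h
  exact ⟨e.toAddMonoidHom.comp f, e.surjective.comp hf⟩

lemma GenBy.subsingleton {A : Type} [AddCommGroup A] [Subsingleton A] (m : ℕ) : GenBy A m :=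
  ⟨0, fun x => ⟨0, Subsingleton.elim _ _⟩⟩

lemma int_prim {k : Type} [CommRing k] (g : ℤ → k) : ∃ F : ℤ → k, ∀ n, F (n+1) - F n = g n := by
  refine ⟨fun n => ∑ i ∈ Finset.range n.toNat, g i - ∑ i ∈ Finset.range (-n).toNat, g (-1 - i), fun n => ?_⟩
  rcases Int.eq_nat_or_neg n with ⟨m, rfl | rfl⟩
  · have h1 : ((m:ℤ)+1).toNat = m + 1 := by omega
    have h2 : (-((m:ℤ)+1)).toNat = 0 := by omega
    have h3 : (-(m:ℤ)).toNat = 0 := by omega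
    simp only [h1, h2, h3, Int.toNat_natCast, Finset.sum_range_succ]
    simp
  · rcases m with _ | m
    · simp
    have h1 : (-((m+1:ℕ):ℤ)+1).toNat = 0 := by omega
    have h2 : (-(-((m+1:ℕ):ℤ)+1)).toNat = m := by omega
    have h3 : (-(-((m+1:ℕ):ℤ))).toNat = m+1 := by omega
    have h4 : (-((m+1:ℕ):ℤ)).toNat = 0 := by omega
    simp only [h1, h2, h3, h4, Finset.sum_range_succ]
    have h5 : -((m+1:ℕ):ℤ) = -1 - m := by push_cast; ring
    rw [h5]; simp

section
variable {k : Type} [CommRing k] {G : Type} [Group G] (χ : G →* Multiplicative ℤ) (t : G) (ht : χ t = Multiplicative.ofAdd 1)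

noncomputable abbrev CI : Rep k G := Rep.coind χ.ker.subtype (Rep.trivial k χ.ker k)

lemma CI_mem (f : G → k) : f ∈ Representation.coindV χ.ker.subtype (Rep.trivial k χ.ker k).ρ ↔
    ∀ s h, χ s = 1 → f (s * h) = f h := by
  rw [Representation.mem_coindV]
  constructor
  · intro H s h hs
    exact H ⟨s, hs⟩ h
  · intro H s h
    exact H s.1 h s.2

noncomputable def ciL : (CI (k := k) χ) →ₗ[k] (CI (k := k) χ) where
  toFun f := ⟨fun h => f.1 (t * h) - f.1 h, by
    rw [CI_mem]
    intro s h hs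
    have hf := (CI_mem χ f.1).1 f.2
    have h1 : t * (s * h) = (t * s * t⁻¹) * (t * h) := by group
    rw [hf s h hs, h1, hf _ _ (by simp [hs])]⟩
  map_add' f g := by
    apply Subtype.ext; funext h
    simp; ring
  map_smul' c f := by
    apply Subtype.ext; funext h
    simp [mul_sub]

noncomputable def ciG : (CI (k := k) χ) ⟶ (CI (k := k) χ) := Rep.ofHom
  ⟨ciL χ t, fun g => by
    apply LinearMap.ext; intro f
    apply Subtype.ext; funext h
    change f.1 (t * h * g) - f.1 (h * g) = f.1 (t * (h * g)) - f.1 (h * g)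
    rw [mul_assoc]⟩

noncomputable def ciF : (Rep.trivial k G k) ⟶ (CI (k := k) χ) := Rep.ofHom
  ⟨{ toFun := fun a => ⟨fun _ => a, by rw [CI_mem]; intros; rfl⟩
     map_add' := fun _ _ => rfl
     map_smul' := fun _ _ => rfl }, fun g => by
    apply LinearMap.ext; intro f
    apply Subtype.ext; funext h
    rfl⟩


lemma chi_decomp (ht : χ t = Multiplicative.ofAdd 1) (h : G) : ∃ s, χ s = 1 ∧ h = s * t ^ (χ h).toAdd := by
  refine ⟨h * (t ^ (χ h).toAdd)⁻¹, ?_, by group⟩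
  rw [map_mul, map_inv, map_zpow, ht, ← ofAdd_zsmul]
  simp

noncomputable def ciS : ShortComplex (Rep k G) := ShortComplex.mk (ciF (k := k) χ) (ciG χ t) (by
  apply Rep.hom_ext
  apply Representation.IntertwiningMap.ext
  apply LinearMap.ext
  intro a
  apply Subtype.ext; funext h
  exact sub_self a)

lemma ciS_exact (ht : χ t = Multiplicative.ofAdd 1) : (ciS (k := k) χ t).ShortExact where
  exact := by
    rw [← ShortComplex.exact_map_iff_of_faithful _ (forget₂ (Rep k G) (ModuleCat k)),
      ShortComplex.moduleCat_exact_iff]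
    intro f hf
    have hf1 : ∀ h, f.1 (t * h) = f.1 h := by
      intro h
      have := congrArg (fun z => z.1 h) (show ciL χ t f = 0 from hf)
      exact sub_eq_zero.1 this
    have hf2 := (CI_mem χ f.1).1 f.2
    have hf3 : ∀ (n : ℤ) h, f.1 (t ^ n * h) = f.1 h := by
      intro n
      induction n with
      | zero => simp
      | succ i ih => intro h; rw [_root_.zpow_add_one, mul_assoc, ih, hf1]
      | pred i ih => 
        intro h; rw [_root_.zpow_sub_one, mul_assoc, ih, ← hf1]; simp
    refine ⟨f.1 1, ?_⟩
    apply Subtype.ext; funext h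
    obtain ⟨s, hs, e⟩ := chi_decomp χ t ht h
    change f.1 1 = f.1 h
    rw [e, hf2 _ _ hs, ← hf3 ((χ h).toAdd) 1, mul_one]
  mono_f := by
    rw [Rep.mono_iff_injective]
    intro a b hab
    exact congrArg (fun z => z.1 1) hab
  epi_g := by
    rw [Rep.epi_iff_surjective]
    intro f
    have hf2 := (CI_mem χ f.1).1 f.2
    obtain ⟨F, hF⟩ := int_prim (fun n => f.1 (t ^ n))
    refine ⟨⟨fun h => F (χ h).toAdd, ?_⟩, ?_⟩
    · rw [CI_mem]
      intro s h hs
      simp [hs]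
    · apply Subtype.ext; funext h
      change F (χ (t * h)).toAdd - F (χ h).toAdd = f.1 h
      obtain ⟨s, hs, e⟩ := chi_decomp χ t ht h
      rw [map_mul, ht, toAdd_mul, toAdd_ofAdd, add_comm, hF]
      conv_rhs => rw [e]
      rw [hf2 _ _ hs]

lemma ci_les (ht : χ t = Multiplicative.ofAdd 1) (i : ℕ) :
    ∃ (f : groupCohomology (Rep.trivial k χ.ker k) i →ₗ[k] groupCohomology (Rep.trivial k G k) (i+1))
      (g : groupCohomology (Rep.trivial k G k) (i+1) →ₗ[k] groupCohomology (Rep.trivial k χ.ker k) (i+1)),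
      ∀ x, g x = 0 → ∃ y, f y = x := by
  have h := groupCohomology.mapShortComplex₁_exact (ciS_exact (k := k) χ t ht) (i := i) rfl
  rw [ShortComplex.moduleCat_exact_iff] at h
  let e := fun j => (groupCohomology.coindIso (Rep.trivial k χ.ker k) j).toLinearEquiv
  refine ⟨(groupCohomology.mapShortComplex₁ (ciS_exact (k := k) χ t ht) (i := i) rfl).f.hom ∘ₗ (e i).symm.toLinearMap,
    (e (i+1)).toLinearMap ∘ₗ (groupCohomology.mapShortComplex₁ (ciS_exact (k := k) χ t ht) (i := i) rfl).g.hom, ?_⟩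
  intro x hx
  have hx' : (groupCohomology.mapShortComplex₁ (ciS_exact (k := k) χ t ht) (i := i) rfl).g.hom x = 0 :=
    (e (i+1)).injective (hx.trans (map_zero _).symm)
  obtain ⟨y, hy⟩ := h x hx'
  refine ⟨e i y, ?_⟩
  exact (congrArg _ ((e i).symm_apply_apply y)).trans hy

end

def lastHom (n : ℕ) : Crystal.Lat (n+1) →* Multiplicative ℤ :=
  AddMonoidHom.toMultiplicative (Pi.evalAddMonoidHom (fun _ : Fin (n+1) => ℤ) 0)

def kerEquiv {G : Type} [Group G] {n : ℕ} (e : G ≃* Crystal.Lat (n+1)) :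
    ((lastHom n).comp e.toMonoidHom).ker ≃* Crystal.Lat n where
  toFun x := Multiplicative.ofAdd (Fin.tail (e x.1).toAdd)
  invFun y := ⟨e.symm (Multiplicative.ofAdd (Fin.cons 0 y.toAdd)), by
    rw [MonoidHom.mem_ker]
    simp [lastHom]⟩
  left_inv x := by
    apply Subtype.ext
    have hx : (e x.1).toAdd 0 = 0 := congrArg Multiplicative.toAdd x.2
    simp only [toAdd_ofAdd]
    rw [← hx, Fin.cons_self_tail]
    simp
  right_inv y := by
    simp
  map_mul' x y := by
    apply Multiplicative.toAdd.injective
    funext i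
    change (e (x.1 * y.1)).toAdd i.succ = (e x.1).toAdd i.succ + (e y.1).toAdd i.succ
    rw [map_mul]; rfl

lemma genBy_zero (G : Type) [Group G] : GenBy (groupCohomology (Rep.trivial ℤ G ℤ) 0) 1 := by
  have e := (groupCohomology.H0IsoOfIsTrivial (Rep.trivial ℤ G ℤ)).toLinearEquiv.toAddEquiv
  exact GenBy.of_equiv e.symm (⟨Pi.evalAddMonoidHom (fun _ : Fin 1 => ℤ) 0, fun x => ⟨fun _ => x, rfl⟩⟩ : GenBy ℤ 1)

lemma genBy_lat (n : ℕ) : ∀ (j : ℕ) (G : Type) [Group G] (e : G ≃* Crystal.Lat n),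
    GenBy (groupCohomology (Rep.trivial ℤ G ℤ) j) (n.choose j) := by
  induction n with
  | zero =>
    intro j G _ e
    rcases j with _ | j
    · exact genBy_zero G
    · have : Subsingleton G := e.toEquiv.subsingleton
      have h := isZero_groupCohomology_succ_of_subsingleton (Rep.trivial ℤ G ℤ) j
      have := ModuleCat.subsingleton_of_isZero h
      exact GenBy.subsingleton _
  | succ n ih =>
    intro j G _ e
    rcases j with _ | j
    · simpa using genBy_zero G
    · let χ := (lastHom n).comp e.toMonoidHom
      let t := e.symm (Multiplicative.ofAdd (Pi.single 0 1))
      have ht : χ t = Multiplicative.ofAdd 1 := by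
        simp [χ, t, lastHom]
      obtain ⟨f, g, h⟩ := ci_les (k := ℤ) χ t ht j
      rw [Nat.choose_succ_succ]
      exact GenBy.ext f.toAddMonoidHom g.toAddMonoidHom h (ih j _ (kerEquiv e)) (ih (j+1) _ (kerEquiv e))

end OHC

open CategoryTheory

namespace OHC
set_option linter.unusedSectionVars false
set_option linter.unusedVariables false

/-! List-based integer linear algebra, suitable for kernel evaluation. -/

def dot : List ℤ → (ℕ → ℤ) → ℤ
  | [], _ => 0
  | a :: l, x => a * x 0 + dot l (fun i => x (i+1))

def addR : List ℤ → List ℤ → List ℤ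
  | [], l => l
  | a :: l, [] => a :: l
  | a :: l, b :: m => (a + b) :: addR l m

def smulR (c : ℤ) (l : List ℤ) : List ℤ := l.map (c * ·)

/-- Linear combination of rows. -/
def lc : List ℤ → List (List ℤ) → List ℤ
  | [], _ => []
  | _ :: _, [] => []
  | a :: l, r :: M => if a = 0 then lc l M else addR (smulR a r) (lc l M)

lemma dot_addR (l m : List ℤ) (x : ℕ → ℤ) : dot (addR l m) x = dot l x + dot m x := by
  induction l generalizing m x with
  | nil => simp [addR, dot]
  | cons a l ih =>
    cases m with
    | nil => simp [addR, dot]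
    | cons b m => simp only [addR, dot, ih]; ring

lemma dot_smulR (c : ℤ) (l : List ℤ) (x : ℕ → ℤ) : dot (smulR c l) x = c * dot l x := by
  induction l generalizing x with
  | nil => simp [smulR, dot]
  | cons a l ih =>
    have := ih (fun i => x (i+1))
    simp only [smulR, List.map_cons, dot] at this ⊢
    rw [this]; ring

def row (M : List (List ℤ)) (i : ℕ) : List ℤ := M.getD i []

def act (M : List (List ℤ)) (x : ℕ → ℤ) : ℕ → ℤ := fun i => dot (row M i) x

lemma dot_lc (l : List ℤ) (M : List (List ℤ)) (x : ℕ → ℤ) : dot (lc l M) x = dot l (act M x) := by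
  induction l generalizing M with
  | nil => simp [lc, dot]
  | cons a l ih =>
    cases M with
    | nil =>
      have : ∀ l : List ℤ, dot l (act [] x) = 0 := by
        intro l
        have : act [] x = fun _ => 0 := by funext i; simp [act, row, dot]
        rw [this]
        induction l with
        | nil => rfl
        | cons b l ih => simp [dot, ih]
      rw [this]; simp [lc, dot]
    | cons r M =>
      have e : (fun i => act (r :: M) x (i+1)) = act M x := by
        funext i; simp [act, row]
      have e0 : act (r :: M) x 0 = dot r x := by simp [act, row]
      simp only [lc, dot, e, e0, ← ih]
      split_ifs with h
      · simp [h]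
      · rw [dot_addR, dot_smulR]

def mulL (A B : List (List ℤ)) : List (List ℤ) := A.map (fun r => lc r B)
def smulL (c : ℤ) (A : List (List ℤ)) : List (List ℤ) := A.map (smulR c)
def addL : List (List ℤ) → List (List ℤ) → List (List ℤ)
  | [], l => l
  | a :: l, [] => a :: l
  | a :: l, b :: m => addR a b :: addL l m

lemma act_mul (A B x) : act (mulL A B) x = act A (act B x) := by
  funext i
  simp only [act, row, mulL]
  rw [show ([] : List ℤ) = (fun r => lc r B) [] from rfl, List.getD_map]
  exact dot_lc _ _ _

lemma act_smul (c A x) : act (smulL c A) x = fun i => c * act A x i := by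
  funext i
  simp only [act, row, smulL]
  rw [show ([] : List ℤ) = (smulR c) [] from rfl, List.getD_map]
  exact dot_smulR _ _ _

lemma act_addL (A B x) : act (addL A B) x = fun i => act A x i + act B x i := by
  funext i
  induction A generalizing B i with
  | nil => simp [addL, act, row, dot]
  | cons a A ih =>
    cases B with
    | nil => simp [addL, act, row, dot]
    | cons b B =>
      cases i with
      | zero => simp [addL, act, row, dot_addR]
      | succ i => simpa [addL, act, row] using ih B i

lemma dot_add (l : List ℤ) (x y : ℕ → ℤ) : dot l (x + y) = dot l x + dot l y := by
  induction l generalizing x y with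
  | nil => simp [dot]
  | cons a l ih =>
    have := ih (fun i => x (i+1)) (fun i => y (i+1))
    simp only [dot, Pi.add_apply] at this ⊢
    rw [← add_add_add_comm, ← mul_add, ← this]; rfl

def actH (M : List (List ℤ)) : (ℕ → ℤ) →+ (ℕ → ℤ) where
  toFun := act M
  map_zero' := by
    funext i
    have h := dot_add (row M i) 0 0
    simp only [add_zero, left_eq_add] at h
    simpa [act] using h
  map_add' x y := by funext i; exact dot_add _ _ _

lemma actH_apply (M x) : actH M x = act M x := rfl

/-- vectors supported on the first `n` entries -/
def Sup (n : ℕ) (x : ℕ → ℤ) : Prop := ∀ i, n ≤ i → x i = 0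

lemma act_sup (M : List (List ℤ)) (n x) (h : M.length ≤ n) : Sup n (act M x) := by
  intro i hi
  simp only [act, row]
  rw [List.getD_eq_default _ _ (h.trans hi)]
  rfl

def unitR : ℕ → List ℤ
  | 0 => [1]
  | i+1 => 0 :: unitR i

lemma dot_unitR (i x) : dot (unitR i) x = x i := by
  induction i generalizing x with
  | zero => simp [unitR, dot]
  | succ i ih => simp [unitR, dot, ih]

/-- rows padded to length `n` -/
def oneL (n : ℕ) : List (List ℤ) := (List.range n).map (fun i => addR (unitR i) (List.replicate n 0))

lemma dot_zero (n : ℕ) (x) : dot (List.replicate n 0) x = 0 := by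
  induction n generalizing x with
  | zero => rfl
  | succ n ih => simp [List.replicate_succ, dot, ih]

lemma act_one (n x) (hx : Sup n x) : act (oneL n) x = x := by
  funext i
  by_cases h : i < n
  · simp [act, row, oneL, h, dot_addR, dot_zero, dot_unitR]
  · rw [hx i (by omega)]
    exact act_sup _ n _ (by simp [oneL]) i (by omega)

def subL (A B : List (List ℤ)) : List (List ℤ) := addL A (smulL (-1) B)

lemma act_sub (A B x) : act (subL A B) x = act A x - act B x := by
  rw [subL, act_addL, act_smul]; funext i; simp [sub_eq_add_neg]

/-- decode rows written as decimal numbers: digit `d` means `d - o` -/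
def decR : ℕ → ℕ → ℕ → List ℤ → List ℤ
  | 0, _, _, acc => acc
  | n+1, o, r, acc => decR n o (r / 10) (((((r % 10 : ℕ) : ℤ) - (o : ℤ))) :: acc)

def decL (n o : ℕ) (l : List ℕ) : List (List ℤ) := l.map (fun r => decR n o r [])

/-- Sum of the powers `M^k`, `k < m`. -/
def normL (n : ℕ) (M : List (List ℤ)) : ℕ → List (List ℤ)
  | 0 => []
  | k+1 => addL (oneL n) (mulL M (normL n M k))

end OHC

open CategoryTheory

namespace OHC
set_option linter.unusedSectionVars false
set_option linter.unusedVariables false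

section
variable {k : Type} [CommRing k] {ι : Type} {c : ComplexShape ι}

/-- `h` is the homology class of the cycle `x`. -/
def HRel (K : HomologicalComplex (ModuleCat.{0} k) c) (j : ι) (x : K.X j) (h : K.homology j) : Prop :=
  ∃ z : K.cycles j, (K.iCycles j).hom z = x ∧ (K.homologyπ j).hom z = h

variable (K K' : HomologicalComplex (ModuleCat.{0} k) c)

lemma HRel.add {j x y h h'} (a : HRel K j x h) (b : HRel K j y h') : HRel K j (x+y) (h+h') := by
  obtain ⟨z, rfl, rfl⟩ := a
  obtain ⟨w, rfl, rfl⟩ := b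
  exact ⟨z+w, map_add _ _ _, map_add _ _ _⟩

lemma HRel.map {j x h} (f : K ⟶ K') (a : HRel K j x h) :
    HRel K' j ((f.f j).hom x) ((HomologicalComplex.homologyMap f j).hom h) := by
  obtain ⟨z, rfl, rfl⟩ := a
  refine ⟨(HomologicalComplex.cyclesMap f j).hom z, ?_, ?_⟩
  · have := congrArg (fun t => t.hom z) (HomologicalComplex.cyclesMap_i f j)
    exact this
  · have := congrArg (fun t => t.hom z) (HomologicalComplex.homologyπ_naturality f j)
    exact this.symm

lemma HRel.surj (j) (h : K.homology j) : ∃ x, HRel K j x h := by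
  obtain ⟨z, hz⟩ := (ModuleCat.epi_iff_surjective (K.homologyπ j)).1 inferInstance h
  exact ⟨_, z, rfl, hz⟩

lemma HRel.cyc {j x h} (a : HRel K j x h) (l) : (K.d j l).hom x = 0 := by
  obtain ⟨z, rfl, rfl⟩ := a
  have := congrArg (fun t => t.hom z) (K.iCycles_d j l)
  exact this

lemma iCyc_inj (j) : Function.Injective (K.iCycles j).hom :=
  (ModuleCat.mono_iff_injective (K.iCycles j)).1 inferInstance

lemma HRel.uniq {j x h h'} (a : HRel K j x h) (b : HRel K j x h') : h = h' := by
  obtain ⟨z, hz, rfl⟩ := a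
  obtain ⟨w, hw, rfl⟩ := b
  rw [iCyc_inj K j (hz.trans hw.symm)]

lemma HRel.zero {j i} (hi : c.prev j = i) {x} : HRel K j x 0 ↔ ∃ y, (K.d i j).hom y = x := by
  have ex : (ShortComplex.mk (K.toCycles i j) (K.homologyπ j) (K.toCycles_comp_homologyπ i j)).Exact :=
    ShortComplex.exact_of_g_is_cokernel _ (K.homologyIsCokernel i j hi)
  rw [ShortComplex.moduleCat_exact_iff] at ex
  have e : ∀ y, (K.iCycles j).hom ((K.toCycles i j).hom y) = (K.d i j).hom y := fun y =>
    congrArg (fun t => t.hom y) (K.toCycles_i i j)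
  constructor
  · rintro ⟨z, rfl, hz⟩
    obtain ⟨y, hy⟩ := ex z hz
    refine ⟨y, ?_⟩
    rw [← e]; exact congrArg _ hy
  · rintro ⟨y, rfl⟩
    refine ⟨(K.toCycles i j).hom y, e y, ?_⟩
    exact congrArg (fun t => t.hom y) (K.toCycles_comp_homologyπ i j)

lemma HRel.ex {j l} (hl : c.next j = l) {x} (hx : (K.d j l).hom x = 0) : ∃ h, HRel K j x h := by
  have ex : (ShortComplex.mk (K.iCycles j) (K.d j l) (K.iCycles_d j l)).Exact :=
    ShortComplex.exact_of_f_is_kernel _ (K.cyclesIsKernel j l hl)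
  rw [ShortComplex.moduleCat_exact_iff] at ex
  obtain ⟨z, hz⟩ := ex x hx
  exact ⟨_, z, hz, rfl⟩

end

section
variable {N : Type} [Group N] {q : ℕ} [NeZero q] (φ : Multiplicative (ZMod q) →* MulAut N)

/-- `h` is the class of the inhomogeneous cocycle `x`. -/
def CRel (N : Type) [Group N] (j : ℕ) (x : Co N j) (h : groupCohomology (Rep.trivial ℤ N ℤ) j) : Prop :=
  HRel (groupCohomology.inhomogeneousCochains (Rep.trivial ℤ N ℤ)) j x h

lemma inh_d (j : ℕ) (x : Co N j) :
   ((groupCohomology.inhomogeneousCochains (Rep.trivial ℤ N ℤ)).d j (j+1)).hom x = del j x := by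
  rw [groupCohomology.inhomogeneousCochains.d_def]
  funext v
  refine (inhomogeneousCochains.d_hom_apply _ _ _ _).trans ?_
  simp only [del, smul_eq_mul]
  rfl

lemma CRel.add {j x y h h'} (a : CRel N j x h) (b : CRel N j y h') : CRel N j (x+y) (h+h') := HRel.add _ a b

lemma CRel.surj (j) (h) : ∃ x, CRel N j x h := HRel.surj _ j h

lemma CRel.cyc {j x h} (a : CRel N j x h) : del j x = 0 := by
  rw [← inh_d]; exact HRel.cyc _ a _

lemma CRel.uniq {j x h h'} (a : CRel N j x h) (b : CRel N j x h') : h = h' := HRel.uniq _ a b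

lemma CRel.zero {j x} : CRel N (j+1) x 0 ↔ ∃ y, del j y = x := by
  refine (HRel.zero _ (i := j) (by simp)).trans ?_
  simp only [← inh_d]

lemma CRel.zero0 {x} : CRel N 0 x 0 ↔ x = 0 := by
  refine (HRel.zero _ (i := 0) (by simp)).trans ?_
  constructor
  · rintro ⟨y, rfl⟩
    rw [HomologicalComplex.shape _ _ _ (by simp)]; rfl
  · rintro rfl
    exact ⟨0, map_zero _⟩

lemma CRel.ex {j x} (hx : del j x = 0) : ∃ h, CRel N j x h :=
  HRel.ex _ (l := j+1) (by simp) (by rw [← inh_d] at hx; exact hx)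

lemma CRel.act {j x h} (a : CRel N j x h) (g : Multiplicative (ZMod q)) : CRel N j (tac φ j g x)
    ((Crystal.cohRep φ (1 : Representation ℤ (Multiplicative (ZMod q)) ℤ) j).ρ g h) :=
  HRel.map _ _ (Crystal.cochainsMap (Rep.trivial ℤ N ℤ) (Rep.trivial ℤ N ℤ) (φ g⁻¹).toMonoidHom
    ((1 : Representation ℤ (Multiplicative (ZMod q)) ℤ) g) (fun _ _ => rfl)) a

lemma CRel.neg {j x h} (a : CRel N j x h) : CRel N j (-x) (-h) := by
  obtain ⟨z, rfl, rfl⟩ := a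
  exact ⟨-z, map_neg _ _, map_neg _ _⟩
end

end OHC

open CategoryTheory

namespace OHC
set_option linter.unusedSectionVars false
set_option linter.unusedVariables false

section
variable {N : Type} [CommGroup N]

/-- Multi-additive cochains. -/
def MLin {j : ℕ} (f : Co N j) : Prop :=
  ∀ v i x y, f (Function.update v i (x * y)) = f (Function.update v i x) + f (Function.update v i y)

lemma contr_eq {j : ℕ} (v : Fin (j+1) → N) (k : Fin j) :
    k.castSucc.contractNth (· * ·) v
      = Function.update (k.castSucc.removeNth v) k (v k.castSucc * v k.succ) := by
  funext i
  rcases lt_trichotomy (i : ℕ) k with h | h | h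
  · rw [Fin.contractNth_apply_of_lt _ _ _ _ h, Function.update_of_ne (by omega)]
    rw [Fin.removeNth_apply, Fin.succAbove_of_castSucc_lt k.castSucc i (Fin.lt_def.2 h)]
  · have : i = k := Fin.ext h
    subst this
    rw [Fin.contractNth_apply_of_eq _ _ _ _ rfl]; simp
  · rw [Fin.contractNth_apply_of_gt _ _ _ _ h, Function.update_of_ne (by omega)]
    rw [Fin.removeNth_apply, Fin.succAbove_of_le_castSucc _ _ (Fin.le_def.2 (show (k:ℕ) ≤ i by omega))]

lemma contr_last {j : ℕ} (v : Fin (j+1) → N) :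
    (Fin.last j).contractNth (· * ·) v = (Fin.last j).removeNth v := by
  funext i
  rw [Fin.contractNth_apply_of_lt _ _ _ _ (by simp), Fin.removeNth_apply, Fin.succAbove_last]

lemma rem_upd1 {j : ℕ} (v : Fin (j+1) → N) (k : Fin j) :
    Function.update (k.castSucc.removeNth v) k (v k.succ) = k.castSucc.removeNth v := by
  rw [Function.update_eq_self_iff, Fin.removeNth_apply, Fin.succAbove_of_le_castSucc _ _ (le_refl _)]

lemma rem_upd2 {j : ℕ} (v : Fin (j+1) → N) (k : Fin j) :
    Function.update (k.castSucc.removeNth v) k (v k.castSucc) = k.succ.removeNth v := by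
  funext i
  rcases lt_trichotomy (i : ℕ) k with h | h | h
  · rw [Function.update_of_ne (by omega), Fin.removeNth_apply, Fin.removeNth_apply,
      Fin.succAbove_of_castSucc_lt k.castSucc i (Fin.lt_def.2 h),
      Fin.succAbove_of_castSucc_lt k.succ i (Fin.lt_def.2 (show (i:ℕ) < k + 1 by omega))]
  · have : i = k := Fin.ext h
    subst this
    rw [Function.update_self, Fin.removeNth_apply, Fin.succAbove_of_castSucc_lt i.succ i (Fin.lt_def.2 (show (i:ℕ) < i + 1 by omega))]
  · rw [Function.update_of_ne (by omega), Fin.removeNth_apply, Fin.removeNth_apply,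
      Fin.succAbove_of_le_castSucc _ _ (Fin.le_def.2 (show (k:ℕ) ≤ i by omega)),
      Fin.succAbove_of_le_castSucc _ _ (Fin.le_def.2 (show (k:ℕ) + 1 ≤ i by omega))]

lemma tele (j : ℕ) (a : ℕ → ℤ) :
    a 0 + (∑ k : Fin j, (-1 : ℤ)^((k:ℕ)+1) * (a k + a (k+1))) + (-1)^(j+1) * a j = 0 := by
  induction j with
  | zero => simp
  | succ j ih =>
    rw [Fin.sum_univ_castSucc]
    simp only [Fin.val_castSucc, Fin.val_last]
    rw [pow_succ (-1) (j+1)]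
    linear_combination ih

lemma del_mlin {j : ℕ} (f : Co N j) (h : MLin f) : del j f = 0 := by
  funext v
  let a : ℕ → ℤ := fun n => if hn : n < j + 1 then f ((⟨n, hn⟩ : Fin (j+1)).removeNth v) else 0
  have := tele j a
  rw [Pi.zero_apply, ← this]
  simp only [del, AddMonoidHom.coe_mk, ZeroHom.coe_mk]
  rw [Fin.sum_univ_castSucc, ← add_assoc]
  congr 1
  · refine congrArg₂ _ ?_ ?_
    · simp only [a, Nat.zero_lt_succ, dif_pos]
      congr 1
    · refine Finset.sum_congr rfl fun k _ => ?_
      rw [contr_eq, h, rem_upd1, rem_upd2]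
      simp only [Fin.val_castSucc]
      congr 1
      have h1 : (k:ℕ) < j+1 := by omega
      have h2 : (k:ℕ)+1 < j+1 := by omega
      simp only [a, dif_pos h1, dif_pos h2]
      rw [add_comm]; rfl
  · rw [contr_last]
    simp only [Fin.val_last, a, Nat.lt_succ_self, dif_pos]
    rfl

lemma MLin.add {j} {f g : Co N j} (hf : MLin f) (hg : MLin g) : MLin (f + g) := by
  intro v i x y
  simp only [Pi.add_apply, hf v i x y, hg v i x y]; ring

lemma MLin.sum {j} {ι : Type} (s : Finset ι) (c : ι → ℤ) {f : ι → Co N j} (hf : ∀ i, MLin (f i)) :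
    MLin (fun v => ∑ i ∈ s, c i * f i v) := by
  intro v i x y
  simp only [hf _ v i x y, mul_add, Finset.sum_add_distrib]

/-- products of additive functions -/
lemma mlin_prod {j : ℕ} (x : Fin j → N → ℤ) (hx : ∀ i a b, x i (a * b) = x i a + x i b) :
    MLin (fun v : Fin j → N => ∏ k, x k (v k)) := by
  intro v i a b
  have e : ∀ c : N, (∏ k, x k (Function.update v i c k)) = x i c * ∏ k ∈ Finset.univ.erase i, x k (v k) := by
    intro c
    rw [← Finset.mul_prod_erase Finset.univ _ (Finset.mem_univ i), Function.update_self]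
    congr 1
    exact Finset.prod_congr rfl fun k hk => by rw [Function.update_of_ne (Finset.ne_of_mem_erase hk)]
  simp only [e, hx]; ring

def palt (j : ℕ) (e : Fin j → N) : Co N j →+ ℤ where
  toFun f := ∑ σ : Equiv.Perm (Fin j), (Equiv.Perm.sign σ : ℤ) * f (fun i => e (σ i))
  map_zero' := by simp
  map_add' f g := by simp [mul_add, Finset.sum_add_distrib]

lemma palt_apply (j : ℕ) (e : Fin j → N) (f : Co N j) :
  palt j e f = ∑ σ : Equiv.Perm (Fin j), (Equiv.Perm.sign σ : ℤ) * f (fun i => e (σ i)) := rfl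

lemma palt_mid {j : ℕ} (f : Co N j) (e : Fin (j+1) → N) (k : Fin j) :
    ∑ σ : Equiv.Perm (Fin (j+1)), (Equiv.Perm.sign σ : ℤ) *
      f (k.castSucc.contractNth (· * ·) (fun i => e (σ i))) = 0 := by
  let s : Equiv.Perm (Fin (j+1)) := Equiv.swap k.castSucc k.succ
  have hne : k.castSucc ≠ k.succ := by simp [Fin.ext_iff]
  have hs : Equiv.Perm.sign s = -1 := Equiv.Perm.sign_swap hne
  have key : ∀ σ : Equiv.Perm (Fin (j+1)), k.castSucc.contractNth (· * ·) (fun i => e ((σ * s) i))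
      = k.castSucc.contractNth (· * ·) (fun i => e (σ i)) := by
    intro σ
    rw [contr_eq, contr_eq]
    have e1 : s k.castSucc = k.succ := Equiv.swap_apply_left _ _
    have e2 : s k.succ = k.castSucc := Equiv.swap_apply_right _ _
    simp only [Equiv.Perm.mul_apply, e1, e2]
    rw [mul_comm]
    funext i
    by_cases hi : i = k
    · subst hi; simp
    · rw [Function.update_of_ne hi, Function.update_of_ne hi, Fin.removeNth_apply, Fin.removeNth_apply]
      congr 2
      apply Equiv.swap_apply_of_ne_of_ne
      · exact Fin.succAbove_ne _ _
      · intro h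
        apply hi
        have : k.castSucc.succAbove k = k.succ := Fin.succAbove_of_le_castSucc _ _ (le_refl _)
        exact Fin.succAbove_right_injective (h.trans this.symm)
  have h := Equiv.sum_comp (Equiv.mulRight s) (fun σ : Equiv.Perm (Fin (j+1)) => (Equiv.Perm.sign σ : ℤ) *
      f (k.castSucc.contractNth (· * ·) (fun i => e (σ i))))
  simp only [Equiv.coe_mulRight, key] at h
  simp only [Equiv.Perm.sign_mul, hs] at h
  simp only [mul_neg, mul_one, Units.val_neg, neg_mul, Finset.sum_neg_distrib] at h
  omega

lemma palt_ends {j : ℕ} (f : Co N j) (e : Fin (j+1) → N) :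
    ∑ σ : Equiv.Perm (Fin (j+1)), (Equiv.Perm.sign σ : ℤ) * f (Fin.tail (fun i => e (σ i)))
     = (-1)^j * ∑ σ : Equiv.Perm (Fin (j+1)), (Equiv.Perm.sign σ : ℤ) *
      f ((Fin.last j).contractNth (· * ·) (fun i => e (σ i))) := by
  have h := Equiv.sum_comp (Equiv.mulRight (finRotate (j+1))) (fun σ : Equiv.Perm (Fin (j+1)) => (Equiv.Perm.sign σ : ℤ) *
      f ((Fin.last j).contractNth (· * ·) (fun i => e (σ i))))
  rw [← h, Finset.mul_sum]
  refine Finset.sum_congr rfl fun σ _ => ?_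
  simp only [Equiv.coe_mulRight, contr_last, Equiv.Perm.sign_mul, sign_finRotate]
  push_cast
  have : (Fin.last j).removeNth (fun i => e ((σ * finRotate (j+1)) i)) = Fin.tail (fun i => e (σ i)) := by
    funext i
    rw [Fin.removeNth_apply, Fin.succAbove_last]
    simp [Fin.tail]
  have h3 : ((Fin.last j).removeNth fun i => e ((⇑σ ∘ ⇑(finRotate (j + 1))) i)) = Fin.tail (fun i => e (σ i)) := this
  rw [h3]
  have h2 : ((-1 : ℤ))^j * (-1)^j = 1 := by rw [← mul_pow]; simp
  linear_combination (-((Equiv.Perm.sign σ : ℤ) * f (Fin.tail (fun i => e (σ i))))) * h2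

lemma palt_del {j : ℕ} (f : Co N j) (e : Fin (j+1) → N) : palt (j+1) e (del j f) = 0 := by
  rw [palt_apply]
  simp only [del, AddMonoidHom.coe_mk, ZeroHom.coe_mk, mul_add, Finset.mul_sum]
  rw [Finset.sum_add_distrib, Finset.sum_comm, Fin.sum_univ_castSucc, palt_ends]
  have : ∀ k : Fin j, ∑ σ : Equiv.Perm (Fin (j+1)), (Equiv.Perm.sign σ : ℤ) * ((-1)^((k.castSucc : ℕ)+1) *
      f (k.castSucc.contractNth (· * ·) (fun i => e (σ i)))) = 0 := by
    intro k
    rw [← mul_zero ((-1 : ℤ)^((k.castSucc : ℕ)+1)), ← palt_mid f e k, Finset.mul_sum]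
    exact Finset.sum_congr rfl fun σ _ => by ring
  rw [Finset.sum_eq_zero (fun k _ => this k), zero_add, Finset.mul_sum, ← Finset.sum_add_distrib]
  refine Finset.sum_eq_zero fun σ _ => ?_
  simp only [Fin.val_last]; ring

/-- the alternating sum of a product is a determinant -/
lemma palt_prod {j : ℕ} (x : Fin j → N → ℤ) (e : Fin j → N) :
    palt j e (fun v => ∏ k, x k (v k)) = Matrix.det (Matrix.of fun a b => x a (e b)) := by
  rw [palt_apply, ← Matrix.det_transpose, Matrix.det_apply']
  rfl

variable {q : ℕ} [NeZero q] (φ : Multiplicative (ZMod q) →* MulAut N)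

lemma tac_del (j : ℕ) (g) (f : Co N j) : tac φ (j+1) g (del j f) = del j (tac φ j g f) := by
  funext v
  simp only [del, tac, AddMonoidHom.coe_mk, ZeroHom.coe_mk]
  congr 1
  refine Finset.sum_congr rfl fun k _ => ?_
  congr 2
  funext i
  exact (Crystal.comp_contractNth ((φ g⁻¹).toMonoidHom) k v i).symm

lemma tau_del (j : ℕ) (f : Co N j) : tau φ (j+1) (del j f) = del j (tau φ j f) := tac_del _ _ _ _

lemma nm_del (j : ℕ) (f : Co N j) : nm φ (j+1) (del j f) = del j (nm φ j f) := by
  simp [nm, AddMonoidHom.finsetSum_apply, tac_del]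

lemma tac_mul (j : ℕ) (g h) (f : Co N j) : tac φ j (g * h) f = tac φ j g (tac φ j h f) := by
  funext v
  simp [tac, _root_.mul_inv_rev]

lemma tac_one (j : ℕ) (f : Co N j) : tac φ j 1 f = f := by
  funext v
  simp [tac]

lemma nm_tau (j : ℕ) (f : Co N j) : nm φ j (tau φ j f) = nm φ j f := by
  simp only [nm, tau, AddMonoidHom.finsetSum_apply, ← tac_mul]
  exact Equiv.sum_comp (Equiv.mulRight (tg q)) (fun d => tac φ j d f)

lemma tau_nm (j : ℕ) (f : Co N j) : tau φ j (nm φ j f) = nm φ j f := by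
  simp only [nm, tau, AddMonoidHom.finsetSum_apply, map_sum, ← tac_mul]
  exact Equiv.sum_comp (Equiv.mulLeft (tg q)) (fun d => tac φ j d f)

lemma MLin.tac {j} {f : Co N j} (hf : MLin f) (g) : MLin (tac φ j g f) := by
  intro v i x y
  have e : ∀ c : N, (fun l => φ g⁻¹ (Function.update v i c l)) = Function.update (fun l => φ g⁻¹ (v l)) i (φ g⁻¹ c) := by
    intro c; funext l
    by_cases h : l = i
    · subst h; simp
    · simp [Function.update_of_ne h]
  simp only [OHC.tac, AddMonoidHom.coe_mk, ZeroHom.coe_mk, e, map_mul]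
  exact hf _ _ _ _

end

end OHC

open CategoryTheory

namespace OHC
set_option linter.unusedSectionVars false
set_option linter.unusedVariables false

lemma dot_eq_sum (l : List ℤ) (x : ℕ → ℤ) : dot l x = ∑ n ∈ Finset.range l.length, l.getD n 0 * x n := by
  induction l generalizing x with
  | nil => simp [dot]
  | cons a l ih =>
    rw [dot, ih, List.length_cons, Finset.sum_range_succ']
    simp [add_comm]

lemma dot_delta (l : List ℤ) (i : ℕ) : dot l (fun k => if k = i then 1 else 0) = l.getD i 0 := by
  rw [dot_eq_sum]
  simp only [mul_ite, mul_one, mul_zero, Finset.sum_ite_eq', Finset.mem_range]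
  split_ifs with h
  · rfl
  · rw [List.getD_eq_default _ _ (by omega)]

abbrev LL := Crystal.Lat 8
def ph : Multiplicative (ZMod 9) →* MulAut LL := Crystal.matAction 9 holM holM_pow

def Qi : List (List ℤ) := [[-1,-1,0,0,0,0,0,1],[0,0,0,0,-1,0,0,-1],[0,0,1,0,1,1,0,1],[-1,0,0,0,0,0,1,1],[0,0,0,0,-1,0,0,0],[0,0,0,-1,0,0,0,0],[0,0,0,0,1,0,1,1],[0,0,0,0,0,-1,1,0]]
def Qc : List (List ℤ) := [[0,0,0,-1,1,0,1,0],[-1,-1,0,1,0,0,-1,0],[0,0,1,0,0,0,-1,1],[0,0,0,0,0,-1,0,0],[0,0,0,0,-1,0,0,0],[0,1,0,0,0,0,1,-1],[0,1,0,0,0,0,1,0],[0,-1,0,0,1,0,0,0]]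
/-- The matrix of the action on the coordinate functions. -/
def Sm : List (List ℤ) := [[0,1,0,0,0,0,1,0],[0,0,1,0,0,0,0,0],[-1,0,0,1,0,0,1,0],[0,0,0,0,1,0,0,0],[0,0,0,0,0,1,0,0],[-1,0,0,0,0,0,1,0],[0,0,0,0,0,0,-1,1],[0,0,0,0,0,0,-1,0]]

def vec (l : LL) : ℕ → ℤ := fun k => if h : k < 8 then l.toAdd ⟨k, h⟩ else 0
def xv (l : LL) : ℕ → ℤ := act Qi (vec l)
def Eb (i : ℕ) : LL := Multiplicative.ofAdd (fun k : Fin 8 => (row Qc k).getD i 0)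

lemma vec_mul (a b : LL) : vec (a * b) = vec a + vec b := by
  funext k
  simp only [vec, Pi.add_apply]
  split_ifs with h
  · rfl
  · rfl

lemma xv_mul (a b : LL) : xv (a * b) = xv a + xv b := by
  rw [xv, vec_mul]
  exact (actH Qi).map_add _ _

lemma xv_sup (l : LL) : Sup 8 (xv l) := act_sup _ _ _ (by decide)

lemma xv_E (i : ℕ) (hi : i < 8) : xv (Eb i) = fun k => if k = i then 1 else 0 := by
  funext k
  by_cases hk : k < 8
  · interval_cases i <;> interval_cases k <;> decide
  · rw [xv_sup _ k (by omega), if_neg (by omega)]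

lemma ph_tg (l : LL) : ph (tg 9) l = Multiplicative.ofAdd (holM.mulVec l.toAdd) := by
  have : ph (tg 9) = Crystal.glToAut 8 (Crystal.matUnit holM 8 holM_pow) := by
    exact pow_one (Crystal.glToAut 8 (Crystal.matUnit holM 8 holM_pow))
  rw [this]
  rfl

def HM : List (List ℤ) := [[-1,0,-1,-1,-1,0,0,0],[1,1,1,0,1,0,1,0],[0,0,0,0,0,0,1,0],[0,0,0,0,1,0,0,0],[1,0,0,0,0,0,-1,-1],[-1,-1,0,0,-1,-1,0,0],[-1,-1,0,0,0,0,0,1],[0,1,0,0,0,1,0,0]]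

lemma vec_HM (v : Fin 8 → ℤ) : vec (Multiplicative.ofAdd (holM.mulVec v)) = act HM (vec (Multiplicative.ofAdd v)) := by
  funext k
  by_cases hk : k < 8
  · have e1 : ∀ i : Fin 8, (HM.getD (i : ℕ) []).length = 8 := by decide
    have e2 : ∀ i a : Fin 8, (HM.getD (i : ℕ) []).getD (a : ℕ) 0 = holM i a := by
      intro i a; fin_cases i <;> fin_cases a <;> rfl
    obtain ⟨i, rfl⟩ : ∃ i : Fin 8, (i : ℕ) = k := ⟨⟨k, hk⟩, rfl⟩
    simp only [vec, act, row, dif_pos hk, dot_eq_sum, e1]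
    change ∑ a, holM i a * v a = _
    rw [← Fin.sum_univ_eq_sum_range (fun n => (HM.getD i []).getD n 0 * (if h : n < 8 then _ else 0)) 8]
    refine Finset.sum_congr rfl fun a _ => ?_
    rw [e2 i a, dif_pos a.2]
    rfl
  · rw [vec, dif_neg hk, act_sup HM 8 _ (by decide) k (by omega)]

lemma xv_tg (l : LL) : xv l = act Sm (xv (ph (tg 9) l)) := by
  rw [ph_tg, xv, xv, vec_HM, ← act_mul, ← act_mul]
  rw [show mulL (mulL Sm Qi) HM = Qi by decide +kernel]
  rfl

lemma xv_tau (l : LL) : xv (ph (tg 9)⁻¹ l) = act Sm (xv l) := by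
  rw [xv_tg (ph (tg 9)⁻¹ l)]
  congr 2
  rw [← MulAut.mul_apply, ← map_mul]; simp

end OHC

open CategoryTheory

namespace OHC
set_option linter.unusedSectionVars false
set_option linter.unusedVariables false

section
variable {j : ℕ} (n : ℕ) (J : ℕ → Fin j → ℕ)

def pp : Co LL j →+ (ℕ → ℤ) where
  toFun f m := if m < n then palt j (fun k => Eb (J m k)) f else 0
  map_zero' := by funext m; simp
  map_add' f g := by
    funext m
    simp only [map_add, Pi.add_apply]
    split_ifs <;> simp

def mm : (ℕ → ℤ) →+ Co LL j where
  toFun f v := ∑ m ∈ Finset.range n, f m * ∏ k, xv (v k) (J m k)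
  map_zero' := by funext m; simp
  map_add' f g := by
    funext m
    simp only [Pi.add_apply, add_mul, Finset.sum_add_distrib]

lemma pp_sup (f) : Sup n (pp n J f) := fun i hi => if_neg (by omega)

lemma mono_mlin (I : Fin j → ℕ) : MLin (fun v : Fin j → LL => ∏ k, xv (v k) (I k)) :=
  mlin_prod (fun k l => xv l (I k)) (fun k a b => by rw [xv_mul]; rfl)

lemma mm_mlin (f) : MLin (mm n J f) := MLin.sum (Finset.range n) f (fun m => mono_mlin (J m))

lemma mm_cyc (f) : del j (mm n J f) = 0 := del_mlin _ (mm_mlin n J f)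

lemma palt_sum (e : Fin j → LL) (f : ℕ → ℤ) (g : ℕ → Co LL j) :
    palt j e (fun v => ∑ m ∈ Finset.range n, f m * g m v) = ∑ m ∈ Finset.range n, f m * palt j e (g m) := by
  simp only [palt_apply, Finset.mul_sum]
  rw [Finset.sum_comm]
  refine Finset.sum_congr rfl fun m _ => Finset.sum_congr rfl fun σ _ => by ring

/-- the hypotheses on the table of index tuples -/
structure Tab (n : ℕ) (J : ℕ → Fin j → ℕ) (T : List (List ℤ)) : Prop where
  lt : ∀ m k, m < n → J m k < 8
  one : ∀ a b, a < n → b < n → Matrix.det (Matrix.of fun k l : Fin j => if J a k = J b l then (1 : ℤ) else 0)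
    = if a = b then 1 else 0
  len : T.length = n
  rlen : ∀ b, b < n → (row T b).length = n
  tt : ∀ a b, a < n → b < n → Matrix.det (Matrix.of fun k l : Fin j => (row Sm (J a k)).getD (J b l) 0)
    = (row T b).getD a 0
  ch : n = Nat.choose 8 j

variable {n J} {T : List (List ℤ)}

lemma pp_mm (h : Tab n J T) (f) (hf : Sup n f) : pp n J (mm n J f) = f := by
  funext m
  by_cases hm : m < n
  · simp only [pp, mm, AddMonoidHom.coe_mk, ZeroHom.coe_mk, if_pos hm]
    rw [palt_sum]
    have : ∀ a ∈ Finset.range n, f a * palt j (fun k => Eb (J m k)) (fun v => ∏ k, xv (v k) (J a k))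
        = if a = m then f a else 0 := by
      intro a ha
      rw [palt_prod (fun k l => xv l (J a k))]
      have := h.one a m (Finset.mem_range.1 ha) hm
      rw [show (Matrix.of fun k l => xv (Eb (J m l)) (J a k)) =
        (Matrix.of fun k l : Fin j => if J a k = J m l then (1 : ℤ) else 0) from ?_, this]
      · simp
      · ext k l
        simp only [Matrix.of_apply]
        rw [xv_E _ (h.lt m l hm)]
    rw [Finset.sum_congr rfl this]
    simp [hm]
  · rw [hf m (by omega), pp_sup n J _ m (by omega)]

lemma pp_tau_mm (h : Tab n J T) (f) : pp n J (tau ph j (mm n J f)) = act T f := by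
  funext m
  by_cases hm : m < n
  · simp only [pp, mm, tau, tac, AddMonoidHom.coe_mk, ZeroHom.coe_mk, if_pos hm, act, dot_eq_sum, h.rlen m hm]
    simp only [xv_tau]
    rw [palt_sum]
    refine Finset.sum_congr rfl fun a ha => ?_
    rw [palt_prod (fun k l => act Sm (xv l) (J a k)), mul_comm]
    have := h.tt a m (Finset.mem_range.1 ha) hm
    rw [← this]
    congr 2
    ext k l
    simp only [Matrix.of_apply]
    rw [xv_E _ (h.lt m l hm)]
    exact dot_delta _ _
  · rw [act_sup T n _ h.len.le m (by omega), pp_sup n J _ m (by omega)]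

end

section
variable {j : ℕ} {n : ℕ} {J : ℕ → Fin (j+1) → ℕ} {T : List (List ℤ)}

lemma pp_del (f) : pp n J (del j f) = 0 := by
  funext m
  simp only [pp, AddMonoidHom.coe_mk, ZeroHom.coe_mk, palt_del]
  simp

/-- surjective endomorphisms of `ℤ^n` are injective -/
lemma surj_inj {A : Type} [AddCommGroup A] {n : ℕ} (hA : GenBy A n) (p : A →+ (Fin n → ℤ))
    (hp : Function.Surjective p) : Function.Injective p := by
  obtain ⟨g, hg⟩ := hA
  have hs : Function.Surjective (p.comp g).toIntLinearMap := hp.comp hg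
  have hi := OrzechProperty.injective_of_surjective_endomorphism _ hs
  intro a b hab
  obtain ⟨x, rfl⟩ := hg a
  obtain ⟨y, rfl⟩ := hg b
  rw [hi (a₁ := x) (a₂ := y) hab]

/-- the coordinates of a cohomology class -/
noncomputable def pbar (n : ℕ) (J : ℕ → Fin (j+1) → ℕ) :
    groupCohomology (Rep.trivial ℤ LL ℤ) (j+1) →+ (ℕ → ℤ) where
  toFun h := pp n J (CRel.surj (j+1) h).choose
  map_zero' := by
    obtain ⟨y, hy⟩ := CRel.zero.1 (CRel.surj (N := LL) (j+1) 0).choose_spec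
    rw [← hy, pp_del]
  map_add' a b := by
    have h1 := (CRel.surj (N := LL) (j+1) a).choose_spec
    have h2 := (CRel.surj (N := LL) (j+1) b).choose_spec
    have h3 := (CRel.surj (N := LL) (j+1) (a+b)).choose_spec
    have := h3.add (h1.add h2).neg
    rw [add_neg_cancel] at this
    obtain ⟨y, hy⟩ := CRel.zero.1 this
    have := pp_del (n := n) (J := J) y
    rw [hy, map_add, map_neg, map_add, ← sub_eq_add_neg, sub_eq_zero] at this
    exact this

lemma pbar_eq {x h} (hx : CRel LL (j+1) x h) : pbar n J h = pp n J x := by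
  have h1 := (CRel.surj (N := LL) (j+1) h).choose_spec
  have := h1.add hx.neg
  rw [add_neg_cancel] at this
  obtain ⟨y, hy⟩ := CRel.zero.1 this
  have := pp_del (n := n) (J := J) y
  rw [hy, map_add, map_neg, ← sub_eq_add_neg, sub_eq_zero] at this
  exact this

lemma pbar_sup (h) : Sup n (pbar n J h) := pp_sup n J _


lemma pbar_surj (h : Tab n J T) (f) (hf : Sup n f) : ∃ x, pbar n J x = f := by
  obtain ⟨x, hx⟩ := CRel.ex (mm_cyc n J f)
  exact ⟨x, (pbar_eq hx).trans (pp_mm h f hf)⟩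

lemma pbar_inj (h : Tab n J T) : Function.Injective (pbar n J) := by
  let r : (ℕ → ℤ) →+ (Fin n → ℤ) := 
    { toFun := fun f i => f i, map_zero' := rfl, map_add' := fun _ _ => rfl }
  have hg : GenBy (groupCohomology (Rep.trivial ℤ LL ℤ) (j+1)) n := by
    rw [h.ch]; exact genBy_lat 8 (j+1) LL (MulEquiv.refl _)
  have := surj_inj hg (r.comp (pbar n J)) (by
    intro f
    obtain ⟨x, hx⟩ := pbar_surj h (fun i => if hi : i < n then f ⟨i, hi⟩ else 0) (fun i hi => dif_neg (by omega))
    refine ⟨x, ?_⟩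
    funext i
    simp [r, hx])
  intro a b hab
  exact this (congrArg r hab)

lemma pp_exact (h : Tab n J T) (c) (hc : del (j+1) c = 0) (hp : pp n J c = 0) : ∃ g, c = del j g := by
  obtain ⟨x, hx⟩ := CRel.ex hc
  have : x = 0 := pbar_inj h (by rw [pbar_eq hx, hp, map_zero])
  subst this
  obtain ⟨y, hy⟩ := CRel.zero.1 hx
  exact ⟨y, hy.symm⟩

lemma pp_tau (h : Tab n J T) (c) (hc : del (j+1) c = 0) : pp n J (tau ph (j+1) c) = act T (pp n J c) := by
  obtain ⟨g, hg⟩ := pp_exact h (c - mm n J (pp n J c)) (by rw [map_sub, hc, mm_cyc, sub_zero])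
    (by rw [map_sub, pp_mm h _ (pp_sup _ _ _), sub_self])
  have := congrArg (tau ph (j+1)) hg
  rw [tau_del] at this
  have := congrArg (pp n J) this
  rw [pp_del, map_sub, map_sub, pp_tau_mm h, sub_eq_zero] at this
  exact this

lemma tau_cyc {j} (c : Co LL j) (hc : del j c = 0) : del j (tau ph j c) = 0 := by
  rw [← tau_del, hc, map_zero]

lemma nm_eq {j} (c : Co LL j) : nm ph j c = ∑ k ∈ Finset.range 9, (tau ph j)^[k] c := by
  have e : ∀ k, (tau ph j)^[k] c = tac ph j ((tg 9)^k) c := by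
    intro k
    induction k with
    | zero => rw [pow_zero, tac_one]; rfl
    | succ k ih => rw [Function.iterate_succ_apply', ih, tau, ← tac_mul, pow_succ']
  simp only [e, nm, AddMonoidHom.finsetSum_apply]
  rw [← Fin.sum_univ_eq_sum_range (fun k => tac ph j ((tg 9)^k) c) 9]
  refine Fintype.sum_equiv (Equiv.refl _) _ _ ?_
  intro d
  congr 2
  revert d
  decide

lemma pp_iter (h : Tab n J T) (c) (hc : del (j+1) c = 0) (k : ℕ) :
    del (j+1) ((tau ph (j+1))^[k] c) = 0 ∧ pp n J ((tau ph (j+1))^[k] c) = (act T)^[k] (pp n J c) := by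
  induction k with
  | zero => exact ⟨hc, rfl⟩
  | succ k ih =>
    rw [Function.iterate_succ_apply', Function.iterate_succ_apply']
    refine ⟨?_, ?_⟩
    · rw [← tau_del, ih.1, map_zero]
    · rw [pp_tau h _ ih.1, ih.2]

lemma act_normL (T : List (List ℤ)) (n : ℕ) (x) (hx : Sup n x) (m : ℕ) :
    act (normL n T m) x = ∑ k ∈ Finset.range m, (act T)^[k] x := by
  induction m with
  | zero => rw [Finset.sum_range_zero]; funext i; simp [normL, act, row, dot]
  | succ m ih =>
    rw [Finset.sum_range_succ', normL, act_addL, act_mul, ih, act_one n x hx]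
    simp only [Function.iterate_succ_apply', Function.iterate_zero, id_eq]
    rw [← actH_apply, map_sum, add_comm]
    rfl

lemma pp_nm (h : Tab n J T) (c) (hc : del (j+1) c = 0) : pp n J (nm ph (j+1) c) = act (normL n T 9) (pp n J c) := by
  rw [nm_eq, map_sum, act_normL _ _ _ (pp_sup _ _ _)]
  exact Finset.sum_congr rfl fun k _ => (pp_iter h c hc k).2

end

end OHC

open CategoryTheory

namespace OHC
set_option linter.unusedSectionVars false
set_option linter.unusedVariables false

def C1 : List (List ℕ) := [[0], [1], [2], [3], [4], [5], [6], [7]]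

def T1 : List (List ℤ) := decL 8 1 [11011011,
  21111111,
  12111111,
  11211111,
  11121111,
  11112111,
  21211200,
  11111121]

def C2 : List (List ℕ) := [[0,1], [0,2], [0,3], [0,4], [0,5], [0,6], [0,7], [1,2], [1,3], [1,4], [1,5], [1,6], [1,7], [2,3], [2,4], [2,5], [2,6], [2,7], [3,4], [3,5], [3,6], [3,7], [4,5], [4,6], [4,7], [5,6], [5,7], [6,7]]

def T2 : List (List ℤ) := decL 28 1 [1211211111111111111111111111,
  1111111211211111111111111111,
  1111111111111112111111111111,
  1111111111111011111211111111,
  1111111111111101111111211111,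
  1211211111111111221111111221,
  1111111111111111011111111011,
  2111111111111111111111111111,
  1211111111111111111111111111,
  1121111111111111111111111111,
  1112111111111111111111111111,
  1211200111111111111111111111,
  1111121111111111111111111111,
  1111111211111111111111111111,
  1111111121111111111111111111,
  1111111112111111111111111111,
  111111211200111111111111111,
  1111111111121111111111111111,
  1111111111111211111111111111,
  1111111111111121111111111111,
  1011111111111112001111111111,
  1111111111111111211111111111,
  1111111111111111112111111111,
  1101111111111011111200111111,
  1111111111111111111121111111,
  1110111111111101111111200111,
  1111111111111111111111121111,
  1111121111111111211111111212]

def C3 : List (List ℕ) := [[0,1,2], [0,1,3], [0,1,4], [0,1,5], [0,1,6], [0,1,7], [0,2,3], [0,2,4], [0,2,5], [0,2,6], [0,2,7], [0,3,4], [0,3,5], [0,3,6], [0,3,7], [0,4,5], [0,4,6], [0,4,7], [0,5,6], [0,5,7], [0,6,7], [1,2,3], [1,2,4], [1,2,5], [1,2,6], [1,2,7], [1,3,4], [1,3,5], [1,3,6], [1,3,7], [1,4,5], [1,4,6], [1,4,7], [1,5,6], [1,5,7], [1,6,7], [2,3,4], [2,3,5], [2,3,6], [2,3,7], [2,4,5],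 [2,4,6], [2,4,7], [2,5,6], [2,5,7], [2,6,7], [3,4,5], [3,4,6], [3,4,7], [3,5,6], [3,5,7], [3,6,7], [4,5,6], [4,5,7], [4,6,7], [5,6,7]]

def T3 : List (List ℤ) := decL 56 1 [1101111111111111111111111111111111111111111111111111111,
  11111111011111111111111111111111111111111111111111111111,
  11111121111101111111111111111111111111111111111111111111,
  11111112111111101111111111111111111111111111111111111111,
  11111111100111111100111111111111111111111111111111111111,
  11111111121111111121111111111111111111111111111111111111,
  11111111111111111111111011111111111111111111111111111111,
  11111111111111111111121111101111111111111111111111111111,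
  11111111111111111111112111111101111111111111111111111111,
  21121111111111111111111100111111100111111111111111111111,
  11111111111111111111111121111111121111111111111111111111,
  11111111111111111111111111111111111110111111111111111111,
  11111111111111111111111111111111111111110111111111111111,
  11111111211111111111111111111111111111111110011111111111,
  11111111111111111111111111111111111111111112111111111111,
  11111111111111111111111111111111111101111111110111111111,
  11111101111121111111111111111111111111221111111110011111,
  11111111111111111111111111111111111111011111111112111111,
  11111110111111121111111111111111111111111221111111110011,
  11111111111111111111111111111111111111111011111111112111,
  11111111121111111121111111111111111111111111101111111110,
  21111111111111111111111111111111111111111111111111111111,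
  12111111111111111111111111111111111111111111111111111111,
  11211111111111111111111111111111111111111111111111111111,
  21120011111111111111111111111111111111111111111111111111,
  11112111111111111111111111111111111111111111111111111111,
  11111121111111111111111111111111111111111111111111111111,
  11111112111111111111111111111111111111111111111111111111,
  11111111200111111111111111111111111111111111111111111111,
  11111111121111111111111111111111111111111111111111111111,
  11111111111211111111111111111111111111111111111111111111,
  11111101111120011111111111111111111111111111111111111111,
  11111111111112111111111111111111111111111111111111111111,
  11111110111111120011111111111111111111111111111111111111,
  11111111111111112111111111111111111111111111111111111111,
  11111111121111111121211111111111111111111111111111111111,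
  11111111111111111111121111111111111111111111111111111111,
  11111111111111111111112111111111111111111111111111111111,
  21111111111111111111111200111111111111111111111111111111,
  11111111111111111111111121111111111111111111111111111111,
  11111111111111111111111111211111111111111111111111111111,
  12111111111111111111101111120011111111111111111111111111,
  11111111111111111111111111112111111111111111111111111111,
  11211111111111111111110111111120011111111111111111111111,
  11111111111111111111111111111112111111111111111111111111,
  11110111111111111111111121111111121211111111111111111111,
  11111111111111111111111111111111111121111111111111111111,
  11111121111111111111111111111111111112001111111111111111,
  11111111111111111111111111111111111111211111111111111111,
  11111112111111111111111111111111111111112001111111111111,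
  11111111111111111111111111111111111111111211111111111111,
  11111111101111111111111111111111111111111112121111111111,
  11111111111211111111111111111111111121111111112001111111,
  11111111111111111111111111111111111111111111111211111111,
  11111111111110111111111111111111111111011111111112121111,
  11111111111111110111111111111111111111111011111111112121]

def C4 : List (List ℕ) := [[0,1,2,3], [0,1,2,4], [0,1,2,5], [0,1,2,6], [0,1,2,7], [0,1,3,4], [0,1,3,5], [0,1,3,6], [0,1,3,7], [0,1,4,5], [0,1,4,6], [0,1,4,7], [0,1,5,6], [0,1,5,7], [0,1,6,7], [0,2,3,4], [0,2,3,5], [0,2,3,6], [0,2,3,7], [0,2,4,5], [0,2,4,6], [0,2,4,7], [0,2,5,6], [0,2,5,7], [0,2,6,7], [0,3,4,5], [0,3,4,6], [0,3,4,7], [0,3,5,6], [0,3,5,7], [0,3,6,7], [0,4,5,6], [0,4,5,7], [0,4,6,7], [0,5,6,7], [1,2,3,4], [1,2,3,5], [1,2,3,6], [1,2,3,7], [1,2,4,5], [1,2,4,6], [1,2,4,7], [1,2,5,6], [1,2,5,7], [1,2,6,7], [1,3,4,5], [1,3,4,6], [1,3,4,7], [1,3,5,6], [1,3,5,7], [1,3,6,7],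 [1,4,5,6], [1,4,5,7], [1,4,6,7], [1,5,6,7], [2,3,4,5], [2,3,4,6], [2,3,4,7], [2,3,5,6], [2,3,5,7], [2,3,6,7], [2,4,5,6], [2,4,5,7], [2,4,6,7], [2,5,6,7], [3,4,5,6], [3,4,5,7], [3,4,6,7], [3,5,6,7], [4,5,6,7]]

def T4 : List (List ℤ) := decL 70 1 [1121111111111111111111111111111111111111111111111111111111111111111111,
  111112111111111111111111111111111111111111111111111111111111111111111,
  1011111112111111111111111111111111111111111111111111111111111111111111,
  1112211111112211111111111111111111111111111111111111111111111111111111,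
  1110111111110111111111111111111111111111111111111111111111111111111111,
  1111111111111111211111111111111111111111111111111111111111111111111111,
  1111111111111111111211111111111111111111111111111111111111111111111111,
  1111111111111111111111221111111111111111111111111111111111111111111111,
  1111111111111111111111011111111111111111111111111111111111111111111111,
  1111111111111112111111111211111111111111111111111111111111111111111111,
  1111111111111111100111111111221111111111111111111111111111111111111111,
  1111111111111111121111111111011111111111111111111111111111111111111111,
  1111111111111111111100111111111221111111111111111111111111111111111111,
  1111111111111111111121111111111011111111111111111111111111111111111111,
  1111111111111111111111112111111111211111111111111111111111111111111111,
  1111111111111111111111111111111111112111111111111111111111111111111111,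
  1111111111111111111111111111111111111112111111111111111111111111111111,
  1121111111111111111111111111111111111111112211111111111111111111111111,
  1111111111111111111111111111111111111111110111111111111111111111111111,
  1111111111111111111111111111111111121111111112111111111111111111111111,
  111112111111111111111111111111111111001111111112211111111111111111111,
  1111111111111111111111111111111111111211111111110111111111111111111111,
  1011111112111111111111111111111111111111001111111112211111111111111111,
  1111111111111111111111111111111111111111211111111110111111111111111111,
  1112111111112111111111111111111111111111111121111111112111111111111111,
  1111111111111111111111111111111111111111111111111111111211111111111111,
  1111111111111111211111111111111111111111111111111111111111221111111111,
  1111111111111111111111111111111111111111111111111111111111011111111111,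
  1111111111111111111211111111111111111111111111111111111111111221111111,
  1111111111111111111111111111111111111111111111111111111111111011111111,
  1111111111111111111111211111111111111111111111111111111111111111211111,
  1111111111111112111111111211111111111111111111111111111122111111122111,
  1111111111111111111111111111111111111111111111111111111101111111101111,
  1111111111111111101111111111211111111111111111111111111111110111111121,
  1111111111111111111101111111111211111111111111111111111111111110111112,
  2111111111111111111111111111111111111111111111111111111111111111111111,
  1211111111111111111111111111111111111111111111111111111111111111111111,
  1120011111111111111111111111111111111111111111111111111111111111111111,
  1112111111111111111111111111111111111111111111111111111111111111111111,
  1111121111111111111111111111111111111111111111111111111111111111111111,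
  111112001111111111111111111111111111111111111111111111111111111111111,
  1111111211111111111111111111111111111111111111111111111111111111111111,
  1011111112001111111111111111111111111111111111111111111111111111111111,
  1111111111211111111111111111111111111111111111111111111111111111111111,
  1112111111112121111111111111111111111111111111111111111111111111111111,
  1111111111111112111111111111111111111111111111111111111111111111111111,
  1111111111111111200111111111111111111111111111111111111111111111111111,
  1111111111111111121111111111111111111111111111111111111111111111111111,
  1111111111111111111200111111111111111111111111111111111111111111111111,
  1111111111111111111121111111111111111111111111111111111111111111111111,
  1111111111111111111111212111111111111111111111111111111111111111111111,
  1111111111111112111111111200111111111111111111111111111111111111111111,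
  1111111111111111111111111121111111111111111111111111111111111111111111,
  1111111111111111101111111111212111111111111111111111111111111111111111,
  1111111111111111111101111111111212111111111111111111111111111111111111,
  1111111111111111111111111111111111121111111111111111111111111111111111,
  111111111111111111111111111111111112001111111111111111111111111111111,
  1111111111111111111111111111111111111211111111111111111111111111111111,
  1011111111111111111111111111111111111112001111111111111111111111111111,
  1111111111111111111111111111111111111111211111111111111111111111111111,
  1112111111111111111111111111111111111111112121111111111111111111111111,
  1111101111111111111111111111111111121111111112001111111111111111111111,
  1111111111111111111111111111111111111111111111211111111111111111111111,
  1111111211111111111111111111111111111011111111112121111111111111111111,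
  1111111111211111111111111111111111111111011111111112121111111111111111,
  1111111111111110111111111111111111111111111111111111111200111111111111,
  1111111111111111111111111111111111111111111111111111111121111111111111,
  1111111111111111121111111111111111111111111111111111111111212111111111,
  1111111111111111111121111111111111111111111111111111111111111212111111,
  1111111111111111111111111121111111111111111111111111111121111111121211]

def zm (x y : ℤ) : ℤ := if x = 0 then 0 else x * y
lemma zm_eq (x y : ℤ) : zm x y = x * y := by
  unfold zm; split_ifs with h
  · rw [h, zero_mul]
  · rfl

def d2 (g : ℕ → ℕ → ℤ) (a b i j : ℕ) : ℤ := zm (g a i) (g b j) - zm (g a j) (g b i)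
def d3 (g : ℕ → ℕ → ℤ) (a b c i j k : ℕ) : ℤ :=
  zm (g a i) (d2 g b c j k) - zm (g a j) (d2 g b c i k) + zm (g a k) (d2 g b c i j)
def d4 (g : ℕ → ℕ → ℤ) (a b c d i j k l : ℕ) : ℤ :=
  zm (g a i) (d3 g b c d j k l) - zm (g a j) (d3 g b c d i k l) + zm (g a k) (d3 g b c d i j l)
   - zm (g a l) (d3 g b c d i j k)

def mnL (g : ℕ → ℕ → ℤ) : List ℕ → List ℕ → ℤ
  | [a], [i] => g a i
  | [a, b], [i, j] => d2 g a b i j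
  | [a, b, c], [i, j, k] => d3 g a b c i j k
  | [a, b, c, d], [i, j, k, l] => d4 g a b c d i j k l
  | _, _ => 0

def lst (C : List (List ℕ)) (j : ℕ) (m : ℕ) : Fin j → ℕ := fun k => (C.getD m []).getD k 0

lemma det1 (g : ℕ → ℕ → ℤ) (a b : List ℕ) (ha : a.length = 1) (hb : b.length = 1) :
    Matrix.det (Matrix.of fun k l : Fin 1 => g (a.getD k 0) (b.getD l 0)) = mnL g a b := by
  match a, b, ha, hb with
  | [a], [i], _, _ => simp [mnL]

lemma det2 (g : ℕ → ℕ → ℤ) (a b : List ℕ) (ha : a.length = 2) (hb : b.length = 2) :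
    Matrix.det (Matrix.of fun k l : Fin 2 => g (a.getD k 0) (b.getD l 0)) = mnL g a b := by
  match a, b, ha, hb with
  | [a, b], [i, j], _, _ => simp [mnL, d2, zm_eq, Matrix.det_fin_two]

lemma det3 (g : ℕ → ℕ → ℤ) (a b : List ℕ) (ha : a.length = 3) (hb : b.length = 3) :
    Matrix.det (Matrix.of fun k l : Fin 3 => g (a.getD k 0) (b.getD l 0)) = mnL g a b := by
  match a, b, ha, hb with
  | [a, b, c], [i, j, k], _, _ => simp [mnL, d2, d3, zm_eq, Matrix.det_fin_three]; ring

lemma det4 (g : ℕ → ℕ → ℤ) (a b : List ℕ) (ha : a.length = 4) (hb : b.length = 4) :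
    Matrix.det (Matrix.of fun k l : Fin 4 => g (a.getD k 0) (b.getD l 0)) = mnL g a b := by
  match a, b, ha, hb with
  | [a, b, c, d], [i, j, k, l], _, _ =>
    rw [Matrix.det_succ_row_zero]
    simp [mnL, d2, d3, d4, zm_eq, Matrix.det_fin_three, Fin.sum_univ_succ, Fin.succAbove]
    ring

lemma getD_map_lt {α β : Type} (l : List α) (f : α → β) (i : ℕ) (a : α) (b : β) (h : i < l.length) :
    (l.map f).getD i b = f (l.getD i a) := by
  rw [List.getD_eq_getElem _ _ (by simpa using h), List.getD_eq_getElem _ _ h]; simp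

lemma mkTab {j : ℕ} (n : ℕ) (C : List (List ℕ)) (T : List (List ℤ))
    (hdet : ∀ (g : ℕ → ℕ → ℤ) (a b : List ℕ), a.length = j → b.length = j → 
      Matrix.det (Matrix.of fun k l : Fin j => g (a.getD k 0) (b.getD l 0)) = mnL g a b)
    (hC : C.length = n) (hl : C.all (fun l => decide (l.length = j) && l.all (· < 8)) = true)
    (h1 : C.map (fun I => C.map (fun A => mnL (fun a b => if a = b then 1 else 0) A I)) = oneL n)
    (hT : C.map (fun I => C.map (fun A => mnL (fun a b => (row Sm a).getD b 0) A I)) = T)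
    (hn : n = Nat.choose 8 j) : Tab n (lst C j) T := by
  have hlen : ∀ m, m < n → (C.getD m []).length = j ∧ ∀ x ∈ C.getD m [], x < 8 := by
    intro m hm
    rw [List.all_eq_true] at hl
    have := hl (C.getD m []) (by rw [List.getD_eq_getElem _ _ (by omega)]; exact List.getElem_mem _)
    simpa using this
  have hrow : ∀ (g : ℕ → ℕ → ℤ) a b, a < n → b < n → 
      (row (C.map (fun I => C.map (fun A => mnL g A I))) b).getD a 0
       = Matrix.det (Matrix.of fun k l : Fin j => g (lst C j a k) (lst C j b l)) := by
    intro g a b ha hb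
    rw [row, getD_map_lt _ _ _ [] _ (by omega), getD_map_lt _ _ _ [] _ (by omega)]
    exact (hdet g _ _ (hlen a ha).1 (hlen b hb).1).symm
  refine ⟨?_, ?_, ?_, ?_, ?_, hn⟩
  · intro m k hm
    refine (hlen m hm).2 _ ?_
    have := (hlen m hm).1
    change (C.getD m []).getD k 0 ∈ C.getD m []
    generalize C.getD m [] = l at this ⊢
    rw [List.getD_eq_getElem l 0 (by omega)]
    exact List.getElem_mem _
  · intro a b ha hb
    have e := hrow (fun a b => if a = b then 1 else 0) a b ha hb
    rw [h1] at e
    rw [← e]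
    have : (row (oneL n) b).getD a 0 = act (oneL n) (fun k => if k = a then 1 else 0) b := (dot_delta _ _).symm
    rw [this, act_one]
    · simp only [eq_comm]
    · intro i hi; simp; omega
  · rw [← hT]; simpa using hC
  · intro b hb
    rw [← hT, row, getD_map_lt _ _ _ [] _ (by omega)]; simpa using hC
  · intro a b ha hb
    rw [← hT]; exact (hrow (fun a b => (row Sm a).getD b 0) a b ha hb).symm

lemma tab1 : Tab 8 (lst C1 1) T1 :=
  mkTab 8 C1 T1 det1 (by decide +kernel) (by decide +kernel) (by decide +kernel) (by decide +kernel) (by decide +kernel)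
lemma tab2 : Tab 28 (lst C2 2) T2 :=
  mkTab 28 C2 T2 det2 (by decide +kernel) (by decide +kernel) (by decide +kernel) (by decide +kernel) (by decide +kernel)
lemma tab3 : Tab 56 (lst C3 3) T3 :=
  mkTab 56 C3 T3 det3 (by decide +kernel) (by decide +kernel) (by decide +kernel) (by decide +kernel) (by decide +kernel)
lemma tab4 : Tab 70 (lst C4 4) T4 :=
  mkTab 70 C4 T4 det4 (by decide +kernel) (by decide +kernel) (by decide +kernel) (by decide +kernel) (by decide +kernel)

end OHC

open CategoryTheory

namespace OHC
set_option linter.unusedSectionVars false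
set_option linter.unusedVariables false

/-! Bilinear and trilinear forms as nested lists. -/

section
variable {α : Type}

def gdot (e : α → ℤ) : List α → (ℕ → ℤ) → ℤ
  | [], _ => 0
  | a :: l, x => e a * x 0 + gdot e l (fun i => x (i+1))

def gadd (ad : α → α → α) : List α → List α → List α
  | [], l => l
  | a :: l, [] => a :: l
  | a :: l, b :: m => ad a b :: gadd ad l m

def glc (z : α) (ad : α → α → α) (sm : ℤ → α → α) : List α → List (List ℤ) → List α
  | [], _ => []
  | _ :: _, [] => []
  | a :: l, r :: M => gadd ad (r.map (fun c => if c = 0 then z else sm c a)) (glc z ad sm l M)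

lemma gdot_gadd (e : α → ℤ) (ad : α → α → α) (h : ∀ a b, e (ad a b) = e a + e b) (l m : List α) (x) :
    gdot e (gadd ad l m) x = gdot e l x + gdot e m x := by
  induction l generalizing m x with
  | nil => simp [gadd, gdot]
  | cons a l ih =>
    cases m with
    | nil => simp [gadd, gdot]
    | cons b m => simp only [gadd, gdot, ih, h]; ring

lemma gdot_outer (e : α → ℤ) (z : α) (sm : ℤ → α → α) (hz : e z = 0) (h : ∀ c a, e (sm c a) = c * e a)
    (r : List ℤ) (a : α) (x) :
    gdot e (r.map (fun c => if c = 0 then z else sm c a)) x = e a * dot r x := by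
  induction r generalizing x with
  | nil => simp [gdot, dot]
  | cons c r ih =>
    simp only [List.map_cons, gdot, dot, ih]
    split_ifs with hc
    · rw [hz, hc]; ring
    · rw [h]; ring

lemma gdot_zero (e : α → ℤ) (l : List α) : gdot e l (fun _ => 0) = 0 := by
  induction l with
  | nil => rfl
  | cons a l ih => simp [gdot, ih]

lemma gdot_glc (e : α → ℤ) (z : α) (hz : e z = 0) (ad : α → α → α) (sm : ℤ → α → α) (h : ∀ a b, e (ad a b) = e a + e b)
    (h' : ∀ c a, e (sm c a) = c * e a) (l : List α) (M : List (List ℤ)) (x) :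
    gdot e (glc z ad sm l M) x = gdot e l (act M x) := by
  induction l generalizing M with
  | nil => simp [glc, gdot]
  | cons a l ih =>
    cases M with
    | nil =>
      have : act [] x = fun _ => 0 := by funext i; simp [act, row, dot]
      rw [this, gdot_zero]; simp [glc, gdot]
    | cons r M =>
      have e1 : (fun i => act (r :: M) x (i+1)) = act M x := by
        funext i; simp [act, row]
      have e0 : act (r :: M) x 0 = dot r x := by simp [act, row]
      simp only [glc, gdot, e1, e0, ← ih]
      rw [gdot_gadd e ad h, gdot_outer e z sm hz h']

lemma gdot_add (e : α → ℤ) (l : List α) (x y : ℕ → ℤ) : gdot e l (x + y) = gdot e l x + gdot e l y := by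
  induction l generalizing x y with
  | nil => simp [gdot]
  | cons a l ih =>
    have := ih (fun i => x (i+1)) (fun i => y (i+1))
    simp only [gdot, Pi.add_apply] at this ⊢
    rw [← add_add_add_comm, ← mul_add, ← this]; rfl

lemma gdot_fun_add (e f g : α → ℤ) (h : ∀ a, g a = e a + f a) (l : List α) (x : ℕ → ℤ) :
    gdot g l x = gdot e l x + gdot f l x := by
  induction l generalizing x with
  | nil => simp [gdot]
  | cons a l ih => simp only [gdot, ih, h]; ring

lemma gdot_smul (e : α → ℤ) (sm : α → α) (c : ℤ) (h : ∀ a, e (sm a) = c * e a) (l : List α) (x : ℕ → ℤ) :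
    gdot e (l.map sm) x = c * gdot e l x := by
  induction l generalizing x with
  | nil => simp [gdot]
  | cons a l ih => simp only [List.map_cons, gdot, ih, h]; ring

lemma gdot_map {β : Type} (e : α → ℤ) (f : β → ℤ) (sm : β → α) (h : ∀ a, e (sm a) = f a) (l : List β) (x : ℕ → ℤ) :
    gdot e (l.map sm) x = gdot f l x := by
  induction l generalizing x with
  | nil => simp [gdot]
  | cons a l ih => simp only [List.map_cons, gdot, ih, h]

lemma gdot_sum (e : α → ℤ) (z : α) (hz : e z = 0) (l : List α) (n : ℕ) (x : ℕ → ℤ) (hx : Sup n x) :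
    gdot e l x = ∑ i ∈ Finset.range n, e (l.getD i z) * x i := by
  induction l generalizing x n with
  | nil => simp [gdot, hz]
  | cons a l ih =>
    cases n with
    | zero =>
      have : x = fun _ => 0 := by funext i; exact hx i (by omega)
      rw [this, gdot_zero]; simp
    | succ n =>
      rw [gdot, ih n (fun i => x (i+1)) (fun i hi => hx _ (by omega)), Finset.sum_range_succ']
      simp [add_comm]

end

lemma gdot_id (l : List ℤ) (x) : gdot (fun a => a) l x = dot l x := by
  induction l generalizing x with
  | nil => rfl
  | cons a l ih => simp [gdot, dot, ih]

abbrev M2L := List (List ℤ)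
abbrev M3L := List (List (List ℤ))

def dot2 (M : M2L) (x y : ℕ → ℤ) : ℤ := gdot (fun r => dot r y) M x
def dot3 (C : M3L) (x y z : ℕ → ℤ) : ℤ := gdot (fun M => dot2 M y z) C x

def add2 (A B : M2L) : M2L := gadd addR A B
def add3 (A B : M3L) : M3L := gadd add2 A B
def sm2 (c : ℤ) (A : M2L) : M2L := A.map (smulR c)
def sm3 (c : ℤ) (A : M3L) : M3L := A.map (sm2 c)
def tau2 (A : M2L) : M2L := glc [] addR smulR (A.map (fun r => lc r Sm)) Sm
def tau3 (A : M3L) : M3L := glc [] add2 sm2 (A.map tau2) Sm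

lemma dot2_add2 (A B x y) : dot2 (add2 A B) x y = dot2 A x y + dot2 B x y :=
  gdot_gadd _ _ (fun a b => dot_addR _ _ _) _ _ _
lemma dot2_sm2 (c A x y) : dot2 (sm2 c A) x y = c * dot2 A x y :=
  gdot_smul _ _ _ (fun a => dot_smulR _ _ _) _ _
lemma dot3_add3 (A B x y z) : dot3 (add3 A B) x y z = dot3 A x y z + dot3 B x y z :=
  gdot_gadd _ _ (fun a b => dot2_add2 _ _ _ _) _ _ _
lemma dot3_sm3 (c A x y z) : dot3 (sm3 c A) x y z = c * dot3 A x y z :=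
  gdot_smul _ _ _ (fun a => dot2_sm2 _ _ _ _) _ _
lemma dot2_tau2 (A x y) : dot2 (tau2 A) x y = dot2 A (act Sm x) (act Sm y) := by
  rw [dot2, tau2, gdot_glc (fun r => dot r y) [] rfl _ _ (fun a b => dot_addR _ _ _) (fun c a => dot_smulR _ _ _)]
  exact gdot_map (fun r => dot r y) (fun r => dot r (act Sm y)) (fun r => lc r Sm) (fun a => dot_lc a Sm y) _ _
lemma dot3_tau3 (A x y z) : dot3 (tau3 A) x y z = dot3 A (act Sm x) (act Sm y) (act Sm z) := by
  rw [dot3, tau3, gdot_glc (fun M => dot2 M y z) [] rfl _ _ (fun a b => dot2_add2 _ _ _ _) (fun c a => dot2_sm2 _ _ _ _)]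
  exact gdot_map (fun r => dot2 r y z) (fun r => dot2 r (act Sm y) (act Sm z)) tau2 (fun a => dot2_tau2 a y z) _ _

lemma dot2_add_l (A x x' y) : dot2 A (x + x') y = dot2 A x y + dot2 A x' y := gdot_add _ _ _ _
lemma dot2_add_r (A x y y') : dot2 A x (y + y') = dot2 A x y + dot2 A x y' :=
  gdot_fun_add _ _ _ (fun a => dot_add _ _ _) _ _
lemma dot3_add_1 (A x x' y z) : dot3 A (x + x') y z = dot3 A x y z + dot3 A x' y z := gdot_add _ _ _ _
lemma dot3_add_2 (A x y y' z) : dot3 A x (y + y') z = dot3 A x y z + dot3 A x y' z :=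
  gdot_fun_add _ _ _ (fun a => dot2_add_l _ _ _ _) _ _
lemma dot3_add_3 (A x y z z') : dot3 A x y (z + z') = dot3 A x y z + dot3 A x y z' :=
  gdot_fun_add _ _ _ (fun a => dot2_add_r _ _ _ _) _ _

def ent2 (A : M2L) (i j : ℕ) : ℤ := (A.getD i []).getD j 0
def ent3 (A : M3L) (i j k : ℕ) : ℤ := ent2 (A.getD i []) j k

lemma dot_sum8 (l : List ℤ) (x) (hx : Sup 8 x) : dot l x = ∑ i ∈ Finset.range 8, l.getD i 0 * x i := by
  rw [← gdot_id]; exact gdot_sum _ 0 rfl l 8 x hx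

lemma dot2_sum (A x y) (hx : Sup 8 x) (hy : Sup 8 y) : dot2 A x y =
    ∑ i ∈ Finset.range 8, ∑ j ∈ Finset.range 8, ent2 A i j * x i * y j := by
  rw [dot2, gdot_sum _ [] rfl A 8 x hx]
  refine Finset.sum_congr rfl fun i _ => ?_
  rw [dot_sum8 _ _ hy, Finset.sum_mul]
  refine Finset.sum_congr rfl fun j _ => ?_
  rw [ent2]; ring

lemma dot3_sum (A x y z) (hx : Sup 8 x) (hy : Sup 8 y) (hz : Sup 8 z) : dot3 A x y z =
    ∑ i ∈ Finset.range 8, ∑ j ∈ Finset.range 8, ∑ k ∈ Finset.range 8, ent3 A i j k * x i * y j * z k := by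
  rw [dot3, gdot_sum _ [] rfl A 8 x hx]
  refine Finset.sum_congr rfl fun i _ => ?_
  rw [dot2_sum _ _ _ hy hz, Finset.sum_mul]
  refine Finset.sum_congr rfl fun j _ => ?_
  rw [Finset.sum_mul]
  refine Finset.sum_congr rfl fun k _ => ?_
  rw [ent3]; ring

def all2 (p : ℕ → ℕ → Bool) : Bool := (List.range 8).all fun i => (List.range 8).all fun j => p i j
def all3 (p : ℕ → ℕ → ℕ → Bool) : Bool := (List.range 8).all fun i => all2 (p i)

lemma all2_spec {p} (h : all2 p = true) (i j) (hi : i < 8) (hj : j < 8) : p i j = true := by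
  simp only [all2, List.all_eq_true, List.mem_range] at h
  exact h i hi j hj
lemma all3_spec {p} (h : all3 p = true) (i j k) (hi : i < 8) (hj : j < 8) (hk : k < 8) : p i j k = true := by
  simp only [all3, List.all_eq_true, List.mem_range] at h
  exact all2_spec (h i hi) j k hj hk

/-- structural comparison, up to padding by zeros -/
def eqR : List ℤ → List ℤ → Bool
  | [], m => m.all (fun b => decide (b = 0))
  | a :: l, m => decide (a = m.headD 0) && eqR l m.tail
def eq2 : M2L → M2L → Bool
  | [], m => m.all (fun b => eqR [] b)
  | a :: l, m => eqR a (m.headD []) && eq2 l m.tail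
def eq3 : M3L → M3L → Bool
  | [], m => m.all (fun b => eq2 [] b)
  | a :: l, m => eq2 a (m.headD []) && eq3 l m.tail
def sym12 (A : M3L) : Bool := all3 fun i j k => decide (ent3 A i j k = ent3 A j i k)
def sym23 (A : M3L) : Bool := all3 fun i j k => decide (ent3 A i j k = ent3 A i k j)
def asym2 (A : M2L) : Bool := all2 fun i j => decide (ent2 A i j = - ent2 A j i)

lemma gdot_head {α : Type} (e : α → ℤ) (z : α) (hz : e z = 0) (m : List α) (x : ℕ → ℤ) :
    gdot e m x = e (m.headD z) * x 0 + gdot e m.tail (fun i => x (i+1)) := by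
  cases m with
  | nil => simp [gdot, hz]
  | cons b m => rfl
lemma gdot_all {α : Type} (e : α → ℤ) (m : List α) (h : ∀ b ∈ m, e b = 0) (x : ℕ → ℤ) : gdot e m x = 0 := by
  induction m generalizing x with
  | nil => rfl
  | cons b m ih => rw [gdot, h b (by simp), ih (fun b hb => h b (by simp [hb]))]; simp

lemma eqR_spec (A B) (h : eqR A B = true) (x) : dot A x = dot B x := by
  induction A generalizing B x with
  | nil =>
    simp only [eqR, List.all_eq_true, decide_eq_true_eq] at h
    rw [← gdot_id B, gdot_all _ _ h]; rfl
  | cons a l ih =>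
    simp only [eqR, Bool.and_eq_true, decide_eq_true_eq] at h
    rw [← gdot_id B, gdot_head _ 0 rfl, gdot_id, ← ih _ h.2, dot, h.1]
lemma eq2_spec {A B} (h : eq2 A B = true) (x y) : dot2 A x y = dot2 B x y := by
  induction A generalizing B x with
  | nil =>
    simp only [eq2, List.all_eq_true] at h
    symm
    exact gdot_all _ _ (fun b hb => (eqR_spec _ _ (h b hb) y).symm) _
  | cons a l ih =>
    simp only [eq2, Bool.and_eq_true] at h
    have := ih h.2 (fun i => x (i+1))
    simp only [dot2] at this ⊢
    rw [gdot_head _ [] rfl B, ← this, gdot, eqR_spec _ _ h.1]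
lemma eq3_spec {A B} (h : eq3 A B = true) (x y z) : dot3 A x y z = dot3 B x y z := by
  induction A generalizing B x with
  | nil =>
    simp only [eq3, List.all_eq_true] at h
    symm
    exact gdot_all _ _ (fun b hb => (eq2_spec (h b hb) y z).symm) _
  | cons a l ih =>
    simp only [eq3, Bool.and_eq_true] at h
    have := ih h.2 (fun i => x (i+1))
    simp only [dot3] at this ⊢
    rw [gdot_head _ [] rfl B, ← this, gdot, eq2_spec h.1]

lemma sym12_spec {A} (h : sym12 A = true) (x y z) (hx : Sup 8 x) (hy : Sup 8 y) (hz : Sup 8 z) :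
    dot3 A x y z = dot3 A y x z := by
  rw [dot3_sum _ _ _ _ hx hy hz, dot3_sum _ _ _ _ hy hx hz, Finset.sum_comm]
  refine Finset.sum_congr rfl fun i hi => Finset.sum_congr rfl fun j hj => Finset.sum_congr rfl fun k hk => ?_
  rw [of_decide_eq_true (all3_spec h i j k (Finset.mem_range.1 hi) (Finset.mem_range.1 hj) (Finset.mem_range.1 hk))]
  ring

lemma sym23_spec {A} (h : sym23 A = true) (x y z) (hx : Sup 8 x) (hy : Sup 8 y) (hz : Sup 8 z) :
    dot3 A x y z = dot3 A x z y := by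
  rw [dot3_sum _ _ _ _ hx hy hz, dot3_sum _ _ _ _ hx hz hy]
  refine Finset.sum_congr rfl fun i hi => ?_
  rw [Finset.sum_comm]
  refine Finset.sum_congr rfl fun j hj => Finset.sum_congr rfl fun k hk => ?_
  rw [of_decide_eq_true (all3_spec h i j k (Finset.mem_range.1 hi) (Finset.mem_range.1 hj) (Finset.mem_range.1 hk))]
  ring

/-- sum of the first `m` iterates -/
def nrm2 : ℕ → M2L → M2L
  | 0, _ => []
  | m+1, A => add2 A (tau2 (nrm2 m A))
def nrm3 : ℕ → M3L → M3L
  | 0, _ => []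
  | m+1, A => add3 A (tau3 (nrm3 m A))

/-! cochains -/
def c1 (r : List ℤ) : Co LL 1 := fun v => dot r (xv (v 0))
def c2 (A : M2L) : Co LL 2 := fun v => dot2 A (xv (v 0)) (xv (v 1))
def c3 (A : M3L) : Co LL 3 := fun v => dot3 A (xv (v 0)) (xv (v 1)) (xv (v 2))

lemma c2_tau (A) : tau ph 2 (c2 A) = c2 (tau2 A) := by
  funext v
  simp only [c2, dot2_tau2, tau, tac, AddMonoidHom.coe_mk, ZeroHom.coe_mk, xv_tau]
lemma c3_tau (A) : tau ph 3 (c3 A) = c3 (tau3 A) := by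
  funext v
  simp only [c3, dot3_tau3, tau, tac, AddMonoidHom.coe_mk, ZeroHom.coe_mk, xv_tau]
lemma c1_tau (r) : tau ph 1 (c1 r) = c1 (lc r Sm) := by
  funext v
  simp only [c1, dot_lc, tau, tac, AddMonoidHom.coe_mk, ZeroHom.coe_mk, xv_tau]
lemma c1_add (A B) : c1 (addR A B) = c1 A + c1 B := by funext v; exact dot_addR _ _ _
lemma c1_sm (c : ℤ) (A) : c1 (smulR c A) = c • c1 A := by funext v; exact dot_smulR _ _ _
lemma c2_add (A B) : c2 (add2 A B) = c2 A + c2 B := by funext v; exact dot2_add2 _ _ _ _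
lemma c3_add (A B) : c3 (add3 A B) = c3 A + c3 B := by funext v; exact dot3_add3 _ _ _ _ _
lemma c2_sm (c : ℤ) (A) : c2 (sm2 c A) = c • c2 A := by funext v; exact dot2_sm2 _ _ _ _
lemma c3_sm (c : ℤ) (A) : c3 (sm3 c A) = c • c3 A := by funext v; exact dot3_sm3 _ _ _ _ _
lemma c2_eq {A B} (h : eq2 A B = true) : c2 A = c2 B := by
  funext v; exact eq2_spec h _ _
lemma c3_eq {A B} (h : eq3 A B = true) : c3 A = c3 B := by
  funext v; exact eq3_spec h _ _ _

lemma iter_sum {A : Type} [AddCommGroup A] (t : A →+ A) (c : A) (m : ℕ) :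
    ∑ k ∈ Finset.range (m+1), t^[k] c = c + t (∑ k ∈ Finset.range m, t^[k] c) := by
  rw [Finset.sum_range_succ', map_sum, add_comm]
  simp only [Function.iterate_succ_apply', Function.iterate_zero, id_eq]

lemma c2_nrm (A) (m) : c2 (nrm2 m A) = ∑ k ∈ Finset.range m, (tau ph 2)^[k] (c2 A) := by
  induction m with
  | zero => rfl
  | succ m ih => rw [iter_sum, ← ih, c2_tau, nrm2, c2_add]
lemma c3_nrm (A) (m) : c3 (nrm3 m A) = ∑ k ∈ Finset.range m, (tau ph 3)^[k] (c3 A) := by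
  induction m with
  | zero => rfl
  | succ m ih => rw [iter_sum, ← ih, c3_tau, nrm3, c3_add]
lemma c2_nm (A) : nm ph 2 (c2 A) = c2 (nrm2 9 A) := by rw [nm_eq, c2_nrm]
lemma c3_nm (A) : nm ph 3 (c3 A) = c3 (nrm3 9 A) := by rw [nm_eq, c3_nrm]

end OHC

open CategoryTheory

namespace OHC
set_option linter.unusedSectionVars false
set_option linter.unusedVariables false

lemma c1_mlin (r) : MLin (c1 r) := by
  intro v i x y
  fin_cases i
  simp only [c1, Fin.zero_eta, Function.update_self, xv_mul, dot_add]
lemma c2_mlin (r) : MLin (c2 r) := by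
  intro v i x y
  fin_cases i
  · simp [c2, xv_mul, dot2_add_l]
  · simp [c2, xv_mul, dot2_add_r]
lemma c3_mlin (r) : MLin (c3 r) := by
  intro v i x y
  fin_cases i
  · simp [c3, xv_mul, dot3_add_1]
  · simp [c3, xv_mul, dot3_add_2, Function.update]
  · simp [c3, xv_mul, dot3_add_3, Function.update]

def vecL (l : List ℤ) : ℕ → ℤ := fun m => l.getD m 0

def dl (i : ℕ) : ℕ → ℤ := fun k => if k = i then 1 else 0

lemma dl_sup (i : ℕ) (hi : i < 8) : Sup 8 (dl i) := by
  intro k hk; simp [dl]; omega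

lemma dot_dl (l : List ℤ) (i) : dot l (dl i) = l.getD i 0 := dot_delta l i

lemma dot2_dl (A i j) (hi : i < 8) (hj : j < 8) : dot2 A (dl i) (dl j) = ent2 A i j := by
  rw [dot2_sum _ _ _ (dl_sup i hi) (dl_sup j hj)]
  simp [dl, hi, hj]

lemma dot3_dl (A i j k) (hi : i < 8) (hj : j < 8) (hk : k < 8) : dot3 A (dl i) (dl j) (dl k) = ent3 A i j k := by
  rw [dot3_sum _ _ _ _ (dl_sup i hi) (dl_sup j hj) (dl_sup k hk)]
  simp [dl, hi, hj, hk]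

lemma pp_getD {j n : ℕ} {C : List (List ℕ)} (hC : C.length = n) (f : Co LL j) (F : List ℕ → ℤ)
    (h : ∀ m, m < n → palt j (fun k => Eb (lst C j m k)) f = F (C.getD m [])) :
    pp n (lst C j) f = vecL (C.map F) := by
  funext m
  simp only [pp, AddMonoidHom.coe_mk, ZeroHom.coe_mk, vecL]
  split_ifs with hm
  · rw [h m hm, getD_map_lt _ _ _ [] _ (by omega)]
  · rw [List.getD_eq_default]; simp; omega

def F1 (r : List ℤ) (I : List ℕ) : ℤ := r.getD (I.getD 0 0) 0
def F2 (A : M2L) (I : List ℕ) : ℤ := ent2 A (I.getD 0 0) (I.getD 1 0) - ent2 A (I.getD 1 0) (I.getD 0 0)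
def F3 (A : M3L) (I : List ℕ) : ℤ :=
  let a := I.getD 0 0
  let b := I.getD 1 0
  let c := I.getD 2 0
  ent3 A a b c - ent3 A b a c - ent3 A a c b - ent3 A c b a + ent3 A b c a + ent3 A c a b

lemma pp_c1 (r) : pp 8 (lst C1 1) (c1 r) = vecL (C1.map (F1 r)) := by
  refine pp_getD (by decide) _ _ fun m hm => ?_
  rw [palt_apply]
  simp only [Finset.univ_unique, Finset.sum_singleton]
  have := tab1.lt m 0 hm
  simp only [c1, Equiv.Perm.default_eq, Equiv.Perm.sign_one, Units.val_one, one_mul, Equiv.Perm.coe_one, id_eq]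
  rw [xv_E _ this]
  exact dot_dl _ _

lemma perm2 : (Finset.univ : Finset (Equiv.Perm (Fin 2))) = {1, Equiv.swap 0 1} := by decide
lemma perm3 : (Finset.univ : Finset (Equiv.Perm (Fin 3))) = {1, Equiv.swap 0 1, Equiv.swap 1 2, Equiv.swap 0 2,
   Equiv.swap 0 1 * Equiv.swap 1 2, Equiv.swap 1 2 * Equiv.swap 0 1} := by decide

lemma palt2 (e : Fin 2 → LL) (f : Co LL 2) : palt 2 e f = f ![e 0, e 1] - f ![e 1, e 0] := by
  rw [palt_apply, perm2, Finset.sum_insert (by decide), Finset.sum_singleton]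
  have e1 : (fun i => e ((1 : Equiv.Perm (Fin 2)) i)) = ![e 0, e 1] := by funext i; fin_cases i <;> rfl
  have e2 : (fun i => e (Equiv.swap (0 : Fin 2) 1 i)) = ![e 1, e 0] := by funext i; fin_cases i <;> rfl
  rw [e1, e2, show Equiv.Perm.sign (1 : Equiv.Perm (Fin 2)) = 1 by decide,
    show Equiv.Perm.sign (Equiv.swap (0 : Fin 2) 1) = -1 by decide]
  simp [sub_eq_add_neg]

lemma palt3 (e : Fin 3 → LL) (f : Co LL 3) : palt 3 e f = f ![e 0, e 1, e 2] - f ![e 1, e 0, e 2] - f ![e 0, e 2, e 1]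
    - f ![e 2, e 1, e 0] + f ![e 1, e 2, e 0] + f ![e 2, e 0, e 1] := by
  rw [palt_apply, perm3, Finset.sum_insert (by decide), Finset.sum_insert (by decide), Finset.sum_insert (by decide), 
    Finset.sum_insert (by decide), Finset.sum_insert (by decide), Finset.sum_singleton]
  have e1 : (fun i => e ((1 : Equiv.Perm (Fin 3)) i)) = ![e 0, e 1, e 2] := by funext i; fin_cases i <;> rfl
  have e2 : (fun i => e (Equiv.swap (0 : Fin 3) 1 i)) = ![e 1, e 0, e 2] := by funext i; fin_cases i <;> rfl
  have e3 : (fun i => e (Equiv.swap (1 : Fin 3) 2 i)) = ![e 0, e 2, e 1] := by funext i; fin_cases i <;> rfl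
  have e4 : (fun i => e (Equiv.swap (0 : Fin 3) 2 i)) = ![e 2, e 1, e 0] := by funext i; fin_cases i <;> rfl
  have e5 : (fun i => e ((Equiv.swap (0 : Fin 3) 1 * Equiv.swap 1 2 : Equiv.Perm (Fin 3)) i)) = ![e 1, e 2, e 0] := by
    funext i; fin_cases i <;> rfl
  have e6 : (fun i => e ((Equiv.swap (1 : Fin 3) 2 * Equiv.swap 0 1 : Equiv.Perm (Fin 3)) i)) = ![e 2, e 0, e 1] := by
    funext i; fin_cases i <;> rfl
  rw [e1, e2, e3, e4, e5, e6, show Equiv.Perm.sign (1 : Equiv.Perm (Fin 3)) = 1 by decide,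
    show Equiv.Perm.sign (Equiv.swap (0 : Fin 3) 1) = -1 by decide,
    show Equiv.Perm.sign (Equiv.swap (1 : Fin 3) 2) = -1 by decide,
    show Equiv.Perm.sign (Equiv.swap (0 : Fin 3) 2) = -1 by decide,
    show Equiv.Perm.sign (Equiv.swap (0 : Fin 3) 1 * Equiv.swap 1 2) = 1 by decide,
    show Equiv.Perm.sign (Equiv.swap (1 : Fin 3) 2 * Equiv.swap 0 1) = 1 by decide]
  simp only [Units.val_one, Units.val_neg]
  ring

lemma pp_c2 (A) : pp 28 (lst C2 2) (c2 A) = vecL (C2.map (F2 A)) := by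
  refine pp_getD (by decide) _ _ fun m hm => ?_
  have h0 := tab2.lt m 0 hm
  have h1 := tab2.lt m 1 hm
  rw [palt2]
  simp only [c2, Matrix.cons_val_zero, Matrix.cons_val_one, Matrix.cons_val_fin_one, xv_E _ h0, xv_E _ h1]
  change dot2 A (dl _) (dl _) - dot2 A (dl _) (dl _) = _
  rw [dot2_dl _ _ _ h0 h1, dot2_dl _ _ _ h1 h0]
  rfl

lemma pp_c3 (A) : pp 56 (lst C3 3) (c3 A) = vecL (C3.map (F3 A)) := by
  refine pp_getD (by decide) _ _ fun m hm => ?_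
  have h0 := tab3.lt m 0 hm
  have h1 := tab3.lt m 1 hm
  have h2 := tab3.lt m 2 hm
  rw [palt3]
  simp only [c3, Matrix.cons_val_zero, Matrix.cons_val_one, Matrix.cons_val_fin_one, Matrix.cons_val,
    xv_E _ h0, xv_E _ h1, xv_E _ h2]
  change dot3 A (dl _) (dl _) (dl _) - dot3 A (dl _) (dl _) (dl _) - dot3 A (dl _) (dl _) (dl _) 
    - dot3 A (dl _) (dl _) (dl _) + dot3 A (dl _) (dl _) (dl _) + dot3 A (dl _) (dl _) (dl _) = _
  rw [dot3_dl _ _ _ _ h0 h1 h2, dot3_dl _ _ _ _ h1 h0 h2, dot3_dl _ _ _ _ h0 h2 h1, dot3_dl _ _ _ _ h2 h1 h0,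
    dot3_dl _ _ _ _ h1 h2 h0, dot3_dl _ _ _ _ h2 h0 h1]
  rfl

/-! explicit coboundaries -/
lemma del1 (f : Co LL 1) (v) : del 1 f v = f ![v 1] - f ![v 0 * v 1] + f ![v 0] := by
  change f (Fin.tail v) + ∑ k : Fin 2, (-1 : ℤ)^((k:ℕ)+1) * f (k.contractNth (· * ·) v) = _
  rw [Fin.sum_univ_two]
  have e1 : Fin.tail v = ![v 1] := by funext i; fin_cases i; rfl
  have e2 : Fin.contractNth 0 (· * ·) v = ![v 0 * v 1] := by funext i; fin_cases i; rfl
  have e3 : Fin.contractNth 1 (· * ·) v = ![v 0] := by funext i; fin_cases i; rfl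
  rw [e1, e2, e3]; norm_num; ring

lemma del2 (f : Co LL 2) (v) : del 2 f v = f ![v 1, v 2] - f ![v 0 * v 1, v 2] + f ![v 0, v 1 * v 2] - f ![v 0, v 1] := by
  change f (Fin.tail v) + ∑ k : Fin 3, (-1 : ℤ)^((k:ℕ)+1) * f (k.contractNth (· * ·) v) = _
  rw [Fin.sum_univ_three]
  have e1 : Fin.tail v = ![v 1, v 2] := by funext i; fin_cases i <;> rfl
  have e2 : Fin.contractNth 0 (· * ·) v = ![v 0 * v 1, v 2] := by funext i; fin_cases i <;> rfl
  have e3 : Fin.contractNth 1 (· * ·) v = ![v 0, v 1 * v 2] := by funext i; fin_cases i <;> rfl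
  have e4 : Fin.contractNth 2 (· * ·) v = ![v 0, v 1] := by funext i; fin_cases i <;> rfl
  rw [e1, e2, e3, e4]; norm_num; ring

/-- the quadratic 2-cochain of a pair of tensors -/
def qb (B B' : M3L) : Co LL 2 := fun v =>
  dot3 B (xv (v 0)) (xv (v 0)) (xv (v 1)) + dot3 B' (xv (v 0)) (xv (v 1)) (xv (v 1))

lemma qb_del {B B'} (h : sym12 B = true) (h' : sym23 B' = true) : del 2 (qb B B') = (2:ℤ) • (c3 B' - c3 B) := by
  funext v
  rw [del2]
  simp only [qb, c3, Matrix.cons_val_zero, Matrix.cons_val_one, Matrix.cons_val_fin_one, xv_mul, dot3_add_1, dot3_add_2,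
    dot3_add_3, Pi.smul_apply, Pi.sub_apply, smul_eq_mul]
  rw [sym12_spec h (xv (v 1)) (xv (v 0)) (xv (v 2)) (xv_sup _) (xv_sup _) (xv_sup _),
    sym23_spec h' (xv (v 0)) (xv (v 2)) (xv (v 1)) (xv_sup _) (xv_sup _) (xv_sup _)]
  ring

lemma qb_tau (B B') : tau ph 2 (qb B B') = qb (tau3 B) (tau3 B') := by
  funext v
  simp only [qb, dot3_tau3, tau, tac, AddMonoidHom.coe_mk, ZeroHom.coe_mk, xv_tau]
lemma qb_add (B B' D D') : qb (add3 B D) (add3 B' D') = qb B B' + qb D D' := by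
  funext v; simp only [qb, dot3_add3, Pi.add_apply]; ring
lemma qb_sm (c : ℤ) (B B') : qb (sm3 c B) (sm3 c B') = c • qb B B' := by
  funext v; simp only [qb, dot3_sm3, Pi.smul_apply, smul_eq_mul]; ring
lemma qb_eq {B B' D D'} (h : eq3 B D = true) (h' : eq3 B' D' = true) : qb B B' = qb D D' := by
  funext v
  simp only [qb]
  rw [eq3_spec h, eq3_spec h']
lemma qb_nrm (B B') (m) : qb (nrm3 m B) (nrm3 m B') = ∑ k ∈ Finset.range m, (tau ph 2)^[k] (qb B B') := by
  induction m with
  | zero => rfl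
  | succ m ih => rw [iter_sum, ← ih, qb_tau, nrm3, nrm3, qb_add]
lemma qb_nm (B B') : nm ph 2 (qb B B') = qb (nrm3 9 B) (nrm3 9 B') := by rw [nm_eq, qb_nrm]

/-- the cubic 1-cochain -/
def cu (s : M3L) (r : List ℤ) : Co LL 1 := fun v =>
  (dot3 s (xv (v 0)) (xv (v 0)) (xv (v 0)) + dot r (xv (v 0))) / 3

def cuok (s : M3L) (r : List ℤ) : Bool := sym12 s && sym23 s && 
  (List.range 8).all fun i => decide ((3:ℤ) ∣ ent3 s i i i + r.getD i 0)

lemma sup_sum (x : ℕ → ℤ) (hx : Sup 8 x) : x = ∑ i ∈ Finset.range 8, x i • dl i := by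
  funext k
  simp only [Finset.sum_apply, Pi.smul_apply, smul_eq_mul, dl, mul_ite, mul_one, mul_zero]
  simp only [Finset.sum_ite_eq, Finset.mem_range]
  split_ifs with h
  · rfl
  · exact hx k (by omega)

lemma cu_dvd {s r} (h : cuok s r = true) (x) (hx : Sup 8 x) : (3:ℤ) ∣ dot3 s x x x + dot r x := by
  simp only [cuok, Bool.and_eq_true, List.all_eq_true, List.mem_range, decide_eq_true_eq] at h
  obtain ⟨⟨h1, h2⟩, h3⟩ := h
  have z3 : ∀ y z, dot3 s 0 y z = 0 := by
    intro y z; have := dot3_add_1 s 0 0 y z; simp only [add_zero] at this; linarith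
  have zd : dot r 0 = 0 := by
    have := dot_add r 0 0; simp only [add_zero] at this; linarith
  have key : ∀ x y, Sup 8 x → Sup 8 y → dot3 s (x+y) (x+y) (x+y) + dot r (x+y) = 
      (dot3 s x x x + dot r x) + (dot3 s y y y + dot r y) + 3 * (dot3 s x x y + dot3 s x y y) := by
    intro x y hx hy
    simp only [dot3_add_1, dot3_add_2, dot3_add_3, dot_add]
    rw [sym12_spec h1 y x x hy hx hx, sym23_spec h2 x y x hx hy hx, sym23_spec h2 y y x hy hy hx,
      sym12_spec h1 y x y hy hx hy]
    ring
  let P : AddSubgroup (ℕ → ℤ) :=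
    { carrier := {x | Sup 8 x ∧ (3:ℤ) ∣ dot3 s x x x + dot r x}
      zero_mem' := by
        refine ⟨fun _ _ => rfl, ?_⟩
        rw [z3, zd]; norm_num
      add_mem' := by
        rintro x y ⟨hx, hx'⟩ ⟨hy, hy'⟩
        refine ⟨fun i hi => by simp [hx i hi, hy i hi], ?_⟩
        rw [key x y hx hy]
        exact dvd_add (dvd_add hx' hy') (dvd_mul_right _ _)
      neg_mem' := by
        rintro x ⟨hx, hx'⟩
        have hy : Sup 8 (-x) := fun i hi => by simp [hx i hi]
        refine ⟨hy, ?_⟩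
        have := key x (-x) hx hy
        rw [add_neg_cancel, z3, zd] at this
        omega }
  have : ∑ i ∈ Finset.range 8, x i • dl i ∈ P := by
    refine P.sum_mem fun i hi => P.zsmul_mem ⟨dl_sup i (Finset.mem_range.1 hi), ?_⟩ _
    have hi := Finset.mem_range.1 hi
    rw [dot3_dl _ _ _ _ hi hi hi, dot_dl]
    exact h3 i hi
  rw [← sup_sum x hx] at this
  exact this.2

lemma cu_spec {s r} (h : cuok s r = true) (v) : 3 * cu s r v = 
    dot3 s (xv (v 0)) (xv (v 0)) (xv (v 0)) + dot r (xv (v 0)) :=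
  Int.mul_ediv_cancel' (cu_dvd h _ (xv_sup _))

lemma cu_del {s r} (h : cuok s r = true) : del 1 (cu s r) = - qb s s := by
  funext v
  have h' := h
  simp only [cuok, Bool.and_eq_true] at h'
  obtain ⟨⟨h1, h2⟩, h3⟩ := h'
  refine mul_left_cancel₀ (show (3:ℤ) ≠ 0 by norm_num) ?_
  rw [del1, mul_add, mul_sub, cu_spec h, cu_spec h, cu_spec h]
  simp only [Matrix.cons_val_zero, Matrix.cons_val_fin_one, Pi.neg_apply, qb]
  generalize v 0 = a; generalize v 1 = b
  simp only [xv_mul, dot3_add_1, dot3_add_2, dot3_add_3, dot_add]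
  have ha := xv_sup a
  have hb := xv_sup b
  rw [sym12_spec h1 _ _ _ hb ha ha, sym23_spec h2 _ _ _ ha hb ha, sym23_spec h2 _ _ _ hb hb ha,
      sym12_spec h1 _ _ _ hb ha hb]
  ring

lemma cu_tau (s r) : tau ph 1 (cu s r) = cu (tau3 s) (lc r Sm) := by
  funext v
  simp only [cu, dot3_tau3, dot_lc, tau, tac, AddMonoidHom.coe_mk, ZeroHom.coe_mk, xv_tau]

end OHC

open CategoryTheory

namespace OHC
set_option linter.unusedSectionVars false
set_option linter.unusedVariables false

/-- decode rows of two-digit numbers: `d` means `d - 50` -/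
def decS : ℕ → ℕ → List ℤ → List ℤ
  | 0, _, acc => acc
  | n+1, r, acc => decS n (r / 100) ((((r % 100 : ℕ) : ℤ) - 50) :: acc)
def dn3 (l : List (List ℕ)) : M3L := l.map (fun m => m.map (fun r => if r = 0 then [] else decS 8 r []))

def sub3 (A B : M3L) : M3L := add3 A (sm3 (-1) B)

lemma c3_sub (A B) : c3 (sub3 A B) = c3 A - c3 B := by rw [sub3, c3_add, c3_sm]; simp [sub_eq_add_neg]
lemma qb_sub (A B C D) : qb (sub3 A B) (sub3 C D) = qb A C - qb B D := by
  rw [sub3, sub3, qb_add, qb_sm]; simp [sub_eq_add_neg]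
lemma dot3_sub (A B x y z) : dot3 (sub3 A B) x y z = dot3 A x y z - dot3 B x y z := by
  rw [sub3, dot3_add3, dot3_sm3]; ring

/-- the norm vanishes on the invariants in degree one -/
lemma nm_one (f : Co LL 1) (hf : del 1 (nm ph 1 f) = 0) : nm ph 1 f = 0 := by
  set c := nm ph 1 f with hc
  have ht : tau ph 1 c = c := by rw [hc, tau_nm]
  set p := pp 8 (lst C1 1) c with hp
  have h1 := pp_nm tab1 c hf
  rw [← hp, nm_eq] at h1
  have hi : ∀ k, (tau ph 1)^[k] c = c := by
    intro k
    induction k with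
    | zero => rfl
    | succ k ih => rw [Function.iterate_succ_apply', ih, ht]
  simp only [hi] at h1
  rw [Finset.sum_const, Finset.card_range, map_nsmul, ← hp] at h1
  have h2 : act (normL 8 T1 9) p = 0 := by
    funext i
    by_cases hi : i < 8
    · have : ∀ i : Fin 8, row (normL 8 T1 9) i = List.replicate 8 0 := by decide +kernel
      rw [act, this ⟨i, hi⟩]
      exact dot_zero _ _
    · exact act_sup _ 8 _ (by decide +kernel) i (by omega)
  rw [h2] at h1
  have h3 : p = 0 := by
    funext i
    have := congrFun h1 i
    simpa using this
  obtain ⟨g, hg⟩ := pp_exact tab1 c hf h3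
  have : g = fun _ => g ![] := by funext v; congr 1; exact Subsingleton.elim _ _
  rw [hg, this, del0]

/-! the special classes -/
structure XD (c b b' s w u u' p : M3L) (lam mu ell : List ℤ) : Prop where
  q1 : eq3 (add3 (nrm3 9 c) b) b' = true
  q2 : eq3 (sub3 (tau3 b) b) s = true
  q3 : eq3 (sub3 (tau3 b') b') s = true
  q4 : eq3 (add3 (sub3 (sm3 3 c) (sub3 (tau3 w) w)) u) u' = true
  q5 : eq3 (sub3 (nrm3 9 u) (sm3 3 b)) p = true
  q6 : eq3 (sub3 (nrm3 9 u') (sm3 3 b')) p = true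
  s1 : sym12 b = true
  s2 : sym23 b' = true
  s4 : cuok s lam = true
  r1 : sym12 u = true
  r2 : sym23 u' = true
  r4 : cuok p mu = true
  r5 : eq3 (sub3 (tau3 p) p) (sm3 (-3) s) = true
  r6 : addR (smulR 3 lam) (addR (lc mu Sm) (smulR (-1) mu)) = smulR 3 ell

def xt (c b b' s : M3L) (lam : List ℤ) : Cx4 LL := (0, (2:ℤ) • c3 c, qb b b', cu s lam, 0)

section
variable {c b b' s w u u' p : M3L} {lam mu ell : List ℤ}

lemma xt_closed (h : XD c b b' s w u u' p lam mu ell) : Closed ph (xt c b b' s lam) := by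
  have e2 : del 1 (cu s lam) + (tau ph 2 (qb b b') - qb b b') = 0 := by
    rw [cu_del h.s4, qb_tau, ← qb_sub, qb_eq h.q2 h.q3]; simp
  constructor
  · simp [xt]
  · simp only [xt, map_zsmul, del_mlin _ (c3_mlin _)]; simp
  · simp only [xt]
    rw [qb_del h.s1 h.s2, map_zsmul, c3_nm, ← c3_eq h.q1, c3_add]; simp
  · exact e2
  · simp only [xt]
    refine nm_one _ ?_
    rw [← nm_del, eq_neg_of_add_eq_zero_left e2, map_neg, map_sub, nm_tau, sub_self, neg_zero]

lemma xt_rel (h : XD c b b' s w u u' p lam mu ell) : 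
    D3 ph ((-2:ℤ) • c3 w, qb u u', cu p mu, 0) = (3:ℤ) • xt c b b' s lam - (0, 0, 0, c1 ell, 0) := by
  have e1 : del 2 (qb u u') - (tau ph 3 ((-2:ℤ) • c3 w) - (-2:ℤ) • c3 w) = (6:ℤ) • c3 c := by
    rw [qb_del h.r1 h.r2, map_zsmul, ← c3_eq h.q4, c3_add, c3_sub, c3_sub, c3_sm, ← c3_tau]
    module
  have e2 : del 1 (cu p mu) + nm ph 2 (qb u u') = (3:ℤ) • qb b b' := by
    rw [cu_del h.r4, qb_nm]
    have : qb (nrm3 9 u) (nrm3 9 u') - (3:ℤ) • qb b b' = qb p p := by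
      rw [← qb_sm, ← qb_sub, qb_eq h.q5 h.q6]
    rw [← this]; abel
  have e3 : -(tau ph 1 (cu p mu) - cu p mu) = (3:ℤ) • cu s lam - c1 ell := by
    funext v
    refine mul_left_cancel₀ (show (3:ℤ) ≠ 0 by norm_num) ?_
    have a1 := cu_spec h.s4 v
    have a2 := cu_spec h.r4 v
    have a3 : 3 * tau ph 1 (cu p mu) v = dot3 (tau3 p) (xv (v 0)) (xv (v 0)) (xv (v 0)) + dot (lc mu Sm) (xv (v 0)) := by
      have := cu_spec h.r4 (fun i => ph (tg 9)⁻¹ (v i))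
      rw [dot3_tau3, dot_lc, ← xv_tau, ← this]; rfl
    have a4 := eq3_spec h.r5 (xv (v 0)) (xv (v 0)) (xv (v 0))
    rw [dot3_sub, dot3_sm3] at a4
    have a5 := congrArg (fun r => dot r (xv (v 0))) h.r6
    simp only [dot_addR, dot_smulR] at a5
    simp only [Pi.neg_apply, Pi.sub_apply, Pi.smul_apply, smul_eq_mul, c1]
    linarith
  refine Prod.ext ?_ (Prod.ext ?_ (Prod.ext ?_ (Prod.ext ?_ ?_)))
  · change del 3 ((-2:ℤ) • c3 w) = _
    rw [map_zsmul, del_mlin _ (c3_mlin _)]; simp [xt]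
  · refine e1.trans ?_
    simp only [xt, Prod.smul_mk, Prod.mk_sub_mk, smul_smul, sub_zero]; norm_num
  · refine e2.trans ?_
    simp only [xt, Prod.smul_mk, Prod.mk_sub_mk, sub_zero]
  · refine e3.trans ?_
    simp only [xt, Prod.smul_mk, Prod.mk_sub_mk]
  · change (9:ℤ) * 0 = _
    simp [xt]

structure VD (c b b' s : M3L) : Prop where
  q1 : eq3 (add3 (sub3 (tau3 c) c) b) b' = true
  q2 : eq3 (nrm3 9 b) s = true
  q3 : eq3 (nrm3 9 b') s = true
  s1 : sym12 b = true
  s2 : sym23 b' = true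
  s4 : cuok s [] = true
  s5 : eq3 (tau3 s) s = true

def vt (c b b' s : M3L) : Cx3 LL := ((2:ℤ) • c3 c, qb b b', cu s [], 0)

lemma vt_closed (h : VD c b b' s) : D3 ph (vt c b b' s) = 0 := by
  refine Prod.ext ?_ (Prod.ext ?_ (Prod.ext ?_ (Prod.ext ?_ ?_)))
  · change del 3 ((2:ℤ) • c3 c) = _
    rw [map_zsmul, del_mlin _ (c3_mlin _)]; simp
  · change del 2 (qb _ _) - (tau ph 3 ((2:ℤ) • c3 c) - (2:ℤ) • c3 c) = 0
    rw [qb_del h.s1 h.s2, map_zsmul, ← c3_eq h.q1, c3_add, c3_sub, ← c3_tau]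
    module
  · change del 1 (cu _ _) + nm ph 2 (qb _ _) = 0
    rw [cu_del h.s4, qb_nm, qb_eq h.q2 h.q3, neg_add_cancel]
  · change -(tau ph 1 (cu _ _) - cu _ _) = 0
    rw [neg_eq_zero, sub_eq_zero, cu_tau]
    funext v
    simp only [cu, dot_lc]
    rw [eq3_spec h.s5]
    rfl
  · change (9:ℤ) * 0 = _
    simp

end

def tc1 : M3L := dn3 [[0,5050515050505050,0,0,5050505050495050,0,0,0],
  [0,0,5050504950505050,0,0,0,0,0],
  [0,0,0,0,0,0,0,0],
  [0,0,0,0,5050505050515050,0,0,0],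
  [0,0,0,0,0,0,0,0],
  [0,0,0,0,0,0,0,0],
  [0,0,0,0,0,0,0,0],
  [0,0,0,0,0,0,0,0]]

def tb1 : M3L := dn3 [[0,5050505050504952,0,0,0,0,5050525049505053,5050495052505050],
  [5050505050504952,0,5050505050504949,0,0,0,5050504950495050,5050505250494950],
  [0,5050505050504949,0,5050505050505249,0,0,5050505049505050,5050505049505050],
  [0,0,5050505050505249,0,5050505050504952,0,5050505050525050,5050505050495050],
  [0,0,0,5050505050504952,0,5050505050504949,5050505050504950,0],
  [0,0,0,0,5050505050504949,0,5250505050505049,4950505050505049],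
  [5050525049505053,5050504950495050,5050505049505050,5050505050525050,5050505050504950,5250505050505049,5248505051484949,4951525048485050],
  [5050495052505050,5050505250494950,5050505049505050,5050505050495050,0,4950505050505049,4951525048485050,5252485050515149]]

def tw1 : M3L := dn3 [[0,5050495050494950,5050505051504851,5050505050505149,5050505050525049,5050505050505250,5050505050505049,0],
  [0,0,5050505250504949,5050505050515148,5050505050505051,5050505050505250,5050505050505049,0],
  [0,0,0,5050505052505149,5050505050505051,5050505050504950,5050505050505051,0],
  [0,0,0,0,5050505050495051,0,5050505050505052,0],
  [0,0,0,0,0,0,0,0],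
  [0,0,0,0,0,0,0,0],
  [0,0,0,0,0,0,0,0],
  [0,0,0,0,0,0,0,0]]

def tu1 : M3L := dn3 [[5050505050505149,5050485050515150,5050505049505049,5050505050504951,5050505050495050,5050505050504950,5050485050505051,0],
  [5050485050515150,0,0,0,0,0,0,0],
  [5050505049505049,0,0,0,0,0,5050504950504949,0],
  [5050505050504951,0,0,0,0,0,5050505050515148,0],
  [5050505050495050,0,0,0,0,0,5050505050525052,0],
  [5050505050504950,0,0,0,0,0,4950505050505050,0],
  [5050485050505051,0,5050504950504949,5050505050515148,5050505050525052,4950505050505050,5050505050495049,0],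
  [0,0,0,0,0,0,0,0]]

def tb1p : M3L := dn3 [[0,0,0,0,5050505050504952,0,5050505049505249,5050505052504952],
  [5050505050504952,0,0,0,0,5050505050504949,4950505050495049,5250505050494952],
  [0,5050505050504949,0,0,0,0,5049505050505050,5049505050505050],
  [0,0,5050505050505249,0,0,0,5050525050505050,5050495050505050],
  [0,0,0,5050505050504952,0,0,5050504950504950,5050505250505050],
  [5050505050505249,0,0,0,5050505050504949,0,5250505049504850,4950505049505049],
  [5050525050505053,5050504950504952,5250505049505052,5049505050525050,5050495050505048,5050505250505047,5049505050505051,5352525048475149],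
  [5050495050505050,5050505250504950,4950505049505049,5052505050495050,5050495050505050,5050504950505050,5049505050505048,5050495050504850]]

def tu1p : M3L := dn3 [[0,0,5050505050504850,0,0,0,5050485050505249,5050505050504950],
  [5050485050525050,0,4850505050505050,0,0,5250505050504950,5050505050495249,5050505050504950],
  [5050505051505050,0,0,5050505050504950,5150505050504850,0,5050504948505049,5050505050504950],
  [0,0,0,0,0,5050505050505150,5050505050514951,5050505050505150],
  [5050505050495050,0,0,0,0,4950505050505250,5050505050524852,5050505050505250],
  [5050505050504950,0,0,0,0,0,4950505050505050,0],
  [5050485050515050,0,4850505050505050,0,0,5150505050504850,5050505050485050,0],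
  [0,0,0,0,0,0,0,0]]

def ts1 : M3L := dn3 [[0,5050505050505148,5050505050504851,0,5050505050505148,5050505050504851,5051485051485347,5048515048514750],
  [5050505050505148,0,0,0,0,0,5150505050505250,4850505050505050],
  [5050505050504851,0,0,0,0,0,4850505050505249,5150505050504950],
  [0,0,0,0,0,0,0,0],
  [5050505050505148,0,0,0,0,0,5150505050504952,4850505050505250],
  [5050505050504851,0,0,0,0,0,4850505050505151,5150505050505150],
  [5051485051485347,5150505050505250,4850505050505249,0,5150505050504952,4850505050505151,5352525049515051,4750495052515151],
  [5048515048514750,4850505050505050,5150505050504950,0,4850505050505250,5150505050505150,4750495052515151,5050505050505150]]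

def tp1 : M3L := dn3 [[0,0,5050505050504750,0,5050505050505047,5050505050504753,5050475050474649,5050505047534946],
  [0,0,0,5050505050505347,0,5050505050505350,5050505350535249,5050504750504946],
  [5050505050504750,0,0,0,5050505050505053,0,4750505050504649,5050505053504952],
  [0,5050505050505347,0,0,0,5050505050504750,5053505050475252,5047505050505246],
  [5050505050505047,0,5050505050505053,0,0,0,5050505050505549,4750535050504952],
  [5050505050504753,5050505050505350,0,5050505050504750,0,0,4753504750505849,5350505050504955],
  [5050475050474649,5050505350535249,4750505050504649,5053505050475252,5050505050505549,4753504750505849,4652465255583542,4949495249494276],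
  [5050505047534946,5050504750504946,5050505053504952,5047505050505246,4750535050504952,5350505050504955,4949495249494276,4646524652557635]]

def lam1 : List ℤ := [0, 0, 0, 0, 0, 0, 0, 0]

def mu1 : List ℤ := [0, 0, 0, 0, 0, 0, 0, 0]

def ell1 : List ℤ := [0, 0, 0, 0, 0, 0, 0, 0]

def tc2 : M3L := dn3 [[0,0,5050505050515050,5050505050515050,0,0,0,0],
  [0,0,0,0,0,0,0,0],
  [0,0,0,0,5050505050505150,0,0,0],
  [0,0,0,0,0,0,0,0],
  [0,0,0,0,0,0,0,0],
  [0,0,0,0,0,0,0,0],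
  [0,0,0,0,0,0,0,0],
  [0,0,0,0,0,0,0,0]]

def tb2 : M3L := dn3 [[5050515050504952,0,0,5050505050495049,0,0,5050485050515247,5050514950504952],
  [0,4950505150505049,0,0,5150505050504950,0,4950505250505048,5150504850505052],
  [0,0,5049505051505050,0,0,5051505050505049,5050505050485049,5049505052505050],
  [5050505050495049,0,0,5050495050515050,0,0,4950515050494951,5150505050505050],
  [0,5150505050504950,0,0,5050504950505050,0,5149504950504851,5049505150504949],
  [0,0,5051505050505049,0,0,5050505049505050,5049505050504851,5051495049505048],
  [5050485050515247,4950505250505048,5050505050485049,4950515050494951,5149504950504851,5049505050504851,5050515150515048,5149494950484749],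
  [5050514950504952,5150504850505052,5049505052505050,5150505050505050,5049505150504949,5051495049505048,5149494950484749,4850505151505050]]

def tw2 : M3L := dn3 [[0,5050505151505050,5050504950495050,5050505049485050,0,0,0,0],
  [0,0,5050505051515050,5050505049504950,5050505050494950,0,0,0],
  [0,0,0,5050505050515150,5050505050494949,5050505050505049,0,0],
  [0,0,0,0,5050505050504951,5050505050505149,0,0],
  [0,0,0,0,0,5050505050504949,0,0],
  [0,0,0,0,0,0,0,0],
  [0,0,0,0,0,0,0,0],
  [0,0,0,0,0,0,0,0]]

def tu2 : M3L := dn3 [[5050505049505150,5050504949505050,5050505150485050,5050505051495050,5050505050505049,4950505050504951,0,0],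
  [5050504949505050,0,0,0,0,0,0,0],
  [5050505150485050,0,0,0,0,0,5050505051515050,0],
  [5050505051495050,0,0,0,0,0,5150505049504950,0],
  [5050505050505049,0,0,0,0,0,5050505050494951,0],
  [4950505050504951,0,0,0,0,0,5150505050505149,0],
  [0,0,5050505051515050,5150505049504950,5050505050494951,5150505050505149,5150505050505050,0],
  [0,0,0,0,0,0,0,0]]

def tb2p : M3L := dn3 [[0,0,5050495050515049,5050505050505049,0,5050515050505150,5050505050515051,5050494950505148],
  [5150505050504949,0,0,5050504950505150,0,0,4950505150505150,4950505050505050],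
  [0,5051505050505349,0,0,5050505049504951,5050505050504850,5053505049485647,5049505051504751],
  [5050505050504951,0,5050515050504853,0,0,5050505050495049,4950485050505246,5150535050494656],
  [5050504950505052,5050505050504949,0,4950505150505048,0,0,5049505050504849,5249504850504952],
  [0,5050505049504850,5050505050505049,0,5049505051505150,0,5048505051504651,5050495050505148],
  [5150504950505049,5049505050504850,5050515050485050,4950504950505050,0,5050485050515049,5048505050504650,4950505050495050],
  [0,5051505049505250,5050495050505148,5050505150505050,5049505049504950,5050505050504850,5052515049485250,5050485050505046]]

def tu2p : M3L := dn3 [[5050505049505050,0,0,0,4950505050505050,0,5050505050505150,0],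
  [5150504948504950,0,0,4950505050505050,4850505050505150,0,4950505051505150,0],
  [4950505150495150,0,0,5150505050505050,5050505050505150,4950505050505050,5150505051504950,0],
  [5050505051495150,0,0,0,5150505050504950,4950505050505050,5150505049504850,0],
  [0,0,0,0,0,5050505050504950,5050505050494950,0],
  [4950505050505150,0,0,0,0,0,5150505050504950,0],
  [5150505049505050,0,0,0,4950505050505150,0,5050505051505050,0],
  [0,0,0,0,0,0,0,0]]

def ts2 : M3L := dn3 [[5050505050505348,0,0,5050505050504951,0,0,5350504950504751,4850505150505150],
  [0,0,0,0,5050505050505150,0,5050505051505050,0],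
  [0,0,0,0,0,5050505050505250,5050505050525051,5050505050505150],
  [5050505050504951,0,0,0,0,0,4950505050505349,5150505050504950],
  [0,5050505050505150,0,0,0,0,5051505050505250,0],
  [0,0,5050505050505250,0,0,0,5050525050504852,5050505050505250],
  [5350504950504751,5050505051505050,5050505050525051,4950505050505349,5051505050505250,5050525050504852,4750505352485647,5150514950524754],
  [4850505150505150,0,5050505050505150,5150505050504950,0,5050505050505250,5150514950524754,5050505050505450]]

def tp2 : M3L := dn3 [[5049495049505149,4951504949505351,4950525050495054,5049505052515051,4949505250505048,5050495150494948,5153505050495349,4951545148484956],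
  [4951504949505351,5150494950494951,5049515049494553,4949505250504650,4950495050525350,5049495052505150,5349454653515248,5151535050504853],
  [4950525050495054,5049515049494553,5251504949504949,5050495150495245,5049495052505346,4949504950505353,5045495253534352,5453494546535252],
  [5049505052515051,4949505250504650,5050495150495245,5052515049495449,5250504951505152,5150494950525053,5046525451504354,5150454952535443],
  [4949505250505048,4950495050525350,5049495052505346,5250504951505152,5050525150494754,5052505049514951,5053535147494955,4850465254515543],
  [5050495150494948,5049495052505150,4949504950505353,5150494950525053,5052505049514951,4950505251505047,4951535049505154,4850535351475449],
  [5153505050495349,5349454653515248,5045495253534352,5046525451504354,5053535147494955,4951535049505154,5352434349516454,4948525455545441],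
  [4951545148484956,5151535050504853,5453494546535252,5150454952535443,4850465254515543,4850535351475449,4948525455545441,5653524343494164]]

def lam2 : List ℤ := [0, 0, 0, 0, 0, 0, 0, 0]

def mu2 : List ℤ := [0, 0, 0, 0, 0, 0, 1, 1]

def ell2 : List ℤ := [0, 0, 0, 0, 0, 0, -1, 0]

def tcv : M3L := dn3 [[0,0,5050505050505052,5050505050505150,5050505050504850,5050505050505048,5050505050505049,0],
  [0,0,0,5050505050504850,5050505050504951,5050505050505248,5050505050505049,0],
  [0,0,0,0,5050505050505248,5050505050505049,5050505050505051,0],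
  [0,0,0,0,0,5050505050505052,5050505050505051,0],
  [0,0,0,0,0,0,0,0],
  [0,0,0,0,0,0,0,0],
  [0,0,0,0,0,0,0,0],
  [0,0,0,0,0,0,0,0]]

def tbv : M3L := dn3 [[5050505050504950,0,5050505050505052,5050505050505150,5050505050504850,0,5050505050505150,0],
  [0,0,0,0,0,0,0,0],
  [5050505050505052,0,0,0,0,0,0,0],
  [5050505050505150,0,0,0,0,0,0,0],
  [5050505050504850,0,0,0,0,0,5050505050505149,0],
  [0,0,0,0,0,0,5050505050504850,0],
  [5050505050505150,0,0,0,5050505050505149,5050505050504850,5050504850504950,0],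
  [0,0,0,0,0,0,0,0]]

def tbvp : M3L := dn3 [[0,0,0,0,0,0,5050505050504951,5050505050505150],
  [0,0,0,0,0,0,5050505050504951,5050505050505150],
  [0,0,0,0,0,0,5050505050504951,5050505050505150],
  [0,0,0,0,0,0,5050505050505249,5050505050504950],
  [0,0,0,0,0,0,5050505050505049,5050505050504950],
  [0,0,0,0,0,0,5050505050504850,0],
  [0,0,0,5050505050504850,0,0,5050504850505050,0],
  [0,0,0,0,0,0,0,0]]

def tsv : M3L := dn3 [[0,0,0,0,0,0,0,0],
  [0,0,0,0,0,0,0,0],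
  [0,0,0,0,0,0,0,0],
  [0,0,0,0,0,0,0,0],
  [0,0,0,0,0,0,0,0],
  [0,0,0,0,0,0,0,0],
  [0,0,0,0,0,0,5050505050505353,5050505050505344],
  [0,0,0,0,0,0,5050505050505344,5050505050504453]]

lemma xd1 : XD tc1 tb1 tb1p ts1 tw1 tu1 tu1p tp1 lam1 mu1 ell1 := by constructor <;> decide +kernel
lemma xd2 : XD tc2 tb2 tb2p ts2 tw2 tu2 tu2p tp2 lam2 mu2 ell2 := by constructor <;> decide +kernel
lemma vdv : VD tcv tbv tbvp tsv := by constructor <;> decide +kernel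

end OHC

open CategoryTheory

namespace OHC
set_option linter.unusedSectionVars false
set_option linter.unusedVariables false

/-! Certificates for the integral linear algebra of the exterior powers. -/

/-- decode a row written in base 200, shifted by 100 -/
def decB : ℕ → ℕ → List ℤ → List ℤ
  | 0, _, acc => acc
  | n+1, r, acc => decB n (r / 200) ((((r % 200 : ℕ) : ℤ) - 100) :: acc)
def decM (n : ℕ) (l : List ℕ) : List (List ℤ) := l.map (fun r => decB n r [])

lemma eq2_act {A B : List (List ℤ)} (h : eq2 A B = true) : act A = act B := by
  have key : ∀ (A : List (List ℤ)) (i : ℕ) (x : ℕ → ℤ), act A x i = dot2 A (dl i) x := by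
    intro A
    induction A with
    | nil => intro i x; simp [act, row, dot, dot2, gdot]
    | cons a A ih =>
      intro i x
      cases i with
      | zero =>
        have : (fun k => dl 0 (k+1)) = fun _ => 0 := by funext k; simp [dl]
        simp only [dot2, gdot, this, gdot_zero]
        simp [act, row, dl]
      | succ i =>
        have : (fun k => dl (i+1) (k+1)) = dl i := by funext k; simp [dl]
        have h := ih i x
        simp only [dot2, gdot, this] at h ⊢
        rw [← h]
        simp [act, row, dl]
  funext x i
  rw [key, key, eq2_spec h]

lemma act_smul' (c A x) : act (smulL c A) x = c • act A x := by rw [act_smul]; rfl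
lemma act_addL' (A B x) : act (addL A B) x = act A x + act B x := by rw [act_addL]; rfl
lemma act_zero (A) : act A 0 = 0 := (actH A).map_zero
lemma act_add (A x y) : act A (x + y) = act A x + act A y := (actH A).map_add x y
lemma act_zsmul (A) (c : ℤ) (x) : act A (c • x) = c • act A x := (actH A).map_zsmul c x
lemma act_sub_r (A x y) : act A (x - y) = act A x - act A y := (actH A).map_sub x y

lemma cert_split {n : ℕ} {A E B U F K : List (List ℤ)} {m : ℤ} (hm : m ≠ 0)
    (h : ∀ x, Sup n x → m • (act A (act U x) + act E (act F x)) + act K (act B x) = m • x)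
    (x) (hx : Sup n x) (hB : act B x = 0) : x = act A (act U x) + act E (act F x) := by
  have h1 := h x hx
  rw [hB, act_zero, add_zero] at h1
  exact ((smul_right_injective _ hm) h1).symm

/-! Rows packed into a single integer in base `b`. -/

def pk (b : ℤ) : List ℤ → ℤ
  | [] => 0
  | a :: l => a + b * pk b l
def lcP : List ℤ → List ℤ → ℤ
  | [], _ => 0
  | _ :: _, [] => 0
  | a :: l, p :: P => if a = 0 then lcP l P else a * p + lcP l P
def Bd (c : ℤ) (l : List ℤ) : Prop := ∀ a ∈ l, |a| ≤ c
def sab : List ℤ → ℤ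
  | [] => 0
  | a :: l => (a.natAbs : ℤ) + sab l

lemma pk_addR (b l m) : pk b (addR l m) = pk b l + pk b m := by
  induction l generalizing m with
  | nil => simp [addR, pk]
  | cons a l ih =>
    cases m with
    | nil => simp [addR, pk]
    | cons b m => simp only [addR, pk, ih]; ring
lemma pk_smulR (b c l) : pk b (smulR c l) = c * pk b l := by
  induction l with
  | nil => simp [smulR, pk]
  | cons a l ih =>
    simp only [smulR, List.map_cons, pk] at ih ⊢
    rw [ih]; ring
lemma pk_lc (b l M) : pk b (lc l M) = lcP l (M.map (pk b)) := by
  induction l generalizing M with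
  | nil => simp [lc, pk, lcP]
  | cons a l ih =>
    cases M with
    | nil => simp [lc, pk, lcP]
    | cons r M =>
      simp only [lc, List.map_cons, lcP]
      split_ifs with h
      · exact ih M
      · rw [pk_addR, pk_smulR, ih]
lemma pk_unitR (b i) : pk b (unitR i) = b ^ i := by
  induction i with
  | zero => simp [unitR, pk]
  | succ i ih => simp [unitR, pk, ih, pow_succ']

lemma Bd.add {c d l m} (hc : 0 ≤ c) (hd : 0 ≤ d) (h1 : Bd c l) (h2 : Bd d m) : Bd (c + d) (addR l m) := by
  induction l generalizing m with
  | nil => intro a ha; have := h2 a ha; linarith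
  | cons a l ih =>
    cases m with
    | nil => intro a ha; have := h1 a ha; linarith
    | cons b m =>
      intro x hx
      simp only [addR, List.mem_cons] at hx
      rcases hx with rfl | hx
      · exact (abs_add_le a b).trans (add_le_add (h1 a (by simp)) (h2 b (by simp)))
      · exact ih (fun a ha => h1 a (by simp [ha])) (fun a ha => h2 a (by simp [ha])) x hx
lemma Bd.smul {c l} (k : ℤ) (h1 : Bd c l) : Bd (|k| * c) (smulR k l) := by
  intro x hx
  simp only [smulR, List.mem_map] at hx
  obtain ⟨a, ha, rfl⟩ := hx
  rw [abs_mul]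
  exact mul_le_mul_of_nonneg_left (h1 a ha) (abs_nonneg _)
lemma sab_nonneg (l) : 0 ≤ sab l := by
  induction l with
  | nil => simp [sab]
  | cons a l ih => simp only [sab]; omega
lemma Bd.lc {c : ℤ} (hc : 0 ≤ c) {M : List (List ℤ)} (h : ∀ r ∈ M, Bd c r) (l) : Bd (sab l * c) (lc l M) := by
  induction l generalizing M with
  | nil => intro x hx; simp [OHC.lc] at hx
  | cons a l ih =>
    cases M with
    | nil => intro x hx; simp [OHC.lc] at hx
    | cons r M =>
      have h2 := ih (M := M) (fun r hr => h r (by simp [hr]))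
      have h3 : 0 ≤ sab l * c := mul_nonneg (sab_nonneg l) hc
      simp only [OHC.lc, sab]
      split_ifs with h0
      · simpa [h0] using h2
      · rw [add_mul, ← Int.abs_eq_natAbs]
        exact Bd.add (by positivity) h3 ((h r (by simp)).smul a) h2
lemma bd_unitR (i) : Bd 1 (unitR i) := by
  induction i with
  | zero => intro x hx; simp [unitR] at hx; simp [hx]
  | succ i ih =>
    intro x hx
    simp only [unitR, List.mem_cons] at hx
    rcases hx with rfl | hx
    · simp
    · exact ih x hx
lemma pk_inj {b c : ℤ} (hb : c < b) {l} (h : Bd c l) (h0 : pk b l = 0) (x) : dot l x = 0 := by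
  induction l generalizing x with
  | nil => rfl
  | cons a l ih =>
    simp only [pk] at h0
    have ha : |a| ≤ c := h a (by simp)
    have hdv : b ∣ a := ⟨- pk b l, by linarith⟩
    have a0 : a = 0 := Int.eq_zero_of_abs_lt_dvd hdv (by linarith)
    subst a0
    have hb0 : b ≠ 0 := by have := abs_nonneg (0:ℤ); intro h; subst h; simp at ha; omega
    have : pk b l = 0 := by simpa [hb0] using h0
    rw [dot, ih (fun a ha => h a (by simp [ha])) this]; simp

def bdR (c : ℤ) (l : List ℤ) : Bool := l.all fun a => decide ((a.natAbs : ℤ) ≤ c)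
/-- `P` is the list of packed rows of `M`, whose entries are bounded by `c` -/
def pkok (b c : ℤ) : List (List ℤ) → List ℤ → Bool
  | [], [] => true
  | r :: M, p :: P => bdR c r && decide (pk b r = p) && pkok b c M P
  | _, _ => false
lemma pkok_spec {b c M P} (h : pkok b c M P = true) : (∀ r ∈ M, Bd c r) ∧ M.map (pk b) = P := by
  induction M generalizing P with
  | nil =>
    cases P with
    | nil => simp
    | cons p P => simp [pkok] at h
  | cons r M ih =>
    cases P with
    | nil => simp [pkok] at h
    | cons p P =>
      simp only [pkok, Bool.and_eq_true, decide_eq_true_eq, bdR, List.all_eq_true] at h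
      obtain ⟨h1, h2⟩ := ih h.2
      refine ⟨?_, by simp [h.1.2, h2]⟩
      intro s hs
      rcases List.mem_cons.1 hs with rfl | hs
      · intro a ha; rw [Int.abs_eq_natAbs]; exact h.1.1 a ha
      · exact h1 s hs

def ckr (b : ℕ) (m cU cF cB : ℤ) (PU PF PB : List ℤ) :
    ℕ → ℕ → List (List ℤ) → List (List ℤ) → List (List ℤ) → Bool
  | 0, _, _, _, _ => true
  | n+1, i, A, E, K =>
    decide (m * (lcP (A.headD []) PU + lcP (E.headD []) PF) + lcP (K.headD []) PB = m * ((b ^ i : ℕ) : ℤ)) &&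
    decide ((m.natAbs : ℤ) * (sab (A.headD []) * cU + sab (E.headD []) * cF) + sab (K.headD []) * cB + (m.natAbs : ℤ) < b) &&
    ckr b m cU cF cB PU PF PB n (i+1) A.tail E.tail K.tail

structure PkD (n : ℕ) (b : ℕ) (m cU cF cB : ℤ) (A E B U F K : List (List ℤ)) (PU PF PB : List ℤ) : Prop where
  hU : pkok b cU U PU = true
  hF : pkok b cF F PF = true
  hB : pkok b cB B PB = true
  h : ckr b m cU cF cB PU PF PB n 0 A E K = true
  p : 0 ≤ cU ∧ 0 ≤ cF ∧ 0 ≤ cB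
  la : A.length ≤ n ∧ E.length ≤ n ∧ K.length ≤ n

lemma row_headD (A : List (List ℤ)) : A.headD [] = row A 0 := by cases A <;> rfl
lemma row_tail (A : List (List ℤ)) (k) : row A.tail k = row A (k+1) := by cases A <;> simp [row]

lemma ckr_spec {b : ℕ} {m cU cF cB : ℤ} {PU PF PB : List ℤ} (n : ℕ) (i : ℕ) (A E K : List (List ℤ))
    (h : ckr b m cU cF cB PU PF PB n i A E K = true) (k : ℕ) (hk : k < n) :
    m * (lcP (row A k) PU + lcP (row E k) PF) + lcP (row K k) PB = m * (b:ℤ) ^ (i + k) ∧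
    |m| * (sab (row A k) * cU + sab (row E k) * cF) + sab (row K k) * cB + |m| < b := by
  induction n generalizing i A E K k with
  | zero => omega
  | succ n ih =>
    simp only [ckr, Bool.and_eq_true, decide_eq_true_eq, row_headD] at h
    cases k with
    | zero => rw [Int.abs_eq_natAbs]; exact ⟨by simpa using h.1.1, h.1.2⟩
    | succ k =>
      have := ih _ _ _ _ h.2 k (by omega)
      rw [row_tail, row_tail, row_tail, show i + 1 + k = i + (k + 1) by ring] at this
      exact this

lemma PkD.spec {n b m cU cF cB A E B U F K PU PF PB} (h : PkD n b m cU cF cB A E B U F K PU PF PB)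
    (x) (hx : Sup n x) : m • (act A (act U x) + act E (act F x)) + act K (act B x) = m • x := by
  funext i
  by_cases hi : i < n
  · obtain ⟨e1, e2⟩ := ckr_spec n 0 A E K h.h i hi
    obtain ⟨bU, rfl⟩ := pkok_spec h.hU
    obtain ⟨bF, rfl⟩ := pkok_spec h.hF
    obtain ⟨bB, rfl⟩ := pkok_spec h.hB
    obtain ⟨p1, p2, p3⟩ := h.p
    have key := pk_inj (b := b) (c := |m| * (sab (row A i) * cU + sab (row E i) * cF) + sab (row K i) * cB + |m|)
      (l := addR (addR (smulR m (addR (lc (row A i) U) (lc (row E i) F))) (lc (row K i) B)) (smulR (-m) (unitR i)))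
      e2 ?_ ?_ x
    · simp only [dot_addR, dot_smulR, dot_lc, dot_unitR] at key
      simp only [Pi.add_apply, Pi.smul_apply, smul_eq_mul]
      simp only [act] at key ⊢
      linarith
    · have q1 := mul_nonneg (sab_nonneg (row A i)) p1
      have q2 := mul_nonneg (sab_nonneg (row E i)) p2
      have q3 := mul_nonneg (sab_nonneg (row K i)) p3
      have q := add_nonneg q1 q2
      have hm := abs_nonneg m
      refine Bd.add (by positivity) hm (Bd.add (by positivity) q3
        (Bd.smul m (Bd.add q1 q2 (Bd.lc p1 bU _) (Bd.lc p2 bF _))) (Bd.lc p3 bB _)) ?_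
      have := (bd_unitR i).smul (-m)
      rwa [abs_neg, mul_one] at this
    · simp only [pk_addR, pk_smulR, pk_lc, pk_unitR]
      simp only [zero_add] at e1
      rw [e1]; ring
  · have hl := h.la
    have r0 : ∀ A : List (List ℤ), A.length ≤ n → ∀ y, act A y i = 0 := fun A hA y => act_sup _ n _ hA i (by omega)
    simp [r0 A hl.1, r0 E hl.2.1, r0 K hl.2.2, hx i (by omega)]

def dvR (d : ℤ) (l : List ℤ) : Bool := l.all fun a => decide (d ∣ a)
def dvL (d : ℤ) (l : List (List ℤ)) : Bool := l.all (dvR d)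

lemma dvR_spec {d : ℤ} {l : List ℤ} (h : dvR d l = true) (x) : d ∣ dot l x := by
  induction l generalizing x with
  | nil => simp [dot]
  | cons a l ih =>
    simp only [dvR, List.all_cons, Bool.and_eq_true, decide_eq_true_eq] at h
    exact dvd_add (Dvd.dvd.mul_right h.1 _) (ih h.2 _)
lemma dvL_spec {d : ℤ} {l : List (List ℤ)} (h : dvL d l = true) (x i) : d ∣ act l x i := by
  simp only [act, row]
  by_cases hi : i < l.length
  · rw [List.getD_eq_getElem _ _ hi]
    exact dvR_spec ((List.all_eq_true.1 h) _ (List.getElem_mem hi)) x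
  · rw [List.getD_eq_default _ _ (by omega)]; simp [dot]

lemma cert_tors {A E F : List (List ℤ)} {m : ℕ} {d : ℤ} (h1 : dvL d (mulL F A) = true)
    (h2 : dvL d (subL (mulL F E) (oneL m)) = true) (u y) (hy : Sup m y) (h : act A u = act E y) (i) : d ∣ y i := by
  have e1 := dvL_spec h1 u i
  have e2 := dvL_spec h2 y i
  rw [act_sub, act_one _ _ hy, act_mul] at e2
  rw [act_mul, h] at e1
  exact (dvd_sub_right e1).1 e2

lemma act_two {α : Type} (l : List α) (f g : α → ℤ) (y) :
    act (l.map fun I => [f I, g I]) y = y 0 • vecL (l.map f) + y 1 • vecL (l.map g) := by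
  funext i
  simp only [act, row, vecL, Pi.add_apply, Pi.smul_apply, smul_eq_mul]
  by_cases hi : i < l.length
  · simp [List.getD_eq_getElem, hi, dot]; ring
  · simp [List.getD_eq_default, not_lt.1 hi, dot]

lemma act_col {α : Type} (l : List α) (f : α → ℤ) (y) :
    act (l.map fun I => [f I]) y = y 0 • vecL (l.map f) := by
  funext i
  simp only [act, row, vecL, Pi.smul_apply, smul_eq_mul]
  by_cases hi : i < l.length
  · simp [List.getD_eq_getElem, hi, dot]; ring
  · simp [List.getD_eq_default, not_lt.1 hi, dot]

/-- what a certificate says about `ker B / im A` -/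
structure Cer (n : ℕ) (A B E : List (List ℤ)) : Prop where
  split : ∀ x, Sup n x → act B x = 0 → ∃ u y, Sup n u ∧ Sup 2 y ∧ x = act A u + act E y
  tors : ∀ u y, Sup 2 y → act A u = act E y → ∀ i, (3:ℤ) ∣ y i
  triple : ∀ y, ∃ u, Sup n u ∧ act A u = (3:ℤ) • act E y
  be : ∀ y, act B (act E y) = 0
  sup : ∀ y, Sup n (act E y)

structure CerD (n : ℕ) (A B E U F K R : List (List ℤ)) : Prop where
  h2 : dvL 3 (mulL F A) = true
  h3 : dvL 3 (subL (mulL F E) (oneL 2)) = true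
  h4 : eq2 (mulL A R) (smulL 3 E) = true
  h5 : eq2 (mulL B E) [] = true
  h6 : U.length ≤ n
  h7 : E.length ≤ n
  h8 : F.length ≤ 2
  h9 : R.length ≤ n

lemma CerD.cer {n A B E U F K R} (h : CerD n A B E U F K R)
    (h1 : ∀ x, Sup n x → (3:ℤ) • (act A (act U x) + act E (act F x)) + act K (act B x) = (3:ℤ) • x) : Cer n A B E where
  split x hx hB := ⟨act U x, act F x, act_sup _ _ _ h.h6, act_sup _ _ _ h.h8, cert_split (by norm_num) h1 x hx hB⟩
  tors u y hy e := cert_tors h.h2 h.h3 u y hy e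
  triple y := ⟨act R y, act_sup _ _ _ h.h9, by
    have := congrFun (eq2_act h.h4) y
    rwa [act_mul, act_smul'] at this⟩
  be y := by
    have := congrFun (eq2_act h.h5) y
    rw [act_mul] at this
    rw [this]; funext i; simp [act, row, dot]
  sup y := act_sup _ _ _ h.h7

def decT : ℕ → ℕ → List ℤ
  | 0, _ => []
  | n+1, r => if r = 0 then [] else (if r % 10 < 5 then ((r % 10 : ℕ) : ℤ) else ((r % 10 : ℕ) : ℤ) - 10) :: decT n (r / 10)

/-- packed row given by the list of its nonzero entries -/
def ps (b : ℕ) : List ℕ → ℤ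
  | [] => 0
  | c :: l => (((c % 200 : ℕ) : ℤ) - 100) * ((b ^ (c / 200) : ℕ) : ℤ) + ps b l

def A1 : List (List ℤ) := [900909,
  91,
  910,
  9100,
  91000,
  910000,
  98100101,
  91000000].map (decT 8)

def A2 : List (List ℤ) := [10019,
  10010000090,
  1000000000000900,
  10000090000000009000,
  10000000900000000090000,
  110000000110000000000910010,
  90000000090000000009000000,
  90000001,
  900000010,
  9000000100,
  90000001000,
  900009910010,
  9000000100000,
  90000010000000,
  900000100000000,
  9000001000000000,
  90009910010000009,
  900000100000000000,
  9000010000000000000,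
  90000100000000000000,
  900991000000000000090,
  9000010000000000000000,
  90001000000000000000000,
  909910000090000000000900,
  9000100000000000000000000,
  99910000000900000000009000,
  900100000000000000000000000,
  10000000010000000000100000].map (decT 28)

def A3 : List (List ℤ) := [9008,
  900000090,
  9000001000900,
  9000000010009000,
  99000000099000090000,
  1000000001000900000,
  900000000000000009000000,
  9000001000000000000090000000,
  9000000010000000000000900000000,
  99000000099000000000000009000001001,
  1000000001000000000000090000000000,
  90000000000000000000000000900000000000,
  90000000000000000000000000009000000000000,
  990000000000000000000000000000090000100000000,
  10000000000000000000000000000900000000000000,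
  90000000009000000000000000000009000000000000000,
  990000000001100000000000000000000090001000009000000,
  10000000000900000000000000000000900000000000000000,
  990000000001100000000000000000000009001000000090000000,
  10000000000900000000000000000000090000000000000000000,
  90000000009000000000000000000000000901000000001000000000,
  9000000000000000000001,
  90000000000000000000010,
  900000000000000000000100,
  9000000000000000000991001,
  90000000000000000000010000,
  900000000000000000001000000,
  9000000000000000000010000000,
  90000000000000000099100000000,
  900000000000000000001000000000,
  9000000000000000000100000000000,
  90000000000000000991000009000000,
  900000000000000000010000000000000,
  9000000000000000991000000090000000,
  90000000000000000010000000000000000,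
  900000000000000101000000001000000000,
  9000000000000001000000000000000000000,
  90000000000000010000000000000000000000,
  900000000000099100000000000000000000001,
  9000000000000001000000000000000000000000,
  90000000000000100000000000000000000000000,
  900000000000991000009000000000000000000010,
  9000000000000010000000000000000000000000000,
  90000000000991000000090000000000000000000100,
  900000000000010000000000000000000000000000000,
  9000000000101000000001000000000000000000090000,
  90000000001000000000000000000000000000000000000,
  900000009910000000000000000000000000000001000000,
  9000000000100000000000000000000000000000000000000,
  90000009910000000000000000000000000000000010000000,
  900000000100000000000000000000000000000000000000000,
  9000001010000000000000000000000000000000009000000000,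
  90009910000000001000000000000000000000000100000000000,
  900000100000000000000000000000000000000000000000000000,
  9001010000000000900000000000000000000000090000000000000,
  91010000000000900000000000000000000000090000000000000000].map (decT 56)

def A4 : List (List ℤ) := [109,
  1000099,
  1000000990,
  11000000010000,
  9000000099000,
  10000000000900000,
  10000000000009000000,
  110000000000000090000000,
  90000000000000900000000,
  10000000001000009000000000,
  110000000009900000090000000000,
  90000000000100000900000000000,
  110000000009900000009000000000000,
  90000000000100000090000000000000,
  10000000001000000000900000000000000,
  1000000000000000000009000000000000000,
  1000000000000000000000090000000000000000,
  11000000000000000000000000900000000000000100,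
  9000000000000000000000009000000000000000000,
  1000000000100000000000000090000000000000000000,
  11000000000990000000000000000900000000000001000009,
  9000000000010000000000000009000000000000000000000,
  11000000000990000000000000000090000000000001000000090,
  9000000000010000000000000000900000000000000000000000,
  1000000000100000000000000000009000000000001000000001000,
  10000000000000000000000000000090000000000000000000000000,
  110000000000000000000000000000000900000000010000000000000000,
  90000000000000000000000000000009000000000000000000000000000,
  110000000000000000000000000000000090000000010000000000000000000,
  90000000000000000000000000000000900000000000000000000000000000,
  10000000000000000000000000000000009000000010000000000000000000000,
  1100000001100000000000000000000000090000010000000001000000000000000,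
  900000000900000000000000000000000900000000000000000000000000000000,
  100000009000000000000000000000000009000010000000000900000000000000000,
  1000009000000000000000000000000000090010000000000900000000000000000000,
  900000000000000000000000000000000001,
  9000000000000000000000000000000000010,
  90000000000000000000000000000000099100,
  900000000000000000000000000000000001000,
  9000000000000000000000000000000000100000,
  90000000000000000000000000000000991000009,
  900000000000000000000000000000000010000000,
  9000000000000000000000000000000991000000090,
  90000000000000000000000000000000010000000000,
  900000000000000000000000000000101000000001000,
  9000000000000000000000000000001000000000000000,
  90000000000000000000000000009910000000000000000,
  900000000000000000000000000000100000000000000000,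
  9000000000000000000000000009910000000000000000000,
  90000000000000000000000000000100000000000000000000,
  900000000000000000000000001010000000000000000000000,
  9000000000000000000000009910000000001000000000000000,
  90000000000000000000000000100000000000000000000000000,
  900000000000000000000001010000000000900000000000000000,
  9000000000000000000001010000000000900000000000000000000,
  90000000000000000000100000000000000000000000000000000000,
  900000000000000000991000000000000000000000000000000000009,
  9000000000000000000010000000000000000000000000000000000000,
  90000000000000000991000000000000000000000000000000000000090,
  900000000000000000010000000000000000000000000000000000000000,
  9000000000000000101000000000000000000000000000000000000001000,
  90000000000000991000000000100000000000000000000000000000900000,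
  900000000000000010000000000000000000000000000000000000000000000,
  9000000000000101000000000090000000000000000000000000000010000000,
  90000000000101000000000090000000000000000000000000000010000000000,
  900000009910000000000000000000000000000000000000009000000000000000,
  9000000000100000000000000000000000000000000000000000000000000000000,
  90000001010000000000000000000000000000000000000000100000000000000000,
  900001010000000000000000000000000000000000000000100000000000000000000,
  9010100000000100000000000000000000000000000100000000000000000000000000].map (decT 70)

def N3 : List (List ℤ) := decM 56 [362098462502150432160804020100502512562814070351758793969849246231155778894472361809045226130653266331658291457286432160804020100,
  362098462502150432160804020100502512562814070351758793969849246231155778894472361809045226130653266331658291457286432160804020100,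
  362098462502150432160804020100502512562814070351758793969849246231155778894472361809045226130653266331658291457286432160804020100,
  362098462502150432160804020100502512562814070351758793969849246231155778894472361809045226130653266331658291457286432160804020100,
  362098462056294012754715127203760846967793435762820582071688182977251324521915563906302344557314129512458291974406367840804100100,
  354910717947249657855060453237301138518656846618612056421744007386616231161275140281283774385406198990858290433312096160787940100,
  362098462502150432160804020100502512562814070351758793969849246231155778894472361809045226130653266331658291457286432160804020100,
  362098462502150432160804020100502512562814070351758793969849246231155778894472361809045226130653266331658291457286432160804020100,
  362098462502150432160804020100502512562814070351758793969849246231155778894472361809045226130653266331658291457286432160804020100,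
  365701252132065540831441496624951794110929218876196465690455148479554478783111518753941486963965869672458291457299360160795980100,
  362080358479745362986175358535488941477599424012161655496326743031373555677833200669844701836132598171658291454713632800812020100,
  362098462502150432160804020100502512562814070351758793969849246231155778894472361809045226130653266331658291457286432160804020100,
  362098462502150432160804020100502512562814070351758793969849246231155778894472361809045226130653266331658291457286432160804020100,
  362170430024195700095485960603598315116248182351758828415486954782446652183837620049045750418620498319308851457286432160804020100,
  362062343633139145965680138566571780373230136911758776618181381128574022199332255569044963986718802343946291457286432160804020100,
  362098462502150432160804020100502512562814070351758793969849246231155778894472361809045226130653266331658291457286432160804020100,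
  358513777340496812070884098037808467694934202755856472620926910436443756595029163906092371165200467970058290942726367840803980100,
  372888996686966315137185063488153168155086442609343203238560387324094026516308740281702938709212937013258292481273696160812060100,
  351307928317334549184422976712851856970541698094174384701138105138217531272635983336387513552093595650058290433299168160795980100,
  369304311525312695047265141425459123287206575013440881889638051529382004216865542378750083743760138651658291966713631840812020100,
  358549715621929755724305458762475742606525302579669959196288350382052418911416932635798012562554962323445811462419167520796060100,
  362098462502150432160804020100502512562814070351758793969849246231155778894472361809045226130653266331658291457286432160804020100,
  362098462502150432160804020100502512562814070351758793969849246231155778894472361809045226130653266331658291457286432160804020100,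
  362098462502150432160804020100502512562814070351758793969849246231155778894472361809045226130653266331658291457286432160804020100,
  369286207502907625872636479860445552201991928673843743416115548329599781000226381239549559449239470491658291964140832480820020100,
  362098462056294012754715127203760846967793435762820582071688182977251324521915563906302344557314129512458291974406367840804100100,
  362098462502150432160804020100502512562814070351758793969849246231155778894472361809045226130653266331658291457286432160804020100,
  362098462502150432160804020100502512562814070351758793969849246231155778894472361809045226130653266331658291457286432160804020100,
  358513776894640392664795205141066802099913568166918260722765847182539302222472366003349489591861331150858291459846303520804060100,
  365701252132065540831441496624951794110929218876196465690455148479554478783111518753941486963965869672458291457299360160795980100,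
  362098462502150432160804020100502512562814070351758793969849246231155778894472361809045226130653266331658291457286432160804020100,
  362062613849116450421245961131337442198963891791758776875879402782446662300247209809044963986620498331719731457286432160804020100,
  362170430024195700095485960603598315116248182351758828415486954782446652183837620049045750418620498319308851457286432160804020100,
  354892613478988169274342898775545901838421565690076706050060440932929553572079181239340368517546394011658290947859232480796020100,
  358513777340496812070884098037808467694934202755856472620926910436443756595029163906092371165200467970058290942726367840803980100,
  351361971067028981418561891899274368562368078846523221648183111537512871178219711108036560817307894982645810438444831520779980100,
  362098462502150432160804020100502512562814070351758793969849246231155778894472361809045226130653266331658291457286432160804020100,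
  362098462502150432160804020100502512562814070351758793969849246231155778894472361809045226130653266331658291457286432160804020100,
  354910717947249657855060453237301138518656846618612056421744007386616231161275140281283774385406198990858290433312096160787940100,
  369286207502907625872636479860445552201991928673843743416115548329599781000226381239549559449239470491658291964140832480820020100,
  362098462502150432160804020100502512562814070351758793969849246231155778894472361809045226130653266331658291457286432160804020100,
  362080358479745362986175358535488941477599424012161655496326743031373555677833200669844701836132598171658291454713632800812020100,
  358513776894640392664795205141066802099913568166918260722765847182539302222472366003349489591861331150858291459846303520804060100,
  362062343633139145965680138566571780373230136911758776618181381128574022199332255569044963986718802343946291457286432160804020100,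
  362062613849116450421245961131337442198963891791758776875879402782446662300247209809044963986620498331719731457286432160804020100,
  351343867490480331650022123231002463072174067095864295072821671591635102334137347871578918096126363641845809918752096480787900100,
  362098462502150432160804020100502512562814070351758793969849246231155778894472361809045226130653266331658291457286432160804020100,
  362098462056294012754715127203760846967793435762820582071688182977251324521915563906302344557314129512458291974406367840804100100,
  354910717947249657855060453237301138518656846618612056421744007386616231161275140281283774385406198990858290433312096160787940100,
  365701252132065540831441496624951794110929218876196465690455148479554478783111518753941486963965869672458291457299360160795980100,
  362080358479745362986175358535488941477599424012161655496326743031373555677833200669844701836132598171658291454713632800812020100,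
  347704958991553936784260765172622449334474985131426606000547904240654645750358084686682395118879296313333809918739168480795940100,
  369286207502907625872636479860445552201991928673843743416115548329599781000226381239549559449239470491658291964140832480820020100,
  362098462056294012754715127203760846967793435762820582071688182977251324521915563906302344557314129512458291974406367840804100100,
  358423525654324551825959868057177302373313245389010980823621336782302020082829204919339583409471735007283250942726432480803980100,
  369214059839140434802340911444827957965585617646595390092332477875240267704665583391997295988031405688883251966713696480812020100]

def a3U : List (List ℤ) := decM 56 [362098462511180488033722350415760593923725796667552559310386351250718977748913196373143318026665735416023091477843359520756100100,
  387318620395023676306918708567812555071614110321622258958523261728983679718605938759327157482307340265359413994092513760900140100,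
  383715740695401597598815412565836163785927910591223282845239699230716140829407611721270562026307340269475893484678177440884100100,
  344084064010773370711674018097757251352353397069307063590898383631157674648122942296820936189558863104256049440160286880708020100,
  380112861004809631058625789010317853861153437176618080576529561573835800794650119247312319293046209357957172998380768480820180100,
  329672545209999365912593914846257266037085061722957592249009588083458778236752957018658961453892155426990128413625950560691900100,
  340481184308899210427797285503968861339700230112294305137408466191595416959537111896819890234999192393840689429894686880723940100,
  369304221892375736408172367588918102487588543835086917495596925034795004390426654283108325153194233403177012455571041120875980100,
  351289823405524849442502011309618924021023806232026549532154019731375597927130565972932558182826229364807730443590559520763980100,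
  311658146729915419149128845339980230955536114687580150474596904244847872844844374167684763408810221283952686417056732640547980101,
  372907101628106779610280826253197764565643381164382745551220930473054685269639293844985593826523945904752794425785950563892340500,
  354892703105146928150605307311590917260198901962425517055502990229643140171688206930989153638826229364807730953004895840780020100,
  318863906113384985896957580096235114524314003940078135054264034543812814997159083512146293512618719275223087399930077600651860100,
  351289823405524849442502011309614525974512702232026549532154019731375597927130565972932558182826229364807730443590559520763980100,
  351289823403261790348266323483656752335729212299274868324400041083153357882658913260484297356099830179870770441017695520771980100,
  362098462484090320414967359469986349731039454942574699262611836192029381185590692680953899938628328162928691928172577440899860100,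
  365701342163422893248961876052237165787374401411796234238636904794273851276847077125224029949150754636933069991353059037811659699,
  336878304613781069404140979349711491124716034423869133962235651443155250297727395828364602871005426948372528933318750560683980101,
  380112860982245637923337515846779547644363017387136235744261930069766684286380944660019424175735200474695733453855650080947940099,
  365701342163422893248961876052237165787374401343076757502636904794273851276847077125224029949150754636933069991353059037811659700,
  365701342190501857884976483886876512794569098357704662790663561781546336656977774515451468863914398058260531943583841119267939900,
  376509981282601040937015691787989692412363017318415041021344603811590684286380946757171424175735200474695733453855650080947940100,
  387318620395023676306918708567812555071614110321622250368588669728983679718605938759327157482307340265359413994092513760900140100,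
  383715740695401597598815412565836163785927910591223282802290026270716140829407611721270562026307340269475893484678177440884100100,
  358495582809295293934980684757445237940654765189042744045380083090937852260105424213038199599939500066990130963283359520756060100,
  380112861004809631058625789010317853861153437176618080576528487832011800794650119247312319293046209357957172998380768480820180100,
  362098462504413547551442424940338354945887864284510475134653551919378018922082912441493486957412433520691251459859296160796020100,
  369304221892375736408172367588918102487588543835086917495596925007951458790426654283108325153194233403177012455571041120875980100,
  390921500051803515004700379917445953625472451083581241446034677475650379873591621578352653208798594839418832515320740637931699699,
  311658146729915419149128845339980230955536114687580150474596904244847201756204374167684763408810221283952686417056732640547980101,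
  354892703105146928150605307311590917260198901962425517055502990229643136816245006930989153638826229364807730953004895840780020100,
  362098462502150432160804020100502512562814070351758793969849246231155778894472361809045226130653266331678771457286432160804020100,
  351289823405524849442502011309614525974512702232026549532154019731375597927046679892932558182826229364807730443590559520763980100,
  376509981320961917836104196780627128019802686327098795475690093613272611904006231440992620357237712169420954919789023203940300500,
  365701342163422893248961876052237165787374401411796234238636904794273851276847075028072029949150754636933069991353059037811659699,
  333275424898362050635834804872631266268840089728903461069823903633849335999258369714579444187153287153592368899923359519155819900,
  376509981282601040937015691787989692412363017318415041021344603811590684286380946757118995375735200474695733453855650080947940100,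
  387318620395023676306918708567812555071614110321622250368588669728983679718605938759326895338307340265359413994092513760900140100,
  369304221894627592799735309314336178470659575244873811460617052829641244418037626443108585979920632592209972458143841120867980100,
  358495582809295293934980684757445237940654765189042744045380083090937852260105424213038199593385900066990130963283359520756060100,
  362098462504413547551442424940338354945887864284510475134653551919378018922082912441493486957379665520691251459859296160796020100,
  358495582840877971072646164148767859338253739291721353701061587668037706512097646492866422312155778026383512923219805283796380500,
  390921500051803515004700379917445953625472451083581241446034677475650379873591621578352653208798594020218832515320740637931699699,
  362098462502150432160804020100502512562814070351758793969849246231155778894472361809045226130653266331658291457286432160804020100,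
  362098462502150432160804020100502512562814070351758793969849246231155778894472361809045226130653266331658291457286432160804020100,
  326069665521659199187489877299883265805330033716668126044515272533068220474247544312252718720631023700387887927328541602227980300,
  362098462511180488033722350415760593923725796667550841323467951250718977748913196373090889226665735416023090965843359520756100100,
  362098462502150432160804020100502512562814070351758793969849246231155778894472361809045226130653266331658291457286432160804060100,
  369304221894627592799735309314336178470659575244873811460617052829641244418037626443108585979920632592209972458131041120867980100,
  344084064006258230043072268563545157032564288096053591453003458041640715821292660462427962720272793208924209934176159520747940101,
  358495582840877971072646164148767859338253739291721353701061587668037706512097646492866422312155778026383512923219804963796380500,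
  376509981293894212199165052060405547412607989380846769539767614519376126523875531953613181442474068748093492967558241120884020299,
  362098462502150432160804020100502512562814070351758793969849246231155778894472361809045226130653266331658291457286432160804020100,
  362098462502150432160804020100502512562814070351758793969849246231155778894472361809045226130653266331658291457286432160804020100,
  362098462502150432160804020100502512562814070351758793969849246231155778894472361809045226130653266331658291457286432160804020100,
  362098462502150432160804020100502512562814070351758793969849246231155778894472361809045226130653266331658291457286432160804020100]

def a3F : List (List ℤ) := decM 56 [354892703116440155709157349414387963318495460026326694120910919950719925625738486617031173056118533802321970469280286880708100100,
  340481184308899266724200002518726539386211334112294305094458793231595416959620997976819890234999192397957169429894686880723940100]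

def a3K : List (List ℤ) := decM 56 [362098462502150432160804020100502512562814070351758793969849246231155778894472361809045226130653266331658291457286432160804020100,
  362098462486297761472431761867216729934347382351758793969849246231155778894472361809045226130653266331658291457286432160804020100,
  362098462497635573534350988927294890930814070351758793969849246231155778894472361809045226130653266331658291457286432160804020100,
  362098462522551738472813477603742617623280758351758793969849246231155778894472361809045226130653266331658291457286432160804020100,
  362098462502150432160804020100502512562814070351758793969849246231155778894472361809045226130653266331658291457286432160804020100,
  362098462502150432160804020100502512562814070351758793969849246231155778894472361809045226130653266331658291457286432160804020100,
  362098462502150432160804020100502512562814070351758793969849246231155778894472361809045226130653266331658291457286432160804020100,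
  362098462502150432160804020100502512562814070351758793969849246231155778894472361809045226130653266331658291457286432160804020100,
  362098462502150432160804020100502512562814070351758793969849246231155778894472361809045226130653266331658291457286432160804020100,
  362098462502150432160804020100502512562814070351758793969849246231155778894472361809045226130653266331658291457286432160804020100,
  362098462502150432160804020100502512562814070351758793969849246231155778894472361809045226130653266331658291457286432160804020100,
  362098462484023443660602659697171052366347382351758793969849246231155778894472361809045226130653266331658291457286432160804020100,
  362098462502150432160804020100502512562814070351758793969849246231155778894472361809045226130653266331658291457286432160804020100,
  362098462502150432160804020100502512562814070351758793969849246231155778894472361809045226130653266331658291457286432160804020100,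
  362098462515728785037325959987386246066814070350728001818809246231155778894472361809045226130653266331658291457286432160804020100,
  362098462502150432160804020100502512562814070351758793969849246231155778894472361809045226130653266331658291457286432160804020100,
  362098462502150432160804020100502512562814070351758793969849246231155778894472361809045226130653266331658291457286432160804020100,
  362098462502150432160804020100502512562814070351758793969849246231155778894472361809045226130653266331658291457286432160804020100,
  362098462502150432160804020100502512562814070351758793969849246231155778894472361809045226130653266331658291457286432160804020100,
  362098462502150432160804020100502512562814070351758793969849246231155778894472361809045226130653266331658291457286432160804020100,
  362098462502150432160804020100502512562814070351758793969849246231155778894472361809045226130653266331658291457286432160804020100,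
  362098462502150432160804020100502512562814070351758793969849246231155778894472361809045226130653266331658291457286432160804020100,
  362098462502150432160804020100502512562814070351758793969849246231155778894472361809045226130653266331658291457286432160804020100,
  362098462502150432160804020100502512562814070351758793969849246231155778894472361809045226130653266331658291457286432160804020100,
  362098462502150432160804020100502512562814070351758793969849246231155778894472361809045226130653266331658291457286432160804020100,
  362098462502150432160804020100502512562814070351758793969849246231155778894472361809045226130653266331658291457286432160804020100,
  362098462479508585034170739147216729934347382351758793969849246231155778894472361809045226130653266331658291457286432160804020100,
  362098462502150432160804020100502512562814070351758793969849246231155778894472361809045226130653266331658291457286432160804020100,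
  362098462502150432160804020100502512562814070351758793969849246231155778894472361809045226130653266331658291457286432160804020100,
  362098462502150432160804020100502512562814070351758793969849246231155778894472361809045226130653266331658291457286432160804020100,
  362098462502150432160804020100502512562814070351758793969849246231155778894472361809045226130653266331658291457286432160804020100,
  362098462502150432160804020100502512562814070351758793969849246231155778894472361809045226130653266331658291457286432160804020100,
  362098462502150432160804020100502512562814070351758793969849246231155778894472361809045226130653266331658291457286432160804020100,
  362098462502150432160804020100502512562814070351758793969849246231155778894472361809045226130653266331658291457286432160804020100,
  362098462502150432160804020100502512562814070351758793969849246231155778894472361809045226130653266331658291457286432160804020100,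
  362098462502150432160804020100502512562814070351758793969849246231155778894472361809045226130653266331658291457286432160804020100,
  362098462502150432160804020100502512562814070351758793969849246231155778894472361809045226130653266331658291457286432160804020100,
  362098462502150432160804020100502512562814070351758793969849246231155778894472361809045226130653266331658291457286432160804020100,
  362098462502150432160804020100502512562814070351758793969849246231155778894472361809045226130653266331658291457286432160804020100,
  362098462502150432160804020100502512562814070351758793969849246231155778894472361809045226130653266331658291457286432160804020100,
  362098462502150432160804020100502512562814070351758793969849246231155778894472361809045226130653266331658291457286432160804020100,
  362098462502150432160804020100502512562814070351758793969849246231155778894472361809045226130653266331658291457286432160804020100,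
  362098462502150432160804020100502512562814070351758793969849246231155778894472361809045226130653266331658291457286432160804020100,
  362098462502150432160804020100502512562814070351758793969849246231155778894472361809045226130653266331658291457286432160804020100,
  362098462502150432160804020100502512562814070351758793969849246231155778894472361809045226130653266331658291457286432160804020100,
  362098462502150432160804020100502512562814070351758793969849246231155778894472361809045226130653266331658291457286432160804020100,
  362098462502150432160804020100502512562814070351758793969849246231155778894472361809045226130653266331658291457286432160804020100,
  362098462502150432160804020100502512562814070351758793969849246231155778894472361809045226130653266331658291457286432160804020100,
  362098462502150432160804020100502512562814070351758793969849246231155778894472361809045226130653266331658291457286432160804020100,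
  362098462502150432160804020100502512562814070351758793969849246231155778894472361809045226130653266331658291457286432160804020100,
  362098462502150432160804020100502512562814070351758793969849246231155778894472361809045226130653266331658291457286432160804020100,
  362098462502150432160804020100502512562814070351758793969849246231155778894472361809045226130653266331658291457286432160804020100,
  362098462502150432160804020100502512562814070351758793969849246231155778894472361809045226130653266331658291457286432160804020100,
  362098462502150432160804020100502512562814070351758793969849246231155778894472361809045226130653266331658291457286432160804020100,
  362098462502150432160804020100502512562814070351758793969849246231155778894472361809045226130653266331658291457286432160804020100,
  362098462502150432160804020100502512562814070351758793969849246231155778894472361809045226130653266331658291457286432160804020100]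

def pa3U_1201 : List ℤ := [32788624518658233416678512928695107903429239333075571237821298077153068688397822130939758110637587770191678794224518789475911151003774627002161782978421816875698045,
  49470316284245287663739679710595439151879895724424049567746813686765945350879349390762542264530961336163285892595909780931669294710252202426369834208385286254193215,
  33007580332047179220940036125448572671800320091973168453104909938263698815924114095085361155776763953195911158137282406241275088920670017916016560962780758081498411,
  -164216855301924670681497891324922705043125240364653480110612497261471435139399600749854702472115242579609936920023358846918307775145075290714916989168966083829575,
  65768835371661902070823976258120380419106634225946227903727960177615951335485307039026264553236897147152411702482927247587063863021057476448109831302251345774822054,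
  -49497685753809228865495843212266518496174359754934678903671183910282830688649632520043587089194816827724407560331614491515812681891224803825507286010033720228400815,
  -33007580332047179220940036125448572671800320091973168453104909938263698815924114095085361155709235131741896015340620255927894460724288683976850993263433348010758011,
  -16312203831678154372998507518685092599193057046355458878855342789945798626629211194847398127003142656349697793361648898269012098002160526997279883082485173469534836,
  -16503790166023589610470018061142223275438558824316987257429587589852848935874504111474000525604749804055890659392009042155525069508036734783384778177265844193331201,
  23706372162966574670127829474942438550251353179230379013780156157683406488664511940704065089793699079888410784901284045676990152729793791083710582555039240416619681969657,
  39609041636757135985614276921591744407459116866798447047558599390351904423984361787834122698653961312318322525346650595937707491465095318330050427106277898156414146958,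
  -41054213825481167670374472831230674435780748526912204541949084196824685698116952802821778889910121559384434227068928858035762286668391846280459513979419938816397,
  -66001475929320287482141802575503619329017134130114592519468332025840627778366203899811812389425963837265069125243441531901261590100591252461517044100355489100301221,
  -16503790166023589610470018061142223275438558824316987257429587589852848935874504111474000525604749804055890659392009042155535885319201529847801151102560802513666802,
  -16490105431249518650731748392074317118241454992901285327929780790372712463687265432544988277538058473736060428187355194918029571220522360961407065596569171199806410,
  -65577249037316466833352465715663247551033938440770492742956171840269386877026045516067629241421695396470113786790826358871612643721818480146754323313660592872822086,
  -23746014349031040111706768578825251044854033016617310696137860773841992782262008454131811925127908244817038195625473870475811593111501934569449562357832415133163715822199,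
  23706372395607122841044234616827453838614897512708739533425195727531481494628810950834483279745711307355171858104266094589310211098221680711639754514475953618997521194819,
  -23706421660652328479356694970785650816769849353590133948459059828867316771495200590336585133380788274705238509308844377291481668542475682308514408062325247951634615964471,
  -39625312786374988658819605054637598269382049141269458596558656166619237544631197462353105376118003392637750529488801908693778742646225151002673029651572616567775618999,
  -19771636400692737041771726470768335024773853648950602874170065895169040053437928294974805339263843707226391788140189374480939722199601347422676474854913441137947632452,
  -32624407663356308745997015037370185198386114092710917757710685579891597253258422530189903408165472574429022987269146589815758737997579515266196161896265325334293672,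
  49470316284245287663739679710595439151879895724424049567746813686765945350879349390762542264530905109001375805049867597625829677201345973172465449886403360801526814,
  33007580332047179220940036125448572671800320091973168453104909938263698815924114095085361155709235131741896015340620255927894460724288683976850990262488289429150810,
  16353258045503635540668881991516323275453839621699368757653909312558476606422748011207225863021277641911878216361940148187607198244814818150993909645780373775978430,
  65768835371661902070823976258120380419106634225946227903727960177615951335485307039026167149597303054256426654200653077055572774388602290089766158745174730942792053,
  -13684734774070959738269669065273772735581598604799476383026979905536106035854547704067116136805303662930441494295344827155319511695595123008558647496225823285991,
  -16312203831678154372998507518685092599193057046355458878855342789945798626629211335342505281162329918079325193907497691546746639995418988268919882948795508375007237,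
  -23745997708393497829703054221882091436882087734656001777814972186661348245937432177164745310185023829851870445825345652682696574931262297850762656006763134292841761801417,
  23706372162966574670127829474942438550251353179230379013780156157683406488664511738053782035527333214382334492726551200404392571624175793287035775107873347038631385294856,
  -41054213825481167670374472831230674435780748526912204541949084196824929081106900976727183362707748461238581399458623765882977640474835590326697460943364245252398,
  3161493736463199779076848518995946292648340134148751982432146797596129663141947223636519376775692687241882385725010391558510720594292801,
  -16503790166023589610470018061142223275438558824316987257429587590203904803958740100803317493374590665379626261460333815886809431087464385885462089842792350107945203,
  39592688378711632350073608039600228084183663027176747678800945481039345947377939039822915472790940034676410647130288655789519884266850509755427581489212250086062980529,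
  -23746014349031040111706768578825251044854033016617310696137860774348356117442578529376408048756094473031255751784427592430574286801190046381027738057681139614698475703000,
  -19821134086446546270637222313980601543270028008705537553074345221444874748786946687439326378013123799339063099120588658967576850303778277615517500459023299399498469267,
  -32624407663356308745997015037370185198386114092710918488089666607681054356139115847609347170581089795660030488540810730515580903129751722903696202786484512161536873,
  49470316284245287663739679710595439151879895724423172382590599311627964791166675170010583603374622410561366777781234617139409353462524600534916340733159981282442413,
  -16325888566460124973874309195493023119330914423650356343069126015472312652507857947310625794967278620685571810625663744030183171229822334958227388195343800834287229,
  16353258045503635540668881991516323275453838356446622248882995914261166485414061165282415379700765074450936912882253555026225998558101044678402162241918666916891629,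
  -13684734774070959738269669065273772737101167153356510250018334974991437468756503401457584072398824253435920597893731645976143254937535705697190685406163586533992,
  39625312786374988658819605054637598269382049141269458596558656166619237544631197462353105376118003392637750497031146839150252941439233548272953649566042104659497356198,
  -23745997708393497829703054221882091436884279561850008992021754384204885685451581390964617018525791859545136139389855069428550549919338216189173321546876466432488441691818,
  0,
  0,
  19722138714938927812906230627556068506277679289195668195266394711258757222749278662454761752174648890398628398936119238214936659920795244225875484846761104280820013637,
  32788624518658233416673952786968139647604699107694922235513854790905775291508916702547314893199724894326396623802622853681552712707600315096118058759294226975574442,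
  16435366473154597870528340575034691078683841017495163437588647066714023038473612578381087381214925836452138098301680824983247612952336209570831279726141602112383601,
  -16325888566460131551427296316232192691976543696098434228959187857000626391664937512697549337054239931648613631320477747931750572832640052696439118304552057946664830,
  23706356069718556380919260742518258345591778181794315883068852658405466022316158442976535969119916340076551172532455491428084599540332741463834072632375497319699922767991,
  39625312786365501189813429113338667515753740932889467910847565884337971870720475268689201346342921498235265285010732797525531302133354664958615928313942837508933296197,
  -23686650024263030192591340549814898316852673658205552159123909191991947805808540016631959067801397786175396896138865190430065904876233534700004310293963699160166298017221,
  0,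
  0,
  0,
  0]

def pa3F_1201 : List ℤ := [32706516091007271081337763983032646550907676712893244497765991828522332970828122330564830759401530148901873825764507110052451997116202089356804324483837333833783258,
  -33007580332047179220940036122284446550877117648633974514859175180407809607917480201606634986749181330759252522920667631773618862174928771770924179685584700215890406]

def pN3_1201 : List ℤ := [[],
  [],
  [],
  [],
  [699,902,1299,1699,1899,2099,2301,2501,3099,3301,3698,3898,4302,5102,5298,5699,6101,6901,7302,7501,7699,7899,8098,8499,9301,9502,9899,10099,10702],
  [98,301,701,1102,1301,1501,1699,1901,2299,3501,3702,4296,4898,5098,5301,5899,6101,6699,6899,7296,7501,7701,8101,8301,8501,9298,9702,9901,10498,10698],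
  [],
  [],
  [],
  [101,499,1101,1501,1902,2299,2501,3099,3502,3701,4302,4501,4699,4899,5099,5301,5498,5901,6698,6898,7501,7699,8101,8299,8499,9701,9902,10499,10699],
  [299,499,701,899,1099,1301,2102,2301,2499,3101,3298,3498,3901,4299,4498,4699,4901,5301,5501,5699,5899,6702,7498,7899,8101,8301,9499,9699,10102,10501],
  [],
  [],
  [304,499,1298,1699,2298,2501,2703,4504,4702,5299,6098,6503,7502,8099,8697,8897],
  [298,499,1304,1702,2301,2498,2903,4498,4696,5302,6101,6297,6497,7499,8102,8703],
  [],
  [99,301,502,899,1499,1701,1899,2099,2299,2499,3101,3301,3701,3901,4297,4501,4702,5099,5501,5702,6099,6901,7298,7702,7902,8502,9299,9499,9899,10099,10699],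
  [103,299,499,699,1099,1299,1701,1901,2501,3099,3501,3699,4306,4501,4699,4901,5101,5498,5902,6099,6699,6899,7304,7698,8298,8498,9302,9699,9901,10501,10701],
  [97,301,501,701,1101,1301,1699,1899,2499,3101,3499,3701,4294,4499,4701,4899,5099,5502,5898,6101,6701,6901,7296,7702,8302,8502,9298,9701,9899,10499,10699],
  [102,501,699,899,1099,1299,1499,1702,2099,2299,3301,3501,3901,4303,4502,4701,4901,5499,5702,5902,6098,6699,7302,7902,8298,9301,9499,9699,10099,10501],
  [99,303,501,699,902,1101,1297,1698,1899,2098,2299,2502,2701,2899,3099,3302,3501,3699,3898,4503,4703,4899,5101,5297,6301,6502,6699,6901,7503,8097,8698,8899,9502,9701,9899,10098,10499,10701],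
  [],
  [],
  [],
  [102,299,898,1098,1499,1702,2101,2499,3101,3299,3499,3902,4302,4902,5301,5701,5901,6098,6701,7302,7498,7901,8101,8299,9301,9498,9698,10101,10502],
  [699,902,1299,1699,1899,2099,2301,2501,3099,3301,3698,3898,4302,5102,5298,5699,6101,6901,7302,7501,7699,7899,8098,8499,9301,9502,9899,10099,10702],
  [],
  [],
  [99,301,502,699,901,1299,1499,1898,2098,3302,3699,3899,4299,4501,4702,5101,5298,5501,5701,6902,7501,7701,7901,8098,8501,9501,9898,10098,10701],
  [101,499,1101,1501,1902,2299,2501,3099,3502,3701,4302,4501,4699,4899,5099,5301,5498,5901,6698,6898,7501,7699,8101,8299,8499,9701,9902,10499,10699],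
  [],
  [298,502,1298,1699,2301,2501,2697,2897,4498,4702,5299,6101,6303,7499,8099,8903],
  [304,499,1298,1699,2298,2501,2703,4504,4702,5299,6098,6503,7502,8099,8697,8897],
  [98,499,701,901,1101,1301,1501,1698,2101,2301,3299,3499,3899,4297,4498,4699,4899,5501,5698,5898,6102,6701,7298,7898,8302,9299,9501,9701,10101,10499],
  [99,301,502,899,1499,1701,1899,2099,2299,2499,3101,3301,3701,3901,4297,4501,4702,5099,5501,5702,6099,6901,7298,7702,7902,8502,9299,9499,9899,10099,10699],
  [97,304,501,902,1103,1298,1501,1697,2098,2298,2502,2701,2899,3099,3302,3502,3701,3898,4296,4503,4703,4897,5099,5298,5899,6101,6301,6502,6698,7296,7504,7701,8098,8301,8501,8698,8899,9298,9502,9703,10098,10497,10699],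
  [],
  [],
  [98,301,701,1102,1301,1501,1699,1901,2299,3501,3702,4296,4898,5098,5301,5899,6101,6699,6899,7296,7501,7701,8101,8301,8501,9298,9702,9901,10498,10698],
  [102,299,898,1098,1499,1702,2101,2499,3101,3299,3499,3902,4302,4902,5301,5701,5901,6098,6701,7302,7498,7901,8101,8299,9301,9498,9698,10101,10502],
  [],
  [299,499,701,899,1099,1301,2102,2301,2499,3101,3298,3498,3901,4299,4498,4699,4901,5301,5501,5699,5899,6702,7498,7899,8101,8301,9499,9699,10102,10501],
  [99,301,502,699,901,1299,1499,1898,2098,3302,3699,3899,4299,4501,4702,5101,5298,5501,5701,6902,7501,7701,7901,8098,8501,9501,9898,10098,10701],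
  [298,499,1304,1702,2301,2498,2903,4498,4696,5302,6101,6297,6497,7499,8102,8703],
  [298,502,1298,1699,2301,2501,2697,2897,4498,4702,5299,6101,6303,7499,8099,8903],
  [97,303,702,899,1102,1501,1698,1901,2101,2298,2701,2899,3101,3299,3703,3901,4293,4501,4702,4898,5097,5301,5501,5898,6301,6502,6899,7294,7501,7702,8101,8302,8502,8698,8899,9297,9499,9702,9901,10101,10498,10697],
  [],
  [699,902,1299,1699,1899,2099,2301,2501,3099,3301,3698,3898,4302,5102,5298,5699,6101,6901,7302,7501,7699,7899,8098,8499,9301,9502,9899,10099,10702],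
  [98,301,701,1102,1301,1501,1699,1901,2299,3501,3702,4296,4898,5098,5301,5899,6101,6699,6899,7296,7501,7701,8101,8301,8501,9298,9702,9901,10498,10698],
  [101,499,1101,1501,1902,2299,2501,3099,3502,3701,4302,4501,4699,4899,5099,5301,5498,5901,6698,6898,7501,7699,8101,8299,8499,9701,9902,10499,10699],
  [299,499,701,899,1099,1301,2102,2301,2499,3101,3298,3498,3901,4299,4498,4699,4901,5301,5501,5699,5899,6702,7498,7899,8101,8301,9499,9699,10102,10501],
  [96,301,702,899,1101,1304,1899,2101,2497,2701,2902,3102,3299,3498,3702,3901,4291,4498,4699,4899,5098,5302,5503,5897,6101,6298,6499,6702,6901,7294,7499,7703,8102,8303,8503,8701,8899,9297,9499,9701,9899,10101,10499,10698],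
  [102,299,898,1098,1499,1702,2101,2499,3101,3299,3499,3902,4302,4902,5301,5701,5901,6098,6701,7302,7498,7901,8101,8299,9301,9498,9698,10101,10502],
  [699,902,1299,1699,1899,2099,2301,2501,3099,3301,3698,3898,4302,5102,5298,5699,6101,6901,7302,7501,7699,7899,8098,8499,9301,9502,9899,10099,10702],
  [99,296,701,899,1305,1702,2101,2302,2497,2698,2902,3101,3299,3499,3701,3901,4297,4495,4696,5099,5303,5501,5899,6102,6298,6496,6701,7298,7497,7701,8103,8301,8501,8704,8902,9299,9499,10101,10699],
  [102,295,499,899,1099,1304,1703,1901,2101,2302,2498,2698,2902,3299,3901,4303,4496,4695,4901,5303,5499,5901,6101,6298,6496,6899,7302,7497,7699,8103,8299,8499,8704,8902,9301,9499,9699,9901,10101,10501]].map (ps 1201)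

def a3R : List (List ℤ) := decM 2 [19700,
  20102,
  20102,
  19700,
  19702,
  20096,
  20098,
  20500,
  20098,
  19296,
  18902,
  20098,
  20096,
  20100,
  20100,
  20900,
  21700,
  19700,
  20900,
  21700,
  20500,
  20900,
  20102,
  20102,
  19702,
  19702,
  20098,
  20500,
  22100,
  19296,
  20098,
  20098,
  20100,
  19300,
  21700,
  20496,
  20900,
  20102,
  20498,
  19702,
  20098,
  18500,
  22100,
  20100,
  20098,
  19696,
  19700,
  20100,
  20498,
  20098,
  18500,
  20500,
  20100,
  20100,
  20100,
  20100]

def v3U : List (List ℤ) := decM 56 [362098462502150432160804020100502512562814070351758793969849246231155778894472361809045226130653266331658291457286432160804020100,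
  362098462502150432160804020100502512562814070351758793969849246231155778893214070609045226130653266356234291457286432160435296509,
  362098462502150432160804020100502512562814070351758793969849246231155778894975678289045226130653266323466291457286432160972341695,
  362098462502150432160804020100502512562814070351758793969849246231155778895227336529045226130653266315274291457286432161004422295,
  362098462502150432160804020100502512562814070351758793969849246231155778894472361809045226130653266331658291457286432160804020100,
  362098462502150432160804020100502512562814070351758793969849246231155778894472361809045226130653266331658291457286432160804020100,
  362098462502150432160804020100502512562814070351758793969849246231155778894472361809045226130653266331658291457286432160804020100,
  362098462502150432160804020100502512562814070351758793969849246231155778894472361809045226130653266331658291457286432160804020100,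
  362098462502150432160804020100502512562814070351758793969849246231155778894472361809045226130653266331658291457286432160804020100,
  362098462502150432160804020100502512562814070351758793969849246231155778894472361809045226130653266331658291457286432160804020100,
  362098462502150432160804020100502512562814070351758793969849246231155778894472361809045226130653266331658291457286432160804020100,
  362098462502150432160804020100502512562814070351758793969849246231155778892710754129045226130653266364426291457286432160283015113,
  362098462502150432160804020100502512562814070351758793969849246231155778894472361809045226130653266331658291457286432160804020100,
  362098462502150432160804020100502512562814070351758793969849246231155778894472361809045226130653266331658291457286432160804020100,
  362098462502150432160804020100502512562814070351758793969849246231155778895227336529045226130653266319370291457286432161028462294,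
  362098462502150432160804020100502512562814070351758793969849246231155778894472361809045226130653266331658291457286432160804020100,
  362098462502150432160804020100502512562814070351758793969849246231155778894472361809045226130653266331658291457286432160804020100,
  362098462502150432160804020100502512562814070351758793969849246231155778894472361809045226130653266331658291457286432160804020100,
  362098462502150432160804020100502512562814070351758793969849246231155778894472361809045226130653266331658291457286432160804020100,
  362098462502150432160804020100502512562814070351758793969849246231155778894472361809045226130653266331658291457286432160804020100,
  362098462502150432160804020100502512562814070351758793969849246231155778894472361809045226130653266331658291457286432160804020100,
  362098462502150432160804020100502512562814070351758793969849246231155778894472361809045226130653266331658291457286432160804020100,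
  362098462502150432160804020100502512562814070351758793969849246231155778894472361809045226130653266331658291457286432160804020100,
  362098462502150432160804020100502512562814070351758793969849246231155778894472361809045226130653266331658291457286432160804020100,
  362098462502150432160804020100502512562814070351758793969849246231155778894472361809045226130653266331658291457286432160804020100,
  362098462502150432160804020100502512562814070351758793969849246231155778894472361809045226130653266331658291457286432160804020100,
  362098462502150432160804020100502512562814070351758793969849246231155778893214070609045226130653266356234291457286432160443296509,
  362098462502150432160804020100502512562814070351758793969849246231155778894472361809045226130653266331658291457286432160804020100,
  362098462502150432160804020100502512562814070351758793969849246231155778894472361809045226130653266331658291457286432160804020100,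
  362098462502150432160804020100502512562814070351758793969849246231155778894472361809045226130653266331658291457286432160804020100,
  362098462502150432160804020100502512562814070351758793969849246231155778894472361809045226130653266331658291457286432160804020100,
  362098462502150432160804020100502512562814070351758793969849246231155778894472361809045226130653266331658291457286432160804020100,
  362098462502150432160804020100502512562814070351758793969849246231155778894472361809045226130653266331658291457286432160804020100,
  362098462502150432160804020100502512562814070351758793969849246231155778894472361809045226130653266331658291457286432160804020100,
  362098462502150432160804020100502512562814070351758793969849246231155778894472361809045226130653266331658291457286432160804020100,
  362098462502150432160804020100502512562814070351758793969849246231155778894472361809045226130653266331658291457286432160804020100,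
  362098462502150432160804020100502512562814070351758793969849246231155778894472361809045226130653266331658291457286432160804020100,
  362098462502150432160804020100502512562814070351758793969849246231155778894472361809045226130653266331658291457286432160804020100,
  362098462502150432160804020100502512562814070351758793969849246231155778894472361809045226130653266331658291457286432160804020100,
  362098462502150432160804020100502512562814070351758793969849246231155778894472361809045226130653266331658291457286432160804020100,
  362098462502150432160804020100502512562814070351758793969849246231155778894472361809045226130653266331658291457286432160804020100,
  362098462502150432160804020100502512562814070351758793969849246231155778894472361809045226130653266331658291457286432160804020100,
  362098462502150432160804020100502512562814070351758793969849246231155778894472361809045226130653266331658291457286432160804020100,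
  362098462502150432160804020100502512562814070351758793969849246231155778894472361809045226130653266331658291457286432160804020100,
  362098462502150432160804020100502512562814070351758793969849246231155778894472361809045226130653266331658291457286432160804020100,
  362098462502150432160804020100502512562814070351758793969849246231155778894472361809045226130653266331658291457286432160804020100,
  362098462502150432160804020100502512562814070351758793969849246231155778894472361809045226130653266331658291457286432160804020100,
  362098462502150432160804020100502512562814070351758793969849246231155778894472361809045226130653266331658291457286432160804020100,
  362098462502150432160804020100502512562814070351758793969849246231155778894472361809045226130653266331658291457286432160804020100,
  362098462502150432160804020100502512562814070351758793969849246231155778894472361809045226130653266331658291457286432160804020100,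
  362098462502150432160804020100502512562814070351758793969849246231155778894472361809045226130653266331658291457286432160804020100,
  362098462502150432160804020100502512562814070351758793969849246231155778894472361809045226130653266331658291457286432160804020100,
  362098462502150432160804020100502512562814070351758793969849246231155778894472361809045226130653266331658291457286432160804020100,
  362098462502150432160804020100502512562814070351758793969849246231155778894472361809045226130653266331658291457286432160804020100,
  362098462502150432160804020100502512562814070351758793969849246231155778894472361809045226130653266331658291457286432160804020100,
  362098462502150432160804020100502512562814070351758793969849246231155778894472361809045226130653266331658291457286432160804020100]

def v3F : List (List ℤ) := decM 56 [362098462502150432160804020100502512562814070351758793969849246231155778894891792209045226130653266323466291457286432160924261297]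

def v3K : List (List ℤ) := decM 56 [354856675202058600345563517764631011040541742125842161623192478257729553605634032669844701829546394011699251457286432800804020100,
  362080448103640950178211394808133932118654070351758811149718430231155775539029161809045488274653266331658291457286432160804020100,
  362134221083191753900451394808147192228885048911758811149718430231155775488697513809045488274653266331596851457286432160804020100,
  365773397996644905391285024772245515607358726803592058663162782178008229472149020087446274732867010971576371457286430880804020100,
  365809428137988358130785455479876935163198768241436547651031966178410879300705820087446536876867013429176371457286430880804020100,
  362026404908078727224784097518342679835245536781200398010110878230753132471691668100244701822992463874119731457286433120804020100,
  362062703921108941536170618999257832896743091791758776918829081111155782300247209809044963986653266331719731457286432160804020100,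
  358477568852104515830971303866582761801677906238797900816143262284707984650053197239444963980099830171678771457286432480804020100,
  362062433705131468191396645392871093006974070351758776789980062231155782249915561809044963986653266331658291457286432160804020100,
  358459553109270545078264406397844615661517864800958600148770867429651357760530003530901226124099336194078771457286432480804020103,
  373159301829069527019592180583740076356271588471717229189993970711859780456564982321017914081294502709012838657286428330404021300,
  362116476900659914143396644865105511674494070351758802559783838231155782249915561809045750418653266331658291457286432160804020100,
  362026675124089977566763244291613153230672113231758759738959897111155785706022057809044701842653266331781171457286432160804020100,
  362098462502150432160804020100502512562814070351758793969849246231155778894724020049045226130653266331658291457286432160804020100,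
  362098462502150432160804020100502446592116403791758793969849246231155778894472361809045226130653266331658291457286432160804020100,
  354802632006530154389341499194839758757133249786964636122829726337855534072376538961043915377886085531760691457286433760804020100,
  347398715126675939829793324100050358896540388118839431236260169803599323348926976727471751741459085314324224257286436311204018897,
  354856673857767888572675634931514744544541741919683731414548233163329553605632774378644701829546394011699251457286432800804020103,
  365665314300992391304528989941000576736541742332000591831189257032257553605634026378388701829546394011699251457286432800804020097,
  347398715126675939829793324100050358896540387912681001028260169803599323348926976727471751741459085314324224257286436311204018900,
  358423525656609847716400604772012808718277660236103057124848243964431328316542780707988177528439521691740211457286433436004019500,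
  354856675202058600345563517764631011040541742125837007662437278257729553605634032669844701829546394011699251457286432800804020100,
  362080448103640950178211394808133932118654070351758785379914654231155775539029161809045488274653266331658291457286432160804020100,
  362134221083191753900451394808147192228885048911758811020869411351155775488697513809045488274653266331596851457286432160804020100,
  354892702654786852542083009639159424212270234258556068594417417163329550199857926378644963993207194011637811457286431840804020100,
  365809428137988358130785455479876935163198768241436547651028744952938879300705820087446536876867013429176371457286430880804020100,
  362062703921108941536170618999257832896743091791758776918829065005028422300247209809044963986653266331719731457286432160804020100,
  358477568852104515830971303866582761801677906238797900816143262204177347850053197239444963980099830171678771457286432480804020100,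
  354640503771092260415148098612291426114812757782600535390913716551553548637765299575216276042565960091883264257286435671204018897,
  358459553109270545078264406397844615661517864800958600148770867429649344494610003530901226124099336194078771457286432480804020103,
  362116476900659914143396644865105511674494070351758802559783838231155772183585961809045750418653266331658291457286432160804020100,
  362062433705131468191396645392857898867440758351758776789980062231155782249663903569044963986653266331719731457286432160804020100,
  362098462502150432160804020100502512562814070351758793969849246231155778894472361809045226130653266331658291457286432160804020100,
  380365061676433106638313296598199431202815424564919954565425799779686009151179417751418176218740575029033318657286428650404021300,
  347398715126675939829793324100050358896540388118839431236260169803599323348926970436015751741459085314324224257286436311204018897,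
  358351468062571919777585960909852975990709126665544661165109875964028681893762086967730373220778719234201651457286434396004019500,
  354856675202058600345563517764631011040541742125837007662437278257729553605634032669687415429546394011699251457286432800804020100,
  362080448103640950178211394808133932118654070351758785379914654231155775539029161809044701842653266331658291457286432160804020100,
  358387227994625575733950467554244356456771858889367150368464973723772678488240161821843911432618719234140211457286434400804020100,
  354892702654786852542083009639159424212270234258556068594417417163329550199857926378644963973546394011637811457286431840804020100,
  362170249880210886754844795906753043988293627471758828200738595351155772082922665809045750418653266331535411457286432160804020100,
  376798209877624924491814716100954666229087752584678156703438322658712234440017746890618700519847447348992358657286428010404021300,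
  354640503771092260415148098612291426114812757782600535390913716551553548637765299575216276042565957634283264257286435671204018897,
  362098462502150432160804020100502512562814070351758793969849246231155778894472361809045226130653266331658291457286432160804020100,
  362062433705131468191396645392857898867440758351758776789980062231155782249663903569044963986653266331658291457286432160804020100,
  365701341753653088666392791566832383679781946895825342704071880497477583049621249201301750425206208514037811457286431845604020700,
  376636080297862541747507043342036767560913730809674738124280734097882249005406513796404347584527319451514931457286429920804020100,
  372961683877487895599152556714490496909169139347353137305710590686365108045650645226646016553794685749258291449606430240804020100,
  358387227994625575733950467554244356456771858889367150368464973723772678488240161821843911432618719234140211457248034400804020100,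
  351145439350243032145822082385256588438507776794500407813163960655946453199400574391443387131511846914181171457286435040804020103,
  376798209877624924491814716100954666229087752584678156703438322658712234440017746890618700519847447348992358657286427050404021300,
  369340251146532975748932405269490280581078152446625536525150259298982004183563607479445750431760138651617331457286431520804020697,
  362098462502150432160804020100502512562814070351758793969849246231155778894472361809045226130653266331658291457286432160804020100,
  362098462502150432160804020100502512562814070351758793969849246231155778894472361809045226130653266331658291457286432160804020100,
  362098462502150432160804020100502512562814070351758793969849246231155778894472361809045226130653266331658291457286432160804020100,
  362098462502150432160804020100502512562814070351758793969849246231155778894472361809045226130653266331658291457286432160804020100]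

def pv3U_17577 : List ℤ := [[],
  [6485,8706,10454,10682,10882,11109],
  [6506,8698,10521,10708,10908,11095],
  [6509,8696,10525,10710,10911,11095],
  [],
  [],
  [],
  [],
  [],
  [],
  [],
  [6479,8708,10435,10675,10875,11113],
  [],
  [],
  [6509,8697,10528,10711,10911,11094],
  [],
  [],
  [],
  [],
  [],
  [],
  [],
  [],
  [],
  [],
  [],
  [6485,8706,10455,10682,10882,11109],
  [],
  [],
  [],
  [],
  [],
  [],
  [],
  [],
  [],
  [],
  [],
  [],
  [],
  [],
  [],
  [],
  [],
  [],
  [],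
  [],
  [],
  [],
  [],
  [],
  [],
  [],
  [],
  [],
  []].map (ps 17577)

def pv3F_17577 : List ℤ := [[6505,8698,10515,10706,10906,11097]].map (ps 17577)

def pA3_17577 : List ℤ := [[98,699],
  [299,1699],
  [499,1301,2499],
  [699,1501,3099],
  [899,1899,2099,3699,3899],
  [1099,1901,3701],
  [1299,4699],
  [1499,4301,5499],
  [1699,4501,6099],
  [101,701,1899,4899,5099,6699,6899],
  [2099,4901,6701],
  [2299,7499],
  [2499,8099],
  [1701,2699,8699,8899],
  [2899,8701],
  [3099,7299,9299],
  [1299,2501,3299,7701,7901,9899,10099],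
  [3499,7699,9901],
  [1499,3101,3699,8301,8501,10499,10699],
  [3899,8299,10501],
  [1901,3701,4099,9099,11099],
  [101,4299],
  [301,4499],
  [501,4699],
  [101,701,899,1099,4899],
  [901,5099],
  [1301,5299],
  [1501,5499],
  [1701,1899,2099,5699],
  [1901,5899],
  [2301,6099],
  [1299,2501,2699,2899,6299],
  [2701,6499],
  [1499,3101,3299,3499,6699],
  [3301,6899],
  [1901,3701,4101,7099],
  [4301,7299],
  [4501,7499],
  [101,4701,4899,5099,7699],
  [4901,7899],
  [5301,8099],
  [301,4299,5501,5699,5899,8299],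
  [5701,8499],
  [501,4499,6101,6299,6499,8699],
  [6301,8899],
  [899,4901,6701,7101,9099],
  [7301,9299],
  [1301,7501,7699,7899,9499],
  [7701,9699],
  [1501,8101,8299,8499,9899],
  [8301,10099],
  [1899,8701,9101,10299],
  [2301,7301,9301,9499,9699,10499],
  [9501,10699],
  [2699,7699,9901,10301,10899],
  [3299,8299,10501,10901,11099]].map (ps 17577)

def N2 : List (List ℤ) := decM 28 [13758325456057349989964318641373429352458292483846432800804020100,
  13624778833390679899583417552093103310858291974406432480804020100,
  13489228960801961809046012562653266343946291457286432160804020100,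
  13355672271805691718664325041372940290058290947846431840804020100,
  13622765517139031899426127219933592373258291966726432480804020100,
  13624104372530263899530725297373266327562291971846432480804020100,
  13624104372530263899530725297373266327562291971846432480804020100,
  13758325456057349989964318641373429352458292483846432800804020100,
  13624778833390679899583417552093103310858291974406432480804020100,
  13489228960801961809046012562653266343946291457286432160804020100,
  13355672271805691718664325041372940290058290947846431840804020100,
  13488554499941545808993320307933429360650291454726432160804020100,
  13624104372530263899530725297373266327562291971846432480804020100,
  13758325456057349989964318641373429352458292483846432800804020100,
  13624778833390679899583417552093103310858291974406432480804020100,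
  13489228960801961809046012562653266343946291457286432160804020100,
  13221451188278605628230731697372777265162290435846431520804020100,
  13488554499941545808993320307933429360650291454726432160804020100,
  13758325456057349989964318641373429352458292483846432800804020100,
  13624778833390679899583417552093103310858291974406432480804020100,
  13622101122608215899374221397213755402250291964166432480804020100,
  13221451188278605628230731697372777265162290435846431520804020100,
  13758325456057349989964318641373429352458292483846432800804020100,
  13490547683533993809149037776092940273674291462406432160804020100,
  13622101122608215899374221397213755402250291964166432480804020100,
  13622101122608215899374221397213755402250291964166432480804020100,
  13490547683533993809149037776092940273674291462406432160804020100,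
  13752970134905330749486275588539917523200668407008225755956260709]

def tW1 : M2L := [[0, 0, 0, 0, 0, 0, 0, 0], [0, 0, 0, 0, 0, 0, 0, 0], [0, 0, 0, 0, 0, 0, 0, 0], [0, 0, 0, 0, 0, 0, 0, 0], [0, 0, 0, 0, 0, 0, 0, 0], [0, 0, 0, 0, 0, 0, 0, 0], [0, 0, 0, 0, 0, 0, 0, -1], [0, 0, 0, 0, 0, 0, 1, 0]]

def tZ1 : M2L := [[0, -1, 0, 0, 0, 1, 0, 0], [1, 0, 0, 0, 0, 0, 0, 0], [0, 0, 0, 0, 0, 0, 0, 0], [0, 0, 0, 0, 0, 0, 0, 0], [0, 0, 0, 0, 0, 0, 0, 0], [-1, 0, 0, 0, 0, 0, 0, 0], [0, 0, 0, 0, 0, 0, 0, 0], [0, 0, 0, 0, 0, 0, 0, 0]]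

def tW2 : M2L := [[0, 0, -1, -1, -1, 1, 0, 0], [0, 0, 0, -1, -1, -1, 0, 0], [1, 0, 0, 0, -1, -1, -1, 0], [1, 1, 0, 0, 0, -1, 1, -1], [1, 1, 1, 0, 0, 0, 0, 1], [-1, 1, 1, 1, 0, 0, 1, 0], [0, 0, 1, -1, 0, -1, 0, 0], [0, 0, 0, 1, -1, 0, 0, 0]]

def tZ2 : M2L := [[0, -3, -2, -1, 0, 4, 0, 0], [3, 0, 0, 0, 0, 0, 0, 0], [2, 0, 0, 0, 0, 0, 0, 0], [1, 0, 0, 0, 0, 0, 0, 0], [0, 0, 0, 0, 0, 0, 0, 0], [-4, 0, 0, 0, 0, 0, 0, 0], [0, 0, 0, 0, 0, 0, 0, 0], [0, 0, 0, 0, 0, 0, 0, 0]]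

def a2U : List (List ℤ) := decM 28 [13489218894472361809045226130653266329917491457286416160801180101,
  13489218894472361809045226130653266331412531457286429920803620100,
  13489218894472361809045226130653266331658291457286432160804020100,
  13489218894472361809045226130653266331658291457286432160804020100,
  13489218894472361809045226130653266333521971457286449440807060099,
  13489218894472361809045226130653266331658291457286432160804020100,
  13489218894472361809045226130653266331658291457286432160804020100,
  13489218894472361809045226130653266331658291457286432160804020100,
  13489218894472361809045226130653266331658291457286432160804020100,
  13489218894472361809045226130653266331555891457286431200803860100,
  13489218894472361809045226130653266331658291457286432160804020100,
  13489218894472361809045226130653266331658291457286432160804020100,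
  13489218894472361809045226130653266331658291457286432160804020100,
  13489218894472361809045226130653266331658291457286432160804020100,
  13489218894472361809045226130653266331658291457286432160804020100,
  13489218894472361809045226130653266331658291457286432160804020100,
  13489218894472361809045226130653266331658291457286432160804020100,
  13489218894472361809045226130653266331658291457286432160804020100,
  13489218894472361809045226130653266331658291457286432160804020100,
  13489218894472361809045226130653266331658291457286432160804020100,
  13489218894472361809045226130653266331658291457286432160804020100,
  13489218894472361809045226130653266331658291457286432160804020100,
  13489218894472361809045226130653266331658291457286432160804020100,
  13489218894472361809045226130653266331658291457286432160804020100,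
  13489218894472361809045226130653266331658291457286432160804020100,
  13489218894472361809045226130653266331658291457286432160804020100,
  13489218894472361809045226130653266331658291457286432160804020100,
  13489218894472361809045226130653266331658291457286432160804020100]

def a2F : List (List ℤ) := decM 28 [13489218894472361809045226130653266329794611457286414880800980101,
  13489218894472361809045226130653266331453491457286430240803700100]

def a2K : List (List ℤ) := decM 28 [13086565710220703569202512530653268789258291457286432160804020100,
  13084552444049051620815798910894167246919731457286432160804020100,
  13084552493877395786799653135695961704642611457286624155980140100,
  13489218894220709892115796443054164789319731457286432160804020100,
  13893885344644013757431939750412367873996851457286432160804020100,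
  13489218894472361809045226130653266331658291457286432160804020103,
  13489218894472355517589226130653266331658291457286432160804020100,
  13086565710220703537745232530653268789258291457286432160804020100,
  13084552444049051620658512510894167246919731457286432160804020100,
  13084552493877395786798866703695961704642611457286624155980140100,
  13489218894220709892115792510894164789319731457286432160804020100,
  13489218894220709860658512510992468789258291457286432160804020097,
  13489218894472361809045226130554962331658291457286432160804020103,
  13086565710220703537745232530652777269258291457286432160804020100,
  13084552444049051620658512510894164789319731457286432160804020100,
  13084562560206995786799653135695961704642611457286624155980140100,
  13489218894472361809045226130653266331658291457286432160804020100,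
  13489218894220709860658512510992468789257984257286432160804020097,
  13086565710220703537745232530652777269258289921286432160804020100,
  13086565760300699620815802843053675726919731457286432160804020100,
  13489229010881957923415793975115858331781478657248224155980140103,
  13489218894472361809045226130653266331658291457286240160804020100,
  13489218894472361809045226130653266331658291457286432160804020100,
  13893875228737727799990801593548877416212224257324640165651780097,
  13489229010881957923415793975115858331781478657248224155956140103,
  13489218894472361809045226130653266331658291457286432160804020100,
  13489218894976930288474653350314061416458598657286432160804020106,
  13489218894472361809045226130653266331658291457286432160804020100]

def pa2U_42865 : List ℤ := [[3215,4450,5029,5501],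
  [3288,4493,5090],
  [],
  [],
  [3391,4554,5176,5499],
  [],
  [],
  [],
  [],
  [3295,4497,5096],
  [],
  [],
  [],
  [],
  [],
  [],
  [],
  [],
  [],
  [],
  [],
  [],
  [],
  [],
  [],
  [],
  [],
  []].map (ps 42865)

def pa2F_42865 : List ℤ := [[3209,4446,5024,5501],
  [3290,4494,5092]].map (ps 42865)

def pA2_42865 : List ℤ := [[99,301,901],
  [299,1501,2101],
  [499,3101],
  [699,2699,3901],
  [899,2899,4501],
  [301,901,1099,3301,3501,5101,5301],
  [1299,3299,5099],
  [101,1499],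
  [301,1699],
  [501,1899],
  [701,2099],
  [301,901,1099,1299,2299],
  [1101,2499],
  [1501,2699],
  [1701,2899],
  [1901,3099],
  [99,1501,2101,2299,2499,3299],
  [2301,3499],
  [2701,3699],
  [2901,3899],
  [299,3101,3299,3499,4099],
  [3301,4299],
  [3701,4499],
  [499,2699,3901,4099,4299,4699],
  [4101,4899],
  [699,2899,4501,4699,4899,5099],
  [4701,5299],
  [1101,3301,5101]].map (ps 42865)

def a2R : List (List ℤ) := decM 2 [19694,
  20096,
  20098,
  20100,
  20508,
  20100,
  20100,
  20100,
  20100,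
  20100,
  20100,
  20100,
  20100,
  20100,
  20100,
  20100,
  20100,
  20100,
  20100,
  20100,
  20100,
  20100,
  20100,
  20100,
  20100,
  20100,
  20100,
  20100]

def k2U : List (List ℤ) := decM 28 [13489218894472361819530986130653430171658291969286432480804020100,
  13489218877694724250141061949145171974092646657299168162419939897,
  13489218827362233132175447186128980801361356028204703524043819491,
  13489218860917508250088633149145171154892646142739167842419939897,
  13489218877695143701355036026519633512437810942726431840804020100,
  13489218894472361809045226130653266331658291457286432160804020101,
  13489218894472359711893226130653266331658291457286432160804020100,
  13489218894472361809045226130653430171658291969286432480804020100,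
  13489218877694724250088633149145171974092646657299168162419939897,
  13489218827362233132175185042128980801361356028204703524043819491,
  13489218860917508250088631838425171154892646142739167842419939897,
  13489218860917508239602871838457939154872166142739167842419939896,
  13489218894472361809045226130620498331658291457286432160804020101,
  13489218894472361809045226130653266331658291969286432480804020100,
  13489218877694724250088633149145171154892646657299168162419939897,
  13489218827362233132175185042128980797265356028204703524043819491,
  13489218894472361809045226130653266331658291457286432160804020100,
  13489218860917508239602871838457939154872063742739167842419939896,
  13489218894472361809045226130653266331658291457286432480804020100,
  13489218877694724250088633149145171154892646654739168162419939897,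
  13489218877694724260521703515832402331617228542726431840811979898,
  13489218894472361809045226130653266331658291457286368160804020100,
  13489218894472361809045226130653266331658291457286432160804020100,
  13489218961582490475481934708490320685230644486380960797572180708,
  13489218877694724260521703515832402331617228542726431840803979898,
  13489218894472361809045226130653266331658291457286432160804020100,
  13489218961582490475481934708490320685230644486380960797572180508,
  13489218894472361809045226130653266331658291457286432160804020100]

def k2K : List (List ℤ) := decM 28 [12683922592807414404245226130653266331658291457286432160804020101,
  13086572421361278391445226130653266331658291457286432160804020100,
  13489222249915561809045226130653266331658291457286432160804020100,
  13489218894472361809045226130653266331658291457286432160804020100,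
  14697165024692850922645226130653266331658291457286432160804020099,
  13489218894472361809045226130653266331658291457286432160804020100,
  13489218894472361809045226130653266331658291457286432160804020100,
  13489218894472361809045226130653266331658291457286432160804020100,
  13489218894472361809045226130653266331658291457286432160804020100,
  13489218894472361809045226130653266331658291457286432160804020100,
  13489218894472361809045226130653266331658291457286432160804020100,
  13489218894472361809045226130653266331658291457286432160804020100,
  13489218894472361809045226130653266331658291457286432160804020100,
  13489218894472361809045226130653266331658291457286432160804020100,
  13489218894472361809045226130653266331658291457286432160804020100,
  13489218894472361809045226130653266331658291457286432160804020100,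
  13489218894472361809045226130653266331658291457286432160804020100,
  13489218894472361809045226130653266331658291457286432160804020100,
  13489218894472361809045226130653266331658291457286432160804020100,
  13489218894472361809045226130653266331658291457286432160804020100,
  13489218894472361809045226130653266331658291457286432160804020100,
  13489218894472361809045226130653266331658291457286432160804020100,
  13489218894472361809045226130653266331658291457286432160804020100,
  13489218894472361809045226130653266331658291457286432160804020100,
  13489218894472361809045226130653266331658291457286432160804020100,
  13489218894472361809045226130653266331658291457286432160804020100,
  13489218894472361809045226130653266331658291457286432160804020100,
  13489218894472361809045226130653266331658291457286432160804020100]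

def pk2U_505 : List ℤ := [296763386671557263676128284637696054472069644657964459062500,
  -29260124162593976194850792071208583437600006717405300937547862123504431375,
  -87780334344162713919832346950722871043741327021973873260200030211668644250,
  -29260124162594272958239767913427176650043972328923928935160074513594547125,
  -296763388975842236485342645772766202240628573715271169897000,
  9746915684022605487897741385454592219366275205675607182085514068603515625,
  -16586252353140625,
  296763386671557263676128284637696054472061268600526123046875,
  -29260124162593976194850792071208583437600006717405305167456868483192322000,
  -87780334344162713919832346950722871043741327021976009364248241854053409875,
  -29260124162594272958239767913427176650043972330002661479506953917901187750,
  -39007039846616878446137509298899660999612055234043083643364604385778219000,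
  9746915684022605487897741385454592219366000101908485119165430767578125000,
  296763386671557263676128145710293657830286626533508300781250,
  -29260124162593976194850792071208583507758344927709401361700712483436462625,
  -87780334344162713919832346950722906473702123225544587457389461977344425500,
  0,
  -39007039846616878446137509307935186751663870310671286983026546677037984625,
  296763386666994323171341979096596415143757345676422119140625,
  -29260124162593976194853096356163500521898262035266098648533541005164978250,
  -19513170334951859280007709473812228425096385513600129387393456649702400125,
  -587650270627711531032360354646725574542093753814697265625,
  0,
  78033380516370435318983727005617926151710313663728050794960572992436534875,
  -19513170410633941964757936740583716644205886285636846468523007583540290750,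
  0,
  78014079693233756892275018606834847751275924999954435731233670984379894250,
  0]

def pN2_505 : List ℤ := [[102,301,701,902,1502,1699,2101,2701,2899,3702,3901,4502],
  [101,302,702,901,1501,1701,2102,2699,2901,3701,3902,4501],
  [503,1903,3103],
  [99,301,701,899,1499,1702,2101,2698,2902,3699,3901,4499],
  [101,299,699,901,1501,1698,2099,2702,2898,3701,3899,4501],
  [101,301,499,701,901,1501,1899,2101,3099,3701,3901,4501],
  [101,301,499,701,901,1501,1899,2101,3099,3701,3901,4501],
  [102,301,701,902,1502,1699,2101,2701,2899,3702,3901,4502],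
  [101,302,702,901,1501,1701,2102,2699,2901,3701,3902,4501],
  [503,1903,3103],
  [99,301,701,899,1499,1702,2101,2698,2902,3699,3901,4499],
  [299,502,699,1699,1902,2099,2701,2899,3102,3899],
  [101,301,499,701,901,1501,1899,2101,3099,3701,3901,4501],
  [102,301,701,902,1502,1699,2101,2701,2899,3702,3901,4502],
  [101,302,702,901,1501,1701,2102,2699,2901,3701,3902,4501],
  [503,1903,3103],
  [98,301,499,701,898,1498,1703,1899,2101,2697,2903,3099,3698,3901,4498],
  [299,502,699,1699,1902,2099,2701,2899,3102,3899],
  [102,301,701,902,1502,1699,2101,2701,2899,3702,3901,4502],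
  [101,302,702,901,1501,1701,2102,2699,2901,3701,3902,4501],
  [101,298,502,698,901,1501,1697,1902,2098,2703,2897,3102,3701,3898,4501],
  [98,301,499,701,898,1498,1703,1899,2101,2697,2903,3099,3698,3901,4498],
  [102,301,701,902,1502,1699,2101,2701,2899,3702,3901,4502],
  [302,496,702,1702,1896,2102,2698,2902,3096,3902],
  [101,298,502,698,901,1501,1697,1902,2098,2703,2897,3102,3701,3898,4501],
  [101,298,502,698,901,1501,1697,1902,2098,2703,2897,3102,3701,3898,4501],
  [302,496,702,1702,1896,2102,2698,2902,3096,3902],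
  [102,293,504,699,899,1103,1306,1514,1691,1901,2105,2294,2488,2709,2891,3101,3312,3506,3705,3896,4097,4303,4505,4697,4894,5106,5303,5509]].map (ps 505)

def l1 : List ℤ := [1, 0, 0, 0, 0, 0, 0, 0]

def r1 : List ℤ := [-1, -1, -1, -1, -1, -1, -1, -1]

def r2 : List ℤ := [0, 0, 0, 0, 0, 0, 1, 1]

def a1U : List (List ℤ) := decM 8 [1286496480804020100,
  1286432480804020100,
  1286432160804020100,
  1286432159204020100,
  1286432159196020100,
  1286432159195980100,
  1286432160804020100,
  1286432160804020099]

def a1F : List (List ℤ) := decM 8 [1299296479195980100,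
  1286496479195979901]

def a1K : List (List ℤ) := decM 0 [0,
  0,
  0,
  0,
  0,
  0,
  0,
  0]

def pa1U_25 : List ℤ := [[301,501],
  [501],
  [],
  [699],
  [699,899],
  [699,899,1099],
  [],
  [1499]].map (ps 25)

def pa1F_25 : List ℤ := [-10171224,
  5849203775]

def pZ1_25 : List ℤ := [[]].map (ps 25)

def a1R : List (List ℤ) := decM 2 [19900,
  19900,
  19900,
  19900,
  19900,
  19900,
  19901,
  19901]

def e4E : List (List ℤ) := decM 8 [1286560162412060099,
  1312224162411980099,
  1286560162412060099,
  1337760162403860100,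
  1260896162420140099,
  1299360160803980100,
  1312352164020020098,
  1286496160804020100,
  1299232160803980100,
  1312352164020020098,
  1299296160803980100,
  1273632160804060100,
  1260640157588060101,
  1337760162403860100,
  1222304159212260100,
  1312224162411980099,
  1299360160803980100,
  1299488164020060098,
  1286368159195980101,
  1312352164020020098,
  1338016165627940098,
  1260896160812140099,
  1273632160804060100,
  1299296160803980100,
  1222048154380140302,
  1286560162412060099,
  1286432159195980101,
  1312288164020020098,
  1312288164020020098,
  1286432159195980101,
  1273632480804060100,
  1286688164028100098,
  1286432159196020100,
  1286432160803980300,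
  1286688165636139898,
  1286560162412060099,
  1312224162411980099,
  1260768159196100100,
  1337760162403860100,
  1299360160803980100,
  1299360162412020099,
  1286496160804020100,
  1286496162412060099,
  1299296160803980100,
  1247840157596140101,
  1312224162411980099,
  1286368159195980101,
  1299488164020060098,
  1286304159187980101,
  1338016165627940098,
  1209248154380180302,
  1286496162412060099,
  1286432159195980101,
  1286432480804020100,
  1235104159204140300,
  1286560162412060099,
  1286432160812020100,
  1260768159196100100,
  1260576157588020102,
  1299360162412020099,
  1299232160804020100,
  1286432162412060099,
  1286368159195980101,
  1234848154372060303,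
  1286432480804020100,
  1286432162404020100,
  1286432160812020100,
  1286432160804060100,
  1286432160804020300,
  1286432160804020101]

def e4F : List (List ℤ) := decM 70 [59326212096352326805226130653266331658291457286432160804020100502512562814070351758793969849246231155778894472361809045226130653266331658291969286432160804020100,
  59326212096352326805226130653266331658291457286432160804020100502512562814070351758793969849246257999324494472361809045226130653266331658291457286432160804020100,
  59326212096352326805226130653266331658291457286432160804020100502512562814070351758793969849246231155778894472361809045226130653266331658291457286432480804020100,
  59326212096352326805226130653266331658291457286432160804020100502512562814070351758793969849246231155778894472361809045226130653266331658291457286432162404020100,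
  59326212096352326805226130653266331658291457286432160804020100502512562814070351758793969849246231155778894472361809045226130653266331658291457286432160812020100,
  59326212096352326805226130653266331658291457286432160804020100502512562814070351758793969849246231155778894472361809045226130653266331658291457286432160804060100,
  59326212096352326805226130653266331658291457286432160804020100502512562814070351758793969849246231155778894472361809045226130653266331658291457286432160804020300,
  59326212096352326805226130653266331658291457286432160804020100502512562814070351758793969849246231155778894472361809045226130653266331658291457286432160804020101]

def e4K : List (List ℤ) := decM 70 [64612355796336967627003274789783159768829271560643163272148265387877735152758017245240222236435325557052494880709840601219750314063861831733001004641120804140100,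
  65801742824630577681224334748266189786422286493620938163088662836704860708772236509240222236424614441460651125015351002273588854863861790772998444642080803900100,
  66383243227413084582139274789783159768829271560643163272148265387877735152758017245240222236435325557052494880709840601219750314063861831733001004641120804140100,
  59942953380379739427822549962666898985526192606297981174944369832166813926140021972809930182957877724595206960972798390053807734863873976371452166434080803540100,
  68717966460253501145872654528014180727936689011834273367234261539050609588456229086878363894163182272644338636410653113445911773263849584693003564640160804380100,
  61696175987958819845835213691416759573952883043214460787297524753586924157077350286793969849208622671264856879714538646543443574866331699251459884834080803900100,
  71096740961770599087777158884783017896960100767831940631216827722070033047459901995686474623613708842734251533363382558267208515661391964214542162851040804020100,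
  59326212096352326805226130653266331658291457286432160804020100502512562814070351758793969849246311686415694472361809045226130653266331658291457286432160804020100,
  58154430640606382304341902501950632789200253330275835557596107600254479559306831758793969849240835468224477832781239445753040093266331637811454713632160803900100,
  72858818227877112361061357284783017896960100767831940631216827722070033047459901995686474623613708842734251533363382558267208515661391964214542162851040804020100,
  59335022261321930626116807030807369268475629406543953898455374402457624930025793422793969849230124623752444552361809046016514474066331658291457286433120803900100,
  61678585172813819488151176888619800669944514118856604370192736953674589790285391758793969849240835468224477831522948244962675933266331699251462432032160804140100,
  49317716447316935197560614372157915261411490241164227869881670136320264927614804216693615470617633470097137819701975632178672451671271413809916128222240804140100,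
  59942953602847472956759742451626898985526192606297981174944369832166813926140021972809930182957877724595206960972798390053807734863873976371452166434080803540100,
  63405333015517454991677508391951291912001368370293687188789737675138275229869375050416151173240939485636809508212771413151544131668777134133006112030240804740100,
  65801742824630577681224334748266189732379090965174986163088662836704860708772236509214452432648614441460651125015351002273588854863861790772998444642080803900100,
  61696175987964353869057326556901559573952883043214460787297524753586924157077350286793969849208622671264856879714538646543443574866331699251459884834080803900100,
  71087945554198126579051251090946518867712677922541511025303793822080880515230642731686474623629815241214062009896732957476824694861391964214539577250080804140100,
  54630319934536888629204830729644010169590865209357953940755845968254479567553167936347717462035634937577611503174916689759440093268801525809918713824160803900100,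
  71096740961770626757893269449110441896960100767831940631216827722070033047459901995686474623613708842734251533363382558267208515661391964214542162851040804020100,
  74048205478638455944223068496742030183302253538889715522157225170897158595227784051340705464072092127142407777668892959321047056458922035254539602852000803780100,
  65193855977758545643403595438865622459187551173585388381207867939050609596702566295224262546958062272644338636404330200165911773266319472693003564640160804380100,
  60497993552098271305418605901817922341782661242588486050444093404770646068833871758793969849251626843333311111942378644699221213266331678771459859232160804140100,
  58154430640606382443384235957536378094800253330275835557596107600254479559306831758793969849240915998861277832781239445753040093266331637811454713632160803900100,
  41652709702544858187080656328350282860488451729119198125158956704979407592812704021801194749700786370633959002742954732147759431772198922289913530012320804380100,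
  66383287499598861485066611954296980363800467089089115272148265387877735152758017245265992040211325557052494880709840601219750314063861831733001004641120804140100,
  52269136693105792263739688669571140667753643012221162579127209530286590475382686272347717462057217285142094064013777489236443152468801484849913568223200803900100,
  71087945554198126579051251090946518867712677922541511025303793808886740981918642731686474623629815241214062009896732957476824694861391964214539577250080804020100,
  68735572477736633896126204769123937010546097890117067459131157370918853539015602731686474623635210928768478650735593757740279414861391923254534431650080804020100,
  56991503175967985133020570722830198739646257361894190601363756319361568659723649600347717462014132717996744942336055890286369194068801566769923859425120803900100,
  60497993552098271305418605901817922341782661242588486050444093404770644419566430094793969849251626843333311111942378644699221213266331678771459859232160804140100,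
  73431463972143309792689456698379301128246380380943895151232955841242907483158113837324745130360445558326095289057903614493369974861379717174544722850080804260100,
  55802101835218300187271690956552280681591024902263275817993706902512562822316688967139868502041111155778894472355486131946130653268801546291457286432160804020100,
  56973839019890834122301084331443749801124877254007717237847464051350535837855105600363761849251626843333311113200669845489585373266331617331452140832160803900100,
  81078835409324923609822982716867351518443479616797049867650881472671430451127022787408926272786384270781744977831625726229915353162909870134549868450080804380100,
  64612355796336967627003274789783159768829271560643163272148265387877735152758017240086261481235325557052494880709840601219750314063861831733001004641120804140100,
  65801742824630577681224334748266189786422286493620938163088662836704860708772236509214452432648614441460651125015351002273588854863861790772998444642080803900100,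
  56374747579484497618896331605634743371949304515375230338009835021685437266302469703139739008787847871370738228050007188172292112468801587251459846431200804260100,
  59942953380379739427822549962666898985526192606297981174944369832166813926140021972809929538712783324595206960972798390053807734863873976371452166434080803540100,
  61696175987964353869057326556901559574223099020856690547297524753586924157077350286793969849208622671264856879714538646543443574866331699251459884834080803900100,
  66982378717531902766884242899581888655513490449777263409512655738962943963535756509240222236413823471018267764595920601746679414863861811253001017442080804020100,
  59326212096352326805226130653266331658291457286432160804020100502512562814070351758793969849246231155778894472361809045226130653266331658291457286432160804020100,
  64022104258167764981247430576888653146992042608106926611540355036770646060587535581240222236456827373980177441548701400692821213263861790772995859040160804140100,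
  59335022261321930626116807030807369268475629406543953898455374402457624930025793422793969849230124621739178632361809046016514474066331658291457286433120803900100,
  54013578650509476006608411420243442842356136644891574625575576638600228455483497722331757128323988368761299014563927344931763011671259207731459833822240804380100,
  65810597261785985936116125312593613786422286527397935368367382836704860708772236514394182991624614441460651125015351002273588854863861790772998444642080803900100,
  54630334691933992271253506042843693853232254484179317429278085968276689702434243136347717462035634804030972059708267089759440093268801525809916166624160803900100,
  71087945554198126579051251090946518867712677922541511025303793822080880515230642731686474623629815241214062008638441757476824694861391964214539577250080804140100,
  50507103698078278780718866820035452571053210628221158335891935617147390483670255166709446311076016754505294064007486033232510992468813772849913568223200803900100,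
  74048205478638455944223068496742030183302253538889715522157225170897158595227784051340705464072092127142407777668861502041047056458922035254539602852000803780100,
  42824491158290802687273131576901873543979655685275523371582949607237490847576224021801194749706182058188375642323524174334449991772198942769916102812320804500100,
  68154160173277847128726137595311842219004694405933588634826025387921827218299276509240222236419138627935884404176490201219769974863861831733003590242080804140100,
  52269136693105792263739688669571140667753643012221162579127209530286590475382686272347717462057217285142094064013777489232510992468801484849913568223200803900100,
  58145620475636778622493559579995340484616081210164042484271456953608617443351390094793969849257022530887727752781239444962656272466331637811454713632160804020100,
  56357097513395687970767472533081020746069004096061896866923194721696284725785435386347801515539980274516998624589680500661908193364789299251457260830240804380100,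
  66383287499598861485066611954296980363800467089089115272148793153459067632758017245265992040211325557052494880709840601219750314063861831733001004641120804140100,
  62850322357486353423180570349980382634991889670601045790046494102512562805782782864406471196451351155778894472368131958506130653263861770291457286432160804020100,
  56374747579484497618896331605634743371949304515375230338009835021685437266302469703139739008787847871370738228050007188172292112468789299251459846431200804260100,
  47564478638506527031401010215586144448870236650322810582736407182944245112910060785901465074862647070343726934826885132975436611671271352368374995614240804020100,
  61660906259339564973733613203616099961513437891548212817133481237608453495935978717240222236478409855091299194195971800169824272463861749812993260639200804020100,
  59326212096352326805226130653266331658291457286432160804020100502512562814070351758793969849246231155778894472361809045226130653266331658291457286432160804020100,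
  61660921016736668477431690583702464576936657210970131006676444685663227114928721117240222236478329593561044002387562200165892112463861749812990713439200804140100,
  54630334691933992271253506042843693853232254484179317429278085968276689702434243136347717462035634804030972059708267089759440093268801525809916128224160803900100,
  36956847276884583849095666791302582743083561798121451369465050202699444064944009485370902051994431471959731478281003019394668871772211128368369824412320804140100,
  59326212096352326805226130653266331658291457286432160804020100502512562814070351758793969849246231155778894472361809045226130653266331658291457286432160804020100,
  59326212096352326805226130653266331658291457286432160804020100502512562814070351758793969849246231155778894472361809045226130653266331658291457286432160804020100,
  59326212096352326805226130653266331658291457286432160804020100502512562814070351758793969849246231155778894472361809045226130653266331658291457286432160804020100,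
  59326212096352326805226130653266331658291457286432160804020100502512562814070351758793969849246231155778894472361809045226130653266331658291457286432160804020100,
  59326212096352326805226130653266331658291457286432160804020100502512562814070351758793969849246231155778894472361809045226130653266331658291457286432160804020100,
  59326212096352326805226130653266331658291457286432160804020100502512562814070351758793969849246231155778894472361809045226130653266331658291457286432160804020100]

def pe4F_644 : List ℤ := [[12101],
  [8301],
  [12901],
  [13101],
  [13301],
  [13501],
  [13701],
  [13901]].map (ps 644)

def pA4_644 : List ℤ := [[99,501],
  [99,299,1301],
  [299,499,1901],
  [901,2501,2701],
  [699,899,2499],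
  [1099,3301],
  [1299,3901],
  [1499,4501,4701],
  [1699,4499],
  [1899,3101,5101],
  [2099,3499,3699,5701,5901],
  [2299,3501,5699],
  [2499,4099,4299,6301,6501],
  [2699,4101,6299],
  [2899,4901,6901],
  [3099,7301],
  [3299,7901],
  [501,3499,8501,8701],
  [3699,8499],
  [3899,7101,9101],
  [99,1301,4099,7499,7699,9701,9901],
  [4299,7501,9699],
  [299,1901,4499,8099,8299,10301,10501],
  [4699,8101,10299],
  [701,2501,4899,8901,10901],
  [5099,11101],
  [3301,5299,11701,11901],
  [5499,11699],
  [3901,5699,12301,12501],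
  [5899,12299],
  [4501,6099,12901],
  [3101,5101,6299,11301,11501,13101,13301],
  [6499,11299,13099],
  [3499,5701,6699,12099,13701],
  [4099,6301,6899,12699,13901],
  [101,7099],
  [301,7299],
  [501,699,899,7499],
  [701,7699],
  [1101,7899],
  [99,1301,1499,1699,8099],
  [1501,8299],
  [299,1901,2099,2299,8499],
  [2101,8699],
  [701,2501,2901,8899],
  [3101,9099],
  [3301,3499,3699,9299],
  [3501,9499],
  [3901,4099,4299,9699],
  [4101,9899],
  [4501,4901,10099],
  [3101,5101,5299,5499,10299],
  [5301,10499],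
  [3499,5701,6101,10699],
  [4099,6301,6701,10899],
  [7101,11099],
  [99,7301,7499,7699,11299],
  [7501,11499],
  [299,7901,8099,8299,11699],
  [8101,11899],
  [701,8501,8901,12099],
  [1099,7101,9101,9299,9499,12299],
  [9301,12499],
  [1501,7499,9701,10101,12699],
  [2101,8099,10301,10701,12899],
  [3099,11101,11299,11499,13099],
  [11301,13299],
  [3501,11701,12101,13499],
  [4101,12301,12701,13699],
  [5301,11301,13101,13501,13899]].map (ps 644)

def Z1 : List (List ℤ) := [[0,0,0,0,0,0,0,0]]
lemma ta1 : eq2 (subL T1 (oneL 8)) A1 = true := by decide +kernel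
lemma ta2 : eq2 (subL T2 (oneL 28)) A2 = true := by decide +kernel
lemma ta3 : eq2 (subL T3 (oneL 56)) A3 = true := by decide +kernel
lemma ta4 : eq2 (subL T4 (oneL 70)) A4 = true := by decide +kernel
def E1 : List (List ℤ) := C1.map fun I => [F1 l1 I, F1 ell2 I]
def E2 : List (List ℤ) := C2.map fun I => [F2 tW1 I, F2 tW2 I]
def E3 : List (List ℤ) := C3.map fun I => [2 * F3 tc1 I, 2 * F3 tc2 I]
def Ev : List (List ℤ) := C3.map fun I => [2 * F3 tcv I]

lemma a3pk : PkD 56 1201 3 57 16 9 A3 E3 N3 a3U a3F a3K pa3U_1201 pa3F_1201 pN3_1201 := by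
  constructor <;> decide +kernel

lemma v3pk : PkD 56 17577 3 65 15 2 N3 Ev A3 v3U v3F v3K pv3U_17577 pv3F_17577 pA3_17577 := by
  constructor <;> decide +kernel

lemma a2pk : PkD 28 42865 3 91 91 1 N2 E2 A2 a2U a2F a2K pa2U_42865 pa2F_42865 pA2_42865 := by
  constructor <;> decide +kernel

lemma k2pk : PkD 28 505 3 9 0 14 A2 [] N2 k2U [] k2K pk2U_505 [] pN2_505 := by
  constructor <;> decide +kernel

lemma a1pk : PkD 8 25 3 1 1 0 A1 E1 Z1 a1U a1F a1K pa1U_25 pa1F_25 pZ1_25 := by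
  constructor <;> decide +kernel

lemma e4pk : PkD 70 644 3 0 1 1 [] e4E A4 [] e4F e4K [] pe4F_644 pA4_644 := by
  constructor <;> decide +kernel

lemma cd1 : CerD 8 A1 Z1 E1 a1U a1F a1K a1R := by constructor <;> decide +kernel
lemma cd2 : CerD 28 N2 A2 E2 a2U a2F a2K a2R := by constructor <;> decide +kernel
lemma cd3 : CerD 56 A3 N3 E3 a3U a3F a3K a3R := by constructor <;> decide +kernel

lemma e4i : eq2 (mulL e4F e4E) (oneL 8) = true := by decide +kernel
lemma e4t : eq2 (mulL A4 e4E) [] = true := by decide +kernel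
lemma n2c : eq2 (normL 28 T2 9) N2 = true := by decide +kernel
lemma n3c : eq2 (normL 56 T3 9) N3 = true := by decide +kernel

end OHC

open CategoryTheory

namespace OHC
set_option linter.unusedSectionVars false
set_option linter.unusedVariables false

/-! Abstract group theory for the final assembly. -/

lemma split_free {H : Type*} [AddCommGroup H] (θ : H →+ (Fin 8 → ℤ)) (h9 : ∀ y, ∃ h, θ h = (9:ℤ) • y) :
    Nonempty (H ≃+ (Fin 8 → ℤ) × θ.ker) := by
  let t : H →ₗ[ℤ] (Fin 8 → ℤ) := θ.toIntLinearMap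
  let R := LinearMap.range t
  have hfr : Module.finrank ℤ R = 8 := by
    apply le_antisymm
    · have := Submodule.finrank_le R
      simpa using this
    · let g : (Fin 8 → ℤ) →ₗ[ℤ] R := LinearMap.codRestrict R ((9:ℤ) • LinearMap.id) (by
        intro y; obtain ⟨h, hh⟩ := h9 y; exact ⟨h, hh⟩)
      have hg : Function.Injective g := by
        intro a b hab
        have h2 : (9:ℤ) • a = (9:ℤ) • b := congrArg Subtype.val hab
        exact smul_right_injective _ (by norm_num) h2
      have := LinearMap.finrank_le_finrank_of_injective hg
      simpa using this
  let e : R ≃ₗ[ℤ] (Fin 8 → ℤ) := LinearEquiv.ofFinrankEq _ _ (by rw [hfr]; simp)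
  obtain ⟨s, hs⟩ := Module.projective_lifting_property t.rangeRestrict LinearMap.id t.surjective_rangeRestrict
  have hs' : ∀ r : R, t (s r) = r := fun r => congrArg Subtype.val (LinearMap.congr_fun hs r)
  refine ⟨AddEquiv.mk' ⟨fun h => (e (t.rangeRestrict h), ⟨h - s (t.rangeRestrict h), ?_⟩),
    fun p => s (e.symm p.1) + p.2, ?_, ?_⟩ ?_⟩
  · change t (h - s (t.rangeRestrict h)) = 0
    rw [map_sub, hs']; simp
  · intro h; simp
  · rintro ⟨a, b, hb⟩
    have hb' : t.rangeRestrict b = 0 := Subtype.ext hb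
    have h1 : t.rangeRestrict (s (e.symm a) + b) = e.symm a := by
      rw [map_add, hb', add_zero]; exact LinearMap.congr_fun hs _
    refine Prod.ext ?_ (Subtype.ext ?_)
    · simp only [h1, LinearEquiv.apply_symm_apply]
    · simp only [h1]; abel
  · intro a b
    refine Prod.ext ?_ (Subtype.ext ?_)
    · simp
    · simp only [Equiv.coe_fn_mk, map_add, Prod.snd_add, AddSubgroup.coe_add]; abel

lemma ker_iso {K : Type*} [AddCommGroup K] (φ : (Fin 6 → ℤ) →+ K) (hφ : Function.Surjective φ)
    (hk : ∀ a, φ a = 0 ↔ (3:ℤ) ∣ a 0 ∧ (9:ℤ) ∣ a 1 ∧ (3:ℤ) ∣ a 2 ∧ (3:ℤ) ∣ a 3 ∧ (3:ℤ) ∣ a 4 ∧ (9:ℤ) ∣ a 5) :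
    Nonempty (K ≃+ (Fin 2 → ZMod 9) × (Fin 4 → ZMod 3)) := by
  let q : (Fin 6 → ℤ) →+ (Fin 2 → ZMod 9) × (Fin 4 → ZMod 3) :=
    { toFun := fun a => (![(a 1 : ZMod 9), (a 5 : ZMod 9)], ![(a 0 : ZMod 3), (a 2 : ZMod 3), (a 3 : ZMod 3), (a 4 : ZMod 3)])
      map_zero' := by
        refine Prod.ext ?_ ?_ <;> funext i <;> fin_cases i <;> simp
      map_add' := by
        intro a b
        refine Prod.ext ?_ ?_ <;> funext i <;> fin_cases i <;> simp }
  have hq : Function.Surjective q := by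
    rintro ⟨u, v⟩
    refine ⟨![(v 0).cast, (u 0).cast, (v 1).cast, (v 2).cast, (v 3).cast, (u 1).cast], ?_⟩
    refine Prod.ext ?_ ?_ <;> funext i <;> fin_cases i <;> simp [q]
  have hqk : φ.ker = q.ker := by
    ext a
    rw [AddMonoidHom.mem_ker, AddMonoidHom.mem_ker, hk]
    have z9 : ∀ c : ℤ, (c : ZMod 9) = 0 ↔ (9:ℤ) ∣ c := fun c => by
      simpa using ZMod.intCast_zmod_eq_zero_iff_dvd c 9
    have z3 : ∀ c : ℤ, (c : ZMod 3) = 0 ↔ (3:ℤ) ∣ c := fun c => by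
      simpa using ZMod.intCast_zmod_eq_zero_iff_dvd c 3
    simp only [q, AddMonoidHom.coe_mk, ZeroHom.coe_mk, Prod.mk_eq_zero, funext_iff, Fin.forall_fin_succ, ← z9, ← z3]
    simp
    tauto
  exact ⟨(QuotientAddGroup.quotientKerEquivOfSurjective φ hφ).symm.trans
    ((QuotientAddGroup.quotientAddEquivOfEq hqk).trans (QuotientAddGroup.quotientKerEquivOfSurjective q hq))⟩

/-- `ker / im` of exponent three with two generators. -/
lemma two_iso {K : Type*} [AddCommGroup K] (φ : (Fin 2 → ℤ) →+ K) (hφ : Function.Surjective φ)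
    (hk : ∀ a, φ a = 0 ↔ (3:ℤ) ∣ a 0 ∧ (3:ℤ) ∣ a 1) :
    Nonempty (K ≃+ (Fin 2 → ZMod 3)) := by
  let q : (Fin 2 → ℤ) →+ (Fin 2 → ZMod 3) :=
    { toFun := fun a => ![(a 0 : ZMod 3), (a 1 : ZMod 3)]
      map_zero' := by funext i; fin_cases i <;> simp
      map_add' := by intro a b; funext i; fin_cases i <;> simp }
  have hq : Function.Surjective q := by
    intro u
    refine ⟨![(u 0).cast, (u 1).cast], ?_⟩
    funext i; fin_cases i <;> simp [q]
  have hqk : φ.ker = q.ker := by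
    ext a
    rw [AddMonoidHom.mem_ker, AddMonoidHom.mem_ker, hk]
    have z3 : ∀ c : ℤ, (c : ZMod 3) = 0 ↔ (3:ℤ) ∣ c := fun c => by
      simpa using ZMod.intCast_zmod_eq_zero_iff_dvd c 3
    simp only [q, AddMonoidHom.coe_mk, ZeroHom.coe_mk, funext_iff, Fin.forall_fin_succ, ← z3]
    simp
  exact ⟨(QuotientAddGroup.quotientKerEquivOfSurjective φ hφ).symm.trans
    ((QuotientAddGroup.quotientAddEquivOfEq hqk).trans (QuotientAddGroup.quotientKerEquivOfSurjective q hq))⟩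

end OHC

open CategoryTheory

namespace OHC
set_option linter.unusedSectionVars false
set_option linter.unusedVariables false

/-! Cochain level consequences of the certificates. -/

def P1 : Co LL 1 →+ (ℕ → ℤ) := pp 8 (lst C1 1)
def P2 : Co LL 2 →+ (ℕ → ℤ) := pp 28 (lst C2 2)
def P3 : Co LL 3 →+ (ℕ → ℤ) := pp 56 (lst C3 3)
def P4 : Co LL 4 →+ (ℕ → ℤ) := pp 70 (lst C4 4)

lemma cr1 : Cer 8 A1 Z1 E1 := cd1.cer a1pk.spec
lemma cr2 : Cer 28 N2 A2 E2 := cd2.cer a2pk.spec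
lemma cr3 : Cer 56 A3 N3 E3 := cd3.cer a3pk.spec

lemma act_tm {n : ℕ} {T A : List (List ℤ)} (h : eq2 (subL T (oneL n)) A = true) (x) (hx : Sup n x) :
    act A x = act T x - x := by
  rw [← eq2_act h, act_sub, act_one n x hx]

section
variable {j n : ℕ} {J : ℕ → Fin (j+1) → ℕ} {T A N : List (List ℤ)}

lemma pp_tm (h : Tab n J T) (hA : eq2 (subL T (oneL n)) A = true) (c) (hc : del (j+1) c = 0) :
    pp n J (tau ph (j+1) c - c) = act A (pp n J c) := by
  rw [map_sub, pp_tau h c hc, act_tm hA _ (pp_sup n J c)]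

lemma pp_nm' (h : Tab n J T) (hA : eq2 (normL n T 9) N = true) (c) (hc : del (j+1) c = 0) :
    pp n J (nm ph (j+1) c) = act N (pp n J c) := by
  rw [pp_nm h c hc, eq2_act hA]
end

lemma tau_cyc' {j} (c : Co LL j) (hc : del j c = 0) : del j (tau ph j c - c) = 0 := by
  rw [map_sub, tau_cyc c hc, hc, sub_zero]
lemma nm_cyc {j} (c : Co LL j) (hc : del j c = 0) : del j (nm ph j c) = 0 := by
  rw [← nm_del, hc, map_zero]
lemma del_del {j} (y : Co LL j) : del (j+1) (del j y) = 0 := (CRel.zero.2 ⟨y, rfl⟩).cyc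
lemma del_z (g : Co LL 0) : del 0 g = 0 := by
  have : g = fun _ => g Fin.elim0 := by funext v; congr 1; exact Subsingleton.elim _ _
  rw [this, del0]

lemma c1_cyc (r) : del 1 (c1 r) = 0 := del_mlin _ (c1_mlin r)
lemma c2_cyc (r) : del 2 (c2 r) = 0 := del_mlin _ (c2_mlin r)
lemma c3_cyc (r) : del 3 (c3 r) = 0 := del_mlin _ (c3_mlin r)
lemma c1_eq {A B} (h : eqR A B = true) : c1 A = c1 B := by funext v; exact eqR_spec _ _ h _

lemma vecL_two {α : Type} (l : List α) (f : α → ℤ) : vecL (l.map fun I => 2 * f I) = (2:ℤ) • vecL (l.map f) := by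
  funext i
  simp only [vecL, Pi.smul_apply, smul_eq_mul]
  by_cases hi : i < l.length
  · simp [List.getD_eq_getElem, hi]
  · simp [List.getD_eq_default, not_lt.1 hi]

/-- the basic cochains -/
def Y1 : Co LL 3 := (2:ℤ) • c3 tc1
def Y2 : Co LL 3 := (2:ℤ) • c3 tc2
def Yv : Co LL 3 := (2:ℤ) • c3 tcv
def W1 : Co LL 2 := c2 tW1
def W2 : Co LL 2 := c2 tW2
def V1 : Co LL 1 := c1 l1
def V2 : Co LL 1 := c1 ell2

lemma y1c : del 3 Y1 = 0 := by rw [Y1, map_zsmul, c3_cyc, smul_zero]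
lemma y2c : del 3 Y2 = 0 := by rw [Y2, map_zsmul, c3_cyc, smul_zero]
lemma yvc : del 3 Yv = 0 := by rw [Yv, map_zsmul, c3_cyc, smul_zero]
lemma w1c : del 2 W1 = 0 := c2_cyc _
lemma w2c : del 2 W2 = 0 := c2_cyc _
lemma v1c : del 1 V1 = 0 := c1_cyc _
lemma v2c : del 1 V2 = 0 := c1_cyc _

lemma actE3 (y) : act E3 y = P3 (y 0 • Y1 + y 1 • Y2) := by
  rw [E3, act_two, vecL_two, vecL_two, ← pp_c3, ← pp_c3, Y1, Y2, P3]
  simp only [map_add, map_zsmul]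
lemma actEv (y) : act Ev y = P3 (y 0 • Yv) := by
  rw [Ev, act_col, vecL_two, ← pp_c3, Yv, P3]
  simp only [map_zsmul]
lemma actE2 (y) : act E2 y = P2 (y 0 • W1 + y 1 • W2) := by
  rw [E2, act_two, ← pp_c2, ← pp_c2, W1, W2, P2]
  simp only [map_add, map_zsmul]
lemma actE1 (y) : act E1 y = P1 (y 0 • V1 + y 1 • V2) := by
  rw [E1, act_two, ← pp_c1, ← pp_c1, V1, V2, P1]
  simp only [map_add, map_zsmul]

def two (a b : ℤ) : ℕ → ℤ := fun i => if i = 0 then a else if i = 1 then b else 0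
lemma two_sup (a b) : Sup 2 (two a b) := fun i hi => by
  simp [two, show i ≠ 0 by omega, show i ≠ 1 by omega]

lemma exact3 (c : Co LL 3) (hc : del 3 c = 0) (h : P3 c = 0) : ∃ g, c = del 2 g := pp_exact tab3 c hc h
lemma exact2 (c : Co LL 2) (hc : del 2 c = 0) (h : P2 c = 0) : ∃ g, c = del 1 g := pp_exact tab2 c hc h
lemma exact1 (c : Co LL 1) (hc : del 1 c = 0) (h : P1 c = 0) : c = 0 := by
  obtain ⟨g, rfl⟩ := pp_exact tab1 c hc h
  exact del_z g
lemma exact4 (c : Co LL 4) (hc : del 4 c = 0) (h : P4 c = 0) : ∃ g, c = del 3 g := pp_exact tab4 c hc h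

lemma p1_tm (c : Co LL 1) (hc : del 1 c = 0) : P1 (tau ph 1 c - c) = act A1 (P1 c) := pp_tm tab1 ta1 c hc
lemma p2_tm (c : Co LL 2) (hc : del 2 c = 0) : P2 (tau ph 2 c - c) = act A2 (P2 c) := pp_tm tab2 ta2 c hc
lemma p3_tm (c : Co LL 3) (hc : del 3 c = 0) : P3 (tau ph 3 c - c) = act A3 (P3 c) := pp_tm tab3 ta3 c hc
lemma p4_tm (c : Co LL 4) (hc : del 4 c = 0) : P4 (tau ph 4 c - c) = act A4 (P4 c) := pp_tm tab4 ta4 c hc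
lemma p2_nm (c : Co LL 2) (hc : del 2 c = 0) : P2 (nm ph 2 c) = act N2 (P2 c) := pp_nm' tab2 n2c c hc
lemma p3_nm (c : Co LL 3) (hc : del 3 c = 0) : P3 (nm ph 3 c) = act N3 (P3 c) := pp_nm' tab3 n3c c hc

lemma p1_del (g : Co LL 0) : P1 (del 0 g) = 0 := pp_del g
lemma p2_del (g : Co LL 1) : P2 (del 1 g) = 0 := pp_del g
lemma p3_del (g : Co LL 2) : P3 (del 2 g) = 0 := pp_del g
lemma p4_del (g : Co LL 3) : P4 (del 3 g) = 0 := pp_del g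

lemma ln1 (u) (hu : Sup 8 u) : ∃ z, del 1 z = 0 ∧ P1 z = u := ⟨mm 8 (lst C1 1) u, mm_cyc _ _ _, pp_mm tab1 u hu⟩
lemma ln2 (u) (hu : Sup 28 u) : ∃ z, del 2 z = 0 ∧ P2 z = u := ⟨mm 28 (lst C2 2) u, mm_cyc _ _ _, pp_mm tab2 u hu⟩
lemma ln3 (u) (hu : Sup 56 u) : ∃ z, del 3 z = 0 ∧ P3 z = u := ⟨mm 56 (lst C3 3) u, mm_cyc _ _ _, pp_mm tab3 u hu⟩
lemma ln4 (u) (hu : Sup 70 u) : ∃ z, del 4 z = 0 ∧ P4 z = u := ⟨mm 70 (lst C4 4) u, mm_cyc _ _ _, pp_mm tab4 u hu⟩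

lemma S3 (f : Co LL 3) (hf : del 3 f = 0) (h : P3 (nm ph 3 f) = 0) : ∃ (a b : ℤ) (z : Co LL 3) (g : Co LL 2),
    del 3 z = 0 ∧ f = a • Y1 + b • Y2 + (tau ph 3 z - z) + del 2 g := by
  rw [p3_nm f hf] at h
  obtain ⟨u, y, hu, hy, e⟩ := cr3.split (P3 f) (pp_sup _ _ _) h
  obtain ⟨z, hz, rfl⟩ := ln3 u hu
  rw [← p3_tm z hz, actE3, ← map_add] at e
  obtain ⟨g, hg⟩ := exact3 (f - (tau ph 3 z - z + (y 0 • Y1 + y 1 • Y2))) (by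
    rw [map_sub, map_add, map_add, tau_cyc' z hz, hf, map_zsmul, map_zsmul, y1c, y2c]; simp) (by
    rw [map_sub, e, sub_self])
  exact ⟨y 0, y 1, z, g, hz, by rw [← hg]; abel⟩

lemma S2 (f : Co LL 2) (hf : del 2 f = 0) (h : P2 (tau ph 2 f - f) = 0) : ∃ (a b : ℤ) (z : Co LL 2) (g : Co LL 1),
    del 2 z = 0 ∧ f = a • W1 + b • W2 + nm ph 2 z + del 1 g := by
  rw [p2_tm f hf] at h
  obtain ⟨u, y, hu, hy, e⟩ := cr2.split (P2 f) (pp_sup _ _ _) h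
  obtain ⟨z, hz, rfl⟩ := ln2 u hu
  rw [← p2_nm z hz, actE2, ← map_add] at e
  obtain ⟨g, hg⟩ := exact2 (f - (nm ph 2 z + (y 0 • W1 + y 1 • W2))) (by
    rw [map_sub, map_add, map_add, nm_cyc z hz, hf, map_zsmul, map_zsmul, w1c, w2c]; simp) (by
    rw [map_sub, e, sub_self])
  exact ⟨y 0, y 1, z, g, hz, by rw [← hg]; abel⟩

lemma S1 (f : Co LL 1) (hf : del 1 f = 0) : ∃ (a b : ℤ) (z : Co LL 1),
    del 1 z = 0 ∧ f = a • V1 + b • V2 + (tau ph 1 z - z) := by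
  obtain ⟨u, y, hu, hy, e⟩ := cr1.split (P1 f) (pp_sup _ _ _) (by
    have : eq2 Z1 [] = true := by decide +kernel
    rw [eq2_act this]; funext i; simp [act, row, dot])
  obtain ⟨z, hz, rfl⟩ := ln1 u hu
  rw [← p1_tm z hz, actE1, ← map_add] at e
  have hg := exact1 (f - (tau ph 1 z - z + (y 0 • V1 + y 1 • V2))) (by
    rw [map_sub, map_add, map_add, tau_cyc' z hz, hf, map_zsmul, map_zsmul, v1c, v2c]; simp) (by
    rw [map_sub, e, sub_self])
  exact ⟨y 0, y 1, z, hz, by rw [sub_eq_zero.1 hg]; abel⟩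

lemma I3 (f : Co LL 3) (hf : del 3 f = 0) (h : P3 (tau ph 3 f - f) = 0) : ∃ (a : ℤ) (z : Co LL 3) (g : Co LL 2),
    del 3 z = 0 ∧ f = a • Yv + nm ph 3 z + del 2 g := by
  rw [p3_tm f hf] at h
  have e := cert_split (by norm_num) v3pk.spec (P3 f) (pp_sup _ _ _) h
  obtain ⟨z, hz, hu⟩ := ln3 (act v3U (P3 f)) (act_sup _ _ _ (by decide +kernel))
  rw [← hu, ← p3_nm z hz, actEv, ← map_add] at e
  obtain ⟨g, hg⟩ := exact3 (f - (nm ph 3 z + (act v3F (P3 f) 0 • Yv))) (by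
    rw [map_sub, map_add, nm_cyc z hz, hf, map_zsmul, yvc]; simp) (by
    rw [map_sub, ← e, sub_self])
  exact ⟨act v3F (P3 f) 0, z, g, hz, by rw [← hg]; abel⟩

lemma K2 (f : Co LL 2) (hf : del 2 f = 0) (h : P2 (nm ph 2 f) = 0) : ∃ (z : Co LL 2) (g : Co LL 1),
    del 2 z = 0 ∧ f = (tau ph 2 z - z) + del 1 g := by
  rw [p2_nm f hf] at h
  have e := cert_split (by norm_num) k2pk.spec (P2 f) (pp_sup _ _ _) h
  have h0 : ∀ x, act [] x = 0 := fun x => by funext i; simp [act, row, dot]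
  rw [h0, add_zero] at e
  obtain ⟨z, hz, hu⟩ := ln2 (act k2U (P2 f)) (act_sup _ _ _ (by decide +kernel))
  rw [← hu, ← p2_tm z hz] at e
  obtain ⟨g, hg⟩ := exact2 (f - (tau ph 2 z - z)) (by
    rw [map_sub, tau_cyc' z hz, hf, sub_zero]) (by rw [map_sub, ← e, sub_self])
  exact ⟨z, g, hz, by rw [← hg]; abel⟩

lemma T3' (g : Co LL 3) (hg : del 3 g = 0) (a b : ℤ) (h : P3 (tau ph 3 g - g) = P3 (a • Y1 + b • Y2)) :
    (3:ℤ) ∣ a ∧ (3:ℤ) ∣ b := by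
  rw [p3_tm g hg, show a • Y1 + b • Y2 = two a b 0 • Y1 + two a b 1 • Y2 from rfl, ← actE3] at h
  exact ⟨cr3.tors _ _ (two_sup a b) h 0, cr3.tors _ _ (two_sup a b) h 1⟩

lemma T2' (g : Co LL 2) (hg : del 2 g = 0) (a b : ℤ) (h : P2 (nm ph 2 g) = P2 (a • W1 + b • W2)) :
    (3:ℤ) ∣ a ∧ (3:ℤ) ∣ b := by
  rw [p2_nm g hg, show a • W1 + b • W2 = two a b 0 • W1 + two a b 1 • W2 from rfl, ← actE2] at h
  exact ⟨cr2.tors _ _ (two_sup a b) h 0, cr2.tors _ _ (two_sup a b) h 1⟩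

lemma T1' (g : Co LL 1) (hg : del 1 g = 0) (a b : ℤ) (h : tau ph 1 g - g = a • V1 + b • V2) :
    (3:ℤ) ∣ a ∧ (3:ℤ) ∣ b := by
  have h := congrArg P1 h
  rw [p1_tm g hg, show a • V1 + b • V2 = two a b 0 • V1 + two a b 1 • V2 from rfl, ← actE1] at h
  exact ⟨cr1.tors _ _ (two_sup a b) h 0, cr1.tors _ _ (two_sup a b) h 1⟩

lemma w1t : tau ph 2 W1 = W1 := by rw [W1, c2_tau]; exact c2_eq (by decide +kernel)
lemma w2t : tau ph 2 W2 = W2 := by rw [W2, c2_tau]; exact c2_eq (by decide +kernel)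
lemma z1n : nm ph 2 (c2 tZ1) = (3:ℤ) • W1 := by rw [c2_nm, W1, ← c2_sm]; exact c2_eq (by decide +kernel)
lemma z2n : nm ph 2 (c2 tZ2) = (3:ℤ) • W2 := by rw [c2_nm, W2, ← c2_sm]; exact c2_eq (by decide +kernel)
lemma r1t : tau ph 1 (c1 r1) - c1 r1 = (3:ℤ) • V1 := by
  rw [c1_tau, V1, ← c1_sm, sub_eq_iff_eq_add, ← c1_add]; exact c1_eq (by decide +kernel)
lemma r2t : tau ph 1 (c1 r2) - c1 r2 = (3:ℤ) • V2 := by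
  rw [c1_tau, V2, ← c1_sm, sub_eq_iff_eq_add, ← c1_add]; exact c1_eq (by decide +kernel)
lemma ell1_zero : c1 ell1 = 0 := by
  rw [c1_eq (show eqR ell1 [] = true by decide +kernel)]; rfl

end OHC

open CategoryTheory

namespace OHC
set_option linter.unusedSectionVars false
set_option linter.unusedVariables false

/-! The chase through the double complex. -/

def clo : AddSubgroup (Cx4 LL) where
  carrier := {f | Closed ph f}
  zero_mem' := ⟨by simp, by simp, by simp, by simp, by simp⟩
  add_mem' {f g} hf hg := by
    refine ⟨?_, ?_, ?_, ?_, ?_⟩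
    · rw [Prod.fst_add, map_add, hf.h5, hg.h5, add_zero]
    · have := congrArg₂ (· + ·) hf.h4 hg.h4
      simp only [Prod.fst_add, Prod.snd_add, map_add, add_zero] at this ⊢
      rw [← this]; abel
    · have := congrArg₂ (· + ·) hf.h3 hg.h3
      simp only [Prod.fst_add, Prod.snd_add, map_add, add_zero] at this ⊢
      rw [← this]; abel
    · have := congrArg₂ (· + ·) hf.h2 hg.h2
      simp only [Prod.fst_add, Prod.snd_add, map_add, add_zero] at this ⊢
      rw [← this]; abel
    · simp only [Prod.fst_add, Prod.snd_add, map_add, hf.h1, hg.h1, add_zero]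
  neg_mem' {f} hf := by
    refine ⟨?_, ?_, ?_, ?_, ?_⟩
    · rw [Prod.fst_neg, map_neg, hf.h5, neg_zero]
    · have := congrArg (- ·) hf.h4
      simp only [Prod.fst_neg, Prod.snd_neg, map_neg, neg_zero] at this ⊢
      rw [← this]; abel
    · have := congrArg (- ·) hf.h3
      simp only [Prod.fst_neg, Prod.snd_neg, map_neg, neg_zero] at this ⊢
      rw [← this]; abel
    · have := congrArg (- ·) hf.h2
      simp only [Prod.fst_neg, Prod.snd_neg, map_neg, neg_zero] at this ⊢
      rw [← this]; abel
    · simp only [Prod.fst_neg, Prod.snd_neg, map_neg, hf.h1, neg_zero]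

lemma D3_mk (g3 : Co LL 3) (g2 : Co LL 2) (g1 : Co LL 1) (g0 : ℤ) : D3 ph (g3, g2, g1, g0) =
    (del 3 g3, del 2 g2 - (tau ph 3 g3 - g3), del 1 g1 + nm ph 2 g2, -(tau ph 1 g1 - g1), 9 * g0) := rfl

lemma D3_clo (g : Cx3 LL) : D3 ph g ∈ clo := by
  obtain ⟨g3, g2, g1, g0⟩ := g
  rw [D3_mk]
  refine ⟨del_del _, ?_, ?_, ?_, ?_⟩
  · simp only [map_sub, del_del, tau_del]; abel
  · simp only [map_sub, map_add, del_del, nm_del, nm_tau]; abel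
  · simp only [map_sub, map_add, map_neg, del_del, tau_del, tau_nm]; abel
  · simp only [map_sub, map_add, map_neg, nm_tau]; abel

def bou : AddSubgroup (Cx4 LL) := (D3 ph).range
lemma bou_mk (g) : D3 ph g ∈ bou := ⟨g, rfl⟩
lemma bou_le : bou ≤ clo := by rintro _ ⟨g, rfl⟩; exact D3_clo g

def X1 : Cx4 LL := xt tc1 tb1 tb1p ts1 lam1
def X2 : Cx4 LL := xt tc2 tb2 tb2p ts2 lam2
def om (a b : ℤ) : Cx4 LL := (0, 0, a • W1 + b • W2, 0, 0)
def la (a b : ℤ) : Cx4 LL := (0, 0, 0, a • V1 + b • V2, 0)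
def ep (e : ℤ) : Cx4 LL := (0, 0, 0, 0, e)

lemma X1_clo : X1 ∈ clo := xt_closed xd1
lemma X2_clo : X2 ∈ clo := xt_closed xd2
lemma om_clo (a b) : om a b ∈ clo := by
  refine ⟨by simp [om], by simp [om], ?_, ?_, by simp [om]⟩
  · simp only [om, map_add, map_zsmul, w1c, w2c]; simp
  · simp only [om, map_add, map_zsmul, w1t, w2t]; simp
lemma la_clo (a b) : la a b ∈ clo := by
  have hc : del 1 (a • V1 + b • V2) = 0 := by simp only [map_add, map_zsmul, v1c, v2c]; simp
  refine ⟨by simp [la], by simp [la], by simp [la], ?_, ?_⟩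
  · simp only [la, hc]; simp
  · exact nm_one _ (nm_cyc _ hc)
lemma ep_clo (e) : ep e ∈ clo := by
  refine ⟨by simp [ep], by simp [ep], by simp [ep], by simp [ep], by simp [ep]⟩

lemma X1_rel : (3:ℤ) • X1 ∈ bou := by
  have := xt_rel xd1
  rw [ell1_zero] at this
  refine ⟨_, this.trans ?_⟩
  exact sub_zero _
lemma X2_rel : (3:ℤ) • X2 - la 0 1 ∈ bou := by
  refine ⟨_, (xt_rel xd2).trans ?_⟩
  rw [la, zero_smul, zero_add, one_smul]; rfl
lemma om_rel (a b) : om (3 * a) (3 * b) ∈ bou := by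
  refine ⟨(0, a • c2 tZ1 + b • c2 tZ2, 0, 0), ?_⟩
  rw [D3_mk, om]
  simp only [map_add, map_zsmul, c2_cyc, z1n, z2n, map_zero, smul_zero, mul_zero, sub_zero, add_zero, zero_add, neg_zero,
    smul_smul, mul_comm a, mul_comm b]
lemma la_rel (a b) : la (3 * a) (3 * b) ∈ bou := by
  refine ⟨(0, 0, -(a • c1 r1 + b • c1 r2), 0), ?_⟩
  have : tau ph 1 (a • c1 r1 + b • c1 r2) - (a • c1 r1 + b • c1 r2) = (3 * a) • V1 + (3 * b) • V2 := by
    rw [mul_comm, mul_smul, ← r1t, mul_comm, mul_smul, ← r2t, map_add, map_zsmul, map_zsmul, smul_sub, smul_sub]; abel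
  rw [D3_mk, la, ← this]
  simp only [map_add, map_neg, map_zsmul, c1_cyc, map_zero, smul_zero, mul_zero, sub_zero, add_zero, zero_add, neg_zero]
  refine Prod.ext rfl (Prod.ext rfl (Prod.ext rfl (Prod.ext ?_ rfl)))
  change - _ = _
  abel
lemma ep_rel (a) : ep (9 * a) ∈ bou := by
  refine ⟨(0, 0, 0, a), ?_⟩
  rw [D3_mk, ep]
  simp

lemma om_add (a b c d) : om (a + c) (b + d) = om a b + om c d := by
  simp only [om, Prod.mk_add_mk, add_zero, add_smul]
  refine Prod.ext rfl (Prod.ext rfl (Prod.ext ?_ rfl)); change _ = _; abel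
lemma la_add (a b c d) : la (a + c) (b + d) = la a b + la c d := by
  simp only [la, Prod.mk_add_mk, add_zero, add_smul]
  refine Prod.ext rfl (Prod.ext rfl (Prod.ext rfl (Prod.ext ?_ rfl))); change _ = _; abel
lemma ep_add (a b) : ep (a + b) = ep a + ep b := by simp [ep]
lemma la_smul (k a b) : la (k * a) (k * b) = k • la a b := by
  simp only [la, Prod.smul_mk, smul_zero, smul_add, smul_smul]

/-- the generic class -/
def Ph (a : Fin 6 → ℤ) : Cx4 LL := a 0 • X1 + a 1 • X2 + om (a 2) (a 3) + la (a 4) 0 + ep (a 5)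

lemma Ph_clo (a) : Ph a ∈ clo :=
  clo.add_mem (clo.add_mem (clo.add_mem (clo.add_mem (clo.zsmul_mem X1_clo _) (clo.zsmul_mem X2_clo _))
    (om_clo _ _)) (la_clo _ _)) (ep_clo _)
lemma Ph_add (a b) : Ph (a + b) = Ph a + Ph b := by
  have : la (a 4 + b 4) 0 = la (a 4) 0 + la (b 4) 0 := by rw [← la_add, add_zero]
  simp only [Ph, Pi.add_apply, om_add, ep_add, add_smul, this]; abel

lemma gen4 (f) (hf : f ∈ clo) (h : P4 f.1 = 0) : ∃ f' ∈ clo, f - f' ∈ bou ∧ f'.1 = 0 := by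
  obtain ⟨g, hg⟩ := exact4 f.1 hf.h5 h
  refine ⟨f - D3 ph (g, 0, 0, 0), clo.sub_mem hf (D3_clo _), ?_, ?_⟩
  · rw [sub_sub_cancel]; exact bou_mk _
  · rw [Prod.fst_sub, D3_mk, hg, sub_self]

lemma gen3 (f) (hf : f ∈ clo) (h : f.1 = 0) : ∃ f' ∈ clo, ∃ a b : ℤ, f - (a • X1 + b • X2) - f' ∈ bou ∧ f'.1 = 0 ∧ f'.2.1 = 0 := by
  have h4 := hf.h4
  have h3 := hf.h3
  rw [h, map_zero, sub_zero, add_zero] at h4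
  obtain ⟨a, b, z, g, hz, e⟩ := S3 f.2.1 h4 (by rw [← sub_eq_zero.1 h3, p3_del])
  refine ⟨f - (a • X1 + b • X2) - D3 ph (-z, g, 0, 0), clo.sub_mem (clo.sub_mem hf (clo.add_mem
    (clo.zsmul_mem X1_clo _) (clo.zsmul_mem X2_clo _))) (D3_clo _), a, b, ?_, ?_, ?_⟩
  · rw [sub_sub_cancel]; exact bou_mk _
  · rw [D3_mk, map_neg, hz]
    simp only [Prod.fst_sub, Prod.fst_add, h, Prod.smul_fst]
    simp [X1, X2, xt]
  · rw [D3_mk]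
    simp only [map_neg, Prod.fst_sub, Prod.fst_add, Prod.snd_sub, Prod.snd_add, Prod.smul_snd, Prod.smul_fst, e]
    change _ - (a • Y1 + b • Y2) - _ = 0
    abel

lemma gen2 (f) (hf : f ∈ clo) (h : f.1 = 0) (h' : f.2.1 = 0) : ∃ f' ∈ clo, ∃ a b : ℤ, f - om a b - f' ∈ bou ∧
    f'.1 = 0 ∧ f'.2.1 = 0 ∧ f'.2.2.1 = 0 := by
  have h2 := hf.h2
  have h3 := hf.h3
  rw [h', map_zero, sub_zero] at h3
  obtain ⟨a, b, z, g, hz, e⟩ := S2 f.2.2.1 h3 (by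
    rw [eq_neg_of_add_eq_zero_right h2, map_neg, p2_del, neg_zero])
  refine ⟨f - om a b - D3 ph (0, z, g, 0), clo.sub_mem (clo.sub_mem hf (om_clo _ _)) (D3_clo _), a, b, ?_, ?_, ?_, ?_⟩
  · rw [sub_sub_cancel]; exact bou_mk _
  · rw [D3_mk, om]
    simp [h]
  · rw [D3_mk, om]
    simp [h', hz]
  · rw [D3_mk, om]
    simp only [Prod.fst_sub, Prod.snd_sub, e]
    abel

lemma gen1 (f) (hf : f ∈ clo) (h : f.1 = 0) (h' : f.2.1 = 0) (h'' : f.2.2.1 = 0) :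
    ∃ a b e : ℤ, f - la a b - ep e ∈ bou := by
  have h2 := hf.h2
  rw [h'', map_zero, sub_zero, add_zero] at h2
  obtain ⟨a, b, z, hz, e⟩ := S1 f.2.2.2.1 h2
  refine ⟨a, b, f.2.2.2.2, (0, 0, -z, 0), ?_⟩
  rw [D3_mk, la, ep]
  refine Prod.ext ?_ (Prod.ext ?_ (Prod.ext ?_ (Prod.ext ?_ ?_)))
  · simp [h]
  · simp [h']
  · simp [h'', hz]
  · simp only [Prod.fst_sub, Prod.snd_sub, e, map_neg]
    abel
  · simp

lemma gen (f) (hf : f ∈ clo) (h : P4 f.1 = 0) : ∃ a, f - Ph a ∈ bou := by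
  obtain ⟨f1, c1, b1, h1⟩ := gen4 f hf h
  obtain ⟨f2, c2, x, y, b2, h2, h2'⟩ := gen3 f1 c1 h1
  obtain ⟨f3, c3, u, v, b3, h3, h3', h3''⟩ := gen2 f2 c2 h2 h2'
  obtain ⟨p, q, e, b4⟩ := gen1 f3 c3 h3 h3' h3''
  refine ⟨![x, y + 3 * q, u, v, p, e], ?_⟩
  have r := bou.zsmul_mem X2_rel (-q)
  have := bou.add_mem (bou.add_mem (bou.add_mem (bou.add_mem b1 b2) b3) b4) r
  convert this using 1
  have e1 : la p q = la p 0 + q • la 0 1 := by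
    rw [← la_smul, ← la_add]; simp
  have e0 : Ph ![x, y + 3 * q, u, v, p, e] = x • X1 + (y + 3 * q) • X2 + om u v + la p 0 + ep e := rfl
  rw [e0, e1, add_smul, smul_sub, smul_smul, neg_smul, neg_mul, neg_smul, mul_comm q 3]
  abel

end OHC

open CategoryTheory

namespace OHC
set_option linter.unusedSectionVars false
set_option linter.unusedVariables false

lemma fl (p q ε : ℤ) (g2 : Co LL 2) (g1 : Co LL 1) (g0 : ℤ)
    (h : D3 ph (0, g2, g1, g0) = la p q + ep ε) : (3:ℤ) ∣ p ∧ (3:ℤ) ∣ q ∧ (9:ℤ) ∣ ε := by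
  rw [D3_mk, la, ep] at h
  simp only [Prod.mk_add_mk, Prod.mk.injEq, map_zero, sub_zero, add_zero, zero_add] at h
  obtain ⟨-, h2, h1, h0, he⟩ := h
  have hn : P2 (nm ph 2 g2) = 0 := by rw [← neg_eq_of_add_eq_zero_right h1, map_neg, p2_del, neg_zero]
  obtain ⟨z, g, hz, e⟩ := K2 g2 (by exact h2) (by exact hn)
  have hn2 : nm ph 2 g2 = del 1 (nm ph 1 g) := by
    rw [e, map_add, map_sub, nm_tau ph 2 z, sub_self, zero_add, nm_del ph 1 g]
  rw [hn2, ← map_add] at h1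
  obtain ⟨h3, h4⟩ := T1' (-(g1 + nm ph 1 g)) (by rw [map_neg, h1, neg_zero]) p q (by
    rw [← h0, map_neg, map_add, tau_nm]; abel)
  exact ⟨h3, h4, ⟨g0, he.symm⟩⟩

lemma injB (c d p q ε : ℤ) (h : om c d + la p q + ep ε ∈ bou) :
    (3:ℤ) ∣ c ∧ (3:ℤ) ∣ d ∧ (3:ℤ) ∣ p ∧ (3:ℤ) ∣ q ∧ (9:ℤ) ∣ ε := by
  obtain ⟨⟨g3, g2, g1, g0⟩, hy⟩ := h
  have h := hy
  rw [D3_mk, om, la, ep] at h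
  simp only [Prod.mk_add_mk, Prod.mk.injEq, add_zero, zero_add] at h
  obtain ⟨h3, h2, -, -, -⟩ := h
  obtain ⟨a, z, g, hz, e⟩ := I3 g3 h3 (by rw [← sub_eq_zero.1 h2, p3_del])
  have ez : D3 ph (nm ph 3 z, 0, 0, 0) = 0 := by
    rw [D3_mk, tau_nm, nm_cyc z hz]; simp
  have eg : D3 ph (del 2 g, tau ph 2 g - g, 0, 0) = 0 := by
    rw [D3_mk, tau_del, del_del]; simp [nm_tau]
  have hv := vt_closed vdv
  obtain ⟨k2, k1, hk⟩ : ∃ k2 k1, D3 ph (0, k2, k1, g0) = om c d + la p q + ep ε := by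
    refine ⟨g2 - a • (vt tcv tbv tbvp tsv).2.1 - (tau ph 2 g - g), g1 - a • (vt tcv tbv tbvp tsv).2.2.1, ?_⟩
    rw [← hy]
    have : ((0, g2 - a • (vt tcv tbv tbvp tsv).2.1 - (tau ph 2 g - g), g1 - a • (vt tcv tbv tbvp tsv).2.2.1, g0) : Cx3 LL)
      = (g3, g2, g1, g0) - a • vt tcv tbv tbvp tsv - (nm ph 3 z, 0, 0, 0) - (del 2 g, tau ph 2 g - g, 0, 0) := by
      refine Prod.ext ?_ (Prod.ext ?_ (Prod.ext ?_ ?_))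
      · change 0 = g3 - a • Yv - nm ph 3 z - del 2 g
        rw [e]; abel
      · change _ = g2 - a • (vt tcv tbv tbvp tsv).2.1 - 0 - (tau ph 2 g - g)
        abel
      · change _ = g1 - a • (vt tcv tbv tbvp tsv).2.2.1 - 0 - 0
        abel
      · change g0 = g0 - a • 0 - 0 - 0
        simp
    rw [this, map_sub, map_sub, map_sub, map_zsmul, ez, eg, hv]; simp
  have hk' := hk
  rw [D3_mk, om, la, ep] at hk'
  simp only [Prod.mk_add_mk, Prod.mk.injEq, map_zero, sub_zero, add_zero, zero_add] at hk'
  obtain ⟨-, e2, e1, -, -⟩ := hk'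
  obtain ⟨⟨c', rfl⟩, ⟨d', rfl⟩⟩ := T2' k2 e2 c d (by rw [← e1, map_add, p2_del, zero_add])
  have hl := fl p q ε (k2 - (c' • c2 tZ1 + d' • c2 tZ2)) k1 g0 (by
    have : ((0, k2 - (c' • c2 tZ1 + d' • c2 tZ2), k1, g0) : Cx3 LL)
        = (0, k2, k1, g0) - (0, c' • c2 tZ1 + d' • c2 tZ2, 0, 0) := by simp
    have e3 : D3 ph (0, c' • c2 tZ1 + d' • c2 tZ2, 0, 0) = om (3 * c') (3 * d') := by
      rw [D3_mk, om]
      simp only [map_add, map_zsmul, c2_cyc, z1n, z2n, map_zero, smul_zero, mul_zero, sub_zero, add_zero, zero_add,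
        neg_zero, smul_smul, mul_comm c', mul_comm d']
    rw [this, map_sub, hk, e3]; abel)
  exact ⟨⟨c', rfl⟩, ⟨d', rfl⟩, hl⟩

lemma Ph_bou (a : Fin 6 → ℤ) : Ph a ∈ bou ↔
    (3:ℤ) ∣ a 0 ∧ (9:ℤ) ∣ a 1 ∧ (3:ℤ) ∣ a 2 ∧ (3:ℤ) ∣ a 3 ∧ (3:ℤ) ∣ a 4 ∧ (9:ℤ) ∣ a 5 := by
  constructor
  · intro h
    obtain ⟨⟨g3, g2, g1, g0⟩, hy⟩ := h
    have h1 : del 3 g3 = 0 := by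
      have := congrArg Prod.fst hy
      rw [D3_mk] at this
      refine this.trans ?_
      change a 0 • (0 : Co LL 4) + a 1 • 0 + 0 + 0 + 0 = 0
      simp
    have h2 : del 2 g2 - (tau ph 3 g3 - g3) = a 0 • Y1 + a 1 • Y2 := by
      have := congrArg (fun x => x.2.1) hy
      rw [D3_mk] at this
      refine this.trans ?_
      change a 0 • Y1 + a 1 • Y2 + 0 + 0 + 0 = _
      simp
    obtain ⟨⟨b0, hb0⟩, ⟨b1, hb1⟩⟩ := T3' (-g3) (by rw [map_neg, h1, neg_zero]) (a 0) (a 1) (by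
      rw [← h2, map_sub P3 (del 2 g2), p3_del, zero_sub, ← map_neg P3]; congr 1; rw [map_neg]; abel)
    have := injB (a 2) (a 3) (a 4) b1 (a 5) (by
      have h3 : Ph a ∈ bou := ⟨_, hy⟩
      have := bou.sub_mem (bou.sub_mem h3 (bou.zsmul_mem X1_rel b0)) (bou.zsmul_mem X2_rel b1)
      convert this using 1
      have e1 : la (a 4) b1 = la (a 4) 0 + b1 • la 0 1 := by
        rw [← la_smul, ← la_add]; simp
      rw [Ph, e1, hb0, hb1, smul_sub, smul_smul, smul_smul, mul_comm b0, mul_comm b1]; abel)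
    obtain ⟨p1, p2, p3, ⟨k, rfl⟩, p5⟩ := this
    exact ⟨⟨b0, hb0⟩, ⟨k, by rw [hb1]; ring⟩, p1, p2, p3, p5⟩
  · rintro ⟨⟨b0, h0⟩, ⟨b1, h1⟩, ⟨b2, h2⟩, ⟨b3, h3⟩, ⟨b4, h4⟩, ⟨b5, h5⟩⟩
    rw [Ph, h0, h1, h2, h3, h4, h5]
    have e1 : (3 * b0) • X1 ∈ bou := by
      rw [mul_comm, mul_smul]; exact bou.zsmul_mem X1_rel _
    have e2 : (9 * b1) • X2 ∈ bou := by
      have := bou.add_mem (bou.zsmul_mem X2_rel (3 * b1)) (la_rel 0 b1)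
      convert this using 1
      have : la (3 * 0) (3 * b1) = (3 * b1) • la 0 1 := by rw [← la_smul]; simp
      rw [this, ← smul_add, sub_add_cancel, smul_smul]
      congr 1; ring
    exact bou.add_mem (bou.add_mem (bou.add_mem (bou.add_mem e1 e2) (om_rel _ _)) (by simpa using la_rel b4 0)) (ep_rel _)

end OHC

open CategoryTheory

namespace OHC
set_option linter.unusedSectionVars false
set_option linter.unusedVariables false

def ex8 (y : Fin 8 → ℤ) : ℕ → ℤ := fun i => if h : i < 8 then y ⟨i, h⟩ else 0
lemma ex8_sup (y) : Sup 8 (ex8 y) := fun i hi => dif_neg (by omega)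
lemma act_nil (x) : act [] x = 0 := by funext i; simp [act, row, dot]

def th0 : clo →+ (Fin 8 → ℤ) where
  toFun f := fun i => act e4F (P4 f.1.1) i
  map_zero' := by
    funext i
    change act e4F (P4 0) i = 0
    rw [map_zero, act_zero]; rfl
  map_add' f g := by
    funext i
    change act e4F (P4 (f.1.1 + g.1.1)) i = _
    rw [map_add, act_add]; rfl

lemma act_e4 (y) (hy : Sup 8 y) : act e4F (act e4E y) = y := by
  rw [← act_mul, eq2_act e4i, act_one 8 y hy]

lemma A4_e4E (y) : act A4 (act e4E y) = 0 := by rw [← act_mul, eq2_act e4t, act_nil]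

lemma inv4 (x) (hx : Sup 70 x) (h : act A4 x = 0) : x = act e4E (act e4F x) := by
  have := cert_split (by norm_num) e4pk.spec x hx h
  rwa [act_nil, zero_add] at this

lemma th0_zero (f : clo) (h : th0 f = 0) : P4 f.1.1 = 0 := by
  have e : act e4F (P4 f.1.1) = 0 := by
    funext i
    by_cases hi : i < 8
    · exact congrFun h ⟨i, hi⟩
    · exact act_sup e4F 8 _ (by decide +kernel) i (by omega)
  have hA : act A4 (P4 f.1.1) = 0 := by
    rw [← p4_tm _ f.2.h5, eq_neg_of_add_eq_zero_right f.2.h4, map_neg, p4_del, neg_zero]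
  rw [inv4 (P4 f.1.1) (pp_sup _ _ _) hA, e, act_zero]

lemma th0_nine (y : Fin 8 → ℤ) : ∃ f, th0 f = (9:ℤ) • y := by
  obtain ⟨z, hz, hP⟩ := ln4 (act e4E (ex8 y)) (act_sup _ _ _ (by decide +kernel))
  have hT : act T4 (P4 z) = P4 z := by
    have := act_tm ta4 (P4 z) (pp_sup _ _ _)
    rw [hP, A4_e4E] at this
    rw [hP, sub_eq_zero.1 this.symm]
  have hn : P4 (nm ph 4 z) = (9:ℤ) • P4 z := by
    rw [nm_eq, map_sum, Finset.sum_congr rfl (g := fun _ => P4 z)]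
    · simp
    · intro k _
      exact (pp_iter tab4 z hz k).2.trans (Function.iterate_fixed hT k)
  refine ⟨⟨(nm ph 4 z, 0, 0, 0, 0), ⟨nm_cyc z hz, ?_, by simp, by simp, by simp⟩⟩, ?_⟩
  · simp [tau_nm]
  · funext i
    change act e4F (P4 (nm ph 4 z)) i = 9 * y i
    rw [hn, act_zsmul, hP, act_e4 _ (ex8_sup y)]
    simp [ex8]

lemma part_one {H : Type*} [AddCommGroup H] (π : clo →+ H) (hs : Function.Surjective π)
    (hk : ∀ f, π f = 0 ↔ f.1 ∈ bou) :
    Nonempty (H ≃+ ((Fin 8 → ℤ) × (Fin 2 → ZMod 9) × (Fin 4 → ZMod 3))) := by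
  let θ : H →+ (Fin 8 → ℤ) := π.liftOfSurjective hs ⟨th0, by
    intro f hf
    obtain ⟨g, hg⟩ := (hk f).1 hf
    change th0 f = 0
    funext i
    change act e4F (P4 f.1.1) i = 0
    rw [← hg]
    change act e4F (P4 (del 3 g.1)) i = 0
    rw [p4_del, act_zero]; rfl⟩
  have hθ : ∀ f, θ (π f) = th0 f := fun f => AddMonoidHom.liftOfRightInverse_comp_apply _ _ _ _ _
  have hP : ∀ a, th0 ⟨Ph a, Ph_clo a⟩ = 0 := by
    intro a
    funext i
    change act e4F (P4 (Ph a).1) i = 0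
    have : (Ph a).1 = 0 := by
      change a 0 • (0 : Co LL 4) + a 1 • 0 + 0 + 0 + 0 = 0
      simp
    rw [this, map_zero, act_zero]; rfl
  obtain ⟨e⟩ := split_free θ (fun y => by
    obtain ⟨f, hf⟩ := th0_nine y
    exact ⟨π f, (hθ f).trans hf⟩)
  obtain ⟨e'⟩ := ker_iso (K := θ.ker) (AddMonoidHom.mk' (fun a => ⟨π ⟨Ph a, Ph_clo a⟩, (hθ _).trans (hP a)⟩) (by
    intro a b
    apply Subtype.ext
    change π _ = π _ + π _
    rw [← map_add]
    congr 1
    exact Subtype.ext (Ph_add a b))) (by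
    rintro ⟨h, hh⟩
    obtain ⟨f, rfl⟩ := hs h
    obtain ⟨a, ha⟩ := gen f.1 f.2 (th0_zero f ((hθ f).symm.trans hh))
    refine ⟨a, Subtype.ext ?_⟩
    change π _ = π f
    rw [← sub_eq_zero, ← map_sub, hk, ← neg_mem_iff]
    convert ha using 1
    exact neg_sub _ _) (by
    intro a
    rw [← Ph_bou, ← hk ⟨Ph a, Ph_clo a⟩]
    exact Subtype.ext_iff)
  exact ⟨e.trans (AddEquiv.prodCongr (AddEquiv.refl _) e')⟩

lemma H_one : Nonempty (H 4 ≃+ ((Fin 8 → ℤ) × (Fin 2 → ZMod 9) × (Fin 4 → ZMod 3))) := by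
  obtain ⟨π, h1, h2, h3⟩ := H4_desc ph
  refine part_one (H := groupCohomology (Rep.trivial ℤ (LL ⋊[ph] (Multiplicative (ZMod 9))) ℤ) 4)
    (AddMonoidHom.mk' (fun f : clo => π ⟨f.1, f.2⟩) (fun x y => h1 _ _ _ rfl)) ?_ ?_
  · intro h
    obtain ⟨f, hf⟩ := h2 h
    exact ⟨⟨f.1, f.2⟩, hf⟩
  · intro f
    exact h3 _

end OHC

open CategoryTheory

namespace OHC
set_option linter.unusedSectionVars false
set_option linter.unusedVariables false

lemma epi_iso_inv {C : Type*} [Category C] {X Y : C} (e : X ≅ Y) : Epi e.inv := inferInstance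

section
variable {k G : Type} [CommRing k] [CommGroup G] [Fintype G] (A : Rep.{0} k G) (g : G)

lemma mem_ker_sub (x : A) : x ∈ LinearMap.ker (Rep.applyAsHom A g - 𝟙 A).hom.toLinearMap ↔ A.ρ g x - x = 0 := Iff.rfl

lemma norm_app (y : A) : A.norm.hom.toLinearMap y = ∑ d, A.ρ d y := by
  change A.ρ.norm y = _
  simp [Representation.norm]

lemma cyc_even' (hg : ∀ x, x ∈ Subgroup.zpowers g) (i : ℕ) [NeZero i] (hi : Even i) :
    ∃ π : LinearMap.ker (Rep.applyAsHom A g - 𝟙 A).hom.toLinearMap →ₗ[k] groupCohomology A i,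
    Function.Surjective π ∧ ∀ x, π x = 0 ↔ ∃ y, ∑ d, A.ρ d y = x.1 := by
  have he : Epi (Rep.FiniteCyclicGroup.groupCohomologyπEven A g hg i hi) :=
    epi_comp' (epi_iso_inv _) (epi_comp' inferInstance inferInstance)
  refine ⟨(Rep.FiniteCyclicGroup.groupCohomologyπEven A g hg i hi).hom, (ModuleCat.epi_iff_surjective _).1 he, ?_⟩
  intro x
  refine (Rep.FiniteCyclicGroup.groupCohomologyπEven_eq_zero_iff A g hg i hi x).trans ?_
  rw [LinearMap.mem_range]
  exact exists_congr fun y => by rw [norm_app]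

lemma cyc_even (hg : ∀ x, x ∈ Subgroup.zpowers g) (i : ℕ) [NeZero i] (hi : Even i) :
    ∃ π : {x : A // A.ρ g x - x = 0} → groupCohomology A i,
    (∀ x y z, z.1 = x.1 + y.1 → π z = π x + π y) ∧ Function.Surjective π ∧
    ∀ x, π x = 0 ↔ ∃ y, ∑ d, A.ρ d y = x.1 := by
  obtain ⟨p, hs, hk⟩ := cyc_even' A g hg i hi
  refine ⟨fun x => p ⟨x.1, (mem_ker_sub A g _).2 x.2⟩, ?_, ?_, fun x => hk _⟩
  · rintro x y ⟨z, hz⟩ e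
    simp only at e
    subst e
    rw [← map_add]; rfl
  · intro h
    obtain ⟨x, hx⟩ := hs h
    exact ⟨⟨x.1, (mem_ker_sub A g _).1 x.2⟩, hx⟩

lemma cyc_odd' (hg : ∀ x, x ∈ Subgroup.zpowers g) (i : ℕ) (hi : Odd i) :
    ∃ π : LinearMap.ker A.norm.hom.toLinearMap →ₗ[k] groupCohomology A i,
    Function.Surjective π ∧ ∀ x, π x = 0 ↔ ∃ y, A.ρ g y - y = x.1 := by
  have he : Epi (Rep.FiniteCyclicGroup.groupCohomologyπOdd A g hg i hi) :=
    epi_comp' (epi_iso_inv _) (epi_comp' inferInstance inferInstance)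
  refine ⟨(Rep.FiniteCyclicGroup.groupCohomologyπOdd A g hg i hi).hom, (ModuleCat.epi_iff_surjective _).1 he, ?_⟩
  intro x
  refine (Rep.FiniteCyclicGroup.groupCohomologyπOdd_eq_zero_iff A g hg i hi x).trans ?_
  rw [LinearMap.mem_range]
  exact Iff.rfl

lemma cyc_odd (hg : ∀ x, x ∈ Subgroup.zpowers g) (i : ℕ) (hi : Odd i) :
    ∃ π : {x : A // ∑ d, A.ρ d x = 0} → groupCohomology A i,
    (∀ x y z, z.1 = x.1 + y.1 → π z = π x + π y) ∧ Function.Surjective π ∧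
    ∀ x, π x = 0 ↔ ∃ y, A.ρ g y - y = x.1 := by
  obtain ⟨p, hs, hk⟩ := cyc_odd' A g hg i hi
  refine ⟨fun x => p ⟨x.1, LinearMap.mem_ker.2 ((norm_app A _).trans x.2)⟩, ?_, ?_, fun x => hk _⟩
  · rintro x y ⟨z, hz⟩ e
    simp only at e
    subst e
    rw [← map_add]; rfl
  · intro h
    obtain ⟨x, hx⟩ := hs h
    exact ⟨⟨x.1, (norm_app A _).symm.trans (LinearMap.mem_ker.1 x.2)⟩, hx⟩

lemma cyc_zero (hg : ∀ x, x ∈ Subgroup.zpowers g) : ∃ ι : groupCohomology A 0 →+ A, Function.Injective ι ∧ (∀ h, A.ρ g (ι h) - ι h = 0) ∧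
    ∀ x, A.ρ g x - x = 0 → ∃ h, ι h = x := by
  let p := Rep.FiniteCyclicGroup.groupCohomologyIso₀ A g hg
  have hs : Function.Injective p.hom := (ModuleCat.mono_iff_injective p.hom).1 inferInstance
  have hs' : Function.Surjective p.hom := (ModuleCat.epi_iff_surjective p.hom).1 inferInstance
  refine ⟨AddMonoidHom.mk' (fun h => (p.hom.hom h).1) (fun x y => ?_), ?_, ?_, ?_⟩
  · rw [map_add]; rfl
  · intro x y h
    exact hs (Subtype.ext h)
  · intro h
    exact (p.hom.hom h).2
  · intro x hx
    obtain ⟨h, e⟩ := hs' ⟨x, hx⟩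
    exact ⟨h, congrArg Subtype.val e⟩
end

lemma cer_iso {H V : Type*} [AddCommGroup H] [AddCommGroup V] (α β : V → V) (π : {x : V // β x = 0} → H)
    (h1 : ∀ x y z, z.1 = x.1 + y.1 → π z = π x + π y) (h2 : Function.Surjective π)
    (h3 : ∀ x, π x = 0 ↔ ∃ y, α y = x.1) {n : ℕ} {A B E : List (List ℤ)} (hc : Cer n A B E)
    (p : V →+ (ℕ → ℤ)) (hi : Function.Injective p) (hs : ∀ f, Sup n f → ∃ x, p x = f) (hs' : ∀ x, Sup n (p x))
    (hA : ∀ x, p (α x) = act A (p x)) (hB : ∀ x, p (β x) = act B (p x)) : Nonempty (H ≃+ (Fin 2 → ZMod 3)) := by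
  choose q hq using fun y : ℕ → ℤ => hs (act E y) (hc.sup y)
  have hβ : ∀ y, β (q y) = 0 := fun y => hi (by rw [hB, hq, hc.be, map_zero])
  have hqa : ∀ y z, q (y + z) = q y + q z := fun y z => hi (by rw [map_add, hq, hq, hq, act_add])
  have ht : ∀ a b : Fin 2 → ℤ, two ((a+b) 0) ((a+b) 1) = two (a 0) (a 1) + two (b 0) (b 1) := by
    intro a b; funext i; simp only [two, Pi.add_apply]; split_ifs <;> simp
  refine two_iso (AddMonoidHom.mk' (fun a => π ⟨q (two (a 0) (a 1)), hβ _⟩) (by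
    intro a b
    refine h1 _ _ _ ?_
    change q _ = q _ + q _
    rw [ht, hqa])) ?_ ?_
  · intro h
    obtain ⟨⟨x, hx⟩, rfl⟩ := h2 h
    obtain ⟨u, y, hu, hy, e⟩ := hc.split (p x) (hs' x) (by rw [← hB, hx, map_zero])
    have hy2 : two (y 0) (y 1) = y := by
      funext i
      rcases i with _ | _ | i
      · rfl
      · rfl
      · rw [hy (i+2) (by omega)]; simp [two]
    obtain ⟨w, rfl⟩ := hs u hu
    have hw : x = α w + q y := hi (by rw [map_add, hA, hq, e])
    have hαw : β (α w) = 0 := hi (by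
      rw [map_zero]
      have e2 : p (α w) = p x - p (q y) := by rw [hw, map_add, add_sub_cancel_right]
      rw [hB, e2, act_sub_r, ← hB, ← hB, hx, hβ, map_zero, sub_zero])
    refine ⟨![y 0, y 1], ?_⟩
    rw [h1 ⟨α w, hαw⟩ ⟨q y, hβ y⟩ ⟨x, hx⟩ hw, (h3 ⟨α w, hαw⟩).2 ⟨w, rfl⟩, zero_add]
    change π ⟨q (two (y 0) (y 1)), _⟩ = _
    simp only [hy2]
  · intro a
    refine (h3 _).trans ?_
    constructor
    · rintro ⟨w, hw⟩
      have := congrArg p hw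
      change p (α w) = p (q _) at this
      rw [hA, hq] at this
      have := hc.tors _ _ (two_sup _ _) this
      exact ⟨this 0, this 1⟩
    · rintro ⟨⟨b0, e0⟩, ⟨b1, e1⟩⟩
      obtain ⟨u, hu, e⟩ := hc.triple (two b0 b1)
      obtain ⟨w, rfl⟩ := hs u hu
      refine ⟨w, hi ?_⟩
      change p (α w) = p (q _)
      rw [hA, hq, e, ← act_zsmul]
      congr 1
      funext i; simp only [two, Pi.smul_apply, e0, e1]; split_ifs <;> simp

lemma nine_iso {H V : Type*} [AddCommGroup H] [AddCommGroup V] (α β : V → V) (π : {x : V // β x = 0} → H)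
    (h1 : ∀ x y z, z.1 = x.1 + y.1 → π z = π x + π y) (h2 : Function.Surjective π)
    (h3 : ∀ x, π x = 0 ↔ ∃ y, α y = x.1)
    (p : V →+ ℤ) (hi : Function.Injective p) (hs : Function.Surjective p)
    (hA : ∀ x, p (α x) = 9 * p x) (hB : ∀ x, β x = 0) : Nonempty (H ≃+ ZMod 9) := by
  choose q hq using hs
  let φ : ℤ →+ H := AddMonoidHom.mk' (fun a => π ⟨q a, hB _⟩) (by
    intro a b
    refine h1 _ _ _ (hi ?_)
    change p (q (a + b)) = p (q a + q b)
    rw [map_add, hq, hq, hq])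
  have hφs : Function.Surjective φ := by
    intro h
    obtain ⟨⟨x, hx⟩, rfl⟩ := h2 h
    refine ⟨p x, ?_⟩
    change π _ = π _
    congr 1
    exact Subtype.ext (hi (hq _))
  have hk : φ.ker = AddSubgroup.zmultiples (9:ℤ) := by
    ext a
    rw [Int.mem_zmultiples_iff]
    refine (h3 _).trans ?_
    constructor
    · rintro ⟨w, hw⟩
      have := congrArg p hw
      change p (α w) = p (q _) at this
      rw [hA, hq] at this
      exact ⟨_, this.symm⟩
    · rintro ⟨b, rfl⟩
      refine ⟨q b, hi ?_⟩
      change p (α (q b)) = p (q _)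
      rw [hA, hq, hq]
  exact ⟨(QuotientAddGroup.quotientKerEquivOfSurjective φ hφs).symm.trans
    ((QuotientAddGroup.quotientAddEquivOfEq hk).trans (Int.quotientZMultiplesNatEquivZMod 9))⟩

end OHC

open CategoryTheory

namespace OHC
set_option linter.unusedSectionVars false
set_option linter.unusedVariables false

/-- the coefficient representation `H^j(L, ℤ)` -/
noncomputable abbrev RJ (j : ℕ) : Rep ℤ (Multiplicative (ZMod 9)) :=
  Crystal.cohRep (Crystal.matAction 9 holM holM_pow) (1 : Representation ℤ (Multiplicative (ZMod 9)) ℤ) j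

lemma tg_gen : ∀ x : Multiplicative (ZMod 9), x ∈ Subgroup.zpowers (tg 9) := by
  intro x
  refine ⟨(Multiplicative.toAdd x).val, ?_⟩
  revert x
  decide

lemma crel_act {j x} {h : RJ j} (a : CRel LL j x h) (g) : CRel LL j (tac ph j g x) ((RJ j).ρ g h) := CRel.act ph a g

lemma crel_addR {j x y} {h h' : RJ j} (a : CRel LL j x h) (b : CRel LL j y h') : CRel LL j (x + y) (h + h' : RJ j) := a.add b
lemma crel_negR {j x} {h : RJ j} (a : CRel LL j x h) : CRel LL j (-x) (-h : RJ j) := a.neg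
lemma crel_zeroR (j) : CRel LL j 0 (0 : RJ j) := by
  obtain ⟨x, hx⟩ := CRel.surj (N := LL) j 0
  have := hx.add hx.neg
  rwa [add_neg_cancel, add_neg_cancel] at this

lemma crel_tm {j x} {h : RJ j} (a : CRel LL j x h) : CRel LL j (tau ph j x - x) ((RJ j).ρ (tg 9) h - h) := by
  rw [sub_eq_add_neg, sub_eq_add_neg]
  exact crel_addR (crel_act a _) (crel_negR a)

lemma crel_sum {j x} {h : RJ j} (a : CRel LL j x h) (s : Finset (Multiplicative (ZMod 9))) :
    CRel LL j (∑ d ∈ s, tac ph j d x) (∑ d ∈ s, (RJ j).ρ d h) := by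
  classical
  induction s using Finset.induction_on with
  | empty => exact crel_zeroR j
  | insert d s hd ih =>
    have e : ∑ d ∈ insert d s, (RJ j).ρ d h = (RJ j).ρ d h + ∑ d ∈ s, (RJ j).ρ d h := Finset.sum_insert hd
    rw [Finset.sum_insert hd]
    exact (congrArg (CRel LL j _) e).mpr (crel_addR (crel_act a d) ih)

lemma crel_nm {j x} {h : RJ j} (a : CRel LL j x h) : CRel LL j (nm ph j x) (∑ d, (RJ j).ρ d h) := by
  have := crel_sum a Finset.univ
  rwa [nm, AddMonoidHom.finsetSum_apply]

section
variable {n j : ℕ} {J : ℕ → Fin (j+1) → ℕ} {T A N : List (List ℤ)}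

noncomputable def pR (n : ℕ) (J : ℕ → Fin (j+1) → ℕ) : RJ (j+1) →+ (ℕ → ℤ) := pbar n J

lemma pR_tm (h : Tab n J T) (hA : eq2 (subL T (oneL n)) A = true) (x : RJ (j+1)) :
    pR n J ((RJ (j+1)).ρ (tg 9) x - x) = act A (pR n J x) := by
  obtain ⟨c, hc⟩ := CRel.surj (N := LL) (j+1) x
  refine (pbar_eq (crel_tm hc)).trans ?_
  rw [pp_tm h hA c hc.cyc]
  exact congrArg _ (pbar_eq hc).symm

lemma pR_nm (h : Tab n J T) (hA : eq2 (normL n T 9) N = true) (x : RJ (j+1)) :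
    pR n J (∑ d, (RJ (j+1)).ρ d x) = act N (pR n J x) := by
  obtain ⟨c, hc⟩ := CRel.surj (N := LL) (j+1) x
  refine (pbar_eq (crel_nm hc)).trans ?_
  rw [pp_nm' h hA c hc.cyc]
  exact congrArg _ (pbar_eq hc).symm

lemma odd_iso (h : Tab n J T) (hA : eq2 (subL T (oneL n)) A = true) (hN : eq2 (normL n T 9) N = true)
    {E} (hc : Cer n A N E) (i : ℕ) (hi : Odd i) : Nonempty (groupCohomology (RJ (j+1)) i ≃+ (Fin 2 → ZMod 3)) := by
  obtain ⟨π, h1, h2, h3⟩ := cyc_odd (RJ (j+1)) (tg 9) tg_gen i hi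
  exact cer_iso (fun y => (RJ (j+1)).ρ (tg 9) y - y) (fun x => ∑ d, (RJ (j+1)).ρ d x) π h1 h2 h3 hc
    (pR n J) (pbar_inj h) (pbar_surj h) pbar_sup (pR_tm h hA) (pR_nm h hN)

lemma even_iso (h : Tab n J T) (hA : eq2 (subL T (oneL n)) A = true) (hN : eq2 (normL n T 9) N = true)
    {E} (hc : Cer n N A E) (i : ℕ) [NeZero i] (hi : Even i) : Nonempty (groupCohomology (RJ (j+1)) i ≃+ (Fin 2 → ZMod 3)) := by
  obtain ⟨π, h1, h2, h3⟩ := cyc_even (RJ (j+1)) (tg 9) tg_gen i hi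
  exact cer_iso (fun x => ∑ d, (RJ (j+1)).ρ d x) (fun y => (RJ (j+1)).ρ (tg 9) y - y) π h1 h2 h3 hc
    (pR n J) (pbar_inj h) (pbar_surj h) pbar_sup (pR_nm h hN) (pR_tm h hA)
end

lemma H13 : Nonempty (Hc 1 3 ≃+ (Fin 2 → ZMod 3)) := odd_iso tab3 ta3 n3c cr3 1 (by decide)
lemma H22 : Nonempty (Hc 2 2 ≃+ (Fin 2 → ZMod 3)) := even_iso tab2 ta2 n2c cr2 2 (by decide)
lemma H31 : Nonempty (Hc 3 1 ≃+ (Fin 2 → ZMod 3)) := odd_iso tab1 ta1 (by decide +kernel) cr1 3 (by decide)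

lemma tac_zero (d) (x : Co LL 0) : tac ph 0 d x = x := by
  funext v
  change x _ = x _
  exact congrArg x (Subsingleton.elim _ _)

noncomputable def p0 : RJ 0 →+ ℤ := AddMonoidHom.mk' (fun h => (CRel.surj (N := LL) 0 h).choose Fin.elim0) (by
  intro a b
  have h1 := (CRel.surj (N := LL) 0 a).choose_spec
  have h2 := (CRel.surj (N := LL) 0 b).choose_spec
  have h3 := (CRel.surj (N := LL) 0 (a + b : RJ 0)).choose_spec
  have h4 := h3.add (h1.add h2).neg
  have e : (a + b : RJ 0) + -(a + b : RJ 0) = 0 := add_neg_cancel _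
  have := CRel.zero0.1 ((show CRel LL 0 _ 0 from e ▸ h4))
  rw [← sub_eq_add_neg, sub_eq_zero] at this
  exact congrFun this Fin.elim0)

lemma p0_eq {x} {h : RJ 0} (hx : CRel LL 0 x h) : p0 h = x Fin.elim0 := by
  have h1 := (CRel.surj (N := LL) 0 h).choose_spec
  have h4 := h1.add hx.neg
  have e : (h : RJ 0) + -h = 0 := add_neg_cancel _
  have := CRel.zero0.1 ((show CRel LL 0 _ 0 from e ▸ h4))
  rw [← sub_eq_add_neg, sub_eq_zero] at this
  exact congrFun this Fin.elim0

lemma p0_inj : Function.Injective p0 := by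
  refine (injective_iff_map_eq_zero p0).2 fun h e => ?_
  obtain ⟨x, hx⟩ := CRel.surj (N := LL) 0 h
  rw [p0_eq hx] at e
  have : x = 0 := by
    funext v
    rw [Subsingleton.elim v Fin.elim0, e]; rfl
  subst this
  exact hx.uniq (crel_zeroR 0)

lemma p0_surj : Function.Surjective p0 := by
  intro a
  obtain ⟨h, hh⟩ := CRel.ex (del_z (fun _ => a))
  exact ⟨h, p0_eq hh⟩

lemma H40 : Nonempty (Hc 4 0 ≃+ ZMod 9) := by
  obtain ⟨π, h1, h2, h3⟩ := cyc_even (RJ 0) (tg 9) tg_gen 4 (by decide)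
  refine nine_iso (fun x => ∑ d, (RJ 0).ρ d x) (fun y => (RJ 0).ρ (tg 9) y - y) π h1 h2 h3 p0 p0_inj p0_surj ?_ ?_
  · intro h
    obtain ⟨x, hx⟩ := CRel.surj (N := LL) 0 h
    refine (p0_eq (crel_nm hx)).trans ?_
    rw [p0_eq hx, nm, AddMonoidHom.finsetSum_apply]
    simp only [tac_zero]
    simp
  · intro h
    obtain ⟨x, hx⟩ := CRel.surj (N := LL) 0 h
    have := crel_tm hx
    rw [tau, tac_zero, sub_self] at this
    exact this.uniq (crel_zeroR 0)

lemma e4F_sup (x) : Sup 8 (act e4F x) := act_sup _ _ _ (by decide +kernel)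
lemma e4E_sup (x) : Sup 70 (act e4E x) := act_sup _ _ _ (by decide +kernel)

lemma eight_iso {W : Type*} [AddCommGroup W] (p : W →+ (ℕ → ℤ)) (hi : Function.Injective p)
    (h1 : ∀ x, Sup 70 (p x)) (h2 : ∀ x, act A4 (p x) = 0) (h3 : ∀ f, Sup 70 f → act A4 f = 0 → ∃ x, p x = f) :
    Nonempty (W ≃+ (Fin 8 → ℤ)) := by
  refine ⟨AddEquiv.ofBijective (AddMonoidHom.mk' (fun w (i : Fin 8) => act e4F (p w) i) ?_) ⟨?_, ?_⟩⟩
  · intro a b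
    funext i
    rw [map_add, act_add]; rfl
  · intro a b e
    refine hi ?_
    rw [inv4 _ (h1 a) (h2 a), inv4 _ (h1 b) (h2 b)]
    congr 1
    funext i
    by_cases hi : i < 8
    · exact congrFun e ⟨i, hi⟩
    · rw [e4F_sup _ i (by omega), e4F_sup _ i (by omega)]
  · intro y
    obtain ⟨w, hw⟩ := h3 (act e4E (ex8 y)) (e4E_sup _) (A4_e4E _)
    refine ⟨w, ?_⟩
    funext i
    change act e4F (p w) i = y i
    rw [hw, act_e4 _ (ex8_sup y)]
    simp [ex8]

lemma H04 : Nonempty (Hc 0 4 ≃+ (Fin 8 → ℤ)) := by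
  obtain ⟨ι, h1, h2, h3⟩ := cyc_zero (RJ 4) (tg 9) tg_gen
  refine eight_iso ((pR 70 (lst C4 4)).comp ι) ?_ ?_ ?_ ?_
  · exact (show Function.Injective (pR 70 (lst C4 4)) from pbar_inj tab4).comp h1
  · intro x; exact pbar_sup _
  · intro x
    have := pR_tm tab4 ta4 (ι x)
    rw [h2, map_zero] at this
    exact this.symm
  · intro f hf e
    obtain ⟨x, hx⟩ := show ∃ x : RJ 4, pR 70 (lst C4 4) x = f from pbar_surj tab4 f hf
    obtain ⟨h, rfl⟩ := h3 x ((show Function.Injective (pR 70 (lst C4 4)) from pbar_inj tab4) (by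
      exact (pR_tm tab4 ta4 x).trans (by rw [hx, e, map_zero])))
    exact ⟨h, hx⟩

lemma H_two : Nonempty ((Hc 0 4 × Hc 1 3 × Hc 2 2 × Hc 3 1 × Hc 4 0) ≃+
    ((Fin 8 → ℤ) × ZMod 9 × (Fin 6 → ZMod 3))) := by
  obtain ⟨e0⟩ := H04
  obtain ⟨e1⟩ := H13
  obtain ⟨e2⟩ := H22
  obtain ⟨e3⟩ := H31
  obtain ⟨e4⟩ := H40
  refine ⟨(e0.prodCongr (e1.prodCongr (e2.prodCongr (e3.prodCongr e4)))).trans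
    { toFun := fun x => (x.1, x.2.2.2.2, ![x.2.1 0, x.2.1 1, x.2.2.1 0, x.2.2.1 1, x.2.2.2.1 0, x.2.2.2.1 1])
      invFun := fun y => (y.1, ![y.2.2 0, y.2.2 1], ![y.2.2 2, y.2.2 3], ![y.2.2 4, y.2.2 5], y.2.1)
      left_inv := ?_
      right_inv := ?_
      map_add' := ?_ }⟩
  · rintro ⟨a, b, c, d, e⟩
    simp only [Prod.mk.injEq, true_and, and_true]
    refine ⟨?_, ?_, ?_⟩ <;> funext i <;> fin_cases i <;> rfl
  · rintro ⟨a, b, c⟩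
    simp only [Prod.mk.injEq, true_and]
    funext i; fin_cases i <;> rfl
  · rintro ⟨a, b, c, d, e⟩ ⟨a', b', c', d', e'⟩
    simp only [Prod.mk_add_mk, Prod.mk.injEq, true_and]
    funext i; fin_cases i <;> rfl

/-- the two abstract groups are told apart by the number of elements killed by three -/
lemma no_iso : ¬ Nonempty (((Fin 8 → ℤ) × (Fin 2 → ZMod 9) × (Fin 4 → ZMod 3)) ≃+
    ((Fin 8 → ℤ) × ZMod 9 × (Fin 6 → ZMod 3))) := by
  rintro ⟨e⟩
  have z8 : ∀ a : Fin 8 → ℤ, (3:ℕ) • a = 0 → a = 0 := by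
    intro a h
    funext i
    have := congrFun h i
    simpa using this
  have t3 : ∀ a : ZMod 3, (3:ℕ) • a = 0 := by decide
  have t9 : ∀ a : ZMod 9, (3:ℕ) • a = 0 → ∃ b : ZMod 3, (3 : ZMod 9) * b.val = a := by decide
  have t9' : ∀ b : ZMod 3, (3:ℕ) • ((3 : ZMod 9) * b.val) = 0 := by decide
  have ti : ∀ b c : ZMod 3, (3 : ZMod 9) * b.val = (3 : ZMod 9) * c.val → b = c := by decide
  let f : ZMod 3 × (Fin 6 → ZMod 3) → ((Fin 8 → ℤ) × ZMod 9 × (Fin 6 → ZMod 3)) := fun x => (0, 3 * x.1.val, x.2)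
  let g : (Fin 2 → ZMod 3) × (Fin 4 → ZMod 3) → ((Fin 8 → ℤ) × (Fin 2 → ZMod 9) × (Fin 4 → ZMod 3)) :=
    fun x => (0, fun i => 3 * (x.1 i).val, x.2)
  have hf : ∀ x, (3:ℕ) • f x = 0 := by
    intro x
    refine Prod.ext (smul_zero (3:ℕ) : (3:ℕ) • (0 : Fin 8 → ℤ) = 0) (Prod.ext (t9' _) ?_)
    funext i; exact t3 _
  have hg : ∀ y, (3:ℕ) • y = 0 → ∃ x, g x = y := by
    rintro ⟨a, b, c⟩ h
    have ha := z8 a (congrArg Prod.fst h)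
    choose u hu using fun i => t9 (b i) (congrFun (congrArg (fun z => z.2.1) h) i)
    exact ⟨(u, c), Prod.ext ha.symm (Prod.ext (funext hu) rfl)⟩
  have hfi : Function.Injective f := by
    rintro ⟨x, y⟩ ⟨x', y'⟩ h
    exact Prod.ext (ti _ _ (congrArg (fun z => z.2.1) h)) (congrArg (fun z => z.2.2) h)
  choose k hk using fun x => hg (e.symm (f x)) (by rw [← map_nsmul, hf, map_zero])
  have hki : Function.Injective k := by
    intro x y h
    have := hk x
    rw [h, hk y] at this
    exact hfi (e.symm.injective this.symm)
  have := Fintype.card_le_of_injective k hki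
  simp [ZMod.card] at this

lemma H_three : ¬ Nonempty (H 4 ≃+ (Hc 0 4 × Hc 1 3 × Hc 2 2 × Hc 3 1 × Hc 4 0)) := by
  rintro ⟨e⟩
  obtain ⟨e1⟩ := H_one
  obtain ⟨e2⟩ := H_two
  exact no_iso ⟨e1.symm.trans (e.trans e2)⟩

end OHC

theorem odd_holonomy_counterexample :
    Nonempty (H 4 ≃+ ((Fin 8 → ℤ) × (Fin 2 → ZMod 9) × (Fin 4 → ZMod 3))) ∧
    Nonempty ((Hc 0 4 × Hc 1 3 × Hc 2 2 × Hc 3 1 × Hc 4 0)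
      ≃+ ((Fin 8 → ℤ) × ZMod 9 × (Fin 6 → ZMod 3))) ∧
    ¬ Nonempty (H 4 ≃+ (Hc 0 4 × Hc 1 3 × Hc 2 2 × Hc 3 1 × Hc 4 0)) := by
  exact ⟨OHC.H_one, OHC.H_two, OHC.H_three⟩
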